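/- Let c > 1 be a constant and for each n let G_n be a connected component with the largest number of vertices (the giant component, ties broken by any fixed rule) of the random graph G(n, c/n). Then there exist constants 0 < a ≤ b such that the probability that a · ln n / ln ln n ≤ D(G_n) ≤ b · ln n / ln ln n tends to 1 as n → ∞. -/

import Mathlib

namespace FODef

/-- First-order formulas in the language of graphs (equality and adjacency), with free
variables among `x_0, …, x_{n-1}`. -/
inductive GForm : ℕ → Type
  | adj {n : ℕ} (i j : Fin n) : GForm n
  | eq {n : ℕ} (i j : Fin n) : GForm n
  | neg {n : ℕ} : GForm n → GForm n
  | conj {n : ℕ} : GForm n → GForm n → GForm n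
  | disj {n : ℕ} : GForm n → GForm n → GForm n
  | ex {n : ℕ} : GForm (n + 1) → GForm n
  | fa {n : ℕ} : GForm (n + 1) → GForm n

/-- Realization of a formula in a graph under a valuation of the free variables. -/
def GForm.Realize {V : Type} (G : SimpleGraph V) : ∀ {n : ℕ}, GForm n → (Fin n → V) → Prop
  | _, .adj i j, f => G.Adj (f i) (f j)
  | _, .eq i j, f => f i = f j
  | _, .neg φ, f => ¬ GForm.Realize G φ f
  | _, .conj φ ψ, f => GForm.Realize G φ f ∧ GForm.Realize G ψ f
  | _, .disj φ ψ, f => GForm.Realize G φ f ∨ GForm.Realize G ψ f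
  | _, .ex φ, f => ∃ v : V, GForm.Realize G φ (Fin.snoc f v)
  | _, .fa φ, f => ∀ v : V, GForm.Realize G φ (Fin.snoc f v)

/-- Quantifier depth: the maximum number of nested quantifiers. -/
def GForm.depth : ∀ {n : ℕ}, GForm n → ℕ
  | _, .adj _ _ => 0
  | _, .eq _ _ => 0
  | _, .neg φ => φ.depth
  | _, .conj φ ψ => max φ.depth ψ.depth
  | _, .disj φ ψ => max φ.depth ψ.depth
  | _, .ex φ => φ.depth + 1
  | _, .fa φ => φ.depth + 1

/-- A sentence (formula with no free variables) holds in a graph. -/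
def Sat {V : Type} (G : SimpleGraph V) (φ : GForm 0) : Prop :=
  φ.Realize G ![]

/-- A sentence defines the graph `G` if `G` satisfies it and every finite graph
satisfying it is isomorphic to `G`. -/
def Defines {V : Type} (G : SimpleGraph V) (φ : GForm 0) : Prop :=
  Sat G φ ∧ ∀ (m : ℕ) (H : SimpleGraph (Fin m)), Sat H φ → Nonempty (G ≃g H)

/-- `D G`: the minimum quantifier depth of a first-order sentence defining `G`. -/
noncomputable def D {V : Type} (G : SimpleGraph V) : ℕ :=
  sInf {d | ∃ φ : GForm 0, φ.depth = d ∧ Defines G φ}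

/-- Degree of a vertex. -/
noncomputable def deg {V : Type} (G : SimpleGraph V) (v : V) : ℕ :=
  Nat.card {w // G.Adj v w}

end FODef

namespace FODef

open Classical in
/-- The probability of the event `E` under the Erdős–Rényi random graph `G(n,p)`:
each of the `n.choose 2` possible edges is present independently with probability `p`. -/
noncomputable def gnpProb (n : ℕ) (p : ℝ) (E : Set (SimpleGraph (Fin n))) : ℝ :=
  ∑ G : SimpleGraph (Fin n),
    if G ∈ E then p ^ (Nat.card G.edgeSet) * (1 - p) ^ (n.choose 2 - Nat.card G.edgeSet)
    else 0

/-- `giant` is a rule choosing, in every nonempty graph, a connected component with the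
largest number of vertices. -/
def IsGiantRule (giant : ∀ n : ℕ, SimpleGraph (Fin n) → Set (Fin n)) : Prop :=
  ∀ n : ℕ, 0 < n → ∀ G : SimpleGraph (Fin n), ∃ cc : G.ConnectedComponent,
    giant n G = cc.supp ∧ ∀ cc' : G.ConnectedComponent, Nat.card cc'.supp ≤ Nat.card cc.supp

end FODef

open Filter FODef

namespace GC

section Games

variable {V W U : Type}

/-- The pairs in `P` form a partial isomorphism. -/
def PIso (G : SimpleGraph V) (H : SimpleGraph W) (P : Set (V × W)) : Prop :=
  ∀ r ∈ P, ∀ s ∈ P, (r.1 = s.1 ↔ r.2 = s.2) ∧ (G.Adj r.1 s.1 ↔ H.Adj r.2 s.2)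

/-- Duplicator wins the `q`-round Ehrenfeucht game from the position `P`. -/
def EF (G : SimpleGraph V) (H : SimpleGraph W) : ℕ → Set (V × W) → Prop
  | 0, P => PIso G H P
  | q + 1, P => PIso G H P ∧ (∀ a, ∃ b, EF G H q (insert (a, b) P)) ∧
      (∀ b, ∃ a, EF G H q (insert (a, b) P))

variable {G : SimpleGraph V} {H : SimpleGraph W} {K : SimpleGraph U}

theorem EF.piso {q : ℕ} {P : Set (V × W)} (h : EF G H q P) : PIso G H P := by
  cases q with
  | zero => exact h
  | succ q => exact h.1

theorem EF.mono {q : ℕ} {P Q : Set (V × W)} (h : EF G H q P) (hQ : Q ⊆ P) : EF G H q Q := by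
  induction q generalizing P Q with
  | zero => exact fun r hr s hs => h r (hQ hr) s (hQ hs)
  | succ q ih =>
    refine ⟨fun r hr s hs => h.1 r (hQ hr) s (hQ hs), fun a => ?_, fun b => ?_⟩
    · obtain ⟨b, hb⟩ := h.2.1 a
      exact ⟨b, ih hb (Set.insert_subset_insert hQ)⟩
    · obtain ⟨a, ha⟩ := h.2.2 b
      exact ⟨a, ih ha (Set.insert_subset_insert hQ)⟩

theorem EF.of_succ {q : ℕ} {P : Set (V × W)} (h : EF G H (q + 1) P) : EF G H q P := by
  induction q generalizing P with
  | zero => exact h.1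
  | succ q ih =>
    refine ⟨h.1, fun a => ?_, fun b => ?_⟩
    · obtain ⟨b, hb⟩ := h.2.1 a
      exact ⟨b, ih hb⟩
    · obtain ⟨a, ha⟩ := h.2.2 b
      exact ⟨a, ih ha⟩

theorem EF.of_le {q q' : ℕ} {P : Set (V × W)} (h : EF G H q P) (hq : q' ≤ q) : EF G H q' P := by
  induction q with
  | zero => rwa [Nat.le_zero.1 hq]
  | succ q ih =>
    rcases Nat.lt_or_ge q q' with h1 | h1
    · rwa [show q' = q + 1 by omega]
    · exact ih h.of_succ h1

theorem EF.swap {q : ℕ} {P : Set (V × W)} (h : EF G H q P) : EF H G q (Prod.swap ⁻¹' P) := by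
  have hp : ∀ {P : Set (V × W)}, PIso G H P → PIso H G (Prod.swap ⁻¹' P) :=
    fun h r hr s hs => ⟨(h _ hr _ hs).1.symm, (h _ hr _ hs).2.symm⟩
  have hi : ∀ (a : V) (b : W) (P : Set (V × W)),
      insert (b, a) (Prod.swap ⁻¹' P) = Prod.swap ⁻¹' (insert (a, b) P) := by
    grind
  induction q generalizing P with
  | zero => exact hp h
  | succ q ih =>
    refine ⟨hp h.1, fun b => ?_, fun a => ?_⟩
    · obtain ⟨a, ha⟩ := h.2.2 b
      exact ⟨a, hi a b P ▸ ih ha⟩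
    · obtain ⟨b, hb⟩ := h.2.1 a
      exact ⟨b, hi a b P ▸ ih hb⟩

theorem EF.comp {q : ℕ} {P : Set (V × W)} {Q : Set (W × U)} (h : EF G H q P) (h' : EF H K q Q) :
    EF G K q {r | ∃ b, (r.1, b) ∈ P ∧ (b, r.2) ∈ Q} := by
  have hp : ∀ {P : Set (V × W)} {Q : Set (W × U)}, PIso G H P → PIso H K Q →
      PIso G K {r | ∃ b, (r.1, b) ∈ P ∧ (b, r.2) ∈ Q} := by
    rintro P Q h h' r ⟨b, hb, hb'⟩ s ⟨d, hd, hd'⟩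
    exact ⟨(h _ hb _ hd).1.trans (h' _ hb' _ hd').1, (h _ hb _ hd).2.trans (h' _ hb' _ hd').2⟩
  have hi : ∀ (a : V) (b : W) (c : U) (P : Set (V × W)) (Q : Set (W × U)),
      insert (a, c) {r : V × U | ∃ b, (r.1, b) ∈ P ∧ (b, r.2) ∈ Q} ⊆
        {r | ∃ b', (r.1, b') ∈ insert (a, b) P ∧ (b', r.2) ∈ insert (b, c) Q} := by
    grind
  induction q generalizing P Q with
  | zero => exact hp h h'
  | succ q ih =>
    refine ⟨hp h.1 h'.1, fun a => ?_, fun c => ?_⟩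
    · obtain ⟨b, hb⟩ := h.2.1 a
      obtain ⟨c, hc⟩ := h'.2.1 b
      exact ⟨c, (ih hb hc).mono (hi a b c P Q)⟩
    · obtain ⟨b, hb⟩ := h'.2.2 c
      obtain ⟨a, ha⟩ := h.2.2 b
      exact ⟨a, (ih ha hb).mono (hi a b c P Q)⟩

theorem EF.of_iso (e : G ≃g H) {q : ℕ} {P : Set (V × W)} (hP : ∀ r ∈ P, r.2 = e r.1) :
    EF G H q P := by
  have hp : ∀ {P : Set (V × W)}, (∀ r ∈ P, r.2 = e r.1) → PIso G H P := fun hP r hr s hs => by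
    rw [hP r hr, hP s hs]
    exact ⟨e.injective.eq_iff.symm, e.map_adj_iff.symm⟩
  induction q generalizing P with
  | zero => exact hp hP
  | succ q ih =>
    have hi : ∀ a, ∀ r ∈ insert (a, e a) P, r.2 = e r.1 := by grind
    exact ⟨hp hP, fun a => ⟨e a, ih (hi a)⟩, fun b => ⟨e.symm b, ih (by simpa using hi (e.symm b))⟩⟩

/-- Duplicator can answer a whole finite set of moves. -/
theorem EF.extend [Nonempty W] {q : ℕ} {P : Set (V × W)} (s : Finset V)
    (h : EF G H (q + s.card) P) :
    ∃ g : V → W, EF G H q (P ∪ (fun a => (a, g a)) '' (s : Set V)) := by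
  classical
  induction s using Finset.induction_on generalizing q with
  | empty => exact ⟨fun _ => Classical.arbitrary W, by simpa using h⟩
  | insert a s has ih =>
    rw [Finset.card_insert_of_notMem has, show q + (s.card + 1) = q + 1 + s.card by ring] at h
    obtain ⟨g, hg⟩ := ih h
    obtain ⟨b, hb⟩ := hg.2.1 a
    refine ⟨Function.update g a b, hb.mono ?_⟩
    grind

theorem range_snoc_pair {n : ℕ} (f : Fin n → V) (g : Fin n → W) (a : V) (b : W) :
    (Set.range fun i => ((Fin.snoc f a : Fin (n + 1) → V) i, (Fin.snoc g b : Fin (n + 1) → W) i)) =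
      insert (a, b) (Set.range fun i => (f i, g i)) := by
  ext r
  constructor
  · rintro ⟨i, rfl⟩
    refine Fin.lastCases ?_ (fun j => ?_) i
    · left; simp
    · right; exact ⟨j, by simp⟩
  · rintro (rfl | ⟨j, rfl⟩)
    · exact ⟨Fin.last n, by simp⟩
    · exact ⟨j.castSucc, by simp⟩

theorem EF.realize_iff {n q : ℕ} (φ : GForm n) (f : Fin n → V) (g : Fin n → W)
    (h : EF G H q (Set.range fun i => (f i, g i))) (hq : φ.depth ≤ q) :
    φ.Realize G f ↔ φ.Realize H g := by
  induction φ generalizing q with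
  | adj i j => exact (h.piso _ ⟨i, rfl⟩ _ ⟨j, rfl⟩).2
  | eq i j => exact (h.piso _ ⟨i, rfl⟩ _ ⟨j, rfl⟩).1
  | neg φ ih => exact not_congr (ih f g h hq)
  | conj φ ψ ih1 ih2 =>
    exact and_congr (ih1 f g h (le_trans (le_max_left _ _) hq))
      (ih2 f g h (le_trans (le_max_right _ _) hq))
  | disj φ ψ ih1 ih2 =>
    exact or_congr (ih1 f g h (le_trans (le_max_left _ _) hq))
      (ih2 f g h (le_trans (le_max_right _ _) hq))
  | ex φ ih =>
    obtain ⟨q, rfl⟩ : ∃ p, q = p + 1 := ⟨q - 1, by simp only [GForm.depth] at hq; omega⟩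
    have hd : φ.depth ≤ q := by simp only [GForm.depth] at hq; omega
    constructor
    · rintro ⟨a, ha⟩
      obtain ⟨b, hb⟩ := h.2.1 a
      exact ⟨b, (ih _ _ (by rwa [range_snoc_pair]) hd).1 ha⟩
    · rintro ⟨b, hb⟩
      obtain ⟨a, ha⟩ := h.2.2 b
      exact ⟨a, (ih _ _ (by rwa [range_snoc_pair]) hd).2 hb⟩
  | fa φ ih =>
    obtain ⟨q, rfl⟩ : ∃ p, q = p + 1 := ⟨q - 1, by simp only [GForm.depth] at hq; omega⟩
    have hd : φ.depth ≤ q := by simp only [GForm.depth] at hq; omega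
    constructor
    · intro hall b
      obtain ⟨a, ha⟩ := h.2.2 b
      exact (ih _ _ (by rwa [range_snoc_pair]) hd).1 (hall a)
    · intro hall a
      obtain ⟨b, hb⟩ := h.2.1 a
      exact (ih _ _ (by rwa [range_snoc_pair]) hd).2 (hall b)

theorem exists_conj_form {n q : ℕ} (h : 0 < n ∨ 0 < q) {ι : Type} (s : Finset ι)
    (R : ι → ∀ (W : Type), SimpleGraph W → (Fin n → W) → Prop)
    (hR : ∀ i, ∃ φ : GForm n, φ.depth ≤ q ∧ ∀ W H g, φ.Realize H g ↔ R i W H g) :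
    ∃ φ : GForm n, φ.depth ≤ q ∧ ∀ W H g, φ.Realize H g ↔ ∀ i ∈ s, R i W H g := by
  classical
  induction s using Finset.induction_on with
  | empty =>
    rcases h with h | h
    · exact ⟨.eq ⟨0, h⟩ ⟨0, h⟩, Nat.zero_le _, by simp [GForm.Realize]⟩
    · exact ⟨.fa (.eq (Fin.last n) (Fin.last n)), h, by simp [GForm.Realize]⟩
  | insert a s _ ih =>
    obtain ⟨φ, h1, h2⟩ := ih
    obtain ⟨ψ, h3, h4⟩ := hR a
    refine ⟨.conj ψ φ, max_le h3 h1, fun W H g => ?_⟩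
    simp only [GForm.Realize, Finset.forall_mem_insert, h2, h4]

theorem exists_piso_form (G : SimpleGraph V) {n q : ℕ} (h : 0 < n ∨ 0 < q) (f : Fin n → V) :
    ∃ φ : GForm n, φ.depth ≤ q ∧ ∀ (W : Type) (H : SimpleGraph W) (g : Fin n → W),
      φ.Realize H g ↔ PIso G H (Set.range fun i => (f i, g i)) := by
  obtain ⟨φ, h1, h2⟩ := exists_conj_form h (Finset.univ : Finset (Fin n × Fin n))
    (fun p W H g => (f p.1 = f p.2 ↔ g p.1 = g p.2) ∧ (G.Adj (f p.1) (f p.2) ↔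
      H.Adj (g p.1) (g p.2))) (fun p => by
      have key : ∀ (c : Prop) (χ : GForm n), χ.depth = 0 → ∃ φ : GForm n, φ.depth = 0 ∧
          ∀ (W : Type) (H : SimpleGraph W) (g : Fin n → W),
            φ.Realize H g ↔ (c ↔ χ.Realize H g) := fun c χ hχ => by
        by_cases hc : c
        · exact ⟨χ, hχ, by simp [hc]⟩
        · exact ⟨.neg χ, hχ, by simp [GForm.Realize, hc]⟩
      obtain ⟨φ, h1, h1'⟩ := key (f p.1 = f p.2) (.eq p.1 p.2) rfl
      obtain ⟨ψ, h2, h2'⟩ := key (G.Adj (f p.1) (f p.2)) (.adj p.1 p.2) rfl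
      exact ⟨.conj φ ψ, (max_le h1.le h2.le).trans (Nat.zero_le _), fun W H g =>
        and_congr (h1' W H g) (h2' W H g)⟩)
  refine ⟨φ, h1, fun W H g => (h2 W H g).trans ⟨fun hp => ?_, fun hp p _ => ?_⟩⟩
  · rintro r ⟨i, rfl⟩ s ⟨j, rfl⟩
    exact hp (i, j) (Finset.mem_univ _)
  · exact hp _ ⟨p.1, rfl⟩ _ ⟨p.2, rfl⟩

theorem exists_ef_form [Finite V] (G : SimpleGraph V) {n q : ℕ} (h : 0 < n ∨ 0 < q)
    (f : Fin n → V) :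
    ∃ φ : GForm n, φ.depth ≤ q ∧ ∀ (W : Type) (H : SimpleGraph W) (g : Fin n → W),
      φ.Realize H g ↔ EF G H q (Set.range fun i => (f i, g i)) := by
  have := Fintype.ofFinite V
  induction q generalizing n with
  | zero => exact exists_piso_form G h f
  | succ q ih =>
    choose F hF1 hF2 using fun v : V => ih (Or.inl (Nat.succ_pos n)) (Fin.snoc f v)
    obtain ⟨φ1, h1, h1'⟩ := exists_piso_form G h f
    obtain ⟨φ2, h2, h2'⟩ := exists_conj_form h (Finset.univ : Finset V)
      (fun v W H g => ∃ b, EF G H q (insert (v, b) (Set.range fun i => (f i, g i))))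
      (fun v => ⟨.ex (F v), Nat.succ_le_succ (hF1 v), fun W H g => by
        simp only [GForm.Realize, hF2, range_snoc_pair]⟩)
    obtain ⟨φ3, h3, h3'⟩ := exists_conj_form (n := n + 1) (q := q) (Or.inl (Nat.succ_pos n))
      (Finset.univ : Finset V) (fun v W H g => ¬ (F v).Realize H g)
      (fun v => ⟨.neg (F v), hF1 v, fun W H g => Iff.rfl⟩)
    refine ⟨.conj φ1 (.conj φ2 (.neg (.ex φ3))), max_le h1 (max_le h2 (Nat.succ_le_succ h3)),
      fun W H g => and_congr (h1' W H g) (and_congr ((h2' W H g).trans (by simp)) ?_)⟩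
    simp only [GForm.Realize, h3', hF2, range_snoc_pair]
    simp

/-- If Duplicator's victory in `q` rounds forces isomorphism, then `q` quantifiers define `G`. -/
theorem exists_defines_of_ef [Finite V] (G : SimpleGraph V) {q : ℕ} (hq : 0 < q)
    (h : ∀ (m : ℕ) (H : SimpleGraph (Fin m)), EF G H q ∅ → Nonempty (G ≃g H)) :
    ∃ φ : GForm 0, φ.depth ≤ q ∧ Defines G φ := by
  obtain ⟨φ, h1, h2⟩ := exists_ef_form G (Or.inr hq) (![] : Fin 0 → V)
  have hr : ∀ {W : Type} (g : Fin 0 → W), (Set.range fun i => ((![] : Fin 0 → V) i, g i)) = ∅ :=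
    fun g => by simp
  refine ⟨φ, h1, ?_, fun m H hH => h m H ?_⟩
  · exact (h2 V G ![]).2 (EF.of_iso .refl (by simp))
  · simpa [hr] using (h2 _ H ![]).1 hH

theorem D_le_of_ef [Finite V] (G : SimpleGraph V) {q : ℕ} (hq : 0 < q)
    (h : ∀ (m : ℕ) (H : SimpleGraph (Fin m)), EF G H q ∅ → Nonempty (G ≃g H)) : D G ≤ q := by
  obtain ⟨φ, h1, h2⟩ := exists_defines_of_ef G hq h
  refine le_trans (Nat.sInf_le ?_) h1
  exact ⟨φ, rfl, h2⟩

theorem ef_of_extra_leaf {k : ℕ} {v : V} {L : Finset V} (hL : k ≤ L.card)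
    (hleaf : ∀ ℓ ∈ L, ∀ y, G.Adj ℓ y ↔ y = v) (j : ℕ) (P : Set (V × W)) (T : Finset V) (e : V → W)
    (hP : ∀ r ∈ P, r.1 ∈ T ∧ r.2 = e r.1) (hT : T.card + j ≤ k)
    (he : Function.Injective e) (hadj : ∀ a b, G.Adj a b ↔ H.Adj (e a) (e b)) (x : W)
    (hx : ∀ y, y ≠ x ↔ y ∈ Set.range e) (hxl : ∀ y, H.Adj x y ↔ y = e v) : EF G H j P := by
  classical
  have hpi : PIso G H P := fun r hr s hs => by grind
  have hins : ∀ (a : V) (P : Set (V × W)) (T : Finset V) (e : V → W),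
      (∀ r ∈ P, r.1 ∈ T ∧ r.2 = e r.1) →
      ∀ r ∈ insert (a, e a) P, r.1 ∈ insert a T ∧ r.2 = e r.1 := by
    grind
  induction j generalizing P T e x with
  | zero => exact hpi
  | succ j ih =>
    have hc : ∀ a, (insert a T).card + j ≤ k := fun a => by
      have := Finset.card_insert_le a T
      omega
    have old : ∀ a, EF G H j (insert (a, e a) P) := fun a =>
      ih _ (insert a T) e (hins a P T e hP) (hc a) he hadj x hx hxl
        (fun r hr s hs => by
          rw [(hins a P T e hP r hr).2, (hins a P T e hP s hs).2, ← hadj]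
          exact ⟨he.eq_iff.symm, Iff.rfl⟩)
    refine ⟨hpi, fun a => ⟨e a, old a⟩, fun b => ?_⟩
    by_cases hb : b = x
    · subst hb
      obtain ⟨ℓ, hℓ, hℓT⟩ : ∃ ℓ ∈ L, ℓ ∉ T := by
        by_contra hcon
        push Not at hcon
        have := Finset.card_le_card hcon
        omega
      have hv : v ≠ ℓ := by
        rintro rfl
        exact G.loopless.irrefl v ((hleaf v hℓ v).2 rfl)
      have hbe : ∀ a, e a ≠ b := fun a => (hx _).2 ⟨a, rfl⟩
      set e' := Function.update e ℓ b with he'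
      have e1 : e' ℓ = b := by simp [he']
      have e2 : ∀ a, a ≠ ℓ → e' a = e a := fun a ha => by simp [he', ha]
      have hinj : Function.Injective e' := by
        intro a c hac
        grind
      have hadj' : ∀ a c, G.Adj a c ↔ H.Adj (e' a) (e' c) := by
        have hl : ∀ c, c ≠ ℓ → (G.Adj ℓ c ↔ H.Adj b (e c)) := fun c _ => by
          rw [hleaf ℓ hℓ, hxl, he.eq_iff]
        intro a c
        by_cases h1 : a = ℓ <;> by_cases h2 : c = ℓ
        · rw [h1, h2]; simp
        · rw [h1, e1, e2 c h2]; exact hl c h2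
        · rw [h2, e1, e2 a h1, G.adj_comm, H.adj_comm]; exact hl a h1
        · rw [e2 a h1, e2 c h2]; exact hadj a c
      have hP' : ∀ r ∈ P, r.1 ∈ T ∧ r.2 = e' r.1 := fun r hr => by grind
      have hI := hins ℓ P T e' hP'
      rw [e1] at hI
      refine ⟨ℓ, ih _ (insert ℓ T) e' hI (hc ℓ) hinj hadj' (e ℓ) (fun y => ?_) (fun y => ?_)
        (fun r hr s hs => ?_)⟩
      · constructor
        · intro hy
          by_cases hyb : y = b
          · exact ⟨ℓ, by rw [e1, hyb]⟩
          · obtain ⟨a, rfl⟩ := (hx y).1 hyb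
            exact ⟨a, e2 a (fun h => hy (by rw [h]))⟩
        · grind
      · rw [e2 v hv]
        by_cases hyb : y = b
        · subst hyb
          rw [H.adj_comm, hxl]
          grind
        · obtain ⟨a, rfl⟩ := (hx y).1 hyb
          rw [← hadj, hleaf ℓ hℓ, he.eq_iff]
      · grind
    · obtain ⟨a, rfl⟩ := (hx b).1 hb
      exact ⟨a, old a⟩

/-- A vertex with many pendant neighbours forces many quantifiers. -/
theorem depth_ge_of_leaves [Finite V] (G : SimpleGraph V) {k : ℕ} {v : V} {L : Finset V}
    (hL : k ≤ L.card) (hleaf : ∀ ℓ ∈ L, ∀ y, G.Adj ℓ y ↔ y = v) (φ : GForm 0)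
    (hφ : Defines G φ) : k < φ.depth := by
  by_contra hlt
  have := Fintype.ofFinite V
  let H : SimpleGraph (Option V) :=
    { Adj := fun a b => match a, b with
        | some a, some b => G.Adj a b
        | some a, none => a = v
        | none, some b => b = v
        | none, none => False
      symm := ⟨by rintro (_ | a) (_ | b) h <;> simp_all [G.adj_comm]⟩
      loopless := ⟨by rintro (_ | a) h <;> simp_all⟩ }
  have hEF : EF G H k ∅ := by
    refine ef_of_extra_leaf hL hleaf k ∅ ∅ some (by simp) (by simp) (Option.some_injective V)
      (fun a b => Iff.rfl) none (fun y => ?_) (fun y => ?_)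
    · cases y <;> simp
    · grind
  let e := Fintype.equivFin (Option V)
  let H' : SimpleGraph (Fin (Fintype.card (Option V))) := H.map e.toEmbedding
  have ei : H ≃g H' := SimpleGraph.Iso.map e H
  have hs : EF G H k (Set.range fun i => ((![] : Fin 0 → V) i, (![] : Fin 0 → Option V) i)) := by
    simpa using hEF
  have hH : Sat H φ := (hs.realize_iff φ _ _ (not_lt.1 hlt)).1 hφ.1
  have hs' : EF H H' φ.depth
      (Set.range fun i => ((![] : Fin 0 → Option V) i, (![] : Fin 0 → _) i)) :=
    EF.of_iso ei (by simp)
  have hH' : Sat H' φ := (hs'.realize_iff φ _ _ le_rfl).1 hH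
  obtain ⟨f⟩ := hφ.2 _ H' hH'
  have h1 := Fintype.card_congr f.toEquiv
  simp at h1

theorem le_D_of_leaves [Finite V] (G : SimpleGraph V) {k : ℕ} {v : V} {L : Finset V}
    (hL : k ≤ L.card) (hleaf : ∀ ℓ ∈ L, ∀ y, G.Adj ℓ y ↔ y = v)
    (hex : ∃ φ : GForm 0, Defines G φ) : k ≤ D G := by
  obtain ⟨φ, hφ⟩ := hex
  refine le_csInf ⟨_, φ, rfl, hφ⟩ ?_
  rintro d ⟨ψ, rfl, hψ⟩
  exact (depth_ge_of_leaves G hL hleaf ψ hψ).le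

end Games


section Components

variable {V W U : Type}

/-- The component of `x`. -/
def cc (F : SimpleGraph V) (x : V) : Set V := {z | F.Reachable x z}

theorem mem_cc_self (F : SimpleGraph V) (x : V) : x ∈ cc F x := SimpleGraph.Reachable.refl x

theorem cc_eq_of_mem {F : SimpleGraph V} {x z : V} (h : z ∈ cc F x) : cc F z = cc F x := by
  ext w
  exact ⟨fun hw => SimpleGraph.Reachable.trans h hw,
    fun hw => SimpleGraph.Reachable.trans (SimpleGraph.Reachable.symm h) hw⟩

theorem cc_eq_of_adj {F : SimpleGraph V} {x z : V} (h : F.Adj x z) : cc F z = cc F x :=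
  cc_eq_of_mem h.reachable

theorem cc_eq_of_inter {F : SimpleGraph V} {x y z : V} (h : z ∈ cc F x) (h' : z ∈ cc F y) :
    cc F x = cc F y := by rw [← cc_eq_of_mem h, cc_eq_of_mem h']

theorem cc_subset {F : SimpleGraph V} {x : V} {S : Set V} (hx : x ∈ S)
    (hS : ∀ a ∈ S, ∀ b, F.Adj a b → b ∈ S) : cc F x ⊆ S := by
  intro z hz
  obtain ⟨w⟩ := (hz : F.Reachable x z)
  induction w with
  | nil => exact hx
  | cons h _ ih => exact ih (hS _ hx _ h)

theorem cc_mono {F F' : SimpleGraph V} (h : F ≤ F') (x : V) : cc F x ⊆ cc F' x :=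
  fun _ hz => SimpleGraph.Reachable.mono h hz

/-- A nonempty set that cannot be cut in two without cutting an edge. -/
def Cn (F : SimpleGraph V) (S : Set V) : Prop :=
  S.Nonempty ∧ ∀ B : Set V, (∃ a ∈ S, a ∈ B) → (∃ b ∈ S, b ∉ B) →
    ∃ a ∈ S, ∃ b ∈ S, a ∈ B ∧ b ∉ B ∧ F.Adj a b

theorem cn_cc (F : SimpleGraph V) (x : V) : Cn F (cc F x) := by
  refine ⟨⟨x, mem_cc_self F x⟩, ?_⟩
  rintro B ⟨a, ha, haB⟩ ⟨b, hb, hbB⟩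
  by_contra hcon
  push Not at hcon
  have hsub : cc F a ⊆ {z | z ∈ cc F x ∧ z ∈ B} := by
    refine cc_subset ⟨ha, haB⟩ ?_
    rintro u ⟨hu, huB⟩ w huw
    have hw : w ∈ cc F x := by
      rw [← cc_eq_of_mem hu]
      exact huw.reachable
    grind
  rw [cc_eq_of_mem ha] at hsub
  exact hbB (hsub hb).2

theorem Cn.subset_cc {F : SimpleGraph V} {S : Set V} (h : Cn F S) {x : V} (hx : x ∈ S) :
    S ⊆ cc F x := by
  intro z hz
  by_contra hzc
  obtain ⟨a, _, b, _, ha, hb, hab⟩ := h.2 (cc F x) ⟨x, hx, mem_cc_self F x⟩ ⟨z, hz, hzc⟩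
  exact hb (SimpleGraph.Reachable.trans ha hab.reachable)

theorem Cn.mono {F F' : SimpleGraph V} {S : Set V} (h : Cn F S)
    (hF : ∀ a ∈ S, ∀ b ∈ S, F.Adj a b → F'.Adj a b) : Cn F' S := by
  refine ⟨h.1, fun B h1 h2 => ?_⟩
  obtain ⟨a, ha, b, hb, haB, hbB, hab⟩ := h.2 B h1 h2
  exact ⟨a, ha, b, hb, haB, hbB, hF a ha b hb hab⟩

theorem cn_singleton (F : SimpleGraph V) (x : V) : Cn F {x} := by
  refine ⟨⟨x, rfl⟩, ?_⟩
  simp_all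

theorem Cn.union_of_link {F : SimpleGraph V} {S T : Set V} (hS : Cn F S) (hT : Cn F T) {a b : V}
    (ha : a ∈ S) (hb : b ∈ T) (hab : a = b ∨ F.Adj a b) : Cn F (S ∪ T) := by
  refine ⟨hS.1.mono Set.subset_union_left, ?_⟩
  intro B h1 h2
  by_cases h3 : (∃ a ∈ S, a ∈ B) ∧ ∃ b ∈ S, b ∉ B
  · obtain ⟨a, ha, b, hb, h⟩ := hS.2 B h3.1 h3.2
    exact ⟨a, Or.inl ha, b, Or.inl hb, h⟩
  by_cases h4 : (∃ a ∈ T, a ∈ B) ∧ ∃ b ∈ T, b ∉ B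
  · obtain ⟨a, ha, b, hb, h⟩ := hT.2 B h4.1 h4.2
    exact ⟨a, Or.inr ha, b, Or.inr hb, h⟩
  have key : (a ∈ B ↔ b ∉ B) := by grind
  rcases hab with rfl | hab
  · simp_all
  · by_cases h : a ∈ B
    · grind
    · exact ⟨b, Or.inr hb, a, Or.inl ha, by_contra fun hb => h (key.2 hb), h, hab.symm⟩

theorem Cn.insert_adj {F : SimpleGraph V} {S : Set V} (hS : Cn F S) {a b : V}
    (ha : a ∈ S) (hab : F.Adj a b) : Cn F (insert b S) := by
  rw [Set.insert_eq, Set.union_comm]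
  exact hS.union_of_link (cn_singleton F b) ha rfl (Or.inr hab)

/-- Edges inside `S`. -/
def eset (F : SimpleGraph V) (S : Set V) : Set (Sym2 V) := {e | e ∈ F.edgeSet ∧ ∀ v ∈ e, v ∈ S}

/-- Number of edges inside `S`. -/
noncomputable def ein (F : SimpleGraph V) (S : Set V) : ℕ := (eset F S).ncard

theorem mk_mem_eset {F : SimpleGraph V} {S : Set V} {a b : V} :
    s(a, b) ∈ eset F S ↔ F.Adj a b ∧ a ∈ S ∧ b ∈ S := by simp [eset]

theorem eset_mono {F F' : SimpleGraph V} {S T : Set V} (h : F ≤ F') (hS : S ⊆ T) :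
    eset F S ⊆ eset F' T :=
  fun _ he => ⟨SimpleGraph.edgeSet_mono h he.1, fun v hv => hS (he.2 v hv)⟩

theorem ein_mono [Finite V] {F F' : SimpleGraph V} {S T : Set V} (h : F ≤ F') (hS : S ⊆ T) :
    ein F S ≤ ein F' T := Set.ncard_le_ncard (eset_mono h hS) (Set.toFinite _)

theorem Cn.ein_add_le [Finite V] {F : SimpleGraph V} {S : Set V} (h : Cn F S) {B : Set V}
    (hB : B ⊆ S) (hne : B.Nonempty) : ein F B + (S \ B).ncard ≤ ein F S := by
  obtain ⟨n, hn⟩ : ∃ n, (S \ B).ncard = n := ⟨_, rfl⟩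
  induction n generalizing B with
  | zero =>
    rw [hn]
    exact ein_mono le_rfl hB
  | succ n ih =>
    have hnem : (S \ B).Nonempty := by
      rw [← Set.ncard_pos (Set.toFinite _)]
      omega
    obtain ⟨y, hy⟩ := hnem
    obtain ⟨x, hx⟩ := hne
    obtain ⟨a, ha, b, hb, haB, hbB, hab⟩ := h.2 B ⟨x, hB hx, hx⟩ ⟨y, hy.1, hy.2⟩
    have h1 : insert b B ⊆ S := Set.insert_subset hb hB
    have h2 : (S \ insert b B).ncard = n := by
      have h3 : S \ B = insert b (S \ insert b B) := by simp_all
      rw [h3, Set.ncard_insert_of_notMem (by simp) (Set.toFinite _)] at hn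
      omega
    have h3 := ih h1 ⟨b, Set.mem_insert _ _⟩ h2
    have h4 : ein F B + 1 ≤ ein F (insert b B) := by
      unfold ein
      rw [← Set.ncard_insert_of_notMem (a := s(a, b)) (s := eset F B)
        (fun hm => hbB (mk_mem_eset.1 hm).2.2) (Set.toFinite _)]
      refine Set.ncard_le_ncard ?_ (Set.toFinite _)
      rintro e (rfl | he)
      · exact mk_mem_eset.2 ⟨hab, Set.mem_insert_of_mem _ haB, Set.mem_insert _ _⟩
      · exact eset_mono le_rfl (Set.subset_insert _ _) he
    omega

theorem Cn.ncard_le [Finite V] {F : SimpleGraph V} {S : Set V} (h : Cn F S) :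
    S.ncard ≤ ein F S + 1 := by
  obtain ⟨x, hx⟩ := h.1
  have h1 := h.ein_add_le (Set.singleton_subset_iff.2 hx) ⟨x, rfl⟩
  have h2 := Set.ncard_sdiff_add_ncard_of_subset (Set.singleton_subset_iff.2 hx) (Set.toFinite S)
  rw [Set.ncard_singleton] at h2
  omega

/-- Remove one edge. -/
def delE (F : SimpleGraph V) (u v : V) : SimpleGraph V where
  Adj a b := F.Adj a b ∧ s(a, b) ≠ s(u, v)
  symm := ⟨fun _ _ h => ⟨h.1.symm, by rw [Sym2.eq_swap]; exact h.2⟩⟩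
  loopless := ⟨fun _ h => F.loopless.irrefl _ h.1⟩

/-- Remove all edges meeting `A`. -/
def delV (F : SimpleGraph V) (A : Set V) : SimpleGraph V where
  Adj a b := F.Adj a b ∧ a ∉ A ∧ b ∉ A
  symm := ⟨fun _ _ h => ⟨h.1.symm, h.2.2, h.2.1⟩⟩
  loopless := ⟨fun _ h => F.loopless.irrefl _ h.1⟩

theorem delE_le (F : SimpleGraph V) (u v : V) : delE F u v ≤ F := fun _ _ h => h.1

theorem delV_le (F : SimpleGraph V) (A : Set V) : delV F A ≤ F := fun _ _ h => h.1

theorem ein_delE [Finite V] {F : SimpleGraph V} {S : Set V} {u v : V} (h : F.Adj u v) (hu : u ∈ S)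
    (hv : v ∈ S) : ein (delE F u v) S + 1 = ein F S := by
  unfold ein
  rw [← Set.ncard_insert_of_notMem (a := s(u, v)) (s := eset (delE F u v) S)
    (fun hm => (mk_mem_eset.1 hm).1.2 rfl) (Set.toFinite _)]
  congr 1
  ext e
  induction e with
  | _ a b =>
    rw [Set.mem_insert_iff, mk_mem_eset, mk_mem_eset]
    constructor
    · rintro (h1 | h1)
      · rcases Sym2.eq_iff.1 h1 with ⟨rfl, rfl⟩ | ⟨rfl, rfl⟩
        · exact ⟨h, hu, hv⟩
        · exact ⟨h.symm, hv, hu⟩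
      · exact ⟨h1.1.1, h1.2⟩
    · intro h1
      by_cases h2 : s(a, b) = s(u, v)
      · exact Or.inl h2
      · exact Or.inr ⟨⟨h1.1, h2⟩, h1.2⟩

/-- If the ends of an edge are joined after its removal, the component is unchanged. -/
theorem cc_delE {F : SimpleGraph V} {u v : V} (h : v ∈ cc (delE F u v) u) (x : V) :
    cc (delE F u v) x = cc F x := by
  refine (cc_mono (delE_le F u v) x).antisymm ?_
  refine cc_subset (mem_cc_self _ _) ?_
  intro a ha b hab
  by_cases h1 : s(a, b) = s(u, v)
  · rcases Sym2.eq_iff.1 h1 with ⟨rfl, rfl⟩ | ⟨rfl, rfl⟩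
    · exact SimpleGraph.Reachable.trans ha h
    · exact SimpleGraph.Reachable.trans ha (SimpleGraph.Reachable.symm h)
  · exact SimpleGraph.Reachable.trans ha
      (SimpleGraph.Adj.reachable (show (delE F u v).Adj a b from ⟨hab, h1⟩))

/-- In a tree component every edge is a bridge. -/
theorem bridge_of_tree [Finite V] {F : SimpleGraph V} {x u v : V}
    (ht : ein F (cc F x) + 1 ≤ (cc F x).ncard) (hu : u ∈ cc F x) (huv : F.Adj u v) :
    v ∉ cc (delE F u v) u := by
  intro h
  have hv : v ∈ cc F x := SimpleGraph.Reachable.trans hu huv.reachable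
  have h1 := ein_delE huv hu hv
  have h2 := cn_cc (delE F u v) x
  rw [cc_delE h] at h2
  have h3 := h2.ncard_le
  omega

/-- A component with a surplus edge has an edge that is not a bridge. -/
theorem exists_not_bridge [Finite V] {F : SimpleGraph V} {x : V}
    (h : (cc F x).ncard ≤ ein F (cc F x)) :
    ∃ u v, u ∈ cc F x ∧ F.Adj u v ∧ v ∈ cc (delE F u v) u := by
  by_contra hcon
  push Not at hcon
  have grow : ∀ n (E : Set (Sym2 V)), (∃ B, B ⊆ cc F x ∧ x ∈ B ∧ (cc F x \ B).ncard = n ∧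
      E ⊆ eset F B ∧ E.ncard + 1 = B.ncard ∧ ∀ b ∈ B, (SimpleGraph.fromEdgeSet E).Reachable x b) →
      ∃ E' ⊆ eset F (cc F x), E'.ncard + 1 = (cc F x).ncard ∧
        ∀ b ∈ cc F x, (SimpleGraph.fromEdgeSet E').Reachable x b := by
    intro n
    induction n with
    | zero =>
      rintro E ⟨B, hB, hxB, hn, hE, hc, hr⟩
      have : B = cc F x := by
        refine hB.antisymm (Set.sdiff_eq_empty.1 ?_)
        rwa [Set.ncard_eq_zero (Set.toFinite _)] at hn
      subst this
      exact ⟨E, hE, hc, hr⟩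
    | succ n ih =>
      rintro E ⟨B, hB, hxB, hn, hE, hc, hr⟩
      have hnem : (cc F x \ B).Nonempty := by
        rw [← Set.ncard_pos (Set.toFinite _)]
        omega
      obtain ⟨y, hy⟩ := hnem
      obtain ⟨a, ha, b, hb, haB, hbB, hab⟩ :=
        (cn_cc F x).2 B ⟨x, hB hxB, hxB⟩ ⟨y, hy.1, hy.2⟩
      have hmem : s(a, b) ∉ E := fun hm => hbB (mk_mem_eset.1 (hE hm)).2.2
      have hle : SimpleGraph.fromEdgeSet E ≤ SimpleGraph.fromEdgeSet (insert s(a, b) E) :=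
        SimpleGraph.fromEdgeSet_mono (Set.subset_insert _ _)
      refine ih (insert s(a, b) E) ⟨insert b B, Set.insert_subset hb hB,
        Set.mem_insert_of_mem _ hxB, ?_, ?_, ?_, ?_⟩
      · have h3 : cc F x \ B = insert b (cc F x \ insert b B) := by simp_all
        rw [h3, Set.ncard_insert_of_notMem (by simp) (Set.toFinite _)] at hn
        omega
      · rintro e (rfl | he)
        · exact mk_mem_eset.2 ⟨hab, Set.mem_insert_of_mem _ haB, Set.mem_insert _ _⟩
        · exact eset_mono le_rfl (Set.subset_insert _ _) (hE he)
      · rw [Set.ncard_insert_of_notMem hmem (Set.toFinite _),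
          Set.ncard_insert_of_notMem hbB (Set.toFinite _)]
        omega
      · rintro w (rfl | hw)
        · refine ((hr a haB).mono hle).trans (SimpleGraph.Adj.reachable ?_)
          rw [SimpleGraph.fromEdgeSet_adj]
          exact ⟨Set.mem_insert _ _, hab.ne⟩
        · exact (hr w hw).mono hle
  obtain ⟨E, hE, hc, hr⟩ := grow _ ∅ ⟨{x}, Set.singleton_subset_iff.2 (mem_cc_self F x), rfl, rfl,
    Set.empty_subset _, by simp, by rintro b rfl; exact SimpleGraph.Reachable.refl _⟩
  have hlt : E.ncard < (eset F (cc F x)).ncard := by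
    change _ < ein F (cc F x)
    omega
  obtain ⟨e, he, heE⟩ := Set.exists_mem_notMem_of_ncard_lt_ncard hlt (Set.toFinite _)
  induction e with
  | _ u v =>
    obtain ⟨huv, hu, hv⟩ := mk_mem_eset.1 he
    refine hcon u v hu huv ?_
    have hle : SimpleGraph.fromEdgeSet E ≤ delE F u v := by
      intro a b hab
      rw [SimpleGraph.fromEdgeSet_adj] at hab
      exact ⟨(mk_mem_eset.1 (hE hab.1)).1, fun h => heE (h ▸ hab.1)⟩
    exact ((hr u hu).symm.trans (hr v hv)).mono hle

end Components


section Matching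

variable {V W U κ κ₁ : Type}

/-- Isomorphism of colored pieces. -/
def SI (F : SimpleGraph V) (F' : SimpleGraph W) (col : V → κ) (col' : W → κ) (S : Set V)
    (S' : Set W) : Prop :=
  ∃ f : V → W, Set.BijOn f S S' ∧ (∀ a ∈ S, ∀ b ∈ S, F.Adj a b ↔ F'.Adj (f a) (f b)) ∧
    ∀ a ∈ S, col a = col' (f a)

theorem SI.refl (F : SimpleGraph V) (col : V → κ) (S : Set V) : SI F F col col S S :=
  ⟨id, Set.bijOn_id S, fun _ _ _ _ => Iff.rfl, fun _ _ => rfl⟩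

theorem SI.trans {F : SimpleGraph V} {F' : SimpleGraph W} {F'' : SimpleGraph U} {col : V → κ}
    {col' : W → κ} {col'' : U → κ} {S : Set V} {S' : Set W} {S'' : Set U}
    (h : SI F F' col col' S S') (h' : SI F' F'' col' col'' S' S'') :
    SI F F'' col col'' S S'' := by
  obtain ⟨f, h1, h2, h3⟩ := h
  obtain ⟨g, h4, h5, h6⟩ := h'
  exact ⟨g ∘ f, h4.comp h1, fun a ha b hb => (h2 a ha b hb).trans
    (h5 _ (h1.mapsTo ha) _ (h1.mapsTo hb)), fun a ha => (h3 a ha).trans (h6 _ (h1.mapsTo ha))⟩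

theorem SI.symm [Nonempty V] {F : SimpleGraph V} {F' : SimpleGraph W} {col : V → κ}
    {col' : W → κ} {S : Set V} {S' : Set W} (h : SI F F' col col' S S') :
    SI F' F col' col S' S := by
  obtain ⟨f, h1, h2, h3⟩ := h
  have hr : ∀ b ∈ S', f (Function.invFunOn f S b) = b := fun b hb =>
    h1.invOn_invFunOn.2 hb
  have hm : ∀ b ∈ S', Function.invFunOn f S b ∈ S := fun b hb => h1.surjOn.mapsTo_invFunOn hb
  refine ⟨Function.invFunOn f S, ⟨h1.surjOn.mapsTo_invFunOn,
    (Set.LeftInvOn.injOn fun b hb => hr b hb), fun a ha =>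
      ⟨f a, h1.mapsTo ha, h1.invOn_invFunOn.1 ha⟩⟩, fun a ha b hb => ?_, fun a ha => ?_⟩
  all_goals simp_all

theorem SI.transfer {F F₁ : SimpleGraph V} {F' F₁' : SimpleGraph W} {col : V → κ}
    {col' : W → κ} {col₁ : V → κ₁} {col₁' : W → κ₁} {S : Set V} {S' : Set W}
    (h : SI F₁ F₁' col₁ col₁' S S') (hc : ∀ a b, col₁ a = col₁' b → col a = col' b)
    (ha : ∀ a b a' b', col₁ a = col₁' a' → col₁ b = col₁' b' →
      (F₁.Adj a b ↔ F₁'.Adj a' b') → (F.Adj a b ↔ F'.Adj a' b')) :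
    SI F F' col col' S S' := by
  obtain ⟨f, h1, h2, h3⟩ := h
  exact ⟨f, h1, fun a haS b hb => ha _ _ _ _ (h3 a haS) (h3 b hb) (h2 a haS b hb),
    fun a haS => hc _ _ (h3 a haS)⟩

theorem SI.ncard_eq {F : SimpleGraph V} {F' : SimpleGraph W} {col : V → κ}
    {col' : W → κ} {S : Set V} {S' : Set W} (h : SI F F' col col' S S') :
    S.ncard = S'.ncard := by
  obtain ⟨f, h1, -, -⟩ := h
  rw [← h1.image_eq, h1.injOn.ncard_image]

theorem SI.ein_eq {F : SimpleGraph V} {F' : SimpleGraph W} {col : V → κ}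
    {col' : W → κ} {S : Set V} {S' : Set W} (h : SI F F' col col' S S') :
    ein F S = ein F' S' := by
  obtain ⟨f, h1, h2, -⟩ := h
  have him : eset F' S' = Sym2.map f '' eset F S := by
    ext e
    induction e with
    | _ a b =>
      constructor
      · intro he
        obtain ⟨hab, ha, hb⟩ := mk_mem_eset.1 he
        obtain ⟨x, hx, rfl⟩ := h1.surjOn ha
        obtain ⟨y, hy, rfl⟩ := h1.surjOn hb
        exact ⟨s(x, y), mk_mem_eset.2 ⟨(h2 x hx y hy).2 hab, hx, hy⟩, rfl⟩
      · rintro ⟨e, he, heq⟩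
        rw [← heq]
        induction e with
        | _ x y =>
          obtain ⟨hab, hx, hy⟩ := mk_mem_eset.1 he
          exact mk_mem_eset.2 ⟨(h2 x hx y hy).1 hab, h1.mapsTo hx, h1.mapsTo hy⟩
  unfold ein
  rw [him, Set.InjOn.ncard_image]
  intro e he e' he' heq
  induction e with
  | _ a b =>
    induction e' with
    | _ c d =>
      obtain ⟨-, ha, hb⟩ := mk_mem_eset.1 he
      obtain ⟨-, hc, hd⟩ := mk_mem_eset.1 he'
      simp only [Sym2.map_mk, Sym2.eq_iff] at heq ⊢
      rcases heq with ⟨h3, h4⟩ | ⟨h3, h4⟩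
      · exact Or.inl ⟨h1.injOn ha hc h3, h1.injOn hb hd h4⟩
      · exact Or.inr ⟨h1.injOn ha hd h3, h1.injOn hb hc h4⟩

/-- The pairs of `P` with first entry `a`. -/
def mark (P : Set (V × W)) (a : V) : Set (V × W) := {r | r ∈ P ∧ r.1 = a}

/-- The pairs of `P` with second entry `b`. -/
def mark' (P : Set (V × W)) (b : W) : Set (V × W) := {r | r ∈ P ∧ r.2 = b}

theorem mark_eq {G : SimpleGraph V} {H : SimpleGraph W} {P Q : Set (V × W)} (h : PIso G H Q)
    (hPQ : P ⊆ Q) {a : V} {b : W} (hab : (a, b) ∈ Q) : mark P a = mark' P b := by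
  ext r
  exact and_congr_right fun hr => (h r (hPQ hr) _ hab).1

theorem eq_of_mark {P : Set (V × W)} {a a' : V} {b b' : W} (hab : (a, b) ∈ P)
    (h : mark P a' = mark' P b') : a' = a ↔ b' = b := by
  constructor
  · rintro rfl
    have : (a', b) ∈ mark' P b' := h ▸ ⟨hab, rfl⟩
    exact this.2.symm
  · rintro rfl
    have : (a, b') ∈ mark P a' := h ▸ ⟨hab, rfl⟩
    exact this.2.symm

/-- Colors and auxiliary adjacencies respected by Duplicator while `q` rounds remain. -/
def Pres (G : SimpleGraph V) (H : SimpleGraph W) (F : SimpleGraph V) (F' : SimpleGraph W)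
    (col : V → κ) (col' : W → κ) (q : ℕ) (P₀ : Set (V × W)) : Prop :=
  ∀ P, P₀ ⊆ P → EF G H q P → ∀ r ∈ P, col r.1 = col' r.2 ∧
    ∀ s ∈ P, (F.Adj r.1 s.1 ↔ F'.Adj r.2 s.2)

variable {G : SimpleGraph V} {H : SimpleGraph W} {F : SimpleGraph V} {F' : SimpleGraph W}
  {col : V → κ} {col' : W → κ} {q : ℕ} {P₀ P : Set (V × W)}

theorem Pres.marks (h : Pres G H F F' col col' q P₀) (hP : P₀ ⊆ P) :
    Pres G H F F' (fun a => (col a, mark P a)) (fun b => (col' b, mark' P b)) q P := by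
  intro Q hQ hE r hr
  refine ⟨?_, (h Q (hP.trans hQ) hE r hr).2⟩
  exact Prod.ext (h Q (hP.trans hQ) hE r hr).1 (mark_eq hE.piso hQ hr)

theorem Pres.swap (h : Pres G H F F' col col' q P₀) :
    Pres H G F' F col' col q (Prod.swap ⁻¹' P₀) := by
  intro Q hQ hE r hr
  have h1 := h (Prod.swap ⁻¹' Q) (fun s hs => hQ (by simpa using hs)) hE.swap r.swap (by simpa)
  grind

/-- Within `t` extra rounds, pieces satisfying `Pd` are matched with isomorphic pieces. -/
def LA (t : ℕ) (Pd : ∀ {V : Type}, SimpleGraph V → Set V → Prop) : Prop :=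
  (∀ {V W κ : Type} [Finite V] [Finite W] (F : SimpleGraph V) (F' : SimpleGraph W) (col : V → κ)
    (col' : W → κ) (S : Set V) (S' : Set W), SI F F' col col' S S' → Pd F S → Pd F' S') ∧
  ∀ {V W κ : Type} [Finite V] [Finite W] (G : SimpleGraph V) (H : SimpleGraph W)
    (F : SimpleGraph V) (F' : SimpleGraph W) (col : V → κ) (col' : W → κ) (q : ℕ)
    (P₀ P : Set (V × W)) (x : V) (y : W), Pres G H F F' col col' q P₀ → P₀ ⊆ P → (x, y) ∈ P →
    EF G H (q + t) P → Pd F (cc F x) → SI F F' col col' (cc F x) (cc F' y)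

variable {Pd : ∀ {V : Type}, SimpleGraph V → Set V → Prop} {t : ℕ}

theorem LA.mono (h : LA t Pd) {t' : ℕ} (ht : t ≤ t') : LA t' Pd :=
  ⟨h.1, fun G H F F' col col' q P₀ P x y h1 h2 h3 h4 h5 =>
    h.2 G H F F' col col' q P₀ P x y h1 h2 h3 (h4.of_le (by omega)) h5⟩

/-- Several pieces are matched with distinct isomorphic pieces. -/
theorem transfer_comps [Finite V] [Finite W] [Nonempty W] (hLA : LA t Pd)
    (hPr : Pres G H F F' col col' q P₀) (hP : P₀ ⊆ P) (T : Finset V)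
    (hT : ∀ a ∈ T, ∀ b ∈ T, b ∈ cc F a → a = b) (hPd : ∀ a ∈ T, Pd F (cc F a))
    (hE : EF G H (q + t + T.card) P) :
    ∃ g : V → W, (∀ a ∈ T, SI F F' col col' (cc F a) (cc F' (g a))) ∧
      ∀ a ∈ T, ∀ b ∈ T, g b ∈ cc F' (g a) → a = b := by
  obtain ⟨g, hg⟩ := hE.extend T
  set Q := P ∪ (fun a => (a, g a)) '' (T : Set V) with hQ
  have hm : ∀ a ∈ T, (a, g a) ∈ Q := fun a ha => Or.inr ⟨a, ha, rfl⟩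
  have key : ∀ a ∈ T, SI F F' (fun a => (col a, mark Q a)) (fun b => (col' b, mark' Q b))
      (cc F a) (cc F' (g a)) := fun a ha =>
    hLA.2 G H F F' _ _ q Q Q a (g a) (hPr.marks (hP.trans Set.subset_union_left)) le_rfl (hm a ha)
      hg (hPd a ha)
  refine ⟨g, fun a ha => ?_, fun a ha b hb hab => ?_⟩
  · exact (key a ha).transfer (fun a b h => (Prod.ext_iff.1 h).1) (fun _ _ _ _ _ _ h => h)
  · obtain ⟨f, h1, -, h3⟩ := key a ha
    obtain ⟨c, hc, hcb⟩ := h1.surjOn hab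
    have h4 := (eq_of_mark (hm b hb) (Prod.ext_iff.1 (h3 c hc)).2).2 hcb
    exact hT a ha b hb (h4 ▸ hc)

/-- Components containing a vertex with color satisfying `ρ`. -/
def RC (F : SimpleGraph V) (col : V → κ) (ρ : κ → Prop) : Set (Set V) :=
  {S | ∃ x, ρ (col x) ∧ S = cc F x}

theorem SI.mem_RC {ρ : κ → Prop} {x : V} {y : W} (h : SI F F' col col' (cc F x) (cc F' y))
    (hx : cc F x ∈ RC F col ρ) : cc F' y ∈ RC F' col' ρ := by
  obtain ⟨a, ha, hxa⟩ := hx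
  obtain ⟨f, h1, -, h3⟩ := h
  have hax : a ∈ cc F x := hxa ▸ mem_cc_self F a
  exact ⟨f a, h3 a hax ▸ ha, (cc_eq_of_mem (h1.mapsTo hax)).symm⟩

theorem exists_reps [Finite V] {𝒞 : Set (Set V)} (h𝒞 : ∀ S ∈ 𝒞, ∃ x, S = cc F x) {j : ℕ}
    (hj : j ≤ 𝒞.ncard) : ∃ T : Finset V, T.card = j ∧ (∀ a ∈ T, cc F a ∈ 𝒞) ∧
      ∀ a ∈ T, ∀ b ∈ T, b ∈ cc F a → a = b := by
  classical
  obtain ⟨𝒟, h1, h2⟩ := Set.exists_subset_card_eq hj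
  have : ∀ S : 𝒟, ∃ x, (S : Set V) = cc F x := fun S => h𝒞 S (h1 S.2)
  choose r hr using this
  have := Fintype.ofFinite 𝒟
  have hinj : Function.Injective r := fun S S' h => Subtype.ext (by rw [hr S, hr S', h])
  refine ⟨Finset.univ.image r, ?_, ?_, ?_⟩
  · rw [Finset.card_image_of_injective _ hinj, Finset.card_univ, ← Nat.card_eq_fintype_card]
    exact h2
  · intro a ha
    obtain ⟨S, -, rfl⟩ := Finset.mem_image.1 ha
    exact hr S ▸ h1 S.2
  · intro a ha b hb hab
    obtain ⟨S, -, rfl⟩ := Finset.mem_image.1 ha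
    obtain ⟨S', -, rfl⟩ := Finset.mem_image.1 hb
    congr 1
    apply Subtype.ext
    rw [hr S, hr S', cc_eq_of_mem hab]

theorem card_le_of_transfer [Finite W] {𝒞 : Set (Set W)} {T : Finset V} {g : V → W}
    (h1 : ∀ a ∈ T, cc F' (g a) ∈ 𝒞) (h2 : ∀ a ∈ T, ∀ b ∈ T, g b ∈ cc F' (g a) → a = b) :
    T.card ≤ 𝒞.ncard := by
  rw [← Set.ncard_coe_finset]
  refine Set.ncard_le_ncard_of_injOn (fun a => cc F' (g a)) h1 (fun a ha b hb hab => ?_)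
    (Set.toFinite _)
  refine h2 a ha b hb ?_
  have : cc F' (g a) = cc F' (g b) := hab
  rw [this]
  exact mem_cc_self _ _

theorem EF.back (h : EF G H (q + (t + 1)) P) (b : W) : ∃ a, EF G H (q + t) (insert (a, b) P) :=
  h.2.2 b

/-- If Duplicator can count rooted components of each isomorphism type, the unions of the rooted
components are isomorphic. -/
theorem si_of_counting [Finite V] [Finite W] [Nonempty V] [Nonempty W] {T : ℕ} {ρ : κ → Prop}
    (hPr : Pres G H F F' col col' q P₀) (hP : P₀ ⊆ P) (hE : EF G H (q + T) P) (hT₀ : 0 < T)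
    (h : ∀ x, ρ (col x) → ∃ (t k : ℕ) (Pd : ∀ {V : Type}, SimpleGraph V → Set V → Prop),
      LA t Pd ∧ Pd F (cc F x) ∧ {S | S ∈ RC F col ρ ∧ SI F F col col (cc F x) S}.ncard ≤ k ∧
        t + k + 1 ≤ T) :
    SI F F' col col' {v | cc F v ∈ RC F col ρ} {w | cc F' w ∈ RC F' col' ρ} := by
  classical
  have hcount : ∀ x, ρ (col x) → {S | S ∈ RC F col ρ ∧ SI F F col col (cc F x) S}.ncard =
      {S | S ∈ RC F' col' ρ ∧ SI F F' col col' (cc F x) S}.ncard := by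
    intro x hx
    obtain ⟨t, k, Pd, hLA, hPd, hk, hT⟩ := h x hx
    apply le_antisymm
    · by_contra hlt
      rw [not_le] at hlt
      obtain ⟨R, hR1, hR2, hR3⟩ := exists_reps (F := F)
        (𝒞 := {S | S ∈ RC F col ρ ∧ SI F F col col (cc F x) S})
        (by rintro S ⟨⟨x, -, rfl⟩, -⟩; exact ⟨x, rfl⟩) (Nat.succ_le_of_lt hlt)
      obtain ⟨g, hg1, hg2⟩ := transfer_comps hLA hPr hP R hR3
        (fun a ha => hLA.1 _ _ _ _ _ _ (hR2 a ha).2 hPd) (hE.of_le (by omega))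
      have := card_le_of_transfer
        (𝒞 := {S | S ∈ RC F' col' ρ ∧ SI F F' col col' (cc F x) S})
        (fun a ha => ⟨(hg1 a ha).mem_RC (hR2 a ha).1, (hR2 a ha).2.trans (hg1 a ha)⟩) hg2
      omega
    · by_contra hlt
      rw [not_le] at hlt
      obtain ⟨R, hR1, hR2, hR3⟩ := exists_reps (F := F')
        (𝒞 := {S | S ∈ RC F' col' ρ ∧ SI F F' col col' (cc F x) S})
        (by rintro S ⟨⟨x, -, rfl⟩, -⟩; exact ⟨x, rfl⟩) (Nat.succ_le_of_lt hlt)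
      obtain ⟨g, hg1, hg2⟩ := transfer_comps hLA hPr.swap (Set.preimage_mono hP) R hR3
        (fun a ha => hLA.1 _ _ _ _ _ _ (hR2 a ha).2 hPd) (hE.swap.of_le (by omega))
      have := card_le_of_transfer
        (𝒞 := {S | S ∈ RC F col ρ ∧ SI F F col col (cc F x) S})
        (fun a ha => ⟨(hg1 a ha).mem_RC (hR2 a ha).1, (hR2 a ha).2.trans (hg1 a ha)⟩) hg2
      omega
  have hcover : ∀ y, ρ (col' y) → ∃ x, ρ (col x) ∧ SI F F' col col' (cc F x) (cc F' y) := by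
    intro y hy
    obtain ⟨T, rfl⟩ : ∃ T', T = T' + 1 := ⟨T - 1, by omega⟩
    obtain ⟨x, hx⟩ := EF.back hE y
    have hc := (hPr _ (hP.trans (Set.subset_insert _ _)) (hx.of_le (Nat.le_add_right _ _)) (x, y)
      (Set.mem_insert _ _)).1
    have hxr : ρ (col x) := by
      rw [show col x = col' y from hc]
      exact hy
    obtain ⟨t, k, Pd, hLA, hPd, hk, hT⟩ := h x hxr
    exact ⟨x, hxr, hLA.2 G H F F' col col' q P₀ _ x y hPr (hP.trans (Set.subset_insert _ _))
      (Set.mem_insert _ _) (hx.of_le (Nat.add_le_add_left (by omega) q)) hPd⟩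
  let fA : RC F col ρ → Set (RC F col ρ) := fun c => {c₂ | SI F F col col c.1 c₂.1}
  let fB : RC F' col' ρ → Set (RC F col ρ) := fun d => {c₂ | SI F F' col col' c₂.1 d.1}
  have hAB : ∀ c d, fA c = fB d ↔ SI F F' col col' c.1 d.1 := by
    intro c d
    constructor
    · intro hcd
      have : c ∈ fA c := SI.refl F col c.1
      rw [hcd] at this
      exact this
    · intro hcd
      ext c₂
      exact ⟨fun h2 => h2.symm.trans hcd, fun h2 => hcd.trans h2.symm⟩
  have hAA : ∀ c c₂, fA c₂ = fA c ↔ SI F F col col c.1 c₂.1 := by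
    intro c c₂
    constructor
    · intro hcd
      have : c₂ ∈ fA c₂ := SI.refl F col c₂.1
      rw [hcd] at this
      exact this
    · intro hcd
      ext c₃
      exact ⟨fun h2 => hcd.trans h2, fun h2 => hcd.symm.trans h2⟩
  have hfib : ∀ s : Set (RC F col ρ), Nonempty ({c // fA c = s} ≃ {d // fB d = s}) := by
    have hc1 : ∀ c : RC F col ρ, Nonempty ({c₂ // fA c₂ = fA c} ≃ {d // fB d = fA c}) := by
      rintro ⟨S, x, hx, rfl⟩
      have e1 : {c₂ // fA c₂ = fA ⟨cc F x, x, hx, rfl⟩} ≃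
          {S | S ∈ RC F col ρ ∧ SI F F col col (cc F x) S} :=
        { toFun := fun c => ⟨c.1.1, c.1.2, (hAA _ _).1 c.2⟩
          invFun := fun S => ⟨⟨S.1, S.2.1⟩, (hAA _ _).2 S.2.2⟩
          left_inv := fun c => rfl
          right_inv := fun c => rfl }
      have e2 : {d // fB d = fA ⟨cc F x, x, hx, rfl⟩} ≃
          {S | S ∈ RC F' col' ρ ∧ SI F F' col col' (cc F x) S} :=
        { toFun := fun c => ⟨c.1.1, c.1.2, (hAB _ _).1 c.2.symm⟩
          invFun := fun S => ⟨⟨S.1, S.2.1⟩, ((hAB _ _).2 S.2.2).symm⟩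
          left_inv := fun c => rfl
          right_inv := fun c => rfl }
      have h3 := hcount x hx
      have : Nonempty ({S | S ∈ RC F col ρ ∧ SI F F col col (cc F x) S} ≃
          {S | S ∈ RC F' col' ρ ∧ SI F F' col col' (cc F x) S}) :=
        Finite.card_eq.1 h3
      exact ⟨e1.trans (this.some.trans e2.symm)⟩
    intro s
    by_cases hA : ∃ c, fA c = s
    · obtain ⟨c, rfl⟩ := hA
      exact hc1 c
    by_cases hB : ∃ d, fB d = s
    · obtain ⟨⟨S, y, hy, rfl⟩, rfl⟩ := hB
      obtain ⟨x, hx, hxy⟩ := hcover y hy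
      exact absurd ⟨⟨cc F x, x, hx, rfl⟩, (hAB _ _).2 hxy⟩ hA
    · have : IsEmpty {c // fA c = s} := ⟨fun c => hA ⟨c.1, c.2⟩⟩
      have : IsEmpty {d // fB d = s} := ⟨fun c => hB ⟨c.1, c.2⟩⟩
      exact ⟨Equiv.equivOfIsEmpty _ _⟩
  let e : RC F col ρ ≃ RC F' col' ρ := Equiv.ofFiberEquiv fun s => (hfib s).some
  have he : ∀ c, SI F F' col col' c.1 (e c).1 := fun c =>
    (hAB _ _).1 (Equiv.ofFiberEquiv_map _ c).symm
  choose φ hφ1 hφ2 hφ3 using he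
  let f : V → W := fun v => if hv : cc F v ∈ RC F col ρ then φ ⟨cc F v, hv⟩ v
    else Classical.arbitrary W
  have hf : ∀ v (hv : cc F v ∈ RC F col ρ), f v = φ ⟨cc F v, hv⟩ v := fun v hv => dif_pos hv
  have hfe : ∀ v (hv : cc F v ∈ RC F col ρ), cc F' (f v) = (e ⟨cc F v, hv⟩).1 := by
    intro v hv
    obtain ⟨y, hy, hyd⟩ := (e ⟨cc F v, hv⟩).2
    have h1 := (hφ1 ⟨cc F v, hv⟩).mapsTo (mem_cc_self F v)
    rw [← hf v hv, hyd] at h1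
    rw [hyd, cc_eq_of_mem h1]
  have hsame : ∀ v (hv : cc F v ∈ RC F col ρ) w (hw : cc F w ∈ RC F col ρ),
      cc F' (f v) = cc F' (f w) → cc F v = cc F w := by
    intro v hv w hw hvw
    rw [hfe v hv, hfe w hw] at hvw
    exact congrArg Subtype.val (e.injective (Subtype.ext hvw))
  have hfs : ∀ v (hv : cc F v ∈ RC F col ρ) w, cc F v = cc F w → f w = φ ⟨cc F v, hv⟩ w := by grind
  refine ⟨f, ⟨fun v hv => ?_, fun v hv w hw hvw => ?_, fun y hy => ?_⟩, fun v hv w hw => ?_,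
    fun v hv => ?_⟩
  · simp_all
  · have h1 := hsame v hv w hw (by rw [hvw])
    rw [hf v hv, hfs v hv w h1] at hvw
    exact (hφ1 ⟨cc F v, hv⟩).injOn (mem_cc_self F v)
      (h1.symm.subset (mem_cc_self F w)) hvw
  · obtain ⟨c, hc⟩ := e.surjective ⟨cc F' y, hy⟩
    obtain ⟨S, x, hx, rfl⟩ := c
    have h1 : y ∈ (e ⟨cc F x, x, hx, rfl⟩).1 := by
      rw [hc]
      exact mem_cc_self F' y
    obtain ⟨v, hv, hvy⟩ := (hφ1 ⟨cc F x, x, hx, rfl⟩).surjOn h1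
    have h2 : cc F v = cc F x := cc_eq_of_mem hv
    refine ⟨v, ?_, ?_⟩
    · change cc F v ∈ RC F col ρ
      rw [h2]
      exact ⟨x, hx, rfl⟩
    · grind
  · by_cases hvw : cc F v = cc F w
    · rw [hf v hv, hfs v hv w hvw]
      exact hφ2 ⟨cc F v, hv⟩ v (mem_cc_self F v) w
        (hvw.symm.subset (mem_cc_self F w))
    · exact ⟨fun h => absurd (cc_eq_of_adj h).symm hvw,
        fun h => absurd (hsame v hv w hw (cc_eq_of_adj h).symm) hvw⟩
  · rw [hf v hv]
    exact hφ3 ⟨cc F v, hv⟩ v (mem_cc_self F v)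

end Matching


section Pieces

variable {V W κ : Type}

/-- Pieces of size at most `m`, degrees at most `l`, and at most `e` edges more than a tree. -/
def PdE (e m l : ℕ) {V : Type} (F : SimpleGraph V) (S : Set V) : Prop :=
  S.ncard ≤ m ∧ (∀ v ∈ S, {w | w ∈ S ∧ F.Adj v w}.ncard ≤ l) ∧ ein F S + 1 ≤ S.ncard + e

theorem PdE.inv {e m l : ℕ} [Finite V] [Finite W] {F : SimpleGraph V} {F' : SimpleGraph W}
    {col : V → κ} {col' : W → κ} {S : Set V} {S' : Set W} (h : SI F F' col col' S S')
    (hP : PdE e m l F S) : PdE e m l F' S' := by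
  refine ⟨h.ncard_eq ▸ hP.1, ?_, ?_⟩
  · obtain ⟨f, h1, h2, -⟩ := h
    intro v' hv'
    obtain ⟨v, hv, rfl⟩ := h1.surjOn hv'
    refine le_trans ?_ (hP.2.1 v hv)
    have : {w | w ∈ S' ∧ F'.Adj (f v) w} ⊆ f '' {w | w ∈ S ∧ F.Adj v w} := by
      rintro w ⟨hw, hvw⟩
      obtain ⟨u, hu, rfl⟩ := h1.surjOn hw
      exact ⟨u, ⟨hu, (h2 v hv u hu).2 hvw⟩, rfl⟩
    exact (Set.ncard_le_ncard this (Set.toFinite _)).trans (Set.ncard_image_le (Set.toFinite _))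
  · rw [← h.ncard_eq, ← h.ein_eq]
    exact hP.2.2

theorem notMem_cc_delV {F : SimpleGraph V} {z s : V} (h : s ≠ z) : z ∉ cc (delV F {z}) s := by
  intro hz
  exact cc_subset (F := delV F {z}) (S := {w | w ≠ z}) h (fun a _ b hab => hab.2.2) hz rfl

theorem cc_delV_self (F : SimpleGraph V) (z : V) : cc (delV F {z}) z = {z} := by
  refine Set.Subset.antisymm (cc_subset rfl ?_) ?_
  · rintro a rfl b hab
    exact absurd rfl hab.2.1
  · rintro a rfl
    exact mem_cc_self _ _

theorem delV_le_delE (F : SimpleGraph V) {z u v : V} (h : z = u ∨ z = v) :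
    delV F {z} ≤ delE F u v := by
  rintro a b ⟨hab, ha, hb⟩
  refine ⟨hab, fun heq => ?_⟩
  grind

theorem exists_centroid [Finite V] {F : SimpleGraph V} {x : V}
    (ht : ein F (cc F x) + 1 ≤ (cc F x).ncard) :
    ∃ z ∈ cc F x, ∀ s, F.Adj z s → 2 * (cc (delV F {z}) s).ncard ≤ (cc F x).ncard := by
  by_contra hcon
  push Not at hcon
  have hsub : ∀ z s, s ∈ cc F x → cc (delV F {z}) s ⊆ cc F x := fun z s hs => by
    rw [← cc_eq_of_mem hs]
    exact cc_mono (delV_le F {z}) s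
  have key : ∀ n z s, z ∈ cc F x → F.Adj z s → (cc F x).ncard < 2 * (cc (delV F {z}) s).ncard →
      (cc (delV F {z}) s).ncard = n → False := by
    intro n
    induction n using Nat.strong_induction_on with
    | _ n ih =>
      intro z s hz hzs hbig hn
      have hs : s ∈ cc F x := SimpleGraph.Reachable.trans hz hzs.reachable
      obtain ⟨s₂, hs₂, hbig₂⟩ := hcon s hs
      have hbr := bridge_of_tree ht hz hzs
      by_cases h2 : s₂ = z
      · subst h2
        have hdis : Disjoint (cc (delV F {s₂}) s) (cc (delV F {s}) s₂) := by
          rw [Set.disjoint_left]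
          intro w h3 h4
          have h5 := cc_mono (delV_le_delE F (z := s₂) (u := s₂) (v := s) (Or.inl rfl)) _ h3
          have h6 := cc_mono (delV_le_delE F (z := s) (u := s₂) (v := s) (Or.inr rfl)) _ h4
          exact hbr (SimpleGraph.Reachable.trans h6 (SimpleGraph.Reachable.symm h5))
        have h7 := Set.ncard_union_eq hdis (Set.toFinite _) (Set.toFinite _)
        have h8 := Set.ncard_le_ncard (Set.union_subset (hsub s₂ s hs) (hsub s s₂ hz))
          (Set.toFinite _)
        omega
      · have hz' : z ∉ cc (delV F {s}) s₂ := by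
          intro h3
          have h5 := cc_mono (delV_le_delE F (z := s) (u := z) (v := s) (Or.inr rfl)) _ h3
          have h6 : (delE F z s).Adj s s₂ := by
            refine ⟨hs₂, fun h => ?_⟩
            simp_all
          exact hbr (SimpleGraph.Reachable.symm (h6.reachable.trans h5))
        have h4 : cc (delV F {s}) s₂ ⊆ {w | w ∈ cc (delV F {s}) s₂ ∧ w ∈ cc (delV F {z}) s} := by
          refine cc_subset ⟨mem_cc_self _ _, ?_⟩ ?_
          · exact SimpleGraph.Adj.reachable (show (delV F {z}).Adj s s₂ from
              ⟨hs₂, hzs.ne', h2⟩)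
          · rintro a ⟨ha, ha'⟩ b hab
            have hb : b ∈ cc (delV F {s}) s₂ := SimpleGraph.Reachable.trans ha hab.reachable
            refine ⟨hb, SimpleGraph.Reachable.trans ha' (SimpleGraph.Adj.reachable ?_)⟩
            exact ⟨hab.1, fun h => hz' (h ▸ ha), fun h => hz' (h ▸ hb)⟩
        have h5 : cc (delV F {s}) s₂ ⊂ cc (delV F {z}) s := by
          refine ⟨fun w hw => (h4 hw).2, fun h => ?_⟩
          exact notMem_cc_delV hs₂.ne' (h (mem_cc_self _ _))
        exact ih _ (hn ▸ Set.ncard_lt_ncard h5 (Set.toFinite _)) s s₂ hs hs₂ hbig₂ rfl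
  obtain ⟨s, hs, hbig⟩ := hcon x (mem_cc_self F x)
  exact key _ x s (mem_cc_self F x) hs hbig rfl

theorem star_cc (F : SimpleGraph V) (z w : V) :
    (∃ b, (F.Adj z b ∨ b = z) ∧ cc (delV F {z}) w = cc (delV F {z}) b) ↔ w ∈ cc F z := by
  constructor
  · rintro ⟨b, hb, hw⟩
    have h1 : w ∈ cc F b := cc_mono (delV_le F {z}) b (hw ▸ mem_cc_self _ _)
    rcases hb with hb | rfl
    · exact SimpleGraph.Reachable.trans hb.reachable h1
    · exact h1
  · intro hw
    refine cc_subset (S := {w | ∃ b, (F.Adj z b ∨ b = z) ∧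
      cc (delV F {z}) w = cc (delV F {z}) b}) ⟨z, Or.inr rfl, rfl⟩ ?_ hw
    rintro a ⟨b, hb, hab⟩ c hac
    by_cases hc : c = z
    · exact ⟨z, Or.inr rfl, by rw [hc]⟩
    by_cases ha : a = z
    · exact ⟨c, Or.inl (ha ▸ hac), rfl⟩
    · exact ⟨b, hb, (cc_eq_of_adj (show (delV F {z}).Adj a c from ⟨hac, ha, hc⟩)).trans hab⟩

theorem ncard_comps_le [Finite V] {F : SimpleGraph V} {𝒞 : Set (Set V)} {A : Set V}
    (h𝒞 : ∀ S ∈ 𝒞, ∃ x, S = cc F x) (hA : ∀ S ∈ 𝒞, ∃ a ∈ A, a ∈ S) : 𝒞.ncard ≤ A.ncard := by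
  rcases isEmpty_or_nonempty V with hV | hV
  · have : 𝒞 = ∅ := Set.eq_empty_of_forall_notMem fun S hS => hV.elim (hA S hS).choose
    simp [this]
  choose! r hr hrS using hA
  refine Set.ncard_le_ncard_of_injOn r hr (fun S hS S' hS' h => ?_) (Set.toFinite _)
  obtain ⟨x, rfl⟩ := h𝒞 S hS
  obtain ⟨y, rfl⟩ := h𝒞 S' hS'
  have h1 := hrS _ hS'
  rw [← h] at h1
  exact cc_eq_of_inter (hrS _ hS) h1

theorem ncard_comps_mul_le [Finite V] {F : SimpleGraph V} {𝒞 : Set (Set V)} {B : Set V} {s : ℕ}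
    (h𝒞 : ∀ S ∈ 𝒞, ∃ x, S = cc F x) (hB : ∀ S ∈ 𝒞, S ⊆ B ∧ S.ncard = s) :
    𝒞.ncard * s ≤ B.ncard := by
  classical
  have := Fintype.ofFinite V
  obtain ⟨T, hT1, hT2, hT3⟩ := exists_reps h𝒞 le_rfl
  have h1 : (T.biUnion fun a => (cc F a).toFinset).card = ∑ a ∈ T, (cc F a).toFinset.card := by
    refine Finset.card_biUnion fun a ha b hb hab => ?_
    simp only [Function.onFun]
    rw [Set.disjoint_toFinset, Set.disjoint_left]
    intro w h1 h2
    refine hab (hT3 a ha b hb ?_)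
    rw [cc_eq_of_inter h1 h2]
    exact mem_cc_self _ _
  rw [Finset.sum_congr rfl (fun a ha => by
    rw [← Set.ncard_eq_toFinset_card', (hB _ (hT2 a ha)).2]), Finset.sum_const, smul_eq_mul,
    hT1] at h1
  rw [← h1, ← Set.ncard_coe_finset]
  refine Set.ncard_le_ncard ?_ (Set.toFinite _)
  simp_all

/-- Number of rounds for tree pieces. -/
def fcost (α m : ℕ) : ℕ := α * Nat.log 2 m + 2

theorem fcost_mono (α : ℕ) {m m' : ℕ} (h : m ≤ m') : fcost α m ≤ fcost α m' :=
  Nat.add_le_add_right (Nat.mul_le_mul_left _ (Nat.log_mono_right h)) _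

theorem la_tree {α l : ℕ} (hα : 3 ≤ α) (hl : ∀ k, 2 ≤ k → k ≤ l → k + 2 ≤ α * Nat.log 2 k)
    (m : ℕ) : LA (fcost α m) (PdE 0 m l) := by
  induction m using Nat.strong_induction_on with
  | _ m ih =>
  refine ⟨fun F F' col col' S S' h hP => PdE.inv h hP, ?_⟩
  intro V W κ _ _ G H F F' col col' q P₀ P x y hPr hP hxy hE hPd
  have : Nonempty V := ⟨x⟩
  have : Nonempty W := ⟨y⟩
  obtain ⟨hm, hdeg, htree⟩ := hPd
  have hxS := mem_cc_self F x
  rcases Nat.lt_or_ge (cc F x).ncard 2 with hsmall | hbig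
  · have h1 : ∀ a ∈ cc F x, a = x := fun a ha => by
      by_contra hne
      have := (Set.one_lt_ncard (Set.toFinite _)).2 ⟨a, ha, x, hxS, hne⟩
      omega
    have h2 : cc F' y ⊆ {y} := by
      refine cc_subset rfl ?_
      rintro _ rfl b hb
      obtain ⟨a, ha⟩ := EF.back (q := q) (t := fcost α m - 1)
        (hE.of_le (by simp only [fcost]; omega)) b
      have h3 := (hPr _ (hP.trans (Set.subset_insert _ _)) (ha.of_le (Nat.le_add_right _ _)) _
        (Set.mem_insert_of_mem _ hxy)).2 _ (Set.mem_insert _ _)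
      have h4 : F.Adj x a := h3.2 hb
      exact absurd (h1 a h4.reachable) h4.ne'
    refine ⟨fun _ => y, ⟨fun _ _ => mem_cc_self F' y, fun a ha b hb _ => by rw [h1 a ha, h1 b hb],
      fun b hb => ⟨x, hxS, (h2 hb).symm⟩⟩, fun a ha b hb => ?_, fun a ha => ?_⟩
    · rw [h1 a ha, h1 b hb]
      simp
    · rw [h1 a ha]
      exact (hPr P hP (hE.of_le (Nat.le_add_right _ _)) _ hxy).1
  obtain ⟨z, hz, hcent⟩ := exists_centroid htree
  obtain ⟨T, hT⟩ : ∃ T, fcost α m = T + 1 := ⟨fcost α m - 1, by simp only [fcost]; omega⟩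
  rw [hT] at hE
  obtain ⟨z', hz'⟩ := (show EF G H (q + T + 1) P from hE).2.1 z
  set P₁ := insert (z, z') P with hP₁
  have hzP : (z, z') ∈ P₁ := Set.mem_insert _ _
  have hP₀₁ : P₀ ⊆ P₁ := hP.trans (Set.subset_insert _ _)
  have hPr₁ : Pres G H (delV F {z}) (delV F' {z'}) (fun a => (col a, F.Adj z a))
      (fun b => (col' b, F'.Adj z' b)) q P₁ := by
    intro Q hQ hEQ r hr
    have h1 := hPr Q (hP₀₁.trans hQ) hEQ
    have hpi : ∀ r ∈ Q, r.1 = z ↔ r.2 = z' := fun r hr => (hEQ.piso r hr _ (hQ hzP)).1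
    refine ⟨Prod.ext (h1 r hr).1 (propext ((h1 _ (hQ hzP)).2 r hr)), fun s hs => ?_⟩
    exact and_congr ((h1 r hr).2 s hs) (and_congr (not_congr (hpi r hr)) (not_congr (hpi s hs)))
  have hPr₂ := hPr₁.marks le_rfl
  set col₁ : V → (κ × Prop) × Set (V × W) := fun a => ((col a, F.Adj z a), mark P₁ a) with hcol₁
  set col₁' : W → (κ × Prop) × Set (V × W) := fun b => ((col' b, F'.Adj z' b), mark' P₁ b)
    with hcol₁'
  let ρ : (κ × Prop) × Set (V × W) → Prop := fun c => c.1.2 ∨ (z, z') ∈ c.2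
  have hρ : ∀ a, ρ (col₁ a) ↔ F.Adj z a ∨ a = z := fun a =>
    or_congr Iff.rfl ⟨fun h => h.2.symm, fun h => ⟨hzP, h.symm⟩⟩
  have hρ' : ∀ b, ρ (col₁' b) ↔ F'.Adj z' b ∨ b = z' := fun b =>
    or_congr Iff.rfl ⟨fun h => h.2.symm, fun h => ⟨hzP, h.symm⟩⟩
  have hRU : {v | cc (delV F {z}) v ∈ RC (delV F {z}) col₁ ρ} = cc F z := by
    ext w
    rw [← star_cc]
    exact exists_congr fun b => and_congr_left fun _ => hρ b
  have hRU' : {v | cc (delV F' {z'}) v ∈ RC (delV F' {z'}) col₁' ρ} = cc F' z' := by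
    ext w
    rw [← star_cc]
    exact exists_congr fun b => and_congr_left fun _ => hρ' b
  have hzx : cc F z = cc F x := cc_eq_of_mem hz
  have main : SI (delV F {z}) (delV F' {z'}) col₁ col₁' (cc F z) (cc F' z') := by
    rw [← hRU, ← hRU']
    refine si_of_counting hPr₂ le_rfl hz' (by simp only [fcost] at hT; omega) ?_
    intro x₀ hx₀
    have hBS : cc (delV F {z}) x₀ ⊆ cc F x := by
      rw [← hzx]
      intro w hw
      rw [← star_cc]
      exact ⟨x₀, (hρ _).1 hx₀, cc_eq_of_mem hw⟩
    have hsub : ∀ S' ∈ RC (delV F {z}) col₁ ρ, S' ⊆ cc F x := by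
      rintro S' ⟨a, ha, rfl⟩ w hw
      rw [← hzx, ← star_cc]
      exact ⟨a, (hρ _).1 ha, cc_eq_of_mem hw⟩
    have hB2 : 2 * (cc (delV F {z}) x₀).ncard ≤ (cc F x).ncard := by
      rcases (hρ _).1 hx₀ with h | rfl
      · exact hcent x₀ h
      · rw [cc_delV_self, Set.ncard_singleton]
        omega
    have hBpos : 0 < (cc (delV F {z}) x₀).ncard :=
      (Set.ncard_pos (Set.toFinite _)).2 ⟨x₀, mem_cc_self _ _⟩
    set s := (cc (delV F {z}) x₀).ncard with hs
    set 𝒞 := {S | S ∈ RC (delV F {z}) col₁ ρ ∧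
      SI (delV F {z}) (delV F {z}) col₁ col₁ (cc (delV F {z}) x₀) S} with h𝒞
    have h𝒞c : ∀ S ∈ 𝒞, ∃ x, S = cc (delV F {z}) x := by
      rintro S ⟨⟨a, -, rfl⟩, -⟩
      exact ⟨a, rfl⟩
    have hn1 : 𝒞.ncard * s ≤ (cc F x).ncard :=
      ncard_comps_mul_le h𝒞c fun S hS => ⟨hsub S hS.1, hS.2.ncard_eq.symm⟩
    have hn2 : 𝒞.ncard ≤ max l 1 := by
      rcases (hρ _).1 hx₀ with h | h
      · refine le_trans ?_ (le_trans (hdeg z hz) (le_max_left _ _))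
        refine ncard_comps_le h𝒞c ?_
        rintro S ⟨hS, f, h1, -, h3⟩
        have h4 := h3 x₀ (mem_cc_self _ _)
        have h5 : F.Adj z x₀ = F.Adj z (f x₀) := (Prod.ext_iff.1 (Prod.ext_iff.1 h4).1).2
        have h6 := h1.mapsTo (mem_cc_self _ _)
        grind
      · subst h
        refine le_trans ?_ (le_max_right _ _)
        rw [← Set.ncard_singleton x₀]
        refine ncard_comps_le h𝒞c ?_
        rintro S ⟨hS, f, h1, -, h3⟩
        have h4 := (Prod.ext_iff.1 (h3 x₀ (mem_cc_self _ _))).2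
        have h5 : (x₀, z') ∈ mark P₁ (f x₀) := by
          have h6 : mark P₁ x₀ = mark P₁ (f x₀) := h4
          rw [← h6]
          exact ⟨hzP, rfl⟩
        have h6 : x₀ = f x₀ := h5.2
        have h7 := h1.mapsTo (mem_cc_self (delV F {x₀}) x₀)
        rw [← h6] at h7
        exact ⟨x₀, rfl, h7⟩
    refine ⟨fcost α s, 𝒞.ncard, PdE 0 s l, ih s (by omega), ⟨le_rfl, fun v hv => ?_, ?_⟩,
      le_rfl, ?_⟩
    · have h1 : {w | w ∈ cc (delV F {z}) x₀ ∧ (delV F {z}).Adj v w} ⊆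
          {w | w ∈ cc F x ∧ F.Adj v w} := fun w hw => ⟨hBS hw.1, hw.2.1⟩
      exact (Set.ncard_le_ncard h1 (Set.toFinite _)).trans (hdeg v (hBS hv))
    · have h1 := (cn_cc F x).ein_add_le hBS ⟨x₀, mem_cc_self _ _⟩
      have h2 := Set.ncard_sdiff_add_ncard_of_subset hBS (Set.toFinite _)
      have h3 : ein (delV F {z}) (cc (delV F {z}) x₀) ≤ ein F (cc (delV F {z}) x₀) :=
        ein_mono (delV_le F {z}) le_rfl
      omega
    · have key : α * Nat.log 2 s + (𝒞.ncard + 2) ≤ α * Nat.log 2 m := by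
        rcases Nat.lt_or_ge 𝒞.ncard 2 with h1 | h1
        · have h2 : Nat.log 2 s + 1 ≤ Nat.log 2 m := by
            rw [← Nat.log_mul_base (by norm_num) (by omega)]
            exact Nat.log_mono_right (by omega)
          have h3 := Nat.mul_le_mul_left α h2
          rw [mul_add, mul_one] at h3
          omega
        · have h2 := hl 𝒞.ncard h1 (by omega)
          have h3 : Nat.log 2 𝒞.ncard + Nat.log 2 s ≤ Nat.log 2 m := by
            refine Nat.le_log_of_pow_le (by norm_num) ?_
            rw [pow_add]
            exact (Nat.mul_le_mul (Nat.pow_log_le_self 2 (by omega))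
              (Nat.pow_log_le_self 2 (by omega))).trans (hn1.trans hm)
          have h4 := Nat.mul_le_mul_left α h3
          rw [mul_add] at h4
          omega
      simp only [fcost] at hT ⊢
      omega
  have hfin : SI F F' (fun a => (col a, mark P₁ a)) (fun b => (col' b, mark' P₁ b)) (cc F z)
      (cc F' z') := by
    refine main.transfer (fun a b h => ?_) (fun a b a' b' ha hb hab => ?_)
    · simp_all
    · have ha1 := Prod.ext_iff.1 ha
      have hb1 := Prod.ext_iff.1 hb
      have ha2 : F.Adj z a = F'.Adj z' a' := (Prod.ext_iff.1 ha1.1).2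
      have hb2 : F.Adj z b = F'.Adj z' b' := (Prod.ext_iff.1 hb1.1).2
      have ha3 := eq_of_mark hzP ha1.2
      have hb3 := eq_of_mark hzP hb1.2
      by_cases h1 : a = z
      · rw [h1, ha3.1 h1, hb2]
      by_cases h2 : b = z
      · rw [h2, hb3.1 h2, F.adj_comm, F'.adj_comm, ha2]
      · have h3 : a' ≠ z' := fun h => h1 (ha3.2 h)
        have h4 : b' ≠ z' := fun h => h2 (hb3.2 h)
        exact ⟨fun h => (hab.1 ⟨h, h1, h2⟩).1, fun h => (hab.2 ⟨h, h3, h4⟩).1⟩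
  have hyz : y ∈ cc F' z' := by
    obtain ⟨f, h1, -, h3⟩ := hfin
    have h4 := (Prod.ext_iff.1 (h3 x (hzx ▸ hxS))).2
    rw [← (eq_of_mark (Set.mem_insert_of_mem _ hxy) h4).1 rfl]
    exact h1.mapsTo (hzx ▸ hxS)
  rw [← hzx, cc_eq_of_mem hyz]
  exact hfin.transfer (fun a b h => (Prod.ext_iff.1 h).1) (fun _ _ _ _ _ _ h => h)

/-- Pieces with `e` surplus edges cost `2 e` more rounds. -/
theorem la_excess {α l : ℕ} (hα : 3 ≤ α) (hl : ∀ k, 2 ≤ k → k ≤ l → k + 2 ≤ α * Nat.log 2 k)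
    (e m : ℕ) : LA (fcost α m + 2 * e) (PdE e m l) := by
  induction e with
  | zero => exact la_tree hα hl m
  | succ e ih =>
    refine ⟨fun F F' col col' S S' h hP => PdE.inv h hP, ?_⟩
    intro V W κ _ _ G H F F' col col' q P₀ P x y hPr hP hxy hE hPd
    by_cases hex : ein F (cc F x) + 1 ≤ (cc F x).ncard + e
    · exact ih.2 G H F F' col col' q P₀ P x y hPr hP hxy (hE.of_le (by omega))
        ⟨hPd.1, hPd.2.1, hex⟩
    obtain ⟨u, v, hu, huv, hcyc⟩ := exists_not_bridge (F := F) (x := x) (by omega)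
    have hv : v ∈ cc F x := SimpleGraph.Reachable.trans hu huv.reachable
    obtain ⟨u', hu'⟩ := (show EF G H (q + (fcost α m + 2 * e) + 1 + 1) P from hE).2.1 u
    obtain ⟨v', hv'⟩ := hu'.2.1 v
    set P₁ := insert (v, v') (insert (u, u') P) with hP₁
    have hPP : P ⊆ P₁ := (Set.subset_insert _ _).trans (Set.subset_insert _ _)
    have huP : (u, u') ∈ P₁ := Set.mem_insert_of_mem _ (Set.mem_insert _ _)
    have hvP : (v, v') ∈ P₁ := Set.mem_insert _ _
    have hPr₁ : Pres G H (delE F u v) (delE F' u' v') col col' q P₁ := by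
      intro Q hQ hEQ r hr
      have h1 := hPr Q ((hP.trans hPP).trans hQ) hEQ
      have hpu : ∀ r ∈ Q, r.1 = u ↔ r.2 = u' := fun r hr => (hEQ.piso r hr _ (hQ huP)).1
      have hpv : ∀ r ∈ Q, r.1 = v ↔ r.2 = v' := fun r hr => (hEQ.piso r hr _ (hQ hvP)).1
      refine ⟨(h1 r hr).1, fun s hs => and_congr ((h1 r hr).2 s hs) (not_congr ?_)⟩
      rw [Sym2.eq_iff, Sym2.eq_iff, hpu r hr, hpu s hs, hpv r hr, hpv s hs]
    have h2 := ih.2 G H _ _ _ _ q P₁ P₁ x y (hPr₁.marks le_rfl) le_rfl (hPP hxy) hv' (by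
      rw [cc_delE hcyc]
      refine ⟨hPd.1, fun w hw => ?_, ?_⟩
      · have h1 : {a | a ∈ cc F x ∧ (delE F u v).Adj w a} ⊆ {a | a ∈ cc F x ∧ F.Adj w a} :=
          fun a ha => ⟨ha.1, ha.2.1⟩
        exact (Set.ncard_le_ncard h1 (Set.toFinite _)).trans (hPd.2.1 w hw)
      · have := ein_delE huv hu hv
        have := hPd.2.2
        omega)
    rw [cc_delE hcyc] at h2
    have huv' : v' ∈ cc (delE F' u' v') u' := by
      obtain ⟨f, h3, -, h4⟩ := h2
      have h5 := (eq_of_mark huP (Prod.ext_iff.1 (h4 u hu)).2).1 rfl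
      have h6 := (eq_of_mark hvP (Prod.ext_iff.1 (h4 v hv)).2).1 rfl
      have h7 := h3.mapsTo hu
      have h8 := h3.mapsTo hv
      rw [h5] at h7
      rw [h6] at h8
      rw [cc_eq_of_mem h7]
      exact h8
    rw [cc_delE huv'] at h2
    refine h2.transfer (fun a b h => (Prod.ext_iff.1 h).1) (fun a b a' b' ha hb hab => ?_)
    have hau := eq_of_mark huP (Prod.ext_iff.1 ha).2
    have hav := eq_of_mark hvP (Prod.ext_iff.1 ha).2
    have hbu := eq_of_mark huP (Prod.ext_iff.1 hb).2
    have hbv := eq_of_mark hvP (Prod.ext_iff.1 hb).2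
    have huv1 : F'.Adj u' v' := ((hPr P₁ (hP.trans hPP) (hv'.of_le (by omega)) _ huP).2 _ hvP).1 huv
    have hs : s(a, b) = s(u, v) ↔ s(a', b') = s(u', v') := by
      rw [Sym2.eq_iff, Sym2.eq_iff, hau, hav, hbu, hbv]
    by_cases h : s(a, b) = s(u, v)
    · have h1 : F.Adj a b := by
        rw [← SimpleGraph.mem_edgeSet, h]
        exact huv
      have h1' : F'.Adj a' b' := by
        rw [← SimpleGraph.mem_edgeSet, hs.1 h]
        exact huv1
      exact ⟨fun _ => h1', fun _ => h1⟩
    · exact ⟨fun h1 => (hab.1 ⟨h1, h⟩).1, fun h1 => (hab.2 ⟨h1, fun h3 => h (hs.2 h3)⟩).1⟩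

end Pieces


section Assembly

variable {V W : Type}

theorem EF.refl (G : SimpleGraph V) (q : ℕ) {P : Set (V × V)} (hP : ∀ r ∈ P, r.1 = r.2) :
    EF G G q P :=
  EF.of_iso .refl fun r hr => (hP r hr).symm

/-- Vertices identified by the `q`-round game. -/
def Idf (G : SimpleGraph V) (q : ℕ) : Set V := {v | ∀ u, u ≠ v → ¬ EF G G q {(v, u)}}

/-- The identified vertices of `G` that look like `b`. -/
def idc (G : SimpleGraph V) (H : SimpleGraph W) (q : ℕ) (b : W) : Set V :=
  {v | v ∈ Idf G q ∧ EF G H q {(v, b)}}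

/-- The identified vertices of `G` that look like some neighbour of `b`. -/
def idn (G : SimpleGraph V) (H : SimpleGraph W) (q : ℕ) (b : W) : Set V :=
  {v | ∃ w, v ∈ idc G H q w ∧ H.Adj b w}

theorem mem_idc_self {G : SimpleGraph V} {q : ℕ} {v a : V} :
    v ∈ idc G G q a ↔ v = a ∧ a ∈ Idf G q := by
  constructor
  · rintro ⟨h1, h2⟩
    by_cases h : a = v
    · exact ⟨h.symm, h ▸ h1⟩
    · exact absurd h2 (h1 a h)
  · rintro ⟨rfl, h⟩
    refine ⟨h, EF.refl G q ?_⟩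
    rintro r rfl
    rfl

theorem mem_idn_self {G : SimpleGraph V} {q : ℕ} {v a : V} :
    v ∈ idn G G q a ↔ v ∈ Idf G q ∧ G.Adj a v := by
  constructor
  · rintro ⟨w, h1, h2⟩
    obtain ⟨rfl, h3⟩ := mem_idc_self.1 h1
    exact ⟨h3, h2⟩
  · rintro ⟨h1, h2⟩
    exact ⟨v, mem_idc_self.2 ⟨rfl, h1⟩, h2⟩

theorem idc_eq {G : SimpleGraph V} {H : SimpleGraph W} {q : ℕ} {P : Set (V × W)} {a : V} {b : W}
    (hE : EF G H q P) (hab : (a, b) ∈ P) : idc G G q a = idc G H q b := by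
  have h1 : EF G H q {(a, b)} := hE.mono (Set.singleton_subset_iff.2 hab)
  ext v
  refine and_congr_right fun _ => ⟨fun h => (h.comp h1).mono ?_,
    fun h => (h.comp h1.swap).mono ?_⟩
  all_goals simp_all

theorem idn_eq {G : SimpleGraph V} {H : SimpleGraph W} {q : ℕ} {P : Set (V × W)} {a : V} {b : W}
    (hE : EF G H (q + 1) P) (hab : (a, b) ∈ P) : idn G G q a = idn G H q b := by
  ext v
  constructor
  · rintro ⟨w, h1, h2⟩
    obtain ⟨w', hw⟩ := hE.2.1 w
    refine ⟨w', idc_eq hw (Set.mem_insert _ _) ▸ h1, ?_⟩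
    exact (hw.piso _ (Set.mem_insert_of_mem _ hab) _ (Set.mem_insert _ _)).2.1 h2
  · rintro ⟨w', h1, h2⟩
    obtain ⟨w, hw⟩ := hE.2.2 w'
    refine ⟨w, (idc_eq hw (Set.mem_insert _ _)).symm ▸ h1, ?_⟩
    exact (hw.piso _ (Set.mem_insert_of_mem _ hab) _ (Set.mem_insert _ _)).2.2 h2

/-- If every large connected set contains an identified vertex and small connected sets have
small excess, few rounds suffice to recognise the graph. -/
theorem iso_of_ef [Finite V] [Finite W] {G : SimpleGraph V} {H : SimpleGraph W} {α l e q₁ q₀ : ℕ}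
    (hα : 3 ≤ α) (hl : ∀ k, 2 ≤ k → k ≤ l → k + 2 ≤ α * Nat.log 2 k)
    (hdeg : ∀ v, {w | G.Adj v w}.ncard ≤ l) (hq₁ : 1 ≤ q₁) (hcard : q₁ ≤ Nat.card V)
    (hconn : Cn G Set.univ) (hIdf : ∀ S, Cn G S → q₁ ≤ S.ncard → ∃ v ∈ S, v ∈ Idf G q₀)
    (hex : ∀ S, Cn G S → S.ncard < q₁ → ein G S + 1 ≤ S.ncard + e)
    (hE : EF G H (q₀ + 1 + (l + fcost α q₁ + 2 * e + 2)) ∅) : Nonempty (G ≃g H) := by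
  classical
  obtain ⟨c, -, hc⟩ := hIdf _ hconn (by rwa [Set.ncard_univ])
  have : Nonempty V := ⟨c⟩
  have : Nonempty W := (hE.2.1 c).nonempty
  set C : Set V := {a | (idc G G q₀ a).Nonempty} with hCdef
  set C' : Set W := {b | (idc G H q₀ b).Nonempty} with hC'def
  have hC : ∀ a, a ∈ C ↔ a ∈ Idf G q₀ := fun a =>
    ⟨fun ⟨v, hv⟩ => (mem_idc_self.1 hv).2, fun h => ⟨a, mem_idc_self.2 ⟨rfl, h⟩⟩⟩
  set F := delV G C with hF
  set F' := delV H C' with hF'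
  set col : V → Set V × Set V := fun a => (idc G G q₀ a, idn G G q₀ a) with hcol
  set col' : W → Set V × Set V := fun b => (idc G H q₀ b, idn G H q₀ b) with hcol'
  let ρ : Set V × Set V → Prop := fun k => k.1.Nonempty ∨ k.2.Nonempty
  have hPr : Pres G H F F' col col' (q₀ + 1) (∅ : Set (V × W)) := by
    intro P _ hP r hr
    have h1 : ∀ r ∈ P, idc G G q₀ r.1 = idc G H q₀ r.2 := fun r hr =>
      idc_eq (hP.of_le (Nat.le_succ _)) hr
    have h2 : ∀ r ∈ P, r.1 ∈ C ↔ r.2 ∈ C' := fun r hr => by grind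
    refine ⟨Prod.ext (h1 r hr) (idn_eq hP hr), fun s hs => ?_⟩
    exact and_congr (hP.piso r hr s hs).2 (and_congr (not_congr (h2 r hr)) (not_congr (h2 s hs)))
  have hsing : ∀ x ∈ C, cc F x = {x} := fun x hx => by
    refine Set.Subset.antisymm (cc_subset rfl ?_) ?_
    · rintro a rfl b hab
      exact absurd hx hab.2.1
    · rintro a rfl
      exact mem_cc_self _ _
  have hpd1 : ∀ x ∈ C, PdE 0 1 l F (cc F x) := fun x hx => by
    have hcd : (cc F x).ncard = 1 := by rw [hsing x hx, Set.ncard_singleton]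
    refine ⟨hcd.le, fun v _ => ?_, ?_⟩
    · have h1 : {w | w ∈ cc F x ∧ F.Adj v w} ⊆ {w | G.Adj v w} := fun w hw => hw.2.1
      exact (Set.ncard_le_ncard h1 (Set.toFinite _)).trans (hdeg v)
    · have h1 : eset F (cc F x) = ∅ := by
        rw [hsing x hx]
        refine Set.eq_empty_of_forall_notMem fun s => ?_
        induction s with
        | _ a b =>
          rw [mk_mem_eset]
          rintro ⟨h1, rfl, h2⟩
          exact h1.ne h2.symm
      simp only [ein, h1, Set.ncard_empty, hcd]
      omega
  have hpd2 : ∀ x, x ∉ C → PdE e q₁ l F (cc F x) := fun x hx => by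
    have hsub : cc F x ⊆ {a | a ∉ C} := cc_subset hx fun a _ b hab => hab.2.2
    have hcn : Cn G (cc F x) := (cn_cc F x).mono fun _ _ _ _ h => delV_le G C h
    have hlt : (cc F x).ncard < q₁ := by
      by_contra hge
      obtain ⟨v, hv, hv'⟩ := hIdf _ hcn (by omega)
      exact hsub hv ((hC v).2 hv')
    refine ⟨hlt.le, fun v _ => ?_, ?_⟩
    · have h1 : {w | w ∈ cc F x ∧ F.Adj v w} ⊆ {w | G.Adj v w} := fun w hw => hw.2.1
      exact (Set.ncard_le_ncard h1 (Set.toFinite _)).trans (hdeg v)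
    · have h1 : ein F (cc F x) ≤ ein G (cc F x) := ein_mono (delV_le G C) le_rfl
      have h2 := hex _ hcn hlt
      omega
  have main := si_of_counting (T := l + fcost α q₁ + 2 * e + 2) (ρ := ρ) hPr le_rfl hE
    (by omega) (by
      intro x hx
      by_cases hxC : x ∈ C
      · refine ⟨fcost α 1, 1, PdE 0 1 l, la_tree hα hl 1, hpd1 x hxC, ?_, ?_⟩
        · rw [← Set.ncard_singleton x]
          refine ncard_comps_le (F := F) ?_ ?_
          · rintro S ⟨⟨a, -, rfl⟩, -⟩
            exact ⟨a, rfl⟩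
          · rintro S ⟨-, f, h1, -, h3⟩
            have h4 : idc G G q₀ x = idc G G q₀ (f x) := (Prod.ext_iff.1 (h3 x (mem_cc_self _ _))).1
            have h5 : x ∈ idc G G q₀ (f x) := h4 ▸ mem_idc_self.2 ⟨rfl, (hC x).1 hxC⟩
            have h6 := (mem_idc_self.1 h5).1
            refine ⟨x, rfl, ?_⟩
            have h7 := h1.mapsTo (mem_cc_self F x)
            rwa [← h6] at h7
        · have := fcost_mono α hq₁
          omega
      · obtain ⟨v, hv⟩ : (idn G G q₀ x).Nonempty := hx.resolve_left hxC
        refine ⟨fcost α q₁ + 2 * e, l, PdE e q₁ l, la_excess hα hl e q₁, hpd2 x hxC, ?_, by omega⟩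
        refine le_trans (ncard_comps_le (F := F) (A := {w | G.Adj v w}) ?_ ?_) (hdeg v)
        · rintro S ⟨⟨a, -, rfl⟩, -⟩
          exact ⟨a, rfl⟩
        · rintro S ⟨-, f, h1, -, h3⟩
          have h4 : idn G G q₀ x = idn G G q₀ (f x) := (Prod.ext_iff.1 (h3 x (mem_cc_self _ _))).2
          have h5 : v ∈ idn G G q₀ (f x) := h4 ▸ hv
          exact ⟨f x, (mem_idn_self.1 h5).2.symm, h1.mapsTo (mem_cc_self F x)⟩)
  have hRU : {v | cc F v ∈ RC F col ρ} = Set.univ := by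
    refine Set.eq_univ_of_forall fun v => ?_
    by_contra hv
    obtain ⟨a, -, b, -, ha, hb, hab⟩ := hconn.2 {v | cc F v ∈ RC F col ρ}
      ⟨c, trivial, c, Or.inl ((hC c).2 hc), rfl⟩ ⟨v, trivial, hv⟩
    refine hb ?_
    by_cases hbC : b ∈ C
    · exact ⟨b, Or.inl hbC, rfl⟩
    by_cases haC : a ∈ C
    · exact ⟨b, Or.inr ⟨a, mem_idn_self.2 ⟨(hC a).1 haC, hab.symm⟩⟩, rfl⟩
    · have h1 : cc F b = cc F a := cc_eq_of_adj (show F.Adj a b from ⟨hab, haC, hbC⟩)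
      simp_all
  have hRU' : {w | cc F' w ∈ RC F' col' ρ} = Set.univ := by
    refine Set.eq_univ_of_forall fun b => ?_
    obtain ⟨a, ha⟩ := EF.back (q := q₀ + 1) (t := l + fcost α q₁ + 2 * e + 1) hE b
    have h1 : cc F a ∈ RC F col ρ := by
      have : a ∈ {v | cc F v ∈ RC F col ρ} := hRU ▸ trivial
      exact this
    refine SI.mem_RC (F := F) (col := col) ?_ h1
    by_cases haC : a ∈ C
    · exact ((la_tree hα hl 1).mono (t' := l + fcost α q₁ + 2 * e + 1)
        (by have := fcost_mono α hq₁; omega)).2 G H F F' col col' _ _ _ a b hPr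
        (Set.empty_subset _) (Set.mem_insert _ _) ha (hpd1 a haC)
    · exact ((la_excess hα hl e q₁).mono (t' := l + fcost α q₁ + 2 * e + 1)
        (by omega)).2 G H F F' col col' _ _ _ a b hPr
        (Set.empty_subset _) (Set.mem_insert _ _) ha (hpd2 a haC)
  rw [hRU, hRU'] at main
  obtain ⟨f, h1, h2, h3⟩ := main
  have hbij : Function.Bijective f := Set.bijOn_univ.1 h1
  have hc1 : ∀ a, idc G G q₀ a = idc G H q₀ (f a) := fun a => (Prod.ext_iff.1 (h3 a trivial)).1
  have hc2 : ∀ a, idn G G q₀ a = idn G H q₀ (f a) := fun a => (Prod.ext_iff.1 (h3 a trivial)).2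
  have hCC : ∀ a, a ∈ C ↔ f a ∈ C' := fun a => by
    change Set.Nonempty _ ↔ Set.Nonempty _
    rw [hc1]
  have huniq : ∀ a w, a ∈ idc G H q₀ w → w = f a := by
    intro a w h
    obtain ⟨b, rfl⟩ := hbij.2 w
    rw [← hc1] at h
    rw [(mem_idc_self.1 h).1]
  have hadj1 : ∀ a b, b ∈ C → (G.Adj a b ↔ H.Adj (f a) (f b)) := by
    intro a b hb
    have hb' := (hC b).1 hb
    have h4 : G.Adj a b ↔ b ∈ idn G G q₀ a := ⟨fun h => mem_idn_self.2 ⟨hb', h⟩,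
      fun h => (mem_idn_self.1 h).2⟩
    rw [h4, hc2]
    constructor
    · rintro ⟨w, h5, h6⟩
      rwa [huniq b w h5] at h6
    · intro h
      exact ⟨f b, hc1 b ▸ mem_idc_self.2 ⟨rfl, hb'⟩, h⟩
  refine ⟨⟨Equiv.ofBijective f hbij, ?_⟩⟩
  intro a b
  change H.Adj (f a) (f b) ↔ G.Adj a b
  by_cases hb : b ∈ C
  · exact (hadj1 a b hb).symm
  by_cases ha : a ∈ C
  · rw [H.adj_comm, G.adj_comm]
    exact (hadj1 b a ha).symm
  · have h4 := h2 a trivial b trivial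
    exact ⟨fun h => (h4.2 ⟨h, fun h => ha ((hCC a).2 h), fun h => hb ((hCC b).2 h)⟩).1,
      fun h => (h4.1 ⟨h, ha, hb⟩).1⟩

end Assembly


section Counting

variable {V : Type} [Finite V]

/-- Number of neighbours of `v` in `S`. -/
noncomputable def dgi (G : SimpleGraph V) (S : Set V) (v : V) : ℕ := {w | w ∈ S ∧ G.Adj v w}.ncard

/-- Number of adjacent pairs between `A` and `B`. -/
noncomputable def ebt (G : SimpleGraph V) (A B : Set V) : ℕ :=
  {r : V × V | r.1 ∈ A ∧ r.2 ∈ B ∧ G.Adj r.1 r.2}.ncard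

omit [Finite V] in
open Classical in
theorem ebt_eq_sum [Fintype V] (G : SimpleGraph V) (A B : Set V) :
    ebt G A B = ∑ v ∈ A.toFinset, dgi G B v := by
  have h1 : ebt G A B = (A.toFinset.sigma fun v => {w | w ∈ B ∧ G.Adj v w}.toFinset).card := by
    rw [ebt, Set.ncard_eq_toFinset_card']
    refine Finset.card_bij (fun r _ => ⟨r.1, r.2⟩) ?_ ?_ ?_
    · intro r hr
      simpa using hr
    · simp_all
    · rintro ⟨a, b⟩ h
      exact ⟨(a, b), by simpa using h, rfl⟩
  rw [h1, Finset.card_sigma]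
  exact Finset.sum_congr rfl fun v _ => (Set.ncard_eq_toFinset_card' _).symm

omit [Finite V] in
open Classical in
theorem handshake [Fintype V] (G : SimpleGraph V) (S : Set V) :
    ∑ v ∈ S.toFinset, dgi G S v = 2 * ein G S := by
  have h1 := (delV G Sᶜ).sum_degrees_eq_twice_card_edges
  have h2 : (delV G Sᶜ).edgeFinset.card = ein G S := by
    rw [ein, Set.ncard_eq_toFinset_card']
    congr 1
    ext e
    induction e with
    | _ a b =>
      rw [Set.mem_toFinset, mk_mem_eset, SimpleGraph.mem_edgeFinset, SimpleGraph.mem_edgeSet]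
      simp [delV]
  rw [h2] at h1
  rw [← h1, ← Finset.sum_subset (Finset.subset_univ S.toFinset)]
  · refine Finset.sum_congr rfl fun v hv => ?_
    rw [dgi, Set.ncard_eq_toFinset_card', ← SimpleGraph.card_neighborFinset_eq_degree]
    congr 1
    ext w
    have hv' : v ∈ S := by simpa using hv
    rw [Set.mem_toFinset, SimpleGraph.mem_neighborFinset]
    simp [delV, hv', and_comm]
  · intro v _ hv
    rw [← SimpleGraph.card_neighborFinset_eq_degree, Finset.card_eq_zero]
    ext w
    have hv' : v ∉ S := by simpa using hv
    rw [SimpleGraph.mem_neighborFinset]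
    simp [delV, hv']

theorem ein_union_ge (G : SimpleGraph V) {A B : Set V} (h : Disjoint A B) :
    ein G A + ein G B + ebt G A B ≤ ein G (A ∪ B) := by
  classical
  have hd : ∀ a, a ∈ A → a ∉ B := fun a ha hb => Set.disjoint_left.1 h ha hb
  set M := (fun r : V × V => s(r.1, r.2)) '' {r : V × V | r.1 ∈ A ∧ r.2 ∈ B ∧ G.Adj r.1 r.2}
  have h1 : M.ncard = ebt G A B := by
    refine Set.InjOn.ncard_image ?_
    rintro ⟨a, b⟩ ⟨ha, hb, -⟩ ⟨c, d⟩ ⟨hc, hd', -⟩ h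
    grind
  have h2 : Disjoint (eset G A) (eset G B) := by
    rw [Set.disjoint_left]
    intro e he he'
    induction e with
    | _ a b =>
      rw [mk_mem_eset] at he he'
      exact hd _ he.2.1 he'.2.1
  have h3 : Disjoint (eset G A ∪ eset G B) M := by
    rw [Set.disjoint_left]
    rintro e he ⟨⟨a, b⟩, ⟨ha, hb, -⟩, rfl⟩
    rcases he with he | he <;> rw [mk_mem_eset] at he
    · exact hd _ he.2.2 hb
    · exact hd _ ha he.2.1
  have h4 : eset G A ∪ eset G B ∪ M ⊆ eset G (A ∪ B) := by
    refine Set.union_subset (Set.union_subset (eset_mono le_rfl Set.subset_union_left)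
      (eset_mono le_rfl Set.subset_union_right)) ?_
    rintro _ ⟨⟨a, b⟩, ⟨ha, hb, hab⟩, rfl⟩
    rw [mk_mem_eset]
    exact ⟨hab, Or.inl ha, Or.inr hb⟩
  have h5 := Set.ncard_le_ncard h4 (Set.toFinite _)
  rw [Set.ncard_union_eq h3 (Set.toFinite _) (Set.toFinite _),
    Set.ncard_union_eq h2 (Set.toFinite _) (Set.toFinite _), h1] at h5
  exact h5

theorem dgi_mono (G : SimpleGraph V) {A B : Set V} (h : A ⊆ B) (v : V) : dgi G A v ≤ dgi G B v :=
  Set.ncard_le_ncard (fun _ hw => ⟨h hw.1, hw.2⟩) (Set.toFinite _)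

theorem ear {G : SimpleGraph V} {S B : Set V} (hS : Cn G S) (hB : B ⊆ S) (hne : B.Nonempty)
    (hR : (S \ B).Nonempty) (hdeg : ∀ v ∈ S \ B, 2 ≤ dgi G S v) :
    ein G B + (S \ B).ncard + 1 ≤ ein G S := by
  classical
  have := Fintype.ofFinite V
  set R := S \ B with hRdef
  have h1 : ∑ v ∈ R.toFinset, dgi G S v = 2 * ein G R + ebt G R B := by
    have e : ∀ v, dgi G S v = dgi G R v + dgi G B v := by
      intro v
      rw [dgi, dgi, dgi, ← Set.ncard_union_eq _ (Set.toFinite _) (Set.toFinite _)]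
      · congr 1
        ext w
        grind
      · grind
    simp only [e, Finset.sum_add_distrib]
    rw [← handshake, ebt_eq_sum]
    congr!
  have h2 : 2 * R.ncard ≤ ∑ v ∈ R.toFinset, dgi G S v := by
    rw [Set.ncard_eq_toFinset_card', mul_comm, ← smul_eq_mul, ← Finset.sum_const]
    exact Finset.sum_le_sum fun v hv => hdeg v (by simpa using hv)
  have h3 : 0 < ebt G R B := by
    obtain ⟨b, hb⟩ := hne
    obtain ⟨r, hr⟩ := hR
    obtain ⟨a, ha, c, hc, haR, hcR, hac⟩ := hS.2 R ⟨r, hr.1, hr⟩ ⟨b, hB hb, fun h => h.2 hb⟩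
    refine (Set.ncard_pos (Set.toFinite _)).2 ⟨(a, c), haR, ?_, hac⟩
    by_contra h
    exact hcR ⟨hc, h⟩
  have h4 := ein_union_ge G (A := R) (B := B) Set.disjoint_sdiff_left
  rw [Set.sdiff_union_of_subset hB] at h4
  omega

/-- `S` is a connected set in which all degrees are at least two. -/
def Cyc (G : SimpleGraph V) (Z : Set V) : Prop := Cn G Z ∧ ∀ v ∈ Z, 2 ≤ dgi G Z v

theorem Cyc.ncard_le_ein {G : SimpleGraph V} {Z : Set V} (h : Cyc G Z) : Z.ncard ≤ ein G Z := by
  classical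
  have := Fintype.ofFinite V
  have h2 : 2 * Z.ncard ≤ ∑ v ∈ Z.toFinset, dgi G Z v := by
    rw [Set.ncard_eq_toFinset_card', mul_comm, ← smul_eq_mul, ← Finset.sum_const]
    exact Finset.sum_le_sum fun v hv => h.2 v (by simpa using hv)
  rw [handshake] at h2
  omega

theorem Cyc.subset_of_linked {G : SimpleGraph V} {Z Z' : Set V} {a b : V} {h : ℕ}
    (huni : ∀ S, Cn G S → S.ncard ≤ 6 * h + 6 → ein G S ≤ S.ncard) (hZ : Cyc G Z)
    (hZ' : Cyc G Z') (hc : Z.ncard ≤ 2 * h) (hc' : Z'.ncard ≤ 2 * h) (ha : a ∈ Z) (hb : b ∈ Z')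
    (hab : G.Adj a b) : Z' ⊆ Z := by
  by_contra hsub
  have hS : Cn G (Z ∪ Z') := hZ.1.union_of_link hZ'.1 ha hb (Or.inr hab)
  have h1 := ear hS Set.subset_union_left ⟨a, ha⟩ (by
    obtain ⟨z, hz, hz'⟩ := Set.not_subset.1 hsub
    exact ⟨z, Or.inr hz, hz'⟩) (by
    rintro v ⟨hv, hv'⟩
    exact (hZ'.2 v (hv.resolve_left hv')).trans (dgi_mono G Set.subset_union_right v))
  have h2 := hZ.ncard_le_ein
  have h3 := Set.ncard_union_le Z Z'
  have h4 := huni _ hS (by omega)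
  have h5 := Set.ncard_sdiff_add_ncard_of_subset (s := Z) (t := Z ∪ Z') Set.subset_union_left
    (Set.toFinite _)
  omega

theorem Cyc.ncard_le_of_cover {G : SimpleGraph V} {Y : Set V} {h : ℕ}
    (huni : ∀ S, Cn G S → S.ncard ≤ 6 * h + 6 → ein G S ≤ S.ncard) (hY : Cn G Y)
    (hcov : ∀ y ∈ Y, ∃ Z, y ∈ Z ∧ Z.ncard ≤ 2 * h ∧ Cyc G Z) : Y.ncard ≤ 2 * h := by
  obtain ⟨y₀, hy₀⟩ := hY.1
  obtain ⟨Z, hZ, hZc, hZcyc⟩ := hcov y₀ hy₀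
  refine (Set.ncard_le_ncard ?_ (Set.toFinite _)).trans hZc
  intro y hy
  by_contra hyZ
  obtain ⟨a, -, b, hb, haZ, hbZ, hab⟩ := hY.2 Z ⟨y₀, hy₀, hZ⟩ ⟨y, hy, hyZ⟩
  obtain ⟨Z', hZ', hZc', hZcyc'⟩ := hcov b hb
  exact hbZ (Cyc.subset_of_linked huni hZcyc hZcyc' hZc hZc' haZ hZ' hab hZ')

end Counting

section Paths

variable {V : Type}

/-- `x 0, …, x w` is a path. -/
def IP (G : SimpleGraph V) (w : ℕ) (x : ℕ → V) : Prop :=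
  (∀ i < w, G.Adj (x i) (x (i + 1))) ∧ Set.InjOn x (Set.Iic w)

theorem IP.shift {G : SimpleGraph V} {w : ℕ} {x : ℕ → V} (h : IP G w x) {a w' : ℕ}
    (hw : a + w' ≤ w) : IP G w' (fun i => x (a + i)) := by
  refine ⟨fun i hi => h.1 (a + i) (by omega), fun i hi j hj hij => ?_⟩
  simp only [Set.mem_Iic] at hi hj
  have := h.2 (show a + i ∈ Set.Iic w by simp only [Set.mem_Iic]; omega)
    (show a + j ∈ Set.Iic w by simp only [Set.mem_Iic]; omega) hij
  omega

theorem IP.reverse {G : SimpleGraph V} {w : ℕ} {x : ℕ → V} (h : IP G w x) :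
    IP G w (fun i => x (w - i)) := by
  refine ⟨fun i hi => ?_, fun i hi j hj hij => ?_⟩
  · have := h.1 (w - (i + 1)) (by omega)
    rw [show w - (i + 1) + 1 = w - i by omega] at this
    exact this.symm
  · simp only [Set.mem_Iic] at hi hj
    have := h.2 (show w - i ∈ Set.Iic w by simp only [Set.mem_Iic]; omega)
      (show w - j ∈ Set.Iic w by simp only [Set.mem_Iic]; omega) hij
    omega

theorem IP.append {G : SimpleGraph V} {w w' : ℕ} {x y : ℕ → V} (h : IP G w x) (h' : IP G w' y)
    (hadj : G.Adj (x w) (y 0)) (hd : ∀ i ≤ w, ∀ j ≤ w', x i ≠ y j) :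
    IP G (w + 1 + w') (fun i => if i ≤ w then x i else y (i - (w + 1))) := by
  refine ⟨fun i hi => ?_, fun i hi j hj hij => ?_⟩
  · by_cases h1 : i + 1 ≤ w
    · simp only [h1, show i ≤ w by omega, if_true]
      exact h.1 i h1
    by_cases h2 : i ≤ w
    · grind
    · simp only [h1, h2, if_false]
      have := h'.1 (i - (w + 1)) (by omega)
      grind
  · simp only [Set.mem_Iic] at hi hj
    by_cases h1 : i ≤ w <;> by_cases h2 : j ≤ w <;> simp only [h1, h2, if_true, if_false] at hij
    · exact h.2 h1 h2 hij
    · exact absurd hij (hd _ h1 _ (by omega))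
    · exact absurd hij.symm (hd _ h2 _ (by omega))
    · have := h'.2 (show i - (w + 1) ∈ Set.Iic w' by simp only [Set.mem_Iic]; omega)
        (show j - (w + 1) ∈ Set.Iic w' by simp only [Set.mem_Iic]; omega) hij
      omega

theorem IP.cn {G : SimpleGraph V} {w : ℕ} {x : ℕ → V} (h : ∀ i < w, G.Adj (x i) (x (i + 1))) :
    Cn G (x '' Set.Iic w) := by
  induction w with
  | zero =>
    have : x '' Set.Iic 0 = {x 0} := by
      ext v
      simp [eq_comm]
    rw [this]
    exact cn_singleton G _
  | succ w ih =>
    have : x '' Set.Iic (w + 1) = insert (x (w + 1)) (x '' Set.Iic w) := by grind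
    rw [this]
    exact (ih fun i hi => h i (by omega)).insert_adj ⟨w, Set.mem_Iic.2 le_rfl, rfl⟩
      (h w (Nat.lt_succ_self w))

theorem cn_of_forall {G : SimpleGraph V} {Y : Set V} {x : V} (hx : x ∈ Y)
    (h : ∀ y ∈ Y, ∃ T ⊆ Y, Cn G T ∧ x ∈ T ∧ y ∈ T) : Cn G Y := by
  refine ⟨⟨x, hx⟩, ?_⟩
  rintro B ⟨a, ha, haB⟩ ⟨b, hb, hbB⟩
  obtain ⟨y, z, hy, hz, hyB, hzB⟩ : ∃ y z, y ∈ Y ∧ z ∈ Y ∧ y ∈ B ∧ z ∉ B := ⟨a, b, ha, hb, haB, hbB⟩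
  by_cases hxB : x ∈ B
  · obtain ⟨T, hT, hc, hxT, hbT⟩ := h b hb
    obtain ⟨c, hc, d, hd, h1⟩ := hc.2 B ⟨x, hxT, hxB⟩ ⟨b, hbT, hbB⟩
    exact ⟨c, hT hc, d, hT hd, h1⟩
  · obtain ⟨T, hT, hc, hxT, haT⟩ := h a ha
    obtain ⟨c, hc, d, hd, h1⟩ := hc.2 B ⟨a, haT, haB⟩ ⟨x, hxT, hxB⟩
    exact ⟨c, hT hc, d, hT hd, h1⟩

/-- A connected set contains a path between any two of its points. -/
theorem Cn.exists_path {G : SimpleGraph V} {S : Set V} (h : Cn G S) {a b : V} (ha : a ∈ S)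
    (hb : b ∈ S) : ∃ (w : ℕ) (x : ℕ → V), IP G w x ∧ x 0 = a ∧ x w = b ∧ ∀ i ≤ w, x i ∈ S := by
  classical
  have h1 : Cn (delV G Sᶜ) S := h.mono fun a ha b hb hab => ⟨hab, not_not.2 ha, not_not.2 hb⟩
  have h2 : (delV G Sᶜ).Reachable a b := h1.subset_cc ha hb
  obtain ⟨p, hp⟩ := h2.exists_isPath
  refine ⟨p.length, p.getVert, ⟨fun i hi => (p.adj_getVert_succ hi).1, hp.getVert_injOn⟩,
    p.getVert_zero, p.getVert_length, fun i hi => ?_⟩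
  have h3 : cc (delV G Sᶜ) a ⊆ S := cc_subset ha fun u _ v huv => not_not.1 huv.2.2
  exact h3 (p.takeUntil _ (p.getVert_mem_support i)).reachable

/-- Connected sets contain connected subsets of all smaller sizes. -/
theorem Cn.exists_subset [Finite V] {G : SimpleGraph V} {S : Set V} (h : Cn G S) {j : ℕ}
    (hj : 1 ≤ j) (hjS : j ≤ S.ncard) : ∃ T ⊆ S, Cn G T ∧ T.ncard = j := by
  induction j, hj using Nat.le_induction with
  | base =>
    obtain ⟨x, hx⟩ := h.1
    exact ⟨{x}, by simpa using hx, cn_singleton G x, Set.ncard_singleton x⟩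
  | succ j hj ih =>
    obtain ⟨T, hT, hc, hTj⟩ := ih (by omega)
    obtain ⟨b, hb, hbT⟩ : ∃ b ∈ S, b ∉ T := by
      by_contra hcon
      push Not at hcon
      have := Set.ncard_le_ncard hcon (Set.toFinite _)
      omega
    obtain ⟨t, ht⟩ := hc.1
    obtain ⟨a, -, c, hcS, haT, hcT, hac⟩ := h.2 T ⟨t, hT ht, ht⟩ ⟨b, hb, hbT⟩
    refine ⟨insert c T, Set.insert_subset hcS hT, hc.insert_adj haT hac, ?_⟩
    rw [Set.ncard_insert_of_notMem hcT (Set.toFinite _), hTj]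

end Paths


variable {V : Type}

/-- Degree of a vertex. -/
noncomputable def dg (G : SimpleGraph V) (v : V) : ℕ := {w | G.Adj v w}.ncard

/-- The degree of a vertex together with the degree statistics of its neighbours. -/
noncomputable def col (G : SimpleGraph V) (v : V) : ℕ × (ℕ → ℕ) :=
  (dg G v, fun d => {w | G.Adj v w ∧ dg G w = d}.ncard)

section Colors

variable [Finite V] {G : SimpleGraph V} {l : ℕ}

theorem ncard_nbr_le (hdeg : ∀ v, dg G v ≤ l) {r : ℕ} {p : V → Prop}
    (hp : ∀ Q w w', (w, w') ∈ Q → EF G G r Q → p w → p w') {P : Set (V × V)} {v u : V}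
    (hE : EF G G (r + l) P) (h : (v, u) ∈ P) :
    {w | G.Adj v w ∧ p w}.ncard ≤ {w | G.Adj u w ∧ p w}.ncard := by
  classical
  have := Fintype.ofFinite V
  have : Nonempty V := ⟨v⟩
  set s : Finset V := {w | G.Adj v w ∧ p w}.toFinset with hs
  have hsc : s.card ≤ l := by
    rw [hs, ← Set.ncard_eq_toFinset_card']
    exact (Set.ncard_le_ncard (fun w hw => hw.1) (Set.toFinite _)).trans (hdeg v)
  obtain ⟨g, hg⟩ := EF.extend s (hE.of_le (q' := r + s.card) (by omega))
  have hmem : ∀ w, G.Adj v w ∧ p w →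
      (w, g w) ∈ P ∪ (fun a => (a, g a)) '' (s : Set V) :=
    fun w hw => Or.inr ⟨w, by simpa [hs] using hw, rfl⟩
  refine Set.ncard_le_ncard_of_injOn g ?_ ?_ (Set.toFinite _)
  · intro w hw
    exact ⟨(hg.piso _ (Or.inl h) _ (hmem w hw)).2.1 hw.1, hp _ _ _ (hmem w hw) hg hw.2⟩
  · intro w hw w' hw' heq
    exact (hg.piso _ (hmem w hw) _ (hmem w' hw')).1.2 heq

theorem ncard_nbr_eq (hdeg : ∀ v, dg G v ≤ l) {r : ℕ} {p : V → Prop}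
    (hp : ∀ Q w w', (w, w') ∈ Q → EF G G r Q → p w → p w') {P : Set (V × V)} {v u : V}
    (hE : EF G G (r + l) P) (h : (v, u) ∈ P) :
    {w | G.Adj v w ∧ p w}.ncard = {w | G.Adj u w ∧ p w}.ncard :=
  (ncard_nbr_le hdeg hp hE h).antisymm
    (ncard_nbr_le hdeg hp hE.swap (show (v, u) ∈ P from h))

theorem dg_eq_of_ef (hdeg : ∀ v, dg G v ≤ l) {P : Set (V × V)} {v u : V}
    (hE : EF G G l P) (h : (v, u) ∈ P) : dg G v = dg G u := by
  have := ncard_nbr_eq (p := fun _ => True) (r := 0) hdeg (fun _ _ _ _ _ _ => trivial)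
    (by rwa [zero_add]) h
  simpa [dg] using this

theorem col_eq_of_ef (hdeg : ∀ v, dg G v ≤ l) {P : Set (V × V)} {v u : V}
    (hE : EF G G (l + l) P) (h : (v, u) ∈ P) : col G v = col G u := by
  refine Prod.ext (dg_eq_of_ef hdeg (hE.of_le (by omega)) h) (funext fun d => ?_)
  exact ncard_nbr_eq hdeg (fun Q w w' hw hQ hd => by rw [← dg_eq_of_ef hdeg hQ hw, hd]) hE h

end Colors

/-- The edges lying on a path of length `h` between consecutive anchors `y i`, `y (i + 1)`. -/
def sg (G : SimpleGraph V) (N h : ℕ) (y : ℕ → V) : SimpleGraph V where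
  Adj a b := ∃ i < N, ∃ z, IP G h z ∧ z 0 = y i ∧ z h = y (i + 1) ∧
    ∃ j < h, z j = a ∧ z (j + 1) = b ∨ z j = b ∧ z (j + 1) = a
  symm := ⟨by
    rintro a b ⟨i, hi, z, h1, h2, h3, j, hj, h4⟩
    exact ⟨i, hi, z, h1, h2, h3, j, hj, h4.symm⟩⟩
  loopless := ⟨by
    rintro a ⟨i, hi, z, h1, h2, h3, j, hj, h4⟩
    have := h1.1 j hj
    rcases h4 with ⟨h5, h6⟩ | ⟨h5, h6⟩ <;>
    · rw [h5, h6] at this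
      exact G.irrefl this⟩

theorem sg_le (G : SimpleGraph V) (N h : ℕ) (y : ℕ → V) : sg G N h y ≤ G := by
  rintro a b ⟨i, hi, z, h1, h2, h3, j, hj, ⟨rfl, rfl⟩ | ⟨rfl, rfl⟩⟩
  · exact h1.1 j hj
  · exact (h1.1 j hj).symm

theorem sg_adj_of_ef {G : SimpleGraph V} {N h : ℕ} {y y' : ℕ → V} {P : Set (V × V)}
    (hE : EF G G (h + 1) P) (hy : ∀ i ≤ N, (y i, y' i) ∈ P) {a a' b b' : V} (ha : (a, a') ∈ P)
    (hb : (b, b') ∈ P) (hab : (sg G N h y).Adj a b) : (sg G N h y').Adj a' b' := by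
  classical
  obtain ⟨i, hi, z, h1, h2, h3, j, hj, h4⟩ := hab
  have : Nonempty V := ⟨a⟩
  set s : Finset V := (Finset.range (h + 1)).image z with hs
  have hsc : s.card ≤ h + 1 := Finset.card_image_le.trans (by simp)
  obtain ⟨g, hg⟩ := EF.extend s (hE.of_le (q' := 0 + s.card) (by omega))
  have hp := hg.piso
  have hmem : ∀ j ≤ h, (z j, g (z j)) ∈ P ∪ (fun a => (a, g a)) '' (s : Set V) := fun j hj =>
    Or.inr ⟨z j, by
      rw [hs]
      exact Finset.mem_coe.2 (Finset.mem_image_of_mem _ (Finset.mem_range.2 (by omega))), rfl⟩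
  have hval : ∀ j ≤ h, ∀ c c', (c, c') ∈ P → z j = c → g (z j) = c' := fun j hj c c' hc hzc =>
    (hp _ (hmem j hj) _ (Or.inl hc)).1.1 hzc
  refine ⟨i, hi, fun j => g (z j), ⟨fun j hj => ?_, fun j hj j' hj' hjj => ?_⟩,
    hval 0 (by omega) _ _ (hy i hi.le) h2, hval h le_rfl _ _ (hy (i + 1) hi) h3, j, hj, ?_⟩
  · exact (hp _ (hmem j hj.le) _ (hmem (j + 1) hj)).2.1 (h1.1 j hj)
  · exact h1.2 hj hj' ((hp _ (hmem j hj) _ (hmem j' hj')).1.2 hjj)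
  · grind

theorem pres_sg [Finite V] {G : SimpleGraph V} {l : ℕ} (hdeg : ∀ v, dg G v ≤ l) {N h : ℕ}
    {y y' : ℕ → V} {P : Set (V × V)} (hy : ∀ i ≤ N, (y i, y' i) ∈ P) :
    Pres G G (sg G N h y) (sg G N h y') (col G) (col G) (h + 1 + 2 * l) P := by
  intro Q hQ hE r hr
  refine ⟨col_eq_of_ef hdeg (hE.of_le (by omega)) hr, fun s hs => ⟨fun hadj => ?_, fun hadj => ?_⟩⟩
  · exact sg_adj_of_ef (hE.of_le (by omega)) (fun i hi => hQ (hy i hi)) hr hs hadj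
  · exact sg_adj_of_ef (P := Prod.swap ⁻¹' Q) (hE.swap.of_le (by omega))
      (fun i hi => hQ (hy i hi)) hr hs hadj

/-- Vertices on the paths of length `h` from `a` to `b`. -/
def onp (G : SimpleGraph V) (h : ℕ) (a b : V) : Set V :=
  {v | ∃ z, IP G h z ∧ z 0 = a ∧ z h = b ∧ ∃ j ≤ h, z j = v}

theorem IP.two_le_dgi [Finite V] {G : SimpleGraph V} {w : ℕ} {x : ℕ → V} (h : IP G w x)
    {S : Set V} (hS : ∀ i ≤ w, x i ∈ S) {j : ℕ} (hj : 0 < j) (hjw : j < w) : 2 ≤ dgi G S (x j) := by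
  have h1 : x (j - 1) ≠ x (j + 1) := by
    intro heq
    have := h.2 (show j - 1 ∈ Set.Iic w by simp only [Set.mem_Iic]; omega)
      (show j + 1 ∈ Set.Iic w by simp only [Set.mem_Iic]; omega) heq
    omega
  rw [← Set.ncard_pair h1]
  refine Set.ncard_le_ncard ?_ (Set.toFinite _)
  rintro v (rfl | rfl)
  · refine ⟨hS _ (by omega), ?_⟩
    have := h.1 (j - 1) (by omega)
    rw [show j - 1 + 1 = j by omega] at this
    exact this.symm
  · exact ⟨hS _ (by omega), h.1 j hjw⟩

theorem IP.ncard_image {G : SimpleGraph V} {w : ℕ} {x : ℕ → V} (h : IP G w x) :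
    (x '' Set.Iic w).ncard = w + 1 := by
  rw [h.2.ncard_image]
  simp [Set.ncard_eq_toFinset_card']

theorem ncard_onp_le [Finite V] {G : SimpleGraph V} {h : ℕ}
    (huni : ∀ S, Cn G S → S.ncard ≤ 6 * h + 6 → ein G S ≤ S.ncard) (a b : V) :
    (onp G h a b).ncard ≤ 2 * h + 2 := by
  by_contra hcon
  push Not at hcon
  have key : ∀ (B : Set V), Cn G B → a ∈ B → b ∈ B → B.ncard < (onp G h a b).ncard →
      ∃ B', B ⊆ B' ∧ Cn G B' ∧ B'.ncard ≤ B.ncard + (h + 1) ∧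
      ein G B + (B' \ B).ncard + 1 ≤ ein G B' := by
    intro B hB haB hbB hcard
    obtain ⟨v, ⟨z, h1, h2, h3, j, hj, rfl⟩, hv⟩ := Set.exists_mem_notMem_of_ncard_lt_ncard hcard
    have hc : Cn G (B ∪ z '' Set.Iic h) := hB.union_of_link (IP.cn h1.1) haB
      ⟨0, Set.mem_Iic.2 (Nat.zero_le _), rfl⟩ (Or.inl h2.symm)
    refine ⟨B ∪ z '' Set.Iic h, Set.subset_union_left, hc, ?_, ?_⟩
    · have := Set.ncard_union_le B (z '' Set.Iic h)
      rwa [h1.ncard_image] at this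
    · refine ear hc Set.subset_union_left ⟨a, haB⟩ ⟨z j, Or.inr ⟨j, hj, rfl⟩, hv⟩ ?_
      rintro w ⟨hw, hwB⟩
      obtain ⟨i, hi, rfl⟩ := hw.resolve_left hwB
      refine h1.two_le_dgi (fun i hi => Or.inr ⟨i, hi, rfl⟩) ?_ ?_
      all_goals grind
  obtain ⟨v, z, h1, h2, h3, -⟩ : (onp G h a b).Nonempty := by
    rw [← Set.ncard_pos (Set.toFinite _)]
    omega
  set B₀ := z '' Set.Iic h with hB₀
  have hc₀ : B₀.ncard = h + 1 := h1.ncard_image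
  have ha₀ : a ∈ B₀ := ⟨0, Set.mem_Iic.2 (Nat.zero_le _), h2⟩
  have hb₀ : b ∈ B₀ := ⟨h, Set.mem_Iic.2 le_rfl, h3⟩
  have hC₀ : Cn G B₀ := IP.cn h1.1
  obtain ⟨B₁, hs₁, hC₁, hc₁, he₁⟩ := key B₀ hC₀ ha₀ hb₀ (by omega)
  obtain ⟨B₂, hs₂, hC₂, hc₂, he₂⟩ := key B₁ hC₁ (hs₁ ha₀) (hs₁ hb₀) (by omega)
  have h4 := hC₀.ncard_le
  have h5 := huni B₂ hC₂ (by omega)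
  have h6 := Set.ncard_sdiff_add_ncard_of_subset hs₁ (Set.toFinite _)
  have h7 := Set.ncard_sdiff_add_ncard_of_subset hs₂ (Set.toFinite _)
  omega

/-- Synchronised paths of equal colours with `k` steps meet (`NoEA`); if they share both ends and
have length in `[h, k]`, they meet in between (`NoEB`). -/
def NoEA (G : SimpleGraph V) (k : ℕ) : Prop :=
  ∀ x x', IP G k x → IP G k x' → (∀ i ≤ k, col G (x i) = col G (x' i)) → ∃ i ≤ k, x i = x' i

def NoEB (G : SimpleGraph V) (h k : ℕ) : Prop :=
  ∀ w, h ≤ w → w ≤ k → ∀ x x', IP G w x → IP G w x' → (∀ i ≤ w, col G (x i) = col G (x' i)) →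
    x 0 = x' 0 → x w = x' w → ∃ i, 0 < i ∧ i < w ∧ x i = x' i

theorem cyc_of_twin [Finite V] {G : SimpleGraph V} {h k : ℕ} (hA : NoEA G k)
    (hB : NoEB G h (2 * k)) {x x' : ℕ → V} (hx : IP G (2 * k) x) (hx' : IP G (2 * k) x')
    (hcol : ∀ i ≤ 2 * k, col G (x i) = col G (x' i)) (hne : x k ≠ x' k) :
    ∃ Z, x k ∈ Z ∧ Z.ncard ≤ 2 * h ∧ Cyc G Z := by
  classical
  obtain ⟨a, hak, hxa, ha⟩ : ∃ a < k, x a = x' a ∧ ∀ j, a < j → j ≤ k → x j ≠ x' j := by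
    obtain ⟨i, hi, hxi⟩ := hA x x' (by simpa using hx.shift (a := 0) (w' := k) (by omega))
      (by simpa using hx'.shift (a := 0) (w' := k) (by omega)) (fun i hi => hcol i (by omega))
    have hex : ∃ a, a ≤ k ∧ x a = x' a ∧ ∀ j, a < j → j ≤ k → x j ≠ x' j := by
      have h1 : (((Finset.range (k + 1)).filter fun i => x i = x' i)).Nonempty :=
        ⟨i, by simp only [Finset.mem_filter, Finset.mem_range]; exact ⟨by omega, hxi⟩⟩
      obtain ⟨a, ha, hmax⟩ := Finset.exists_max_image _ id h1
      simp only [Finset.mem_filter, Finset.mem_range, id] at ha hmax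
      grind
    grind
  obtain ⟨b, hkb, hb2, hxb, hb⟩ : ∃ b, k < b ∧ b ≤ 2 * k ∧ x b = x' b ∧
      ∀ j, k ≤ j → j < b → x j ≠ x' j := by
    obtain ⟨i, hi, hxi⟩ := hA _ _ (hx.shift (a := k) (w' := k) (by omega))
      (hx'.shift (a := k) (w' := k) (by omega)) (fun i hi => hcol (k + i) (by omega))
    have hex : ∃ b, k ≤ b ∧ x b = x' b := ⟨k + i, by omega, hxi⟩
    obtain ⟨h1, h2⟩ := Nat.find_spec hex
    refine ⟨Nat.find hex, lt_of_le_of_ne h1 ?_, ?_, h2, fun j hj hjb hjj => ?_⟩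
    · grind
    · have := Nat.find_min' hex ⟨(by omega : k ≤ k + i), hxi⟩
      omega
    · exact Nat.find_min hex hjb ⟨hj, hjj⟩
  have hns : ∀ j, a < j → j < b → x j ≠ x' j := fun j h1 h2 => by grind
  have hy := hx.shift (a := a) (w' := b - a) (by omega)
  have hy' := hx'.shift (a := a) (w' := b - a) (by omega)
  have hab : a + (b - a) = b := by omega
  set w := b - a with hw
  have hwh : w < h := by
    by_contra hcon
    obtain ⟨i, hi, hiw, hxi⟩ := hB w (by omega) (by omega) _ _ hy hy'
      (fun i hi => hcol (a + i) (by omega)) (by simpa using hxa) (by simpa [hab] using hxb)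
    exact hns (a + i) (by omega) (by omega) hxi
  set y : ℕ → V := fun i => x (a + i) with hydef
  set y' : ℕ → V := fun i => x' (a + i) with hydef'
  have hyk : y (k - a) = x k := by simp only [hydef]; congr 1; omega
  refine ⟨y '' Set.Iic w ∪ y' '' Set.Iic w, ?_, ?_, ?_, ?_⟩
  · grind
  · have := Set.ncard_union_le (y '' Set.Iic w) (y' '' Set.Iic w)
    rw [hy.ncard_image, hy'.ncard_image] at this
    omega
  · exact (IP.cn hy.1).union_of_link (IP.cn hy'.1) (a := y 0) (b := y' 0)
      ⟨0, Set.mem_Iic.2 (Nat.zero_le _), rfl⟩ ⟨0, Set.mem_Iic.2 (Nat.zero_le _), rfl⟩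
      (Or.inl (by simpa [hydef, hydef'] using hxa))
  · have hl : ∀ i ≤ w, y i ∈ y '' Set.Iic w ∪ y' '' Set.Iic w := fun i hi => Or.inl ⟨i, hi, rfl⟩
    have hr : ∀ i ≤ w, y' i ∈ y '' Set.Iic w ∪ y' '' Set.Iic w := fun i hi => Or.inr ⟨i, hi, rfl⟩
    have h0 : y 0 = y' 0 := by simpa [hydef, hydef'] using hxa
    have hw0 : y w = y' w := by simpa [hydef, hydef', hab] using hxb
    have e0 : 2 ≤ dgi G (y '' Set.Iic w ∪ y' '' Set.Iic w) (y 0) := by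
      rw [← Set.ncard_pair (hns (a + 1) (by omega) (by omega))]
      refine Set.ncard_le_ncard ?_ (Set.toFinite _)
      rintro v (rfl | rfl)
      · exact ⟨hl 1 (by omega), hy.1 0 (by omega)⟩
      · exact ⟨hr 1 (by omega), h0 ▸ hy'.1 0 (by omega)⟩
    have ew : 2 ≤ dgi G (y '' Set.Iic w ∪ y' '' Set.Iic w) (y w) := by
      rw [← Set.ncard_pair (hns (a + (w - 1)) (by omega) (by omega))]
      refine Set.ncard_le_ncard ?_ (Set.toFinite _)
      have e1 := hy.1 (w - 1) (by omega)
      have e2 := hy'.1 (w - 1) (by omega)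
      rw [show w - 1 + 1 = w by omega] at e1 e2
      rintro v (rfl | rfl)
      · exact ⟨hl (w - 1) (by omega), e1.symm⟩
      · exact ⟨hr (w - 1) (by omega), hw0 ▸ e2.symm⟩
    rintro v (⟨i, hi, rfl⟩ | ⟨i, hi, rfl⟩)
    · rcases Nat.eq_zero_or_pos i with rfl | hi0
      · exact e0
      rcases lt_or_eq_of_le (Set.mem_Iic.1 hi) with hiw | rfl
      · exact hy.two_le_dgi hl hi0 hiw
      · exact ew
    · rcases Nat.eq_zero_or_pos i with rfl | hi0
      · exact h0 ▸ e0
      rcases lt_or_eq_of_le (Set.mem_Iic.1 hi) with hiw | rfl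
      · exact hy'.two_le_dgi hr hi0 hiw
      · exact hw0 ▸ ew

/-- A vertex in the middle of a long path that is not identified lies on a short cycle. -/
theorem cyc_of_ambiguous [Finite V] {G : SimpleGraph V} {α l N h k s m e₁ e M q₀ : ℕ}
    (hα : 3 ≤ α) (hl : ∀ k, 2 ≤ k → k ≤ l → k + 2 ≤ α * Nat.log 2 k) (hdeg : ∀ v, dg G v ≤ l)
    (huni : ∀ S, Cn G S → S.ncard ≤ 6 * h + 6 → ein G S ≤ S.ncard)
    (hexc : ∀ S, Cn G S → S.ncard ≤ s → ein G S ≤ S.ncard + e₁ * (S.ncard / m + 1))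
    (hA : NoEA G k) (hB : NoEB G h (2 * k)) (hk : k = N * h) (hN : 0 < N)
    (hM : M = 2 * N * (2 * h + 2)) (hMs : M ≤ s) (he : e = e₁ * (M / m + 1) + 1)
    (hq : q₀ = h + 1 + 2 * l + (fcost α M + 2 * e) + (2 * N + 1)) {x : ℕ → V}
    (hx : IP G (2 * k) x) {v : V} (hv : x k = v) (hamb : v ∉ Idf G q₀) :
    ∃ Z, v ∈ Z ∧ Z.ncard ≤ 2 * h ∧ Cyc G Z := by
  classical
  subst hv
  obtain ⟨u, hu, hE⟩ : ∃ u, u ≠ x k ∧ EF G G q₀ {(x k, u)} := by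
    simpa [Idf] using hamb
  have : Nonempty V := ⟨u⟩
  set s₀ : Finset V := (Finset.range (2 * N + 1)).image fun i => x (i * h) with hs₀
  have hsc : s₀.card ≤ 2 * N + 1 := Finset.card_image_le.trans (by simp)
  obtain ⟨g, hg⟩ := EF.extend s₀
    (hE.of_le (q' := h + 1 + 2 * l + (fcost α M + 2 * e) + s₀.card) (by omega))
  set P : Set (V × V) := {(x k, u)} ∪ (fun a => (a, g a)) '' (s₀ : Set V) with hP
  set y : ℕ → V := fun i => x (i * h) with hy
  set y' : ℕ → V := fun i => g (y i) with hy'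
  have hyP : ∀ i ≤ 2 * N, (y i, y' i) ∈ P := fun i hi =>
    Or.inr ⟨y i, Finset.mem_coe.2 (Finset.mem_image_of_mem _ (Finset.mem_range.2 (by omega))), rfl⟩
  have hxP : (x k, u) ∈ P := Or.inl rfl
  have hpres := (pres_sg hdeg (h := h) hyP).marks (P := P) subset_rfl
  set F := sg G (2 * N) h y with hF
  set F' := sg G (2 * N) h y' with hF'
  have h2k : 2 * k = 2 * N * h := by rw [hk, mul_assoc]
  have hFx : ∀ j < 2 * k, F.Adj (x j) (x (j + 1)) := by
    intro j hj
    have hh : 0 < h := by grind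
    have h1 : j / h < 2 * N := by
      rw [Nat.div_lt_iff_lt_mul hh]
      omega
    have h3 : (j / h + 1) * h ≤ 2 * k := by
      rw [h2k]
      exact Nat.mul_le_mul_right h h1
    have h4 := Nat.div_add_mod j h
    have h5 := Nat.mod_lt j hh
    have h6 : j / h * h = h * (j / h) := mul_comm _ _
    have h7 : (j / h + 1) * h = h * (j / h) + h := by ring
    refine ⟨j / h, h1, fun i => x (j / h * h + i), hx.shift (by omega), by simp [hy], ?_,
      j % h, h5, Or.inl ⟨?_, ?_⟩⟩
    all_goals grind
  have hxcc : ∀ j ≤ 2 * k, x j ∈ cc F (x k) := by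
    have h1 : Cn F (x '' Set.Iic (2 * k)) := IP.cn hFx
    intro j hj
    exact h1.subset_cc ⟨k, by simp only [Set.mem_Iic]; omega, rfl⟩ ⟨j, hj, rfl⟩
  have hsub : cc F (x k) ⊆ ⋃ i ∈ Finset.range (2 * N), onp G h (y i) (y (i + 1)) := by
    refine cc_subset ?_ ?_
    · have hkm : k = N * h := hk
      refine Set.mem_biUnion (Finset.mem_coe.2 (Finset.mem_range.2 (show N < 2 * N by omega)))
        ⟨fun i => x (N * h + i), hx.shift (a := N * h) (w' := h) ?_, by simp [hy], ?_, 0,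
          Nat.zero_le _, by simp [← hkm]⟩
      · rw [h2k]
        have : N * h + h = (N + 1) * h := by ring
        rw [this]
        exact Nat.mul_le_mul_right h (by omega)
      · simp only [hy]
        congr 1
        ring
    · rintro a - b ⟨i, hi, z, h1, h2, h3, j, hj, h4⟩
      refine Set.mem_biUnion (Finset.mem_coe.2 (Finset.mem_range.2 hi)) ⟨z, h1, h2, h3, ?_⟩
      grind
  have hcard : (cc F (x k)).ncard ≤ M := by
    refine (Set.ncard_le_ncard hsub (Set.toFinite _)).trans ?_
    refine (Finset.set_ncard_biUnion_le _ _).trans ?_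
    refine (Finset.sum_le_card_nsmul _ _ (2 * h + 2) fun i _ => ncard_onp_le huni _ _).trans ?_
    simp [hM]
  have hPd : PdE e M l F (cc F (x k)) := by
    refine ⟨hcard, fun v _ => ?_, ?_⟩
    · exact (Set.ncard_le_ncard (fun w hw => sg_le G _ _ _ hw.2) (Set.toFinite _)).trans (hdeg v)
    · have h1 : Cn G (cc F (x k)) := (cn_cc F (x k)).mono fun a _ b _ hab => sg_le G _ _ _ hab
      have h2 := hexc _ h1 (hcard.trans hMs)
      have h3 : ein F (cc F (x k)) ≤ ein G (cc F (x k)) := ein_mono (sg_le G _ _ _) subset_rfl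
      have h4 : e₁ * ((cc F (x k)).ncard / m + 1) ≤ e₁ * (M / m + 1) :=
        Nat.mul_le_mul_left _ (Nat.add_le_add_right (Nat.div_le_div_right hcard) 1)
      omega
  obtain ⟨f, hf, hfadj, hfcol⟩ := (la_excess hα hl e M).2 G G F F' _ _ _ P P (x k) u hpres
    subset_rfl hxP hg hPd
  have hfk : f (x k) = u :=
    (eq_of_mark hxP (congrArg Prod.snd (hfcol _ (mem_cc_self F (x k))))).1 rfl
  refine cyc_of_twin (x' := fun i => f (x i)) hA hB hx ⟨fun i hi => ?_, fun i hi j hj hij => ?_⟩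
    (fun i hi => congrArg Prod.fst (hfcol _ (hxcc i hi))) (by simpa [hfk] using hu.symm)
  · exact sg_le G _ _ _ ((hfadj _ (hxcc i hi.le) _ (hxcc (i + 1) hi)).1 (hFx i hi))
  · exact hx.2 hi hj (hf.injOn (hxcc i hi) (hxcc j hj) hij)


variable {V : Type} [Finite V] {G : SimpleGraph V}

omit [Finite V] in
theorem ncard_biUnion_le' {ι : Type} [Finite ι] {I : Set ι} {f : ι → Set V} {c n : ℕ}
    (hI : I.ncard ≤ n) (hf : ∀ i ∈ I, (f i).ncard ≤ c) : (⋃ i ∈ I, f i).ncard ≤ n * c := by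
  classical
  have := Fintype.ofFinite ι
  have h1 := Finset.set_ncard_biUnion_le I.toFinset f
  have h2 := Finset.sum_le_card_nsmul I.toFinset (fun i => (f i).ncard) c
    fun i hi => hf i (by simpa using hi)
  simp only [Set.mem_toFinset, smul_eq_mul] at h1 h2
  rw [← Set.ncard_eq_toFinset_card'] at h2
  exact h1.trans (h2.trans (Nat.mul_le_mul_right c hI))

omit [Finite V] in
theorem notMem_of_mem_cc_delV {X : Set V} {z v : V} (hz : z ∉ X) (hv : v ∈ cc (delV G X) z) :
    v ∉ X :=
  cc_subset (S := Xᶜ) hz (fun _ _ _ (hab : (delV G X).Adj _ _) => hab.2.2) hv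

omit [Finite V] in
theorem Cn.of_cc_delV (X : Set V) (z : V) : Cn G (cc (delV G X) z) :=
  (cn_cc _ z).mono fun _ _ _ _ hab => delV_le G X hab

omit [Finite V] in
theorem mem_cc_delV_of_adj {X : Set V} {z a b : V} (hz : z ∉ X) (ha : a ∈ cc (delV G X) z)
    (hab : G.Adj a b) (hb : b ∉ X) : b ∈ cc (delV G X) z := by
  have h1 : (delV G X).Adj a b := ⟨hab, notMem_of_mem_cc_delV hz ha, hb⟩
  exact SimpleGraph.Reachable.trans (show (delV G X).Reachable z a from ha) h1.reachable

theorem ebt_mono {A A' B B' : Set V} (h : ∀ a ∈ A, ∀ b ∈ B, G.Adj a b → a ∈ A' ∧ b ∈ B') :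
    ebt G A B ≤ ebt G A' B' :=
  Set.ncard_le_ncard (fun _ hr => ⟨(h _ hr.1 _ hr.2.1 hr.2.2).1, (h _ hr.1 _ hr.2.1 hr.2.2).2,
    hr.2.2⟩) (Set.toFinite _)

/-- Two disjoint pieces of a sparse connected set are joined by few edges. -/
theorem ebt_le_of_excess {e₁ m s : ℕ}
    (hexc : ∀ S, Cn G S → S.ncard ≤ s → ein G S ≤ S.ncard + e₁ * (S.ncard / m + 1))
    {A B : Set V} (hd : Disjoint A B) (hc : Cn G (A ∪ B)) (hs : A.ncard + B.ncard ≤ s)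
    (hA : A.ncard ≤ ein G A + 1) (hB : B.ncard ≤ ein G B + 1) :
    ebt G A B ≤ 2 + e₁ * ((A.ncard + B.ncard) / m + 1) := by
  have h1 := ein_union_ge G hd
  have h2 := Set.ncard_union_eq hd (Set.toFinite _) (Set.toFinite _)
  have h3 := hexc _ hc (by omega)
  rw [h2] at h3
  omega

section Structure

variable {l g e₁ m s₀ s₂ M₁ : ℕ} (hdeg : ∀ v, dg G v ≤ l)
  (hexp : ∀ S, Cn G S → s₀ ≤ S.ncard → S.ncard ≤ s₂ → S.ncard ≤ g * ebt G S Sᶜ)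
  (hexc : ∀ S, Cn G S → S.ncard ≤ 2 * s₂ → ein G S ≤ S.ncard + e₁ * (S.ncard / m + 1))
  (hM₁ : M₁ ≤ s₂) (hn₁ : ∀ b, s₀ ≤ b → b ≤ s₂ → g * (2 + e₁ * ((b + M₁) / m + 1)) < b)
  (hls : 1 + l * s₀ ≤ s₂)

include hexp hexc hM₁ hn₁ in
theorem small_or_huge {X : Set V} (hX : Cn G X) (hXM : X.ncard ≤ M₁) {x z : V} (hx : x ∈ X)
    (hz : z ∉ X) (hxz : G.Adj x z) (hh : (cc (delV G X) z).ncard ≤ s₂) :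
    (cc (delV G X) z).ncard ≤ s₀ := by
  by_contra hcon
  push Not at hcon
  set B := cc (delV G X) z with hB
  have hBc : Cn G B := Cn.of_cc_delV X z
  have h1 := hexp B hBc hcon.le hh
  have hd : Disjoint B X := Set.disjoint_left.2 fun v hv => notMem_of_mem_cc_delV hz hv
  have h2 : ebt G B Bᶜ ≤ ebt G B X := by
    refine ebt_mono fun a ha b hb hab => ⟨ha, ?_⟩
    by_contra hbX
    exact hb (mem_cc_delV_of_adj hz ha hab hbX)
  have h3 := ebt_le_of_excess hexc hd
    (hBc.union_of_link hX (mem_cc_self _ z) hx (Or.inr hxz.symm)) (by omega) hBc.ncard_le hX.ncard_le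
  have h4 := hn₁ _ hcon.le hh
  have h5 : (B.ncard + X.ncard) / m ≤ (B.ncard + M₁) / m := Nat.div_le_div_right (by omega)
  have h6 : g * ebt G B Bᶜ ≤ g * (2 + e₁ * ((B.ncard + M₁) / m + 1)) :=
    Nat.mul_le_mul_left g ((h2.trans h3).trans
      (Nat.add_le_add_left (Nat.mul_le_mul_left _ (by omega)) _))
  omega

include hdeg hexp hexc hM₁ hn₁ hls in
theorem exists_arm (k : ℕ) {X : Set V} (hX : Cn G X) (hXM : X.ncard + k ≤ M₁) {x z : V}
    (hx : x ∈ X) (hz : z ∉ X) (hxz : G.Adj x z) (hh : s₂ < (cc (delV G X) z).ncard) :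
    ∃ y, IP G k y ∧ y 0 = z ∧ ∀ i ≤ k, y i ∉ X := by
  induction k generalizing X x z with
  | zero =>
    exact ⟨fun _ => z, ⟨fun i hi => absurd hi (by omega), fun i hi j hj _ => by
      simp only [Set.mem_Iic] at hi hj; omega⟩, rfl, fun _ _ => hz⟩
  | succ k ih =>
    have hX' : Cn G (insert z X) := hX.insert_adj hx hxz
    have hXc : (insert z X).ncard ≤ X.ncard + 1 := Set.ncard_insert_le z X
    obtain ⟨b, hzb, hb, hbh⟩ : ∃ b, G.Adj z b ∧ b ∉ insert z X ∧
        s₂ < (cc (delV G (insert z X)) b).ncard := by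
      by_contra hcon
      push Not at hcon
      set I : Set V := {b | G.Adj z b ∧ b ∉ insert z X} with hI
      have hIc : I.ncard ≤ l :=
        (Set.ncard_le_ncard (fun b hb => hb.1) (Set.toFinite _)).trans (hdeg z)
      have h1 : ∀ b ∈ I, (cc (delV G (insert z X)) b).ncard ≤ s₀ := fun b hb =>
        small_or_huge hexp hexc hM₁ hn₁ hX' (by omega) (Set.mem_insert z X) hb.2 hb.1
          (hcon b hb.1 hb.2)
      have h2 : cc (delV G X) z ⊆ insert z (⋃ b ∈ I, cc (delV G (insert z X)) b) := by
        refine cc_subset (Set.mem_insert z _) ?_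
        intro a ha b hab
        by_cases hbz : b = z
        · exact Or.inl hbz
        refine Or.inr ?_
        have hbX : b ∉ insert z X := fun h => h.elim hbz hab.2.2
        rcases ha with rfl | ha
        · exact Set.mem_biUnion (show b ∈ I from ⟨hab.1, hbX⟩) (mem_cc_self _ b)
        · obtain ⟨b', hb', hab'⟩ := Set.mem_iUnion₂.1 ha
          exact Set.mem_biUnion hb' (mem_cc_delV_of_adj hb'.2 hab' hab.1 hbX)
      have h3 := (Set.ncard_le_ncard h2 (Set.toFinite _)).trans (Set.ncard_insert_le _ _)
      have h4 := ncard_biUnion_le' hIc h1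
      omega
    obtain ⟨y, hy, hy0, hyX⟩ := ih hX' (by omega) (Set.mem_insert z X) hb hzb hbh
    have h0 : IP G 0 (fun _ => z) := ⟨fun i hi => absurd hi (by omega), fun i hi j hj _ => by
      simp only [Set.mem_Iic] at hi hj; omega⟩
    have h1 := h0.append hy (by simpa [hy0] using hzb)
      (fun i _ j hj h => hyX j hj (Or.inl h.symm))
    grind

variable {q₁ k h : ℕ}
  (hn₂ : ∀ b, q₁ ≤ b → b ≤ s₂ →
    g * (2 + e₁ * ((b + (k + 1)) / m + 1) + l * (2 * h + 1)) < b)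
  (hMq : q₁ + 2 * k + 2 ≤ M₁) (hq₁ : s₀ ≤ q₁) (hqs : q₁ + q₁ * (l * s₀) ≤ s₂)

include hdeg hexp hexc hM₁ hn₁ hn₂ hMq hq₁ hqs in
theorem many_exits {S A : Set V} (hS : Cn G S) (hSq : S.ncard = q₁) (hd : Disjoint S A)
    (hSA : Cn G (S ∪ A)) (hAk : A.ncard ≤ k + 1) (hA : A.ncard ≤ ein G A + 1) :
    2 * h + 2 ≤ {x | x ∈ S ∧ ∃ z, z ∉ S ∪ A ∧ G.Adj x z ∧
      s₂ < (cc (delV G (S ∪ A)) z).ncard}.ncard := by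
  set X := S ∪ A with hX
  set E := {x | x ∈ S ∧ ∃ z, z ∉ X ∧ G.Adj x z ∧ s₂ < (cc (delV G X) z).ncard} with hE
  by_contra hcon
  have hXc : X.ncard ≤ q₁ + (k + 1) := by
    have : X.ncard ≤ _ := Set.ncard_union_le S A
    omega
  set I : V → Set V := fun a => {z | G.Adj a z ∧ z ∉ X ∧ (cc (delV G X) z).ncard ≤ s₂} with hI
  set T := ⋃ a ∈ S, ⋃ z ∈ I a, cc (delV G X) z with hT
  have hTc : T.ncard ≤ q₁ * (l * s₀) := by
    refine ncard_biUnion_le' hSq.le fun a ha => ncard_biUnion_le' ?_ fun z hz => ?_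
    · exact (Set.ncard_le_ncard (fun z hz => hz.1) (Set.toFinite _)).trans (hdeg a)
    · exact small_or_huge hexp hexc hM₁ hn₁ hSA (by omega) (Or.inl ha) hz.2.1 hz.1 hz.2.2
  have hTX : ∀ v ∈ T, v ∉ X := by
    intro v hv
    obtain ⟨a, ha, hv⟩ := Set.mem_iUnion₂.1 hv
    obtain ⟨z, hz, hv⟩ := Set.mem_iUnion₂.1 hv
    exact notMem_of_mem_cc_delV hz.2.1 hv
  set S₁ := S ∪ T with hS₁
  have hS₁c : S₁.ncard ≤ s₂ := by
    have : S₁.ncard ≤ _ := Set.ncard_union_le S T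
    omega
  have hqS : q₁ ≤ S₁.ncard := hSq ▸ Set.ncard_le_ncard Set.subset_union_left (Set.toFinite _)
  obtain ⟨r, hr⟩ := hS.1
  have hS₁n : Cn G S₁ := by
    refine cn_of_forall (x := r) (Or.inl hr) ?_
    rintro y (hy | hy)
    · exact ⟨S, Set.subset_union_left, hS, hr, hy⟩
    · obtain ⟨a, ha, hy⟩ := Set.mem_iUnion₂.1 hy
      obtain ⟨z, hz, hy⟩ := Set.mem_iUnion₂.1 hy
      refine ⟨S ∪ cc (delV G X) z, Set.union_subset_union_right _ ?_,
        hS.union_of_link (Cn.of_cc_delV X z) ha (mem_cc_self _ z) (Or.inr hz.1), Or.inl hr,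
        Or.inr hy⟩
      exact fun v hv => Set.mem_iUnion₂.2 ⟨a, ha, Set.mem_iUnion₂.2 ⟨z, hz, hv⟩⟩
  have hd₁ : Disjoint S₁ A := by grind
  have hSA₁ : Cn G (S₁ ∪ A) := by
    have h1 := hS₁n.union_of_link hSA (Or.inl hr) (Or.inl hr) (Or.inl rfl)
    have h2 : S₁ ∪ X = S₁ ∪ A := by grind
    rwa [h2] at h1
  have h1 := ebt_le_of_excess hexc hd₁ hSA₁ (by omega) hS₁n.ncard_le hA
  have h2 := hexp S₁ hS₁n (by omega) hS₁c
  have h3 : ebt G S₁ S₁ᶜ ≤ ebt G S₁ A + l * E.ncard := by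
    have h4 : ({r : V × V | r.1 ∈ S₁ ∧ r.2 ∈ S₁ᶜ ∧ G.Adj r.1 r.2}) ⊆
        {r : V × V | r.1 ∈ S₁ ∧ r.2 ∈ A ∧ G.Adj r.1 r.2} ∪
          ⋃ a ∈ E, (fun b => (a, b)) '' {b | G.Adj a b} := by
      rintro ⟨a, b⟩ ⟨ha, hb, hab⟩
      simp only at ha hb hab
      by_cases hbA : b ∈ A
      · exact Or.inl ⟨ha, hbA, hab⟩
      have hbX : b ∉ X := fun h => h.elim (fun h => hb (Or.inl h)) hbA
      refine Or.inr (Set.mem_iUnion₂.2 ?_)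
      rcases ha with ha | ha
      · refine ⟨a, ⟨ha, b, hbX, hab, ?_⟩, b, hab, rfl⟩
        by_contra hcon
        push Not at hcon
        exact hb (Or.inr (Set.mem_iUnion₂.2 ⟨a, ha, Set.mem_iUnion₂.2
          ⟨b, ⟨hab, hbX, hcon⟩, mem_cc_self _ b⟩⟩))
      · obtain ⟨c, hc, ha⟩ := Set.mem_iUnion₂.1 ha
        obtain ⟨z, hz, ha⟩ := Set.mem_iUnion₂.1 ha
        exact absurd (Or.inr (Set.mem_iUnion₂.2 ⟨c, hc, Set.mem_iUnion₂.2
          ⟨z, hz, mem_cc_delV_of_adj hz.2.1 ha hab hbX⟩⟩)) hb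
    refine (Set.ncard_le_ncard h4 (Set.toFinite _)).trans ((Set.ncard_union_le _ _).trans ?_)
    refine Nat.add_le_add_left ?_ _
    rw [mul_comm]
    exact ncard_biUnion_le' le_rfl fun a _ => (Set.ncard_image_le (Set.toFinite _)).trans (hdeg a)
  have h4 := hn₂ _ hqS hS₁c
  have h5 : (S₁.ncard + A.ncard) / m ≤ (S₁.ncard + (k + 1)) / m := Nat.div_le_div_right (by omega)
  have h6 : g * ebt G S₁ S₁ᶜ ≤
      g * (2 + e₁ * ((S₁.ncard + (k + 1)) / m + 1) + l * (2 * h + 1)) :=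
    Nat.mul_le_mul_left g (h3.trans (Nat.add_le_add (h1.trans
      (Nat.add_le_add_left (Nat.mul_le_mul_left _ (by omega)) _))
      (Nat.mul_le_mul_left l (by omega))))
  omega

include hdeg hexp hexc hM₁ hn₁ hls hn₂ hMq hq₁ hqs in
theorem exists_midpoints {S : Set V} (hS : Cn G S) (hSq : S.ncard = q₁) :
    ∃ Y ⊆ S, Cn G Y ∧ 2 * h + 2 ≤ Y.ncard ∧ ∀ y ∈ Y, ∃ x, IP G (2 * k) x ∧ x k = y := by
  have h1 := many_exits hdeg hexp hexc hM₁ hn₁ hn₂ hMq hq₁ hqs hS hSq (A := ∅)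
    (Set.disjoint_empty S) (by simpa using hS) (by simp) (by simp)
  obtain ⟨r, hr, z, hz, hrz, hzh⟩ := (Set.ncard_pos (Set.toFinite _)).1 (by omega :
    0 < {x | x ∈ S ∧ ∃ z, z ∉ S ∪ ∅ ∧ G.Adj x z ∧ s₂ < (cc (delV G (S ∪ ∅)) z).ncard}.ncard)
  rw [Set.union_empty] at hz hzh
  obtain ⟨a, ha, ha0, haS⟩ := exists_arm hdeg hexp hexc hM₁ hn₁ hls k hS (by omega) hr hz hrz hzh
  set A := a '' Set.Iic k with hA
  have hAn : Cn G A := IP.cn ha.1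
  have hAc : A.ncard = k + 1 := ha.ncard_image
  have hd : Disjoint S A := by grind
  have hSA : Cn G (S ∪ A) := hS.union_of_link hAn hr ⟨0, Set.mem_Iic.2 (Nat.zero_le _), rfl⟩
    (Or.inr (ha0 ▸ hrz))
  have h2 := many_exits hdeg hexp hexc hM₁ hn₁ hn₂ hMq hq₁ hqs hS hSq hd hSA hAc.le hAn.ncard_le
  set E := {x | x ∈ S ∧ ∃ z, z ∉ S ∪ A ∧ G.Adj x z ∧ s₂ < (cc (delV G (S ∪ A)) z).ncard} with hE
  set Y : Set V := {y | ∃ w p, IP G w p ∧ p 0 = r ∧ p w ∈ E ∧ (∀ i ≤ w, p i ∈ S) ∧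
    ∃ i ≤ w, p i = y} with hY
  have hEY : E ⊆ Y := by
    intro x hx
    obtain ⟨w, p, hp, hp0, hpw, hpS⟩ := hS.exists_path hr hx.1
    exact ⟨w, p, hp, hp0, hpw ▸ hx, hpS, w, le_rfl, hpw⟩
  refine ⟨Y, ?_, ?_, h2.trans (Set.ncard_le_ncard hEY (Set.toFinite _)), ?_⟩
  · grind
  · obtain ⟨x, hx⟩ : E.Nonempty := (Set.ncard_pos (Set.toFinite _)).1 (by omega)
    obtain ⟨w, p, hp, hp0, hpw, hpS, -⟩ := hEY hx
    have hrY : r ∈ Y := ⟨w, p, hp, hp0, hpw, hpS, 0, Nat.zero_le _, hp0⟩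
    refine cn_of_forall hrY ?_
    rintro y ⟨w, p, hp, hp0, hpw, hpS, i, hi, rfl⟩
    exact ⟨p '' Set.Iic w, by
      rintro _ ⟨j, hj, rfl⟩
      exact ⟨w, p, hp, hp0, hpw, hpS, j, hj, rfl⟩, IP.cn hp.1,
      ⟨0, Set.mem_Iic.2 (Nat.zero_le _), hp0⟩, ⟨i, hi, rfl⟩⟩
  · rintro y ⟨w, p, hp, hp0, ⟨hpwS, z', hz', hpz', hzh'⟩, hpS, i, hi, rfl⟩
    obtain ⟨b, hb, hb0, hbX⟩ := exists_arm hdeg hexp hexc hM₁ hn₁ hls k hSA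
      (by have := Set.ncard_union_le S A; omega) (Or.inl hpwS) hz' hpz' hzh'
    have e1 := ha.reverse.append hp (by simpa [ha0, hp0] using hrz.symm)
      (fun i _ j hj h => haS (k - i) (by omega) (by simpa [h] using hpS j hj))
    have e2 := e1.append hb (by
      rw [if_neg (by omega), hb0, show k + 1 + w - (k + 1) = w by omega]
      exact hpz') (by
      intro i hi j hj h
      refine hbX j hj ?_
      rw [← h]
      split_ifs with h3
      · grind
      · exact Or.inl (hpS _ (by omega)))
    refine ⟨_, e2.shift (a := i + 1) (w' := 2 * k) (by omega), ?_⟩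
    grind

end Structure


/-- The structural properties of a sparse random graph used by the identification argument. -/
structure Good {V : Type} (G : SimpleGraph V) (l g e₁ m s₀ s₂ h k : ℕ) : Prop where
  deg_le : ∀ v, dg G v ≤ l
  expansion : ∀ S, Cn G S → s₀ ≤ S.ncard → S.ncard ≤ s₂ → S.ncard ≤ g * ebt G S Sᶜ
  excess : ∀ S, Cn G S → S.ncard ≤ 2 * s₂ → ein G S ≤ S.ncard + e₁ * (S.ncard / m + 1)
  unicyclic : ∀ S, Cn G S → S.ncard ≤ 6 * h + 6 → ein G S ≤ S.ncard
  noEA : NoEA G k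
  noEB : NoEB G h (2 * k)

/-- Relations between the parameters used by the identification argument. -/
structure Sizes (l g e₁ m s₀ s₂ h N q₁ : ℕ) : Prop where
  pos : 0 < N
  q_pos : 0 < q₁
  fan : 2 * N * (2 * h + 2) ≤ 2 * s₂
  dich : ∀ b, s₀ ≤ b → b ≤ s₂ → g * (2 + e₁ * ((b + (q₁ + 2 * (N * h) + 2)) / m + 1)) < b
  exits : ∀ b, q₁ ≤ b → b ≤ s₂ →
    g * (2 + e₁ * ((b + (N * h + 1)) / m + 1) + l * (2 * h + 1)) < b
  arms : q₁ + 2 * (N * h) + 2 ≤ s₂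
  start : s₀ ≤ q₁
  hull : q₁ + q₁ * (l * s₀) ≤ s₂

/-- Rounds used to identify a vertex in the middle of a long path. -/
def idCost (α l e₁ m h N : ℕ) : ℕ :=
  h + 1 + 2 * l + (fcost α (2 * N * (2 * h + 2)) + 2 * (e₁ * (2 * N * (2 * h + 2) / m + 1) + 1)) +
    (2 * N + 1)

/-- Rounds used to identify the whole graph. -/
def totalCost (α l e₁ m h N q₁ : ℕ) : ℕ :=
  idCost α l e₁ m h N + 1 + (l + fcost α q₁ + 2 * (e₁ * (q₁ / m + 1) + 1) + 2)

theorem Good.iso_of_ef {V W : Type} [Finite V] [Finite W] {G : SimpleGraph V} {H : SimpleGraph W}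
    {α l g e₁ m s₀ s₂ h N q₁ : ℕ} (hG : Good G l g e₁ m s₀ s₂ h (N * h))
    (hs : Sizes l g e₁ m s₀ s₂ h N q₁) (hα : 3 ≤ α)
    (hl : ∀ k, 2 ≤ k → k ≤ l → k + 2 ≤ α * Nat.log 2 k) (hc : Cn G Set.univ)
    (hcard : q₁ ≤ Nat.card V) (hE : EF G H (totalCost α l e₁ m h N q₁) ∅) : Nonempty (G ≃g H) := by
  have := hs.pos
  have := hs.q_pos
  have hull := hs.hull
  have arms := hs.arms
  refine GC.iso_of_ef (q₁ := q₁) (q₀ := idCost α l e₁ m h N) hα hl hG.deg_le hs.q_pos hcard hc ?_ ?_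
    hE
  · intro S hS hqS
    obtain ⟨T, hTS, hT, hTq⟩ := hS.exists_subset hs.q_pos hqS
    have hls : 1 + l * s₀ ≤ s₂ := by
      have := Nat.mul_le_mul_right (l * s₀) hs.q_pos
      omega
    obtain ⟨Y, hYT, hY, hYc, hYm⟩ := exists_midpoints hG.deg_le hG.expansion hG.excess hs.arms
      hs.dich hls hs.exits le_rfl hs.start hs.hull hT hTq
    by_contra hcon
    push Not at hcon
    have := Cyc.ncard_le_of_cover hG.unicyclic hY (fun y hy => by
      obtain ⟨x, hx, hxy⟩ := hYm y hy
      exact cyc_of_ambiguous hα hl hG.deg_le hG.unicyclic hG.excess hG.noEA hG.noEB rfl hs.pos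
        rfl hs.fan rfl rfl hx hxy (hcon y (hTS (hYT hy))))
    omega
  · intro S hS hSq
    have h1 := hG.excess S hS (by omega)
    have h2 : e₁ * (S.ncard / m + 1) ≤ e₁ * (q₁ / m + 1) :=
      Nat.mul_le_mul_left _ (Nat.add_le_add_right (Nat.div_le_div_right hSq.le) 1)
    omega

section Transfer

variable {V V' : Type} {G : SimpleGraph V} {G' : SimpleGraph V'} (φ : G' ↪g G)

theorem Cn.image {S : Set V'} (h : Cn G' S) : Cn G (φ '' S) := by
  refine ⟨h.1.image φ, ?_⟩
  rintro B ⟨_, ⟨a, ha, rfl⟩, haB⟩ ⟨_, ⟨b, hb, rfl⟩, hbB⟩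
  obtain ⟨x, hx, y, hy, hxB, hyB, hxy⟩ := h.2 (φ ⁻¹' B) ⟨a, ha, haB⟩ ⟨b, hb, hbB⟩
  exact ⟨φ x, ⟨x, hx, rfl⟩, φ y, ⟨y, hy, rfl⟩, hxB, hyB, φ.map_adj_iff.2 hxy⟩

theorem ein_image (S : Set V') : ein G (φ '' S) = ein G' S := by
  rw [ein, ein, ← Set.ncard_image_of_injective (eset G' S) (Sym2.map.injective φ.injective)]
  congr 1
  ext e
  induction e with
  | _ a b =>
    rw [mk_mem_eset]
    constructor
    · rintro ⟨hab, ⟨a, ha, rfl⟩, ⟨b, hb, rfl⟩⟩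
      exact ⟨s(a, b), mk_mem_eset.2 ⟨φ.map_adj_iff.1 hab, ha, hb⟩, rfl⟩
    · rintro ⟨e, he, hab⟩
      induction e with
      | _ c d =>
        rw [mk_mem_eset] at he
        rw [Sym2.map_mk, Sym2.eq_iff] at hab
        rcases hab with ⟨rfl, rfl⟩ | ⟨rfl, rfl⟩
        · simp_all
        · exact ⟨(φ.map_adj_iff.2 he.1).symm, ⟨d, he.2.2, rfl⟩, ⟨c, he.2.1, rfl⟩⟩

variable (hφ : ∀ a b, G.Adj (φ a) b → b ∈ Set.range φ)
include hφ

theorem ebt_image (S : Set V') : ebt G (φ '' S) (φ '' S)ᶜ = ebt G' S Sᶜ := by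
  rw [ebt, ebt, ← Set.ncard_image_of_injective {r : V' × V' | r.1 ∈ S ∧ r.2 ∈ Sᶜ ∧ G'.Adj r.1 r.2}
    (φ.injective.prodMap φ.injective)]
  congr 1
  ext ⟨a, b⟩
  constructor
  · rintro ⟨⟨a, ha, rfl⟩, hb, hab⟩
    obtain ⟨b, rfl⟩ := hφ _ _ hab
    simp_all
  · rintro ⟨⟨c, d⟩, ⟨hc, hd, hcd⟩, heq⟩
    obtain ⟨rfl, rfl⟩ := Prod.ext_iff.1 heq
    refine ⟨⟨c, hc, rfl⟩, ?_, φ.map_adj_iff.2 hcd⟩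
    simp_all

theorem nbr_image (v : V') (p : V → Prop) :
    {w | G.Adj (φ v) w ∧ p w}.ncard = {w | G'.Adj v w ∧ p (φ w)}.ncard := by
  rw [← Set.ncard_image_of_injective _ φ.injective]
  congr 1
  ext w
  constructor
  · rintro ⟨h1, h2⟩
    obtain ⟨w, rfl⟩ := hφ _ _ h1
    exact ⟨w, ⟨φ.map_adj_iff.1 h1, h2⟩, rfl⟩
  · rintro ⟨w, ⟨h1, h2⟩, rfl⟩
    exact ⟨φ.map_adj_iff.2 h1, h2⟩

theorem dg_image (v : V') : dg G (φ v) = dg G' v := by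
  simpa [dg] using nbr_image φ hφ v (fun _ => True)

theorem col_image (v : V') : col G (φ v) = col G' v := by
  refine Prod.ext (dg_image φ hφ v) (funext fun d => ?_)
  have := nbr_image φ hφ v (fun w => dg G w = d)
  simp only [dg_image φ hφ] at this
  exact this

omit hφ in
theorem IP.image {w : ℕ} {x : ℕ → V'} (h : IP G' w x) : IP G w (fun i => φ (x i)) :=
  ⟨fun i hi => φ.map_adj_iff.2 (h.1 i hi), fun _ hi _ hj hij => h.2 hi hj (φ.injective hij)⟩

theorem Good.comap {l g e₁ m s₀ s₂ h k : ℕ} (hG : Good G l g e₁ m s₀ s₂ h k) :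
    Good G' l g e₁ m s₀ s₂ h k where
  deg_le v := dg_image φ hφ v ▸ hG.deg_le _
  expansion S hS h1 h2 := by
    have h3 : (φ '' S).ncard = S.ncard := Set.ncard_image_of_injective _ φ.injective
    rw [← ebt_image φ hφ, ← h3]
    exact hG.expansion _ (hS.image φ) (by omega) (by omega)
  excess S hS h1 := by
    have h3 : (φ '' S).ncard = S.ncard := Set.ncard_image_of_injective _ φ.injective
    rw [← ein_image φ, ← h3]
    exact hG.excess _ (hS.image φ) (by omega)
  unicyclic S hS h1 := by
    have h3 : (φ '' S).ncard = S.ncard := Set.ncard_image_of_injective _ φ.injective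
    rw [← ein_image φ, ← h3]
    exact hG.unicyclic _ (hS.image φ) (by omega)
  noEA x x' hx hx' hc := by
    obtain ⟨i, hi, h1⟩ := hG.noEA _ _ (hx.image φ) (hx'.image φ) (fun i hi => by
      simpa only [col_image φ hφ] using hc i hi)
    exact ⟨i, hi, φ.injective h1⟩
  noEB w h1 h2 x x' hx hx' hc h0 hw := by
    obtain ⟨i, hi, hiw, h3⟩ := hG.noEB w h1 h2 _ _ (hx.image φ) (hx'.image φ) (fun i hi => by
      simpa only [col_image φ hφ] using hc i hi) (congrArg φ h0) (congrArg φ hw)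
    exact ⟨i, hi, hiw, φ.injective h3⟩

end Transfer

/-- The induced graph on a connected component of a good graph is definable cheaply. -/
theorem Good.D_induce_le {n : ℕ} {G : SimpleGraph (Fin n)} {α l g e₁ m s₀ s₂ h N q₁ : ℕ}
    (hG : Good G l g e₁ m s₀ s₂ h (N * h)) (hs : Sizes l g e₁ m s₀ s₂ h N q₁) (hα : 3 ≤ α)
    (hl : ∀ k, 2 ≤ k → k ≤ l → k + 2 ≤ α * Nat.log 2 k) (C : G.ConnectedComponent)
    (hcard : q₁ ≤ C.supp.ncard) :
    (∃ φ, Defines (G.induce C.supp) φ) ∧ D (G.induce C.supp) ≤ totalCost α l e₁ m h N q₁ := by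
  have hφ : ∀ (a : C.supp) b, G.Adj (SimpleGraph.Embedding.induce (G := G) C.supp a) b →
      b ∈ Set.range (SimpleGraph.Embedding.induce (G := G) C.supp) := by
    intro a b hab
    exact ⟨⟨b, (C.mem_supp_congr_adj hab).1 a.2⟩, rfl⟩
  have hG' := hG.comap (SimpleGraph.Embedding.induce C.supp) hφ
  have hconn : (G.induce C.supp).Connected := C.connected_toSimpleGraph
  have hc : Cn (G.induce C.supp) Set.univ := by
    obtain ⟨x⟩ := hconn.nonempty
    have : cc (G.induce C.supp) x = Set.univ := Set.eq_univ_of_forall fun y => hconn.preconnected x y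
    exact this ▸ cn_cc _ x
  have hq : 0 < totalCost α l e₁ m h N q₁ := by
    unfold totalCost
    omega
  have key : ∀ (m' : ℕ) (H : SimpleGraph (Fin m')),
      EF (G.induce C.supp) H (totalCost α l e₁ m h N q₁) ∅ → Nonempty (G.induce C.supp ≃g H) :=
    fun m' H hE => hG'.iso_of_ef hs hα hl hc (by rwa [Nat.card_coe_set_eq]) hE
  obtain ⟨φ, -, hφ'⟩ := exists_defines_of_ef _ hq key
  exact ⟨⟨φ, hφ'⟩, D_le_of_ef _ hq key⟩


/-! ### Expectation over random subsets -/

/-- Expectation of `f A` where `A` is a random subset of `S` containing each element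
independently with probability `p`. -/
noncomputable def Exs {ι : Type*} (p : ℝ) (S : Finset ι) (f : Finset ι → ℝ) : ℝ :=
  ∑ A ∈ S.powerset, p ^ A.card * (1 - p) ^ (S.card - A.card) * f A

section Exs

variable {ι : Type*} {p : ℝ} {S T : Finset ι} {f g : Finset ι → ℝ}

lemma Exs_empty : Exs p ∅ f = f ∅ := by simp [Exs]

lemma Exs_congr (h : ∀ A ⊆ S, f A = g A) : Exs p S f = Exs p S g := by
  refine Finset.sum_congr rfl fun A hA => ?_
  rw [h A (Finset.mem_powerset.1 hA)]

lemma Exs_mono (h0 : 0 ≤ p) (h1 : p ≤ 1) (h : ∀ A ⊆ S, f A ≤ g A) : Exs p S f ≤ Exs p S g := by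
  refine Finset.sum_le_sum fun A hA => ?_
  have := sub_nonneg.2 h1
  exact mul_le_mul_of_nonneg_left (h A (Finset.mem_powerset.1 hA)) (by positivity)

lemma Exs_nonneg (h0 : 0 ≤ p) (h1 : p ≤ 1) (h : ∀ A ⊆ S, 0 ≤ f A) : 0 ≤ Exs p S f := by
  refine Finset.sum_nonneg fun A hA => ?_
  have := sub_nonneg.2 h1
  exact mul_nonneg (by positivity) (h A (Finset.mem_powerset.1 hA))

lemma Exs_add : Exs p S (fun A => f A + g A) = Exs p S f + Exs p S g := by
  simp only [Exs, mul_add, Finset.sum_add_distrib]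

lemma Exs_sub : Exs p S (fun A => f A - g A) = Exs p S f - Exs p S g := by
  simp only [Exs, mul_sub, Finset.sum_sub_distrib]

lemma Exs_const_mul (r : ℝ) : Exs p S (fun A => r * f A) = r * Exs p S f := by
  simp only [Exs, Finset.mul_sum]
  exact Finset.sum_congr rfl fun A _ => by ring

lemma Exs_mul_const (r : ℝ) : Exs p S (fun A => f A * r) = Exs p S f * r := by
  simp only [Exs, Finset.sum_mul]
  exact Finset.sum_congr rfl fun A _ => by ring

lemma Exs_sum {κ : Type*} (K : Finset κ) (F : κ → Finset ι → ℝ) :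
    Exs p S (fun A => ∑ k ∈ K, F k A) = ∑ k ∈ K, Exs p S (F k) := by
  simp only [Exs, Finset.mul_sum]
  exact Finset.sum_comm

lemma Exs_const (r : ℝ) : Exs p S (fun _ => r) = r := by
  have := Finset.sum_pow_mul_eq_add_pow p (1 - p) S
  simp only [Exs, ← Finset.sum_mul]
  rw [this]; simp

variable [DecidableEq ι]

lemma Exs_insert {e : ι} (he : e ∉ S) :
    Exs p (insert e S) f = (1 - p) * Exs p S f + p * Exs p S (fun A => f (insert e A)) := by
  unfold Exs
  rw [Finset.sum_powerset_insert he, Finset.mul_sum, Finset.mul_sum]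
  congr 1 <;> refine Finset.sum_congr rfl fun A hA => ?_
  · have hA' := Finset.card_le_card (Finset.mem_powerset.1 hA)
    rw [Finset.card_insert_of_notMem he, Nat.sub_add_comm hA', pow_succ]; ring
  · grind

lemma Exs_union (h : Disjoint S T) :
    Exs p (S ∪ T) f = Exs p S (fun A => Exs p T (fun B => f (A ∪ B))) := by
  induction S using Finset.induction_on generalizing f with
  | empty => simp [Exs_empty]
  | insert e S he ih =>
    rw [Finset.disjoint_insert_left] at h
    have he' : e ∉ S ∪ T := by simp [he, h.1]
    rw [Finset.insert_union, Exs_insert he', Exs_insert he, ih h.2, ih h.2]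
    simp only [Finset.insert_union]

lemma Exs_prod (h0 h1 : ι → ℝ) :
    Exs p S (fun A => ∏ e ∈ S, if e ∈ A then h1 e else h0 e)
      = ∏ e ∈ S, (p * h1 e + (1 - p) * h0 e) := by
  induction S using Finset.induction_on with
  | empty => simp [Exs_empty]
  | insert e S he ih =>
    rw [Exs_insert he, Finset.prod_insert he, ← ih, add_mul, add_comm]
    congr 1
    · rw [mul_assoc, ← Exs_const_mul, ← Exs_const_mul, ← Exs_const_mul]
      refine Exs_congr fun A hA => ?_
      rw [Finset.prod_insert he, if_pos (Finset.mem_insert_self _ _)]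
      congr 2
      refine Finset.prod_congr rfl fun e' he' => ?_
      grind
    · rw [mul_assoc, ← Exs_const_mul, ← Exs_const_mul, ← Exs_const_mul]
      refine Exs_congr fun A hA => ?_
      grind

/-- If `f` only depends on `A ∩ S` then the remaining coordinates integrate out. -/
lemma Exs_marginal (h : S ⊆ T) (hf : ∀ A ⊆ T, f A = f (A ∩ S)) : Exs p T f = Exs p S f := by
  rw [← Finset.union_sdiff_of_subset h, Exs_union Finset.disjoint_sdiff]
  refine Exs_congr fun A hA => ?_
  rw [← Exs_const (p := p) (S := T \ S) (f A)]
  refine Exs_congr fun B hB => ?_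
  rw [hf _ (Finset.union_subset (hA.trans h) (hB.trans Finset.sdiff_subset)),
    Finset.union_inter_distrib_right, Finset.inter_eq_left.2 hA,
    Finset.disjoint_iff_inter_eq_empty.1 (Finset.disjoint_of_subset_left hB Finset.sdiff_disjoint),
    Finset.union_empty]

lemma Exs_indep (h : Disjoint S T) (f g : Finset ι → ℝ) :
    Exs p (S ∪ T) (fun A => f (A ∩ S) * g (A ∩ T)) = Exs p S f * Exs p T g := by
  rw [Exs_union h, ← Exs_mul_const]
  refine Exs_congr fun A hA => ?_
  rw [← Exs_const_mul]
  refine Exs_congr fun B hB => ?_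
  rw [Finset.union_inter_distrib_right, Finset.union_inter_distrib_right,
    Finset.inter_eq_left.2 hA, Finset.inter_eq_left.2 hB,
    Finset.disjoint_iff_inter_eq_empty.1 (Finset.disjoint_of_subset_left hB h.symm),
    Finset.disjoint_iff_inter_eq_empty.1 (Finset.disjoint_of_subset_left hA h)]
  simp

/-- Expectation restricted to the sets containing `T`. -/
lemma Exs_superset (h : T ⊆ S) :
    Exs p S (fun A => if T ⊆ A then f A else 0)
      = p ^ T.card * Exs p (S \ T) (fun A => f (A ∪ T)) := by
  have h1 : Exs p S (fun A => if T ⊆ A then f A else 0)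
      = Exs p (S \ T) (fun A => Exs p T (fun B => if B = T then f (A ∪ T) else 0)) := by
    conv_lhs => rw [← Finset.sdiff_union_of_subset h]
    rw [Exs_union Finset.sdiff_disjoint]
    refine Exs_congr fun A hA => Exs_congr fun B hB => ?_
    grind
  rw [h1, ← Exs_const_mul]
  refine Exs_congr fun A hA => ?_
  simp only [Exs, mul_ite, mul_zero]
  rw [Finset.sum_ite_eq']
  simp

lemma Exs_superset_one (h : T ⊆ S) :
    Exs p S (fun A => if T ⊆ A then 1 else 0) = p ^ T.card := by
  rw [Exs_superset (f := fun _ => 1) h, Exs_const, mul_one]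

end Exs

/-! ### Random graphs -/

open Classical in
/-- Indicator of a proposition as a real number. -/
noncomputable def ind (P : Prop) : ℝ := if P then 1 else 0

lemma ind_nonneg (P : Prop) : 0 ≤ ind P := by unfold ind; split <;> norm_num
lemma ind_le_one (P : Prop) : ind P ≤ 1 := by unfold ind; split <;> norm_num
lemma ind_pos {P : Prop} (h : P) : ind P = 1 := by simp [ind, h]
lemma ind_neg {P : Prop} (h : ¬ P) : ind P = 0 := by simp [ind, h]
lemma ind_mono {P Q : Prop} (h : P → Q) : ind P ≤ ind Q := by
  by_cases hP : P
  · rw [ind_pos hP, ind_pos (h hP)]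
  · rw [ind_neg hP]; exact ind_nonneg _
lemma ind_congr {P Q : Prop} (h : P ↔ Q) : ind P = ind Q := by rw [propext h]
lemma ind_and (P Q : Prop) : ind (P ∧ Q) = ind P * ind Q := by
  by_cases hP : P <;> by_cases hQ : Q <;> simp [ind, hP, hQ]
lemma ind_not (P : Prop) : ind (¬ P) = 1 - ind P := by
  by_cases hP : P <;> simp [ind, hP]
lemma ind_le_of {P : Prop} {r : ℝ} (h0 : 0 ≤ r) (h : P → 1 ≤ r) : ind P ≤ r := by
  by_cases hP : P
  · rw [ind_pos hP]; exact h hP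
  · rw [ind_neg hP]; exact h0

/-- All possible edges on `n` vertices. -/
def edges (n : ℕ) : Finset (Sym2 (Fin n)) := Finset.univ.filter fun e => ¬ e.IsDiag

lemma mk_mem_edges {n : ℕ} {u v : Fin n} : s(u, v) ∈ edges n ↔ u ≠ v := by
  simp [edges]

/-- The graph with a given edge set. -/
def Gr {n : ℕ} (A : Finset (Sym2 (Fin n))) : SimpleGraph (Fin n) :=
  SimpleGraph.fromEdgeSet (A : Set (Sym2 (Fin n)))

lemma Gr_adj {n : ℕ} {A : Finset (Sym2 (Fin n))} {u v : Fin n} :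
    (Gr A).Adj u v ↔ s(u, v) ∈ A ∧ u ≠ v := by simp [Gr]

lemma Gr_adj' {n : ℕ} {A : Finset (Sym2 (Fin n))} (hA : A ⊆ edges n) {u v : Fin n} :
    (Gr A).Adj u v ↔ s(u, v) ∈ A := by
  rw [Gr_adj]
  exact ⟨fun h => h.1, fun h => ⟨h, mk_mem_edges.1 (hA h)⟩⟩

lemma Gr_mono {n : ℕ} {A B : Finset (Sym2 (Fin n))} (h : A ⊆ B) : Gr A ≤ Gr B :=
  SimpleGraph.fromEdgeSet_mono (by exact_mod_cast h)

/-- Expectation over the random graph `G(n,p)`. -/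
noncomputable def Eg (n : ℕ) (p : ℝ) (f : SimpleGraph (Fin n) → ℝ) : ℝ :=
  Exs p (edges n) (fun A => f (Gr A))

/-- Probability of a graph property. -/
noncomputable def Pg (n : ℕ) (p : ℝ) (P : SimpleGraph (Fin n) → Prop) : ℝ :=
  Eg n p (fun G => ind (P G))

lemma card_edges (n : ℕ) : (edges n).card = n.choose 2 := by
  have := Sym2.card_subtype_not_diag (α := Fin n)
  rw [Fintype.card_subtype] at this
  simpa [edges] using this

lemma gnpProb_eq (n : ℕ) (p : ℝ) (E : Set (SimpleGraph (Fin n))) :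
    gnpProb n p E = Pg n p (fun G => G ∈ E) := by
  classical
  unfold gnpProb Pg Eg Exs
  refine Finset.sum_bij' (fun G _ => G.edgeFinset) (fun A _ => Gr A) ?_ ?_ ?_ ?_ ?_
  · intro G _
    rw [Finset.mem_powerset]
    intro e he
    rw [SimpleGraph.mem_edgeFinset] at he
    simp [edges, G.not_isDiag_of_mem_edgeSet he]
  · intro A _; simp
  · intro G _; simp [Gr]
  · intro A hA
    rw [Finset.mem_powerset] at hA
    ext e
    induction e using Sym2.ind with
    | _ u v => rw [SimpleGraph.mem_edgeFinset, SimpleGraph.mem_edgeSet, Gr_adj' hA]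
  · intro G _
    have h1 : Nat.card G.edgeSet = G.edgeFinset.card := by
      rw [Nat.card_eq_fintype_card, SimpleGraph.edgeFinset_card]
    have h2 : Gr G.edgeFinset = G := by simp [Gr]
    dsimp only
    rw [h1, h2, card_edges]
    unfold ind
    split <;> simp

section Pg

variable {n : ℕ} {p : ℝ} {P Q : SimpleGraph (Fin n) → Prop}

lemma Pg_nonneg (h0 : 0 ≤ p) (h1 : p ≤ 1) : 0 ≤ Pg n p P :=
  by
  unfold Pg Eg
  exact Exs_nonneg h0 h1 fun _ _ => ind_nonneg _

lemma Pg_mono (h0 : 0 ≤ p) (h1 : p ≤ 1) (h : ∀ G, P G → Q G) : Pg n p P ≤ Pg n p Q :=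
  by
  unfold Pg Eg
  exact Exs_mono h0 h1 fun _ _ => ind_mono (h _)

lemma Pg_le_one (h0 : 0 ≤ p) (h1 : p ≤ 1) : Pg n p P ≤ 1 := by
  have := Exs_mono (S := edges n) (f := fun A => ind (P (Gr A))) (g := fun _ => 1) h0 h1
    (fun _ _ => ind_le_one _)
  rwa [Exs_const] at this

lemma Pg_not : Pg n p (fun G => ¬ P G) = 1 - Pg n p P := by
  have : Pg n p (fun G => ¬ P G) = Exs p (edges n) (fun A => 1 - ind (P (Gr A))) := by
    unfold Pg Eg
    exact Exs_congr fun A _ => ind_not _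
  rw [this, Exs_sub, Exs_const]; rfl

lemma Pg_or_le (h0 : 0 ≤ p) (h1 : p ≤ 1) : Pg n p (fun G => P G ∨ Q G) ≤ Pg n p P + Pg n p Q := by
  unfold Pg Eg
  rw [← Exs_add]
  refine Exs_mono h0 h1 fun A _ => ind_le_of (add_nonneg (ind_nonneg _) (ind_nonneg _)) ?_
  dsimp only
  rintro (h | h)
  · rw [ind_pos h]; linarith [ind_nonneg (Q (Gr A))]
  · rw [ind_pos h]; linarith [ind_nonneg (P (Gr A))]

/-- Union bound in the form of a weighted count. -/
lemma Pg_exists_le {κ : Type*} (h0 : 0 ≤ p) (h1 : p ≤ 1) (K : Finset κ)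
    (R : κ → SimpleGraph (Fin n) → Prop) (h : ∀ G, P G → ∃ k ∈ K, R k G) :
    Pg n p P ≤ ∑ k ∈ K, Pg n p (R k) := by
  unfold Pg Eg
  rw [← Exs_sum]
  refine Exs_mono h0 h1 fun A _ => ind_le_of (Finset.sum_nonneg fun _ _ => ind_nonneg _) ?_
  intro hP
  obtain ⟨k, hk, hR⟩ := h _ hP
  refine le_trans (ind_pos hR).ge (Finset.single_le_sum (f := fun k => ind (R k (Gr A)))
    (fun _ _ => ind_nonneg _) hk)

lemma Pg_le_Eg {f : SimpleGraph (Fin n) → ℝ} (h0 : 0 ≤ p) (h1 : p ≤ 1) (hf : ∀ G, 0 ≤ f G)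
    (h : ∀ G, P G → 1 ≤ f G) : Pg n p P ≤ Eg n p f := by
  unfold Pg Eg
  exact Exs_mono h0 h1 fun _ _ => ind_le_of (hf _) (h _)

end Pg

/-- A sequence of graph properties holds with high probability in `G(n,c/n)`. -/
def Whp (c : ℝ) (P : ∀ n : ℕ, SimpleGraph (Fin n) → Prop) : Prop :=
  Tendsto (fun n : ℕ => Pg n (c / n) (fun G => ¬ P n G)) atTop (nhds 0)

lemma eventually_p {c : ℝ} (hc : 0 < c) : ∀ᶠ n : ℕ in atTop, 0 ≤ c / n ∧ c / n ≤ 1 := by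
  filter_upwards [eventually_ge_atTop (⌈c⌉₊ + 1)] with n hn
  have h1 : c ≤ n := (Nat.le_ceil c).trans (by exact_mod_cast (by omega))
  exact ⟨by positivity, div_le_one_of_le₀ h1 (by positivity)⟩

lemma Whp.of_bound {c : ℝ} (hc : 0 < c) {P : ∀ n : ℕ, SimpleGraph (Fin n) → Prop} {b : ℕ → ℝ}
    (hb : Tendsto b atTop (nhds 0))
    (h : ∀ᶠ n : ℕ in atTop, Pg n (c / n) (fun G => ¬ P n G) ≤ b n) : Whp c P := by
  refine tendsto_of_tendsto_of_tendsto_of_le_of_le' tendsto_const_nhds hb ?_ h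
  filter_upwards [eventually_p hc] with n hn
  exact Pg_nonneg hn.1 hn.2

lemma Whp.and {c : ℝ} (hc : 0 < c) {P Q : ∀ n : ℕ, SimpleGraph (Fin n) → Prop}
    (hP : Whp c P) (hQ : Whp c Q) : Whp c (fun n G => P n G ∧ Q n G) := by
  have h := hP.add hQ
  rw [add_zero] at h
  refine Whp.of_bound hc h ?_
  filter_upwards [eventually_p hc] with n hn
  refine le_trans (Pg_mono hn.1 hn.2 fun G hG => ?_) (Pg_or_le hn.1 hn.2)
  tauto

lemma Whp.mono {c : ℝ} (hc : 0 < c) {P Q : ∀ n : ℕ, SimpleGraph (Fin n) → Prop}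
    (hP : Whp c P) (h : ∀ᶠ n in atTop, ∀ G, P n G → Q n G) : Whp c Q := by
  refine Whp.of_bound hc hP ?_
  filter_upwards [eventually_p hc, h] with n hn hPQ
  exact Pg_mono hn.1 hn.2 fun G hG h' => hG (hPQ G h')

lemma Whp.tendsto_one {c : ℝ} {P : ∀ n : ℕ, SimpleGraph (Fin n) → Prop}
    (hP : Whp c P) : Tendsto (fun n : ℕ => Pg n (c / n) (P n)) atTop (nhds 1) := by
  have h : Tendsto (fun n : ℕ => 1 - Pg n (c / n) (fun G => ¬ P n G)) atTop (nhds (1 - 0)) :=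
    tendsto_const_nhds.sub hP
  simp only [Pg_not, sub_zero, sub_sub_cancel] at h
  exact h


/-! ### First moment bounds for connected sets -/

section Trees

variable {n : ℕ} {p : ℝ}

/-- Possible edges inside `S`. -/
def inE (S : Finset (Fin n)) : Finset (Sym2 (Fin n)) :=
  (edges n).filter fun e => ∀ v ∈ e, v ∈ S

/-- Possible edges leaving `S`. -/
def bdE (S : Finset (Fin n)) : Finset (Sym2 (Fin n)) :=
  (S ×ˢ Sᶜ).image fun r => s(r.1, r.2)

lemma mk_mem_inE {S : Finset (Fin n)} {u v : Fin n} :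
    s(u, v) ∈ inE S ↔ u ≠ v ∧ u ∈ S ∧ v ∈ S := by
  simp [inE, mk_mem_edges]

lemma bdE_subset (S : Finset (Fin n)) : bdE S ⊆ edges n := by
  intro e he
  simp only [bdE, Finset.mem_image, Finset.mem_product, Finset.mem_compl] at he
  obtain ⟨r, ⟨h1, h2⟩, rfl⟩ := he
  rw [mk_mem_edges]
  exact fun h => h2 (h ▸ h1)

lemma bdE_injOn (S : Finset (Fin n)) :
    Set.InjOn (fun r : Fin n × Fin n => s(r.1, r.2)) ((S ×ˢ Sᶜ : Finset _) : Set (Fin n × Fin n)) := by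
  rintro ⟨a, b⟩ h ⟨a', b'⟩ h' he
  simp only [Finset.coe_product, Set.mem_prod, Finset.mem_coe, Finset.mem_compl] at h h'
  grind

lemma card_bdE (S : Finset (Fin n)) : (bdE S).card = S.card * (n - S.card) := by
  rw [bdE, Finset.card_image_of_injOn (bdE_injOn S), Finset.card_product, Finset.card_compl,
    Fintype.card_fin]

lemma disjoint_inE_bdE (S : Finset (Fin n)) : Disjoint (inE S) (bdE S) := by
  rw [Finset.disjoint_left]
  intro e h1 h2
  simp only [bdE, Finset.mem_image, Finset.mem_product, Finset.mem_compl] at h2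
  obtain ⟨r, ⟨h3, h4⟩, rfl⟩ := h2
  exact h4 (mk_mem_inE.1 h1).2.2

lemma card_inE_le (S : Finset (Fin n)) : (inE S).card ≤ S.card ^ 2 := by
  have : inE S ⊆ (S ×ˢ S).image fun r => s(r.1, r.2) := by
    intro e he
    induction e using Sym2.ind with
    | _ u v =>
      rw [mk_mem_inE] at he
      exact Finset.mem_image.2 ⟨(u, v), Finset.mem_product.2 he.2, rfl⟩
  refine (Finset.card_le_card this).trans (Finset.card_image_le.trans ?_)
  rw [Finset.card_product, sq]

/-- A parent function for a connected set. -/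
lemma exists_parent {G : SimpleGraph (Fin n)} {S : Finset (Fin n)} (h : Cn G S) :
    ∃ f : Fin n → Fin n, (∀ v, v ∉ S → f v = v) ∧ (∀ v ∈ S, f v ∈ S) ∧
      (∀ v, f v ≠ v → G.Adj v (f v)) ∧
      S.card ≤ ((S.image fun v => s(v, f v)).filter fun e => ¬ e.IsDiag).card + 1 := by
  obtain ⟨r, hr⟩ := h.1
  have key : ∀ k, 1 ≤ k → k ≤ S.card → ∃ U ⊆ S, U.card = k ∧ ∃ f : Fin n → Fin n,
      (∀ v, v ∉ U → f v = v) ∧ (∀ v ∈ U, f v ∈ U) ∧ (∀ v, f v ≠ v → G.Adj v (f v)) ∧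
      k ≤ ((U.image fun v => s(v, f v)).filter fun e => ¬ e.IsDiag).card + 1 := by
    intro k hk
    induction k, hk using Nat.le_induction with
    | base =>
      intro _
      refine ⟨{r}, by simpa using hr, by simp, id, by simp, by simp, by simp, by simp⟩
    | succ k hk ih =>
      intro hkS
      obtain ⟨U, hUS, hU, f, hf1, hf2, hf3, hf4⟩ := ih (by omega)
      have hne : ∃ b ∈ S, b ∉ U := by
        by_contra hcon
        push Not at hcon
        have := Finset.card_le_card (show S ⊆ U from hcon)
        omega
      obtain ⟨b0, hb0, hb0'⟩ := hne
      obtain ⟨a0, ha0⟩ : U.Nonempty := Finset.card_pos.1 (by omega)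
      obtain ⟨a, haS, b, hbS, ha, hb, hab⟩ := h.2 U ⟨a0, hUS ha0, ha0⟩ ⟨b0, hb0, hb0'⟩
      simp only [Finset.mem_coe] at ha hb haS hbS
      refine ⟨insert b U, Finset.insert_subset hbS hUS, by rw [Finset.card_insert_of_notMem hb, hU],
        Function.update f b a, ?_, ?_, ?_, ?_⟩
      · simp_all
      · grind
      · intro v hv
        by_cases hvb : v = b
        · subst hvb; simpa using hab.symm
        · simp_all
      · have himg : (insert b U).image (fun v => s(v, Function.update f b a v))
            = insert s(b, a) (U.image fun v => s(v, f v)) := by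
          rw [Finset.image_insert, Function.update_self]
          congr 1
          refine Finset.image_congr fun v hv => ?_
          grind
        have hba : b ≠ a := fun h => hb (h ▸ ha)
        rw [himg, Finset.filter_insert, if_pos (by simpa using hba), Finset.card_insert_of_notMem]
        · omega
        · intro hmem
          rw [Finset.mem_filter, Finset.mem_image] at hmem
          obtain ⟨⟨v, hv, hve⟩, -⟩ := hmem
          rw [Sym2.eq_iff] at hve
          rcases hve with ⟨rfl, -⟩ | ⟨-, h2⟩
          · exact hb hv
          · exact hb (h2 ▸ hf2 v hv)
  obtain ⟨U, hUS, hU, f, hf⟩ := key S.card (Finset.card_pos.2 ⟨r, hr⟩) le_rfl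
  obtain rfl := Finset.eq_of_subset_of_card_le hUS hU.ge
  exact ⟨f, hf⟩

/-- A small family of trees spanning every connected set with vertex set `S`. -/
lemma exists_trees (S : Finset (Fin n)) :
    ∃ F : Finset (Finset (Sym2 (Fin n))), F.card ≤ S.card ^ S.card ∧
      (∀ T ∈ F, T ⊆ inE S ∧ T.card = S.card - 1) ∧
      ∀ A ⊆ edges n, Cn (Gr A) S → ∃ T ∈ F, T ⊆ A := by
  classical
  let Φ : Finset (Fin n → Fin n) := Fintype.piFinset fun v => if v ∈ S then S else {v}
  let τ : (Fin n → Fin n) → Finset (Sym2 (Fin n)) := fun f =>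
    (S.image fun v => s(v, f v)).filter fun e => ¬ e.IsDiag
  let Ts : Finset (Finset (Sym2 (Fin n))) :=
    (Φ.image fun f => if h : S.card - 1 ≤ (τ f).card then
      (Finset.exists_subset_card_eq h).choose else ∅)
  refine ⟨Ts.filter fun T => T ⊆ inE S ∧ T.card = S.card - 1, ?_, ?_, ?_⟩
  · refine (Finset.card_filter_le _ _).trans (Finset.card_image_le.trans ?_)
    rw [Fintype.card_piFinset]
    have : ∀ v, (if v ∈ S then S else {v}).card = if v ∈ S then S.card else 1 := by
      intro v; split <;> simp
    simp only [this]
    rw [Finset.prod_ite]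
    simp
  · intro T hT
    exact (Finset.mem_filter.1 hT).2
  · intro A hA hC
    obtain ⟨f, hf1, hf2, hf3, hf4⟩ := exists_parent hC
    have hle : S.card - 1 ≤ (τ f).card := by simp only [τ]; omega
    have hsp := (Finset.exists_subset_card_eq hle).choose_spec
    have hτ : ∀ e ∈ τ f, e ∈ inE S ∧ e ∈ A := by
      intro e he
      simp only [τ, Finset.mem_filter, Finset.mem_image] at he
      obtain ⟨⟨v, hv, rfl⟩, hd⟩ := he
      have hne : v ≠ f v := by simpa using hd
      exact ⟨mk_mem_inE.2 ⟨hne, hv, hf2 v hv⟩, (Gr_adj.1 (hf3 v hne.symm)).1⟩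
    refine ⟨(Finset.exists_subset_card_eq hle).choose, ?_, fun e he => (hτ e (hsp.1 he)).2⟩
    refine Finset.mem_filter.2 ⟨Finset.mem_image.2 ⟨f, ?_, by rw [dif_pos hle]⟩,
      fun e he => (hτ e (hsp.1 he)).1, hsp.2⟩
    grind

lemma pow_self_le (s : ℕ) : (s : ℝ) ^ s ≤ Real.exp s * s.factorial := by
  have := Real.pow_div_factorial_le_exp (s : ℝ) (by positivity) s
  rwa [div_le_iff₀ (by positivity)] at this

lemma choose_mul_pow_le (n s : ℕ) : (n.choose s : ℝ) * (s : ℝ) ^ s ≤ (Real.exp 1 * n) ^ s := by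
  have h1 : (n.choose s : ℝ) ≤ (n : ℝ) ^ s / s.factorial := Nat.choose_le_pow_div s n
  calc (n.choose s : ℝ) * (s : ℝ) ^ s ≤ ((n : ℝ) ^ s / s.factorial) * (Real.exp s * s.factorial) :=
        mul_le_mul h1 (pow_self_le s) (by positivity) (by positivity)
    _ = (Real.exp 1 * n) ^ s := by
        rw [mul_pow, ← Real.exp_nat_mul, mul_one]
        field_simp

/-- Union bound over connected sets of a given size. -/
lemma Pg_exists_cn_le (h0 : 0 ≤ p) (h1 : p ≤ 1) {s : ℕ} {M : ℝ} (hM : 0 ≤ M)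
    (Q : SimpleGraph (Fin n) → Set (Fin n) → Prop)
    (hQ : ∀ S : Finset (Fin n), S.card = s → ∀ T ⊆ inE S, T.card = s - 1 →
      Exs p (edges n) (fun A => if T ⊆ A then ind (Q (Gr A) S) else 0) ≤ M) :
    Pg n p (fun G => ∃ S : Set (Fin n), Cn G S ∧ S.ncard = s ∧ Q G S)
      ≤ (Real.exp 1 * n) ^ s * M := by
  classical
  choose F hF1 hF2 hF3 using exists_trees (n := n)
  have step : Pg n p (fun G => ∃ S : Set (Fin n), Cn G S ∧ S.ncard = s ∧ Q G S)
      ≤ ∑ S ∈ Finset.powersetCard s (Finset.univ : Finset (Fin n)), ∑ T ∈ F S,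
        Exs p (edges n) (fun A => if T ⊆ A then ind (Q (Gr A) S) else 0) := by
    simp only [← Exs_sum]
    have hnn : ∀ (S : Finset (Fin n)) (T A : Finset (Sym2 (Fin n))),
        0 ≤ (if T ⊆ A then ind (Q (Gr A) S) else 0) := by
      intro S T A; split
      · exact ind_nonneg _
      · exact le_rfl
    unfold Pg Eg
    refine Exs_mono h0 h1 fun A hA => ind_le_of
      (Finset.sum_nonneg fun _ _ => Finset.sum_nonneg fun _ _ => hnn _ _ _) ?_
    rintro ⟨S, hS, hSs, hSQ⟩
    have hS' : ((S.toFinset : Finset (Fin n)) : Set (Fin n)) = S := by simp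
    obtain ⟨T, hT, hTA⟩ := hF3 S.toFinset A hA (by rw [hS']; exact hS)
    refine le_trans ?_ (Finset.single_le_sum (fun S _ => Finset.sum_nonneg fun _ _ => hnn S _ _)
      (show S.toFinset ∈ _ from ?_))
    · refine le_trans ?_ (Finset.single_le_sum (fun T _ => hnn S.toFinset T A) hT)
      rw [if_pos hTA, ind_pos]
      rw [hS']; exact hSQ
    · rw [Finset.mem_powersetCard]
      exact ⟨Finset.subset_univ _, by rw [← hSs, Set.ncard_eq_toFinset_card']⟩
  refine step.trans ?_
  calc _ ≤ ∑ S ∈ Finset.powersetCard s (Finset.univ : Finset (Fin n)), (s : ℝ) ^ s * M := by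
        refine Finset.sum_le_sum fun S hS => ?_
        have hSs := (Finset.mem_powersetCard.1 hS).2
        refine (Finset.sum_le_sum (g := fun _ => M) fun T hT => hQ S hSs T (hF2 S T hT).1
          (by rw [(hF2 S T hT).2, hSs])).trans ?_
        rw [Finset.sum_const, nsmul_eq_mul]
        refine mul_le_mul_of_nonneg_right ?_ hM
        have := hF1 S
        rw [hSs] at this
        exact_mod_cast this
    _ = (n.choose s : ℝ) * (s : ℝ) ^ s * M := by
        rw [Finset.sum_const, Finset.card_powersetCard, Finset.card_univ, Fintype.card_fin,
          nsmul_eq_mul, mul_assoc]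
    _ ≤ _ := mul_le_mul_of_nonneg_right (choose_mul_pow_le n s) hM

/-- Connected sets spanning many edges are unlikely. -/
lemma Pg_dense_le (h0 : 0 ≤ p) (h1 : p ≤ 1) (s r : ℕ) :
    Pg n p (fun G => ∃ S : Set (Fin n), Cn G S ∧ S.ncard = s ∧ s - 1 + r ≤ ein G S)
      ≤ (Real.exp 1 * n) ^ s * ((s : ℝ) ^ (2 * r) * p ^ (s - 1 + r)) := by
  classical
  refine Pg_exists_cn_le h0 h1 (by positivity) (fun G S => s - 1 + r ≤ ein G S) ?_
  intro S hS T hT hTs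
  have hsub : inE S ⊆ edges n := Finset.filter_subset _ _
  calc _ ≤ Exs p (edges n) (fun A => ∑ U ∈ (inE S \ T).powersetCard r,
          if T ∪ U ⊆ A then (1 : ℝ) else 0) := by
        refine Exs_mono h0 h1 fun A hA => ?_
        have hnn : ∀ U : Finset (Sym2 (Fin n)), 0 ≤ (if T ∪ U ⊆ A then (1 : ℝ) else 0) := by
          intro U; split <;> norm_num
        split
        · rename_i hTA
          refine ind_le_of (Finset.sum_nonneg fun _ _ => hnn _) fun hein => ?_
          have he : eset (Gr A) S = ((A ∩ inE S : Finset _) : Set (Sym2 (Fin n))) := by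
            ext e
            induction e using Sym2.ind with
            | _ u v =>
              rw [mk_mem_eset, Gr_adj]
              simp only [Finset.coe_inter, Set.mem_inter_iff, Finset.mem_coe, mk_mem_inE]
              tauto
          have hc : r ≤ ((A ∩ inE S) \ T).card := by
            rw [Finset.card_sdiff_of_subset (Finset.subset_inter hTA hT), hTs]
            simp only [ein, he, Set.ncard_coe_finset] at hein
            omega
          obtain ⟨U, hU, hUr⟩ := Finset.exists_subset_card_eq hc
          have hUA : U ⊆ A := fun e he => (Finset.mem_inter.1 (Finset.mem_sdiff.1 (hU he)).1).1
          have hUm : U ∈ (inE S \ T).powersetCard r := by grind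
          refine le_trans ?_ (Finset.single_le_sum (fun U _ => hnn U) hUm)
          rw [if_pos (Finset.union_subset hTA hUA)]
        · exact Finset.sum_nonneg fun _ _ => hnn _
    _ = ∑ U ∈ (inE S \ T).powersetCard r, p ^ (s - 1 + r) := by
        rw [Exs_sum]
        refine Finset.sum_congr rfl fun U hU => ?_
        obtain ⟨hU, hUr⟩ := Finset.mem_powersetCard.1 hU
        rw [Exs_superset_one (Finset.union_subset (hT.trans hsub)
            (hU.trans (Finset.sdiff_subset.trans hsub))), Finset.card_union_of_disjoint
            (Finset.disjoint_of_subset_right hU Finset.disjoint_sdiff), hTs, hUr]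
    _ ≤ (s : ℝ) ^ (2 * r) * p ^ (s - 1 + r) := by
        rw [Finset.sum_const, Finset.card_powersetCard, nsmul_eq_mul]
        refine mul_le_mul_of_nonneg_right ?_ (by positivity)
        have h2 : (inE S \ T).card.choose r ≤ (s ^ 2) ^ r := by
          refine (Nat.choose_le_pow _ _).trans (Nat.pow_le_pow_left ?_ r)
          refine (Finset.card_le_card Finset.sdiff_subset).trans ?_
          rw [← hS]; exact card_inE_le S
        rw [pow_mul]
        exact_mod_cast h2

/-- Connected sets with few outgoing edges are unlikely. -/
lemma Pg_closed_le (h0 : 0 ≤ p) (h1 : p ≤ 1) (s t : ℕ) {z : ℝ} (hz : 0 < z) (hz1 : z ≤ 1) :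
    Pg n p (fun G => ∃ S : Set (Fin n), Cn G S ∧ S.ncard = s ∧ ebt G S Sᶜ ≤ t)
      ≤ (Real.exp 1 * n) ^ s *
        (p ^ (s - 1) * ((z⁻¹) ^ t * Real.exp (-(p * (1 - z)) * (s * (n - s : ℕ) : ℕ)))) := by
  classical
  refine Pg_exists_cn_le h0 h1 (by positivity) (fun G S => ebt G S Sᶜ ≤ t) ?_
  intro S hS T hT hTs
  have hsub : inE S ⊆ edges n := Finset.filter_subset _ _
  have hq : 0 ≤ p * z + (1 - p) := by
    have := mul_nonneg h0 hz.le
    linarith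
  calc _ ≤ Exs p (edges n) (fun A => if T ⊆ A then
          (z⁻¹) ^ t * ∏ e ∈ bdE S, (if e ∈ A then z else 1) else 0) := by
        refine Exs_mono h0 h1 fun A hA => ?_
        split
        · have hpr : ∏ e ∈ bdE S, (if e ∈ A then z else 1) = z ^ (bdE S ∩ A).card := by simp_all
          rw [hpr]
          refine ind_le_of (by positivity) fun hebt => ?_
          have hle : (bdE S ∩ A).card ≤ t := by
            refine le_trans ?_ hebt
            rw [ebt, Set.ncard_eq_toFinset_card']
            refine le_trans (Finset.card_le_card (t := Finset.image (fun r => s(r.1, r.2)) _) ?_)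
              Finset.card_image_le
            intro e he
            rw [Finset.mem_inter, bdE, Finset.mem_image] at he
            obtain ⟨⟨r, hr, rfl⟩, hrA⟩ := he
            rw [Finset.mem_product, Finset.mem_compl] at hr
            refine Finset.mem_image.2 ⟨r, ?_, rfl⟩
            simp only [Set.mem_toFinset, Set.mem_ofPred_eq, Set.mem_compl_iff, Finset.mem_coe]
            exact ⟨hr.1, hr.2, (Gr_adj' hA).2 hrA⟩
          rw [inv_pow, ← div_eq_inv_mul, one_le_div (by positivity)]
          exact pow_le_pow_of_le_one hz.le hz1 hle
        · exact le_rfl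
    _ = p ^ (s - 1) * ((z⁻¹) ^ t * (p * z + (1 - p)) ^ (s * (n - s))) := by
        rw [Exs_superset (hT.trans hsub), hTs, Exs_const_mul]
        congr 2
        have hdisj : Disjoint (bdE S) T :=
          (Finset.disjoint_of_subset_left hT (disjoint_inE_bdE S)).symm
        rw [Exs_marginal (S := bdE S) (T := edges n \ T)
          (Finset.subset_sdiff.2 ⟨bdE_subset S, hdisj⟩)]
        · have := Exs_prod (p := p) (S := bdE S) (fun _ => 1) (fun _ => z)
          rw [Finset.prod_const, card_bdE, hS, mul_one] at this
          rw [← this]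
          refine Exs_congr fun A _ => Finset.prod_congr rfl fun e he => ?_
          have heT : e ∉ T := Finset.disjoint_left.1 hdisj he
          simp [heT]
        · simp_all
    _ ≤ _ := by
        refine mul_le_mul_of_nonneg_left (mul_le_mul_of_nonneg_left ?_ (by positivity))
          (by positivity)
        rw [mul_comm _ ((s * (n - s) : ℕ) : ℝ), Real.exp_nat_mul]
        refine pow_le_pow_left₀ hq ?_ _
        have := Real.add_one_le_exp (-(p * (1 - z)))
        linarith

/-- Vertices of large degree are unlikely. -/
lemma Pg_deg_le (h0 : 0 ≤ p) (h1 : p ≤ 1) (l : ℕ) :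
    Pg n p (fun G => ∃ v, l < dg G v) ≤ n * ((n * p) ^ (l + 1) / (l + 1).factorial) := by
  classical
  have step : Pg n p (fun G => ∃ v, l < dg G v) ≤ ∑ r ∈ (Finset.univ : Finset (Fin n)) ×ˢ
      (Finset.univ : Finset (Fin n)).powersetCard (l + 1),
      Pg n p (fun G => ∀ w ∈ r.2, G.Adj r.1 w) := by
    refine Pg_exists_le (κ := Fin n × Finset (Fin n)) h0 h1 _
      (fun (r : Fin n × Finset (Fin n)) (G : SimpleGraph (Fin n)) => ∀ w ∈ r.2, G.Adj r.1 w) ?_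
    rintro G ⟨v, hv⟩
    rw [dg, Set.ncard_eq_toFinset_card'] at hv
    obtain ⟨U, hU, hUc⟩ := Finset.exists_subset_card_eq (Nat.succ_le_of_lt hv)
    have hm : U ∈ (Finset.univ : Finset (Fin n)).powersetCard (l + 1) :=
      Finset.mem_powersetCard.2 ⟨Finset.subset_univ U, hUc⟩
    refine ⟨(v, U), Finset.mk_mem_product (Finset.mem_univ v) hm, fun w hw => ?_⟩
    simpa using hU hw
  refine step.trans ?_
  calc _ ≤ ∑ r ∈ (Finset.univ : Finset (Fin n)) ×ˢ
      (Finset.univ : Finset (Fin n)).powersetCard (l + 1), p ^ (l + 1) := by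
        refine Finset.sum_le_sum fun r hr => ?_
        have hr2 := (Finset.mem_powersetCard.1 (Finset.mem_product.1 hr).2).2
        by_cases hv : r.1 ∈ r.2
        · refine le_trans (le_of_eq ?_) (by positivity : (0 : ℝ) ≤ p ^ (l + 1))
          unfold Pg Eg
          rw [← Exs_const (p := p) (S := edges n) 0]
          refine Exs_congr fun A _ => ind_neg fun h => ?_
          exact (h _ hv).ne rfl
        · have hinj : ((r.2).image fun w => s(r.1, w)).card = l + 1 := by
            rw [Finset.card_image_of_injective _ fun a b h => Sym2.congr_right.1 h, hr2]
          have hsub : ((r.2).image fun w => s(r.1, w)) ⊆ edges n := by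
            intro e he
            obtain ⟨w, hw, rfl⟩ := Finset.mem_image.1 he
            exact mk_mem_edges.2 fun h => hv (h ▸ hw)
          rw [← hinj, ← Exs_superset_one hsub]
          unfold Pg Eg
          refine Exs_mono h0 h1 fun A _ => ind_le_of (by split <;> norm_num) fun h => ?_
          rw [if_pos]
          intro e he
          obtain ⟨w, hw, rfl⟩ := Finset.mem_image.1 he
          exact (Gr_adj.1 (h w hw)).1
    _ = n * (n.choose (l + 1) * p ^ (l + 1)) := by
        rw [Finset.sum_const, Finset.card_product, Finset.card_powersetCard, Finset.card_univ,
          Fintype.card_fin, nsmul_eq_mul]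
        push_cast; ring
    _ ≤ _ := by
        refine mul_le_mul_of_nonneg_left ?_ (by positivity)
        rw [mul_pow, mul_div_right_comm]
        exact mul_le_mul_of_nonneg_right (Nat.choose_le_pow_div _ _) (by positivity)

end Trees


/-! ### Structural properties holding with high probability -/

lemma tendsto_log_nat : Tendsto (fun n : ℕ => Real.log n) atTop atTop :=
  Real.tendsto_log_atTop.comp tendsto_natCast_atTop_atTop

lemma tendsto_loglog_nat : Tendsto (fun n : ℕ => Real.log (Real.log n)) atTop atTop :=
  Real.tendsto_log_atTop.comp tendsto_log_nat

lemma tendsto_const_div_nat (C : ℝ) : Tendsto (fun n : ℕ => C / (n : ℝ)) atTop (nhds 0) :=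
  tendsto_const_nhds.div_atTop tendsto_natCast_atTop_atTop

lemma Pg_exists_size_le {n : ℕ} {p : ℝ} (h0 : 0 ≤ p) (h1 : p ≤ 1)
    {P : SimpleGraph (Fin n) → Prop} (K : Finset ℕ) (R : ℕ → SimpleGraph (Fin n) → Prop) {b : ℝ}
    (h : ∀ G, P G → ∃ k ∈ K, R k G) (hb : ∀ k ∈ K, Pg n p (R k) ≤ b) :
    Pg n p P ≤ K.card * b := by
  refine (Pg_exists_le h0 h1 K R h).trans ((Finset.sum_le_sum hb).trans ?_)
  rw [Finset.sum_const, nsmul_eq_mul]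

lemma whp_deg {c : ℝ} (hc : 1 < c) {l : ℕ → ℕ}
    (hl : ∀ᶠ n : ℕ in atTop, 4 * Real.log n ≤ l n * Real.log (Real.log n)) :
    Whp c (fun n G => ∀ v, dg G v ≤ l n) := by
  have hc0 : 0 < c := by linarith
  refine Whp.of_bound hc0 (tendsto_const_div_nat 1) ?_
  have e1 : ∀ᶠ y : ℝ in atTop, Real.log y ≤ y / 4 := by
    have := Real.isLittleO_log_id_atTop.bound (show (0 : ℝ) < 1 / 4 by norm_num)
    filter_upwards [this, eventually_ge_atTop 1] with y hy h1
    have h2 : 0 ≤ Real.log y := Real.log_nonneg h1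
    rw [Real.norm_of_nonneg h2, id, Real.norm_of_nonneg (by linarith)] at hy
    linarith
  filter_upwards [hl, eventually_p hc0, tendsto_loglog_nat.eventually e1,
    tendsto_loglog_nat.eventually_ge_atTop (4 * (1 + Real.log c)), eventually_ge_atTop 1,
    tendsto_loglog_nat.eventually_ge_atTop 1, tendsto_log_nat.eventually_ge_atTop 1]
    with n h1 hp h2 h3 h4 h5 h6
  have hn : (0 : ℝ) < n := by exact_mod_cast h4
  refine (Pg_mono hp.1 hp.2 (Q := fun G => ∃ v, l n < dg G v) ?_).trans ((Pg_deg_le hp.1 hp.2 (l n)).trans ?_)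
  · intro G hG; push Not at hG; exact hG
  have hnp : (n : ℝ) * (c / n) = c := by field_simp
  rw [hnp]
  set L := l n + 1 with hL
  set y := Real.log (Real.log n) with hy
  have hL0 : (0 : ℝ) < L := by positivity
  have hly : 4 * Real.log n ≤ L * y := by
    rw [hL]; push_cast; nlinarith
  have hlogL : 3 / 4 * y ≤ Real.log L := by
    have h7 : Real.log n / y ≤ L := by
      rw [div_le_iff₀ (by linarith)]; linarith
    have h8 := Real.log_le_log (by positivity) h7
    rw [Real.log_div (by linarith) (by linarith), ← hy] at h8
    linarith
  have hfac : c ^ L / (L.factorial : ℝ) ≤ Real.exp (-(2 * Real.log n)) := by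
    have h9 := pow_self_le L
    have h10 : c ^ L = Real.exp (L * Real.log c) := by
      rw [mul_comm, Real.exp_mul, Real.exp_log hc0, Real.rpow_natCast]
    have h11 : (L : ℝ) ^ L = Real.exp (L * Real.log L) := by
      rw [mul_comm, Real.exp_mul, Real.exp_log hL0, Real.rpow_natCast]
    rw [div_le_iff₀ (by positivity)]
    have h12 : Real.exp (L * Real.log L - L) ≤ L.factorial := by
      rw [Real.exp_sub, div_le_iff₀ (Real.exp_pos _), ← h11, mul_comm]; exact h9
    refine le_trans ?_ (mul_le_mul_of_nonneg_left h12 (Real.exp_pos _).le)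
    rw [h10, ← Real.exp_add, Real.exp_le_exp]
    have : (L : ℝ) * (y / 2) ≤ L * (Real.log L - 1 - Real.log c) :=
      mul_le_mul_of_nonneg_left (by linarith) hL0.le
    linarith
  refine (mul_le_mul_of_nonneg_left hfac hn.le).trans (le_of_eq ?_)
  have : Real.exp (-(2 * Real.log n)) = ((n : ℝ) ^ 2)⁻¹ := by
    rw [Real.exp_neg, mul_comm, Real.exp_mul, Real.exp_log hn]; norm_cast
  rw [this]; field_simp

/-- The first moment bound for dense connected sets when `p = c / n`. -/
lemma Pg_dense_le' {n : ℕ} {c : ℝ} (hc : 0 < c) (hn : 0 < n) {s : ℕ} (hs : 1 ≤ s) (r : ℕ)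
    (hp : c / n ≤ 1) :
    Pg n (c / n) (fun G => ∃ S : Set (Fin n), Cn G S ∧ S.ncard = s ∧ s - 1 + r ≤ ein G S)
      ≤ (Real.exp 1 * c) ^ s * (n / c) * ((s : ℝ) ^ 2 * c / n) ^ r := by
  refine (Pg_dense_le (by positivity) hp s r).trans (le_of_eq ?_)
  have hn' : (0 : ℝ) < n := by exact_mod_cast hn
  obtain ⟨s, rfl⟩ := Nat.exists_eq_add_of_le' hs
  simp only [Nat.add_sub_cancel]
  rw [pow_mul, pow_add (c / n) s r, mul_pow, mul_pow, div_pow, div_pow, mul_div_assoc _ c, mul_pow,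
    div_pow, pow_succ (n : ℝ), pow_succ c]
  field_simp

lemma whp_unicyclic {c : ℝ} (hc : 1 < c) {u : ℕ → ℕ}
    (hu : ∀ᶠ n : ℕ in atTop, (u n : ℝ) * (1 + Real.log c) ≤ Real.log n / 4)
    (hu' : ∀ᶠ n : ℕ in atTop, (u n) ^ 10 ≤ n) :
    Whp c (fun n G => ∀ S, Cn G S → S.ncard ≤ u n → ein G S ≤ S.ncard) := by
  have hc0 : 0 < c := by linarith
  have ht : Tendsto (fun n : ℕ => c * (n : ℝ) ^ (-(1 / 4 : ℝ))) atTop (nhds 0) := by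
    have := ((tendsto_rpow_neg_atTop (show (0 : ℝ) < 1 / 4 by norm_num)).comp
      (tendsto_natCast_atTop_atTop (R := ℝ))).const_mul c
    simpa using this
  refine Whp.of_bound hc0 ht ?_
  filter_upwards [hu, hu', eventually_p hc0, eventually_ge_atTop 1] with n h1 h2 hp h4
  have hn : (0 : ℝ) < n := by exact_mod_cast h4
  have hn1 : (1 : ℝ) ≤ n := by exact_mod_cast h4
  have hu4 : (u n : ℝ) ^ 5 ≤ (n : ℝ) ^ (1 / 2 : ℝ) := by
    rw [← Real.sqrt_eq_rpow]
    refine Real.le_sqrt_of_sq_le ?_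
    rw [← pow_mul]; exact_mod_cast h2
  refine (Pg_exists_size_le hp.1 hp.2 (Finset.Icc 1 (u n)) (fun s G => ∃ S : Set (Fin n),
    Cn G S ∧ S.ncard = s ∧ s - 1 + 2 ≤ ein G S) (b := c * (n : ℝ) ^ (-(3 / 4) : ℝ) * (u n) ^ 4) ?_ ?_).trans ?_
  · intro G hG
    push Not at hG
    obtain ⟨S, hS, hSu, he⟩ := hG
    have hpos := (Set.ncard_pos (Set.toFinite S)).2 hS.1
    grind
  · intro s hs
    rw [Finset.mem_Icc] at hs
    refine (Pg_dense_le' hc0 h4 hs.1 2 hp.2).trans ?_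
    have hsu : (s : ℝ) ≤ u n := by exact_mod_cast hs.2
    have h5 : (Real.exp 1 * c) ^ s ≤ (n : ℝ) ^ (1 / 4 : ℝ) := by
      have : Real.exp 1 * c = Real.exp (1 + Real.log c) := by
        rw [Real.exp_add, Real.exp_log hc0]
      rw [this, ← Real.exp_nat_mul, Real.rpow_def_of_pos hn, Real.exp_le_exp]
      have := Real.log_pos hc
      nlinarith
    have h6 : (n / c) * ((s : ℝ) ^ 2 * c / n) ^ 2 = c * (n : ℝ) ^ (-1 : ℝ) * s ^ 4 := by
      rw [Real.rpow_neg_one]; field_simp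
    rw [mul_assoc, h6]
    have h7 : (n : ℝ) ^ (-(3 / 4) : ℝ) = (n : ℝ) ^ (1 / 4 : ℝ) * (n : ℝ) ^ (-1 : ℝ) := by
      rw [← Real.rpow_add hn]; norm_num
    rw [h7]
    calc _ ≤ (n : ℝ) ^ (1 / 4 : ℝ) * (c * (n : ℝ) ^ (-1 : ℝ) * (u n) ^ 4) := by gcongr
      _ = _ := by ring
  · rw [Nat.card_Icc, Nat.add_sub_cancel]
    calc _ = c * (n : ℝ) ^ (-(3 / 4) : ℝ) * (u n : ℝ) ^ 5 := by ring
      _ ≤ c * (n : ℝ) ^ (-(3 / 4) : ℝ) * (n : ℝ) ^ (1 / 2 : ℝ) := by gcongr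
      _ = _ := by rw [mul_assoc, ← Real.rpow_add hn]; norm_num

lemma whp_excess {c : ℝ} (hc : 1 < c) {m u : ℕ → ℕ} {B e₁ : ℕ} (hB : 2 * (B + 3) ≤ e₁)
    (hm : ∀ᶠ n : ℕ in atTop, (Real.exp 1 * c) ^ (m n) ≤ (n : ℝ) ^ B)
    (hm0 : ∀ᶠ n : ℕ in atTop, 0 < m n)
    (hu : ∀ᶠ n : ℕ in atTop, (u n : ℝ) ^ 4 * c ^ 2 ≤ n) (hu' : ∀ᶠ n : ℕ in atTop, u n ≤ n) :
    Whp c (fun n G => ∀ S, Cn G S → S.ncard ≤ u n →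
      ein G S ≤ S.ncard + e₁ * (S.ncard / m n + 1)) := by
  have hc0 : 0 < c := by linarith
  refine Whp.of_bound hc0 (tendsto_const_div_nat 1) ?_
  filter_upwards [hm, hm0, hu, hu', eventually_p hc0, eventually_ge_atTop 1]
    with n h1 hm0 h2 h3 hp h4
  have hn : (0 : ℝ) < n := by exact_mod_cast h4
  have hn1 : (1 : ℝ) ≤ n := by exact_mod_cast h4
  refine (Pg_exists_size_le hp.1 hp.2 (Finset.Icc 1 (u n)) (fun s G => ∃ S : Set (Fin n),
    Cn G S ∧ S.ncard = s ∧ s - 1 + 2 * (1 + (B + 3) * (s / m n + 1)) ≤ ein G S)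
    (b := ((n : ℝ) ^ 2)⁻¹) ?_ ?_).trans ?_
  · intro G hG
    push Not at hG
    obtain ⟨S, hS, hSu, he⟩ := hG
    have hpos := (Set.ncard_pos (Set.toFinite S)).2 hS.1
    refine ⟨S.ncard, Finset.mem_Icc.2 ⟨hpos, hSu⟩, S, hS, rfl, ?_⟩
    have := Nat.mul_le_mul_right (S.ncard / m n + 1) hB
    rw [mul_assoc] at this
    omega
  · intro s hs
    rw [Finset.mem_Icc] at hs
    refine (Pg_dense_le' hc0 h4 hs.1 _ hp.2).trans ?_
    have hsu : (s : ℝ) ≤ u n := by exact_mod_cast hs.2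
    set q := s / m n + 1 with hq
    have hsm : s ≤ m n * q := by
      have := Nat.lt_div_mul_add (a := s) hm0
      rw [hq, mul_add, mul_one, mul_comm]; exact this.le
    have hec : 1 ≤ Real.exp 1 * c := by
      have := Real.add_one_le_exp (1 : ℝ)
      nlinarith
    have h5 : (Real.exp 1 * c) ^ s ≤ (n : ℝ) ^ (B * q) := by
      refine (pow_le_pow_right₀ hec hsm).trans ?_
      rw [pow_mul, pow_mul]
      exact pow_le_pow_left₀ (by positivity) h1 _
    have h6 : ((s : ℝ) ^ 2 * c / n) ^ 2 ≤ (n : ℝ)⁻¹ := by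
      have : (s : ℝ) ^ 4 * c ^ 2 ≤ n := by
        refine le_trans ?_ h2
        gcongr
      rw [div_pow, div_le_iff₀ (by positivity), mul_pow, ← pow_mul]
      calc _ ≤ (n : ℝ) := this
        _ = _ := by field_simp
    rw [pow_mul]
    calc _ ≤ (n : ℝ) ^ (B * q) * (n / 1) * ((n : ℝ)⁻¹) ^ (1 + (B + 3) * q) := by gcongr
      _ = ((n : ℝ) ^ (3 * q))⁻¹ := by
        rw [inv_pow, show 1 + (B + 3) * q = B * q + 1 + 3 * q by ring, pow_add, pow_add]
        field_simp
      _ ≤ _ := by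
        have hq1 : 1 ≤ q := Nat.le_add_left _ _
        gcongr
        omega
  · rw [Nat.card_Icc, Nat.add_sub_cancel]
    calc _ ≤ (n : ℝ) * ((n : ℝ) ^ 2)⁻¹ := by
          gcongr
      _ = _ := by field_simp

/-- Connected sets of logarithmic to linear size have linearly many outgoing edges. -/
lemma whp_expansion {c : ℝ} (hc : 1 < c) : ∃ (ε : ℝ) (g : ℕ) (C : ℝ), 0 < ε ∧ 0 < C ∧
    Whp c (fun n G => ∀ S, Cn G S → C * Real.log n ≤ S.ncard → (S.ncard : ℝ) ≤ ε * n →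
      S.ncard ≤ g * ebt G S Sᶜ) := by
  have hc0 : 0 < c := by linarith
  set δ := c - 1 - Real.log c with hδ
  have hδ0 : 0 < δ := by
    have := Real.log_lt_sub_one_of_pos hc0 hc.ne'
    linarith
  have hδc : δ < c := by
    have := Real.log_pos hc
    linarith
  set z := δ / (8 * c) with hz
  have hz0 : 0 < z := by positivity
  have hz1 : z < 1 / 8 := by
    rw [hz, div_lt_iff₀ (by positivity)]; linarith
  obtain ⟨g, hg⟩ := exists_nat_gt (4 * Real.log z⁻¹ / δ)
  have hlz : 0 < Real.log z⁻¹ := Real.log_pos (by rw [one_lt_inv₀ hz0]; linarith)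
  have hg0 : 0 < g := by
    have : (0 : ℝ) < g := lt_of_le_of_lt (by positivity) hg
    exact_mod_cast this
  refine ⟨z, g, 6 / δ, hz0, by positivity, ?_⟩
  refine Whp.of_bound hc0 (tendsto_const_div_nat (2 / c)) ?_
  filter_upwards [eventually_p hc0, eventually_ge_atTop 1] with n hp h4
  have hn : (0 : ℝ) < n := by exact_mod_cast h4
  have hn1 : (1 : ℝ) ≤ n := by exact_mod_cast h4
  refine (Pg_exists_size_le hp.1 hp.2
    ((Finset.Icc 1 n).filter fun s : ℕ => 6 / δ * Real.log n ≤ s ∧ (s : ℝ) ≤ z * n)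
    (fun s G => ∃ S : Set (Fin n), Cn G S ∧ S.ncard = s ∧ ebt G S Sᶜ ≤ s / g)
    (b := (n / c) * ((n : ℝ) ^ 3)⁻¹) ?_ ?_).trans ?_
  · intro G hG
    push Not at hG
    obtain ⟨S, hS, hSl, hSu, he⟩ := hG
    have hpos := (Set.ncard_pos (Set.toFinite S)).2 hS.1
    have hle : S.ncard ≤ n := by
      have := Set.ncard_le_ncard (Set.subset_univ S)
      simpa [Set.ncard_univ] using this
    refine ⟨S.ncard, Finset.mem_filter.2 ⟨Finset.mem_Icc.2 ⟨hpos, hle⟩, hSl, hSu⟩, S, hS, rfl, ?_⟩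
    rw [Nat.le_div_iff_mul_le hg0, mul_comm]; exact he.le
  · intro s hs
    rw [Finset.mem_filter, Finset.mem_Icc] at hs
    obtain ⟨⟨hs1, hsn⟩, hsl, hsu⟩ := hs
    refine (Pg_closed_le hp.1 hp.2 s (s / g) hz0 (by linarith)).trans ?_
    have hcast : ((s * (n - s) : ℕ) : ℝ) = s * (n - s) := by
      push_cast [Nat.cast_sub hsn]; ring
    have e1 : (Real.exp 1 * n) ^ s * (c / n) ^ (s - 1) = (n / c) * Real.exp (s * (1 + Real.log c)) := by
      obtain ⟨s, rfl⟩ := Nat.exists_eq_add_of_le' hs1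
      rw [Nat.add_sub_cancel, Real.exp_nat_mul, Real.exp_add, Real.exp_log hc0, mul_pow, mul_pow,
        div_pow, pow_succ (n : ℝ), pow_succ c]
      field_simp
    have e2 : (z⁻¹) ^ (s / g) ≤ Real.exp (s * (δ / 4)) := by
      have : (z⁻¹) ^ (s / g) = Real.exp ((s / g : ℕ) * Real.log z⁻¹) := by
        rw [Real.exp_nat_mul, Real.exp_log (by positivity)]
      rw [this, Real.exp_le_exp]
      have h5 : ((s / g : ℕ) : ℝ) ≤ s / g := Nat.cast_div_le
      have h6 : Real.log z⁻¹ ≤ g * (δ / 4) := by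
        rw [div_lt_iff₀ hδ0] at hg; linarith
      have hg' : (0 : ℝ) < g := by exact_mod_cast hg0
      calc _ ≤ (s / g : ℝ) * (g * (δ / 4)) := by gcongr
        _ = _ := by field_simp
    have e3 : Real.exp (-(c / n * (1 - z)) * ((s * (n - s) : ℕ) : ℝ)) ≤ Real.exp (s * (δ / 4 - c)) := by
      rw [Real.exp_le_exp, hcast]
      have h7 : c * (1 - z) * (1 - z) ≥ c - δ / 4 := by
        have : c * z = δ / 8 := by rw [hz]; field_simp
        nlinarith [mul_pos hc0 (sq_pos_of_pos hz0)]
      have h8 : (n : ℝ) - s ≥ n * (1 - z) := by linarith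
      have h9 : c / n * (1 - z) * (s * (n - s)) ≥ s * (c * (1 - z) * (1 - z)) := by
        calc c / n * (1 - z) * (s * (n - s)) ≥ c / n * (1 - z) * (s * (n * (1 - z))) := by
              have : 0 ≤ 1 - z := by linarith
              gcongr
          _ = _ := by field_simp
      have hs0 : (0 : ℝ) ≤ s := by positivity
      nlinarith
    calc _ = (Real.exp 1 * n) ^ s * (c / n) ^ (s - 1) * ((z⁻¹) ^ (s / g) *
          Real.exp (-(c / n * (1 - z)) * ((s * (n - s) : ℕ) : ℝ))) := by ring
      _ ≤ (n / c) * Real.exp (s * (1 + Real.log c)) * (Real.exp (s * (δ / 4)) *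
          Real.exp (s * (δ / 4 - c))) := by rw [e1]; gcongr
      _ = (n / c) * Real.exp (-(s * (δ / 2))) := by
          rw [mul_assoc, ← Real.exp_add, ← Real.exp_add]
          congr 2
          rw [hδ]; ring
      _ ≤ _ := by
          gcongr
          rw [← Real.exp_log hn, ← Real.exp_nat_mul, ← Real.exp_neg, Real.exp_le_exp]
          have : 6 / δ * Real.log n * (δ / 2) = 3 * Real.log n := by field_simp; ring
          push_cast
          nlinarith
  · have hcard : (((Finset.Icc 1 n).filter fun s : ℕ => 6 / δ * Real.log n ≤ s ∧
        (s : ℝ) ≤ z * n).card : ℝ) ≤ n := by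
      have := (Finset.card_filter_le (Finset.Icc 1 n) fun s : ℕ => 6 / δ * Real.log n ≤ s ∧
        (s : ℝ) ≤ z * n)
      simp_all
    calc _ ≤ (n : ℝ) * ((n / c) * ((n : ℝ) ^ 3)⁻¹) := by gcongr
      _ = 1 / c / n := by field_simp
      _ ≤ _ := by gcongr; norm_num


/-! ### Sums over sequences of vertices -/

/-- The sequence `v, y 0, y 1, …`. -/
def scons {V : Type} (v : V) (y : ℕ → V) : ℕ → V := fun i => Nat.casesOn i v y

@[simp] lemma scons_zero {V : Type} (v : V) (y : ℕ → V) : scons v y 0 = v := rfl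
@[simp] lemma scons_succ {V : Type} (v : V) (y : ℕ → V) (i : ℕ) : scons v y (i + 1) = y i := rfl

lemma scons_shift {V : Type} (y : ℕ → V) : scons (y 0) (fun i => y (i + 1)) = y := by
  funext i; cases i <;> rfl

/-- Sum of `F` over the sequences of length `r + 1` starting at `v`. -/
noncomputable def sumFrom {V : Type} [Fintype V] : ℕ → V → ((ℕ → V) → ℝ) → ℝ
  | 0, v, F => F fun _ => v
  | r + 1, v, F => ∑ z, sumFrom r z fun y => F (scons v y)

/-- Sum of `F` over the sequences of length `r + 1`. -/
noncomputable def sumSeq {V : Type} [Fintype V] (r : ℕ) (F : (ℕ → V) → ℝ) : ℝ :=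
  ∑ v, sumFrom r v F

section Seq

variable {V : Type} [Fintype V]

lemma sumFrom_mono {r : ℕ} {v : V} {F F' : (ℕ → V) → ℝ} (h : ∀ y, y 0 = v → F y ≤ F' y) :
    sumFrom r v F ≤ sumFrom r v F' := by
  induction r generalizing v F F' with
  | zero => exact h _ rfl
  | succ r ih => exact Finset.sum_le_sum fun z _ => ih fun y _ => h _ rfl

lemma sumSeq_mono {r : ℕ} {F F' : (ℕ → V) → ℝ} (h : ∀ y, F y ≤ F' y) :
    sumSeq r F ≤ sumSeq r F' := Finset.sum_le_sum fun _ _ => sumFrom_mono fun y _ => h y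

lemma sumFrom_const_mul {r : ℕ} {v : V} {F : (ℕ → V) → ℝ} (a : ℝ) :
    sumFrom r v (fun y => a * F y) = a * sumFrom r v F := by
  induction r generalizing v F with
  | zero => rfl
  | succ r ih => simp only [sumFrom, ih, Finset.mul_sum]

lemma sumSeq_const_mul {r : ℕ} {F : (ℕ → V) → ℝ} (a : ℝ) :
    sumSeq r (fun y => a * F y) = a * sumSeq r F := by
  simp only [sumSeq, sumFrom_const_mul, Finset.mul_sum]

lemma sumFrom_const {r : ℕ} {v : V} (a : ℝ) :
    sumFrom r v (fun _ => a) = (Fintype.card V : ℝ) ^ r * a := by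
  induction r generalizing v with
  | zero => simp [sumFrom]
  | succ r ih =>
    simp only [sumFrom, ih, Finset.sum_const, Finset.card_univ, nsmul_eq_mul]
    ring

lemma sumSeq_const {r : ℕ} (a : ℝ) :
    sumSeq r (fun _ : ℕ → V => a) = (Fintype.card V : ℝ) ^ (r + 1) * a := by
  simp only [sumSeq, sumFrom_const, Finset.sum_const, Finset.card_univ, nsmul_eq_mul]
  ring

/-- Weight of a sequence that does not backtrack, the step before the first one coming from `u`. -/
noncomputable def seqWt [DecidableEq V] (s : V → V → ℝ) (t : V → ℝ) : ℕ → V → (ℕ → V) → ℝ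
  | 0, _, y => t (y 0)
  | r + 1, u, y => (if y 1 ≠ u then s (y 0) (y 1) else 0) * seqWt s t r (y 0) fun i => y (i + 1)

/-- Total weight of the sequences of `r` steps from `v`, the previous vertex being `u`. -/
noncomputable def walkSum [DecidableEq V] (s : V → V → ℝ) (t : V → ℝ) : ℕ → V → V → ℝ
  | 0, _, v => t v
  | r + 1, u, v => ∑ z, (if z ≠ u then s v z else 0) * walkSum s t r v z

variable [DecidableEq V] {s : V → V → ℝ} {t t' : V → ℝ}

lemma sumFrom_seqWt (r : ℕ) (u v : V) : sumFrom r v (seqWt s t r u) = walkSum s t r u v := by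
  induction r generalizing u v with
  | zero => rfl
  | succ r ih =>
    simp only [sumFrom, walkSum]
    refine Finset.sum_congr rfl fun z _ => ?_
    rw [← ih, ← sumFrom_const_mul]
    refine le_antisymm (sumFrom_mono fun y hy => ?_) (sumFrom_mono fun y hy => ?_) <;>
    · simp only [seqWt, scons_zero, scons_succ, ← hy]
      exact le_rfl

omit [Fintype V] in
lemma seqWt_eq (r : ℕ) (u : V) (y : ℕ → V) (hu : 0 < r → y 1 ≠ u)
    (hy : ∀ i, i + 2 ≤ r → y (i + 2) ≠ y i) :
    seqWt s t r u y = (∏ i ∈ Finset.range r, s (y i) (y (i + 1))) * t (y r) := by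
  induction r generalizing u y with
  | zero => simp [seqWt]
  | succ r ih =>
    rw [seqWt, if_pos (hu (by omega)), ih _ _ (fun hr => hy 0 (by omega))
      (fun i hi => hy (i + 1) (by omega)), Finset.prod_range_succ']
    ring

lemma walkSum_nonneg (hs : ∀ v z, 0 ≤ s v z) (ht : ∀ v, 0 ≤ t v) (r : ℕ) (u v : V) :
    0 ≤ walkSum s t r u v := by
  induction r generalizing u v with
  | zero => exact ht v
  | succ r ih =>
    refine Finset.sum_nonneg fun z _ => mul_nonneg ?_ (ih _ _)
    split
    · exact hs _ _
    · exact le_rfl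

lemma walkSum_mono (hs : ∀ v z, 0 ≤ s v z) (h : ∀ v, t v ≤ t' v) (r : ℕ) (u v : V) :
    walkSum s t r u v ≤ walkSum s t' r u v := by
  induction r generalizing u v with
  | zero => exact h v
  | succ r ih =>
    refine Finset.sum_le_sum fun z _ => mul_le_mul_of_nonneg_left (ih _ _) ?_
    split
    · exact hs _ _
    · exact le_rfl

end Seq

lemma Pg_exists_seq_le {n : ℕ} {p : ℝ} (h0 : 0 ≤ p) (h1 : p ≤ 1) (r : ℕ)
    {P : SimpleGraph (Fin n) → Prop} (R : (ℕ → Fin n) → SimpleGraph (Fin n) → Prop)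
    (hR : ∀ x y G, (∀ i ≤ r, x i = y i) → R x G → R y G) (h : ∀ G, P G → ∃ x, R x G) :
    Pg n p P ≤ sumSeq r (fun x => Pg n p (R x)) := by
  have key : ∀ r (R : (ℕ → Fin n) → SimpleGraph (Fin n) → Prop) (v : Fin n),
      (∀ x y G, (∀ i ≤ r, x i = y i) → R x G → R y G) →
      Pg n p (fun G => ∃ x, x 0 = v ∧ R x G) ≤ sumFrom r v (fun x => Pg n p (R x)) := by
    intro r
    induction r with
    | zero =>
      intro R v hR
      refine Pg_mono h0 h1 ?_
      grind
    | succ r ih =>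
      intro R v hR
      refine (Pg_exists_le h0 h1 Finset.univ
        (fun z G => ∃ y, y 0 = z ∧ R (scons v y) G) ?_).trans (Finset.sum_le_sum fun z _ => ?_)
      · rintro G ⟨x, rfl, hx⟩
        exact ⟨x 1, Finset.mem_univ _, fun i => x (i + 1), rfl, by rwa [scons_shift]⟩
      · refine ih (fun y => R (scons v y)) z fun x y G hxy => hR _ _ G fun i hi => ?_
        cases i with
        | zero => rfl
        | succ i => exact hxy i (by omega)
  refine (Pg_exists_le h0 h1 Finset.univ (fun v G => ∃ x, x 0 = v ∧ R x G) ?_).trans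
    (Finset.sum_le_sum fun v _ => key r R v hR)
  simp_all

/-! ### Weights relative to a fixed path -/

section PathWeights

variable {V : Type} [Fintype V] [DecidableEq V]

/-- `u v` is an edge of the path `x 0, …, x w`. -/
def PEdge (x : ℕ → V) (w : ℕ) (u v : V) : Prop :=
  ∃ i < w, (u = x i ∧ v = x (i + 1)) ∨ (u = x (i + 1) ∧ v = x i)

/-- `v` is a vertex of the path `x 0, …, x w`. -/
def PVert (x : ℕ → V) (w : ℕ) (v : V) : Prop := ∃ i ≤ w, v = x i

open Classical in
/-- Weight of a step relative to a path. -/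
noncomputable def stepWt (x : ℕ → V) (w : ℕ) (p b : ℝ) (v z : V) : ℝ :=
  (if PEdge x w v z then 1 else p) * (if PVert x w z then 1 else b)

variable {x : ℕ → V} {w : ℕ} {p b : ℝ}

omit [Fintype V] [DecidableEq V] in
lemma PEdge.right {u v : V} (h : PEdge x w u v) : PVert x w v := by
  obtain ⟨i, hi, h | h⟩ := h
  · exact ⟨i + 1, by omega, h.2⟩
  · exact ⟨i, by omega, h.2⟩

omit [Fintype V] [DecidableEq V] in
lemma PEdge.symm {u v : V} (h : PEdge x w u v) : PEdge x w v u := by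
  obtain ⟨i, hi, h | h⟩ := h
  · exact ⟨i, hi, Or.inr ⟨h.2, h.1⟩⟩
  · exact ⟨i, hi, Or.inl ⟨h.2, h.1⟩⟩

omit [Fintype V] [DecidableEq V] in
lemma stepWt_nonneg (hp : 0 ≤ p) (hb : 0 ≤ b) (v z : V) : 0 ≤ stepWt x w p b v z := by
  unfold stepWt
  positivity

open Classical in
lemma card_PVert_le (x : ℕ → V) (w : ℕ) : (Finset.univ.filter (PVert x w)).card ≤ w + 1 := by
  have : Finset.univ.filter (PVert x w) ⊆ (Finset.range (w + 1)).image x := by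
    intro v hv
    obtain ⟨i, hi, rfl⟩ := (Finset.mem_filter.1 hv).2
    grind
  exact (Finset.card_le_card this).trans (Finset.card_image_le.trans (by simp))

open Classical in
lemma card_PEdge_le (hx : Set.InjOn x (Set.Iic w)) (v : V) :
    (Finset.univ.filter (PEdge x w v)).card ≤ 2 := by
  by_cases hv : PVert x w v
  · obtain ⟨j, hj, rfl⟩ := hv
    have : Finset.univ.filter (PEdge x w (x j)) ⊆ {x (j + 1), x (j - 1)} := by
      intro z hz
      obtain ⟨i, hi, ⟨h1, rfl⟩ | ⟨h1, rfl⟩⟩ := (Finset.mem_filter.1 hz).2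
      · have := hx (Set.mem_Iic.2 hj) (Set.mem_Iic.2 (by omega)) h1
        subst this; simp
      · have := hx (Set.mem_Iic.2 hj) (Set.mem_Iic.2 (by omega)) h1
        subst this; simp
    exact (Finset.card_le_card this).trans Finset.card_le_two
  · rw [Finset.filter_false_of_mem]
    · simp
    · intro z _ h
      exact hv h.symm.right

open Classical in
lemma walkSum_succ_le (hp : 0 ≤ p) (hb : 0 ≤ b) {t : V → ℝ} (ht : ∀ v, 0 ≤ t v) {r : ℕ} {u v : V}
    {O A F : ℝ} (hnb : Fintype.card V * (p * b) ≤ 1)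
    (hO0 : 0 ≤ O) (hA0 : 0 ≤ A)
    (hO : ∀ z, ¬ PVert x w z → walkSum (stepWt x w p b) t r v z ≤ O)
    (hA : ∀ z, PVert x w z → walkSum (stepWt x w p b) t r v z ≤ A)
    (hF : ∀ z, PEdge x w v z → walkSum (stepWt x w p b) t r v z ≤ F) :
    walkSum (stepWt x w p b) t (r + 1) u v ≤ O + (w + 1) * p * A +
      (Finset.univ.filter fun z => PEdge x w v z ∧ z ≠ u).card * F := by
  have hs := stepWt_nonneg (x := x) (w := w) hp hb
  have hT := walkSum_nonneg (t := t) hs ht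
  rw [walkSum]
  calc _ ≤ ∑ z, (p * b * O + (if PVert x w z then p * A else 0) +
        (if PEdge x w v z ∧ z ≠ u then F else 0)) := by
        refine Finset.sum_le_sum fun z _ => ?_
        have hpbO : 0 ≤ p * b * O := by positivity
        have hpA : 0 ≤ p * A := by positivity
        by_cases hzu : z = u
        · have h1 : ¬ (PEdge x w v z ∧ z ≠ u) := fun h => h.2 hzu
          rw [if_neg (not_not.2 hzu), if_neg h1]
          split <;> linarith
        rw [if_pos hzu]
        by_cases hz : PVert x w z
        · by_cases he : PEdge x w v z
          · have := hF z he
            simp only [stepWt, he, hz, hzu, if_true, ne_eq, not_false_iff, and_self]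
            linarith
          · have := mul_le_mul_of_nonneg_left (hA z hz) hp
            simp only [stepWt, he, hz, if_true, if_false, false_and]
            linarith
        · have he : ¬ PEdge x w v z := fun h => hz h.right
          have := mul_le_mul_of_nonneg_left (hO z hz) (mul_nonneg hp hb)
          simp only [stepWt, he, hz, if_false, false_and]
          linarith
    _ = Fintype.card V * (p * b) * O + (Finset.univ.filter (PVert x w)).card * (p * A) +
        (Finset.univ.filter fun z => PEdge x w v z ∧ z ≠ u).card * F := by
        rw [Finset.sum_add_distrib, Finset.sum_add_distrib, Finset.sum_const, Finset.card_univ,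
          ← Finset.sum_filter, ← Finset.sum_filter, Finset.sum_const, Finset.sum_const]
        simp only [nsmul_eq_mul]; ring
    _ ≤ _ := by
        have h1 : ((Finset.univ.filter (PVert x w)).card : ℝ) ≤ w + 1 := by
          exact_mod_cast card_PVert_le x w
        have h2 := mul_le_mul_of_nonneg_right hnb hO0
        have h3 := mul_le_mul_of_nonneg_right h1 (mul_nonneg hp hA0)
        linarith

/-- Bounds for the total weight of non-backtracking walks relative to a path. -/
lemma walkSum_bounds (hx : Set.InjOn x (Set.Iic w)) (hp : 0 ≤ p) (hb : 0 ≤ b)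
    (hnb : Fintype.card V * (p * b) ≤ 1) (hε : 8 * p * (w + 1) ^ 3 ≤ 1) {r : ℕ} (hr : r ≤ w) :
    (∀ u v, ¬ PVert x w v → walkSum (stepWt x w p b) 1 r u v ≤ 1 + 8 * p * (w + 1) ^ 2 * r) ∧
    (∀ u v, PVert x w v → walkSum (stepWt x w p b) 1 r u v ≤ 8 * (r + 1)) ∧
    (∀ u v, PEdge x w u v → walkSum (stepWt x w p b) 1 r u v ≤ 3 * r + 1) := by
  classical
  have ht : ∀ v : V, (0 : ℝ) ≤ (1 : V → ℝ) v := fun _ => zero_le_one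
  induction r with
  | zero =>
    refine ⟨fun u v _ => ?_, fun u v _ => ?_, fun u v _ => ?_⟩ <;> simp [walkSum]
  | succ r ih =>
    obtain ⟨h1, h2, h3⟩ := ih (by omega)
    have hrw : ((r : ℝ) + 1) ≤ w + 1 := by
      have : (r : ℝ) ≤ w := by exact_mod_cast (by omega : r ≤ w)
      linarith
    have hw1 : (1 : ℝ) ≤ w + 1 := by linarith [Nat.cast_nonneg (α := ℝ) w]
    have hA : ((w : ℝ) + 1) * p * (8 * (r + 1)) ≤ 8 * p * (w + 1) ^ 2 := by
      have : (0 : ℝ) ≤ (w + 1) * p := by positivity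
      nlinarith
    have hA1 : ((w : ℝ) + 1) * p * (8 * (r + 1)) ≤ 1 := by
      refine hA.trans (le_trans ?_ hε)
      have : (0 : ℝ) ≤ 8 * p * (w + 1) ^ 2 := by positivity
      calc 8 * p * ((w : ℝ) + 1) ^ 2 ≤ 8 * p * (w + 1) ^ 2 * (w + 1) :=
            le_mul_of_one_le_right this hw1
        _ = _ := by ring
    have hO1 : 1 + 8 * p * ((w : ℝ) + 1) ^ 2 * r ≤ 2 := by
      have : 8 * p * ((w : ℝ) + 1) ^ 2 * r ≤ 8 * p * (w + 1) ^ 2 * (w + 1) := by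
        gcongr; linarith
      linarith
    have main : ∀ u v, walkSum (stepWt x w p b) 1 (r + 1) u v ≤
        (1 + 8 * p * (w + 1) ^ 2 * r) + (w + 1) * p * (8 * (r + 1)) +
          (Finset.univ.filter fun z => PEdge x w v z ∧ z ≠ u).card * (3 * r + 1) := fun u v =>
      walkSum_succ_le hp hb ht hnb (by positivity) (by positivity) (fun z hz => h1 v z hz)
        (fun z hz => h2 v z hz) (fun z hz => h3 v z hz)
    have hcard : ∀ u v, (Finset.univ.filter fun z => PEdge x w v z ∧ z ≠ u).card ≤ 2 := fun u v =>
      (Finset.card_le_card (fun z hz => by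
        simp only [Finset.mem_filter] at hz ⊢; exact ⟨hz.1, hz.2.1⟩)).trans (card_PEdge_le hx v)
    refine ⟨fun u v hv => ?_, fun u v hv => ?_, fun u v hv => ?_⟩
    · have h0 : (Finset.univ.filter fun z => PEdge x w v z ∧ z ≠ u) = ∅ :=
        Finset.filter_false_of_mem fun z _ h => hv h.1.symm.right
      have := main u v
      rw [h0] at this
      simp only [Finset.card_empty, Nat.cast_zero, zero_mul, add_zero] at this
      push_cast
      linarith
    · have := main u v
      have hc : ((Finset.univ.filter fun z => PEdge x w v z ∧ z ≠ u).card : ℝ) ≤ 2 := by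
        exact_mod_cast hcard u v
      have := mul_le_mul_of_nonneg_right hc (show (0 : ℝ) ≤ 3 * r + 1 by positivity)
      push_cast
      linarith
    · have := main u v
      have hc : ((Finset.univ.filter fun z => PEdge x w v z ∧ z ≠ u).card : ℝ) ≤ 1 := by
        have h6 : (Finset.univ.filter fun z => PEdge x w v z ∧ z ≠ u) ⊂
            Finset.univ.filter (PEdge x w v) := by
          refine Finset.ssubset_iff_of_subset (fun z hz => ?_) |>.2 ⟨u, ?_, ?_⟩
          · simp_all
          · simpa using hv.symm
          · simp
        have := Finset.card_lt_card h6
        have := card_PEdge_le hx v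
        have h7 : (Finset.univ.filter fun z => PEdge x w v z ∧ z ≠ u).card ≤ 1 := by omega
        simp_all
      have := mul_le_mul_of_nonneg_right hc (show (0 : ℝ) ≤ 3 * r + 1 by positivity)
      push_cast
      linarith

open Classical in
/-- Walks from outside the path that end on it have small total weight. -/
lemma walkSum_return (hx : Set.InjOn x (Set.Iic w)) (hp : 0 ≤ p) (hb : 0 ≤ b)
    (hnb : Fintype.card V * (p * b) ≤ 1) (hε : 8 * p * (w + 1) ^ 3 ≤ 1) {r : ℕ} (hr : r ≤ w)
    (u v : V) (hv : ¬ PVert x w v) :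
    walkSum (stepWt x w p b) (fun z => if PVert x w z then 1 else 0) r u v
      ≤ 8 * p * (w + 1) ^ 2 * r := by
  have ht : ∀ v : V, (0 : ℝ) ≤ (if PVert x w v then 1 else 0) := by
    intro v; split <;> norm_num
  induction r generalizing u v with
  | zero => simp [walkSum, hv]
  | succ r ih =>
    have h2 := (walkSum_bounds hx hp hb hnb hε (show r ≤ w by omega)).2.1
    have hle : ∀ u v, walkSum (stepWt x w p b) (fun z => if PVert x w z then 1 else 0) r u v
        ≤ walkSum (stepWt x w p b) 1 r u v := walkSum_mono (stepWt_nonneg hp hb) (by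
          intro v; simp only [Pi.one_apply]; split <;> norm_num) r
    have := walkSum_succ_le (x := x) (w := w) (u := u) (F := 0) (r := r) (v := v) hp hb ht hnb
      (show (0 : ℝ) ≤ 8 * p * (w + 1) ^ 2 * r by positivity)
      (show (0 : ℝ) ≤ 8 * (r + 1) by positivity)
      (fun z hz => ih (by omega) v z hz) (fun z hz => (hle v z).trans (h2 v z hz))
      (fun z hz => absurd hz.symm.right hv)
    have hrw : ((r : ℝ) + 1) ≤ w + 1 := by
      have : (r : ℝ) ≤ w := by exact_mod_cast (by omega : r ≤ w)
      linarith
    have hA : ((w : ℝ) + 1) * p * (8 * (r + 1)) ≤ 8 * p * (w + 1) ^ 2 := by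
      have : (0 : ℝ) ≤ (w + 1) * p := by positivity
      nlinarith
    push_cast
    linarith

open Classical in
/-- Walks which leave the path at once from its first vertex and end on it. -/
lemma walkSum_ear (hx : Set.InjOn x (Set.Iic w)) (hp : 0 ≤ p) (hb : 0 ≤ b)
    (hnb : Fintype.card V * (p * b) ≤ 1) (hε : 8 * p * (w + 1) ^ 3 ≤ 1) (hw : 0 < w) :
    walkSum (stepWt x w p b) (fun z => if PVert x w z then 1 else 0) w (x 1) (x 0)
      ≤ 8 * p * (w + 1) ^ 3 := by
  have ht : ∀ v : V, (0 : ℝ) ≤ (if PVert x w v then 1 else 0) := by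
    intro v; split <;> norm_num
  obtain ⟨r, rfl⟩ : ∃ r, w = r + 1 := ⟨w - 1, by omega⟩
  have h2 := (walkSum_bounds hx hp hb hnb hε (show r ≤ r + 1 by omega)).2.1
  have hle : ∀ u v, walkSum (stepWt x (r + 1) p b) (fun z => if PVert x (r + 1) z then 1 else 0) r u v
      ≤ walkSum (stepWt x (r + 1) p b) 1 r u v := walkSum_mono (stepWt_nonneg hp hb) (by
        intro v; simp only [Pi.one_apply]; split <;> norm_num) r
  have h0 : (Finset.univ.filter fun z => PEdge x (r + 1) (x 0) z ∧ z ≠ x 1) = ∅ := by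
    refine Finset.filter_false_of_mem fun z _ h => ?_
    obtain ⟨⟨i, hi, ⟨h1, rfl⟩ | ⟨h1, rfl⟩⟩, hz⟩ := h
    · have := hx (Set.mem_Iic.2 (by omega)) (Set.mem_Iic.2 (by omega)) h1
      subst this; exact hz rfl
    · have := hx (Set.mem_Iic.2 (by omega)) (Set.mem_Iic.2 (by omega)) h1
      omega
  have := walkSum_succ_le (x := x) (w := r + 1) (u := x 1) (F := 8 * (r + 1)) (r := r) (v := x 0)
    hp hb ht hnb
    (show (0 : ℝ) ≤ 8 * p * ((r + 1 : ℕ) + 1) ^ 2 * r by positivity)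
    (show (0 : ℝ) ≤ 8 * (r + 1) by positivity)
    (fun z hz => walkSum_return hx hp hb hnb hε (by omega) _ z hz)
    (fun z hz => (hle _ z).trans (h2 _ z hz)) (fun z hz => (hle _ z).trans (h2 _ z hz.right))
  rw [h0] at this
  simp only [Finset.card_empty, Nat.cast_zero, zero_mul, add_zero] at this
  refine this.trans ?_
  push_cast
  have h7 : (0 : ℝ) ≤ p * ((r : ℝ) + 1 + 1) := by positivity
  nlinarith [mul_nonneg h7 (show (0 : ℝ) ≤ (r : ℝ) + 1 + 1 by positivity)]

end PathWeights


/-! ### Two paths with equal colours -/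

section TwoPaths

variable {V : Type} [Finite V] {G : SimpleGraph V}

theorem ein_union_le {M E : ℕ} (hex : ∀ S, Cn G S → S.ncard ≤ M → ein G S ≤ S.ncard + E)
    {A B : Set V} (hA : Cn G A) (hB : Cn G B) (hM : (A ∪ B).ncard ≤ M) :
    ein G (A ∪ B) ≤ (A ∪ B).ncard + 2 * E := by
  by_cases hlink : ∃ a ∈ A, ∃ b ∈ B, a = b ∨ G.Adj a b
  · obtain ⟨a, ha, b, hb, hab⟩ := hlink
    have := hex _ (hA.union_of_link hB ha hb hab) hM
    omega
  · push Not at hlink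
    have hd : Disjoint A B := Set.disjoint_left.2 fun v hv hv' => (hlink v hv v hv').1 rfl
    have hsub : eset G (A ∪ B) ⊆ eset G A ∪ eset G B := by
      intro e
      induction e using Sym2.ind with
      | _ u v =>
        simp only [mk_mem_eset, Set.mem_union]
        grind [G.adj_comm u v]
    have h1 : ein G (A ∪ B) ≤ ein G A + ein G B :=
      (Set.ncard_le_ncard hsub (Set.toFinite _)).trans (Set.ncard_union_le _ _)
    have h2 := hex A hA ((Set.ncard_le_ncard Set.subset_union_left (Set.toFinite _)).trans hM)
    have h3 := hex B hB ((Set.ncard_le_ncard Set.subset_union_right (Set.toFinite _)).trans hM)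
    have h4 := Set.ncard_union_eq hd (Set.toFinite _) (Set.toFinite _)
    omega

/-- Number of neighbours of `y` outside `S` having `d` neighbours outside `S`. -/
noncomputable def chx (G : SimpleGraph V) (S : Set V) (y : V) (d : ℕ) : ℕ :=
  {z | G.Adj y z ∧ z ∉ S ∧ dgi G Sᶜ z = d}.ncard

/-- Vertices of `S` with at least three neighbours in `S`. -/
def T3 (G : SimpleGraph V) (S : Set V) : Set V := {v | v ∈ S ∧ 3 ≤ dgi G S v}

/-- Vertices of `S` sharing a neighbour outside `S` with another vertex of `S`. -/
def Shr (G : SimpleGraph V) (S : Set V) : Set V :=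
  {v | v ∈ S ∧ ∃ z, z ∉ S ∧ G.Adj v z ∧ ∃ v' ∈ S, v' ≠ v ∧ G.Adj v' z}

variable {w : ℕ} {x x' : ℕ → V}

theorem two_mul_ncard_add_T3_le (hx : IP G w x) (hx' : IP G w x') {S : Set V}
    (hS : S = x '' Set.Iic w ∪ x' '' Set.Iic w) :
    2 * S.ncard + (T3 G S).ncard ≤ 2 * ein G S + 8 := by
  classical
  have := Fintype.ofFinite V
  set D : Finset V := {x 0, x w, x' 0, x' w} with hD
  have hDc : D.card ≤ 4 := Finset.card_le_four
  have hpt : ∀ v ∈ S.toFinset, 2 + (if v ∈ T3 G S then 1 else 0)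
      ≤ dgi G S v + (if v ∈ D then 2 else 0) := by
    intro v hv
    rw [Set.mem_toFinset] at hv
    by_cases h3 : 3 ≤ dgi G S v
    · split <;> omega
    · rw [if_neg fun h => h3 h.2]
      by_cases hvD : v ∈ D
      · rw [if_pos hvD]; omega
      · have hsub : (∀ i ≤ w, x i ∈ S) ∧ ∀ i ≤ w, x' i ∈ S := by grind
        have key : ∀ {y : ℕ → V}, IP G w y → (∀ i ≤ w, y i ∈ S) → y 0 ∈ D → y w ∈ D →
            ∀ j ≤ w, y j ∉ D → 2 ≤ dgi G S (y j) := fun hy hyS h0 hw j hj hjD =>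
          hy.two_le_dgi hyS (by grind) (by grind)
        have h2 : 2 ≤ dgi G S v := by
          rw [hS] at hv
          rcases hv with ⟨j, hj, rfl⟩ | ⟨j, hj, rfl⟩
          all_goals grind
        omega
  have hsum := Finset.sum_le_sum hpt
  rw [Finset.sum_add_distrib, Finset.sum_add_distrib, handshake] at hsum
  have h1 : ∑ v ∈ S.toFinset, (if v ∈ D then 2 else 0) ≤ 2 * D.card := by
    rw [← Finset.sum_filter, Finset.sum_const, smul_eq_mul, mul_comm]
    refine Nat.mul_le_mul_left 2 (Finset.card_le_card fun v hv => (Finset.mem_filter.1 hv).2)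
  have h2 : ∑ v ∈ S.toFinset, (if v ∈ T3 G S then 1 else 0) = (T3 G S).ncard := by
    rw [← Finset.sum_filter, Finset.sum_const, smul_eq_mul, mul_one, Set.ncard_eq_toFinset_card']
    congr 1
    ext v
    simp only [Finset.mem_filter, Set.mem_toFinset]
    exact ⟨fun h => h.2, fun h => ⟨h.1, h⟩⟩
  have h3 : ∑ v ∈ S.toFinset, 2 = 2 * S.ncard := by
    rw [Finset.sum_const, smul_eq_mul, mul_comm, Set.ncard_eq_toFinset_card']
  omega

theorem T3_ncard_le {M E : ℕ} (hex : ∀ S, Cn G S → S.ncard ≤ M → ein G S ≤ S.ncard + E)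
    (hx : IP G w x) (hx' : IP G w x') {S : Set V} (hS : S = x '' Set.Iic w ∪ x' '' Set.Iic w)
    (hM : S.ncard ≤ M) : (T3 G S).ncard ≤ 4 * E + 8 := by
  have h1 := two_mul_ncard_add_T3_le hx hx' hS
  have h2 : ein G S ≤ S.ncard + 2 * E := by
    subst hS
    exact ein_union_le hex (IP.cn hx.1) (IP.cn hx'.1) hM
  omega

theorem Shr_ncard_le {M E : ℕ} (hex : ∀ S, Cn G S → S.ncard ≤ M → ein G S ≤ S.ncard + E)
    (hx : IP G w x) (hx' : IP G w x') {S : Set V} (hS : S = x '' Set.Iic w ∪ x' '' Set.Iic w)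
    (hM : S.ncard + (2 * E + 5) ≤ M) : (Shr G S).ncard ≤ 4 * E + 8 := by
  classical
  have := Fintype.ofFinite V
  set Z : Set V := {z | z ∉ S ∧ 2 ≤ dgi G S z} with hZ
  have hein := two_mul_ncard_add_T3_le hx hx' hS
  have key : ∀ Y ⊆ Z, S.ncard + Y.ncard ≤ M → ebt G S Y ≤ Y.ncard + 2 * E + 4 := by
    intro Y hY hYM
    have hd : Disjoint S Y := Set.disjoint_left.2 fun v hv hv' => (hY hv').1 hv
    have hcard := Set.ncard_union_eq hd (Set.toFinite _) (Set.toFinite _)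
    have hbig := ein_union_ge G hd
    set Y₁ : Set V := {z | z ∈ Y ∧ ∃ a ∈ x '' Set.Iic w, G.Adj a z} with hY₁
    set Y₂ : Set V := {z | z ∈ Y ∧ ∃ a ∈ x' '' Set.Iic w, G.Adj a z} with hY₂
    have hcn : ∀ {A : Set V}, Cn G A → Cn G (A ∪ {z | z ∈ Y ∧ ∃ a ∈ A, G.Adj a z}) := by
      intro A hA
      obtain ⟨a₀, ha₀⟩ := hA.1
      refine cn_of_forall (x := a₀) (Or.inl ha₀) fun y hy => ?_
      rcases hy with hy | ⟨hyY, a, ha, hay⟩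
      · grind
      · refine ⟨A ∪ {y}, Set.union_subset Set.subset_union_left ?_,
          hA.union_of_link (cn_singleton G y) ha rfl (Or.inr hay), Or.inl ha₀, Or.inr rfl⟩
        grind
    have hunion : S ∪ Y = (x '' Set.Iic w ∪ Y₁) ∪ (x' '' Set.Iic w ∪ Y₂) := by
      ext v
      constructor
      · rintro (hv | hv)
        · grind
        · have h2 := (hY hv).2
          have hne : {u | u ∈ S ∧ G.Adj v u}.Nonempty := by
            refine Set.nonempty_of_ncard_ne_zero ?_
            unfold dgi at h2
            omega
          obtain ⟨u, hu, huv⟩ := hne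
          rw [hS] at hu
          exact hu.imp (fun hu => Or.inr ⟨hv, u, hu, huv.symm⟩) fun hu => Or.inr ⟨hv, u, hu, huv.symm⟩
      · rw [hS]
        grind
    have hup : ein G (S ∪ Y) ≤ (S ∪ Y).ncard + 2 * E := by
      rw [hunion]
      refine ein_union_le hex (hcn (IP.cn hx.1)) (hcn (IP.cn hx'.1)) ?_
      rw [← hunion]
      omega
    omega
  have hlow : ∀ Y ⊆ Z, 2 * Y.ncard ≤ ebt G Y S := by
    intro Y hY
    rw [ebt_eq_sum, Set.ncard_eq_toFinset_card', mul_comm, ← smul_eq_mul, ← Finset.sum_const]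
    exact Finset.sum_le_sum fun v hv => (hY (by simpa using hv)).2
  have hsymm : ∀ Y, ebt G Y S = ebt G S Y := by
    intro Y
    exact Set.ncard_congr (fun r _ => r.swap) (fun r h => ⟨h.2.1, h.1, h.2.2.symm⟩)
      (fun _ _ _ _ h => Prod.swap_injective h)
      (fun r h => ⟨r.swap, ⟨h.2.1, h.1, h.2.2.symm⟩, r.swap_swap⟩)
  have hZc : Z.ncard ≤ 2 * E + 4 := by
    by_contra hcon
    obtain ⟨Y, hYZ, hYc⟩ := Set.exists_subset_card_eq (show 2 * E + 5 ≤ Z.ncard by omega)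
    grind
  have h1 := key Z subset_rfl (by omega)
  have h2 : (Shr G S).ncard ≤ ebt G S Z := by
    rw [ebt_eq_sum, Set.ncard_eq_toFinset_card', Finset.card_eq_sum_ones]
    refine (Finset.sum_le_sum fun v hv => ?_).trans
      (Finset.sum_le_sum_of_subset (f := fun v => dgi G Z v) fun v hv => ?_)
    · simp only [Set.mem_toFinset] at hv
      obtain ⟨hvS, z, hz, hvz, v', hv', hne, hvz'⟩ := hv
      refine (Set.ncard_pos (Set.toFinite _)).2 ⟨z, ⟨hz, ?_⟩, hvz⟩
      have : ({v, v'} : Set V) ⊆ {u | u ∈ S ∧ G.Adj z u} := by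
        rintro _ (rfl | rfl)
        · exact ⟨hvS, hvz.symm⟩
        · exact ⟨hv', hvz'.symm⟩
      have h3 := Set.ncard_le_ncard this (Set.toFinite _)
      rwa [Set.ncard_pair hne.symm] at h3
    · simp only [Set.mem_toFinset] at hv ⊢
      exact hv.1
  omega

theorem ncard_adj_dg_eq {S : Set V} (hx : IP G w x) (hS : ∀ i ≤ w, x i ∈ S) {j : ℕ} (hj : 0 < j)
    (hjw : j < w) (h3 : x j ∉ T3 G S) (hsh : x j ∉ Shr G S) (d : ℕ) :
    {z | G.Adj (x j) z ∧ dg G z = d + 1}.ncard = chx G S (x j) d +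
      ((if dg G (x (j - 1)) = d + 1 then 1 else 0) + if dg G (x (j + 1)) = d + 1 then 1 else 0) := by
  classical
  have hne : x (j - 1) ≠ x (j + 1) := by
    intro heq
    have := hx.2 (show j - 1 ∈ Set.Iic w by simp only [Set.mem_Iic]; omega)
      (show j + 1 ∈ Set.Iic w by simp only [Set.mem_Iic]; omega) heq
    omega
  have ha1 : G.Adj (x j) (x (j - 1)) := by
    have := hx.1 (j - 1) (by omega)
    rw [show j - 1 + 1 = j by omega] at this
    exact this.symm
  have ha2 : G.Adj (x j) (x (j + 1)) := hx.1 j hjw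
  have hin : ({x (j - 1), x (j + 1)} : Set V) = {u | u ∈ S ∧ G.Adj (x j) u} := by
    refine Set.eq_of_subset_of_ncard_le ?_ ?_ (Set.toFinite _)
    · grind
    · rw [Set.ncard_pair hne]
      have : ¬ 3 ≤ dgi G S (x j) := fun h => h3 ⟨hS j hjw.le, h⟩
      unfold dgi at this
      omega
  have hout : ∀ z, G.Adj (x j) z → z ∉ S → dg G z = dgi G Sᶜ z + 1 := by
    intro z hz hzS
    have h1 : {v | G.Adj z v} = {v | v ∈ Sᶜ ∧ G.Adj z v} ∪ {x j} := by
      ext v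
      simp only [Set.mem_ofPred_eq, Set.mem_union, Set.mem_compl_iff, Set.mem_singleton_iff]
      constructor
      · intro hv
        by_cases hvS : v ∈ S
        · right
          by_contra hvj
          exact hsh ⟨hS j hjw.le, z, hzS, hz, v, hvS, hvj, hv.symm⟩
        · exact Or.inl ⟨hvS, hv⟩
      · rintro (hv | rfl)
        · exact hv.2
        · exact hz.symm
    unfold dg
    rw [h1, Set.ncard_union_eq (Set.disjoint_singleton_right.2 fun h => h.1 (hS j hjw.le))
      (Set.toFinite _) (Set.toFinite _), Set.ncard_singleton]
    rfl
  have hsplit : {z | G.Adj (x j) z ∧ dg G z = d + 1}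
      = {z | G.Adj (x j) z ∧ z ∉ S ∧ dgi G Sᶜ z = d} ∪
        {z | z ∈ ({x (j - 1), x (j + 1)} : Set V) ∧ dg G z = d + 1} := by
    rw [hin]
    ext z
    simp only [Set.mem_ofPred_eq, Set.mem_union]
    grind
  rw [hsplit, Set.ncard_union_eq (Set.disjoint_left.2 fun z hz hz' => ?_) (Set.toFinite _)
    (Set.toFinite _)]
  · have : {z | z ∈ ({x (j - 1), x (j + 1)} : Set V) ∧ dg G z = d + 1}
        = (({x (j - 1), x (j + 1)} : Finset V).filter fun z => dg G z = d + 1 : Finset V) := by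
      ext z; simp
    rw [this, Set.ncard_coe_finset, Finset.card_filter, Finset.sum_pair hne]
    rfl
  · simp_all

theorem exists_good_indices {M E : ℕ}
    (hex : ∀ S, Cn G S → S.ncard ≤ M → ein G S ≤ S.ncard + E)
    (hx : IP G w x) (hx' : IP G w x') {S : Set V} (hS : S = x '' Set.Iic w ∪ x' '' Set.Iic w)
    (hM : 2 * (w + 1) + (2 * E + 5) ≤ M) (hcol : ∀ i ≤ w, col G (x i) = col G (x' i)) :
    ∃ B ⊆ Finset.range (w + 1), B.card ≤ 16 * E + 34 ∧ ∀ j ≤ w, j ∉ B →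
      0 < j ∧ j < w ∧ ∀ d, chx G S (x j) d = chx G S (x' j) d := by
  classical
  have := Fintype.ofFinite V
  have hSc : S.ncard ≤ 2 * (w + 1) := by
    have h1 := Set.ncard_union_le (x '' Set.Iic w) (x' '' Set.Iic w)
    rw [← hS, hx.ncard_image, hx'.ncard_image] at h1
    omega
  have hT := T3_ncard_le hex hx hx' hS (by omega)
  have hSh := Shr_ncard_le hex hx hx' hS (by omega)
  set U : Set V := T3 G S ∪ Shr G S with hU
  have hUc : U.ncard ≤ 8 * E + 16 := (Set.ncard_union_le _ _).trans (by omega)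
  have hxS : ∀ i ≤ w, x i ∈ S := by subst hS; exact fun i hi => Or.inl ⟨i, hi, rfl⟩
  have hxS' : ∀ i ≤ w, x' i ∈ S := by subst hS; exact fun i hi => Or.inr ⟨i, hi, rfl⟩
  have hpre : ∀ {y : ℕ → V}, IP G w y →
      ((Finset.range (w + 1)).filter fun j => y j ∈ U).card ≤ U.ncard := by
    intro y hy
    rw [Set.ncard_eq_toFinset_card']
    refine Finset.card_le_card_of_injOn y (fun j hj => ?_) fun i hi j hj hij => ?_
    · simpa using (Finset.mem_filter.1 hj).2
    · have h1 := Finset.mem_range.1 (Finset.mem_filter.1 hi).1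
      have h2 := Finset.mem_range.1 (Finset.mem_filter.1 hj).1
      exact hy.2 (Set.mem_Iic.2 (by omega)) (Set.mem_Iic.2 (by omega)) hij
  refine ⟨(Finset.range (w + 1)).filter fun j => j = 0 ∨ j = w ∨ x j ∈ U ∨ x' j ∈ U,
    Finset.filter_subset _ _, ?_, ?_⟩
  · have h1 : ((Finset.range (w + 1)).filter fun j => j = 0 ∨ j = w ∨ x j ∈ U ∨ x' j ∈ U) ⊆
        ({0, w} : Finset ℕ) ∪ (((Finset.range (w + 1)).filter fun j => x j ∈ U) ∪
          (Finset.range (w + 1)).filter fun j => x' j ∈ U) := by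
      grind
    have h2 := Finset.card_le_card h1
    grind
  · intro j hj hjB
    simp only [Finset.mem_filter, Finset.mem_range, not_and, not_or] at hjB
    obtain ⟨h0, hw, hu, hu'⟩ := hjB (by omega)
    have h0' : 0 < j := Nat.pos_of_ne_zero h0
    have hw' : j < w := lt_of_le_of_ne hj hw
    refine ⟨h0', hw', fun d => ?_⟩
    have e1 := ncard_adj_dg_eq hx hxS h0' hw' (fun h => hu (Or.inl h)) (fun h => hu (Or.inr h)) d
    have e2 := ncard_adj_dg_eq hx' hxS' h0' hw' (fun h => hu' (Or.inl h))
      (fun h => hu' (Or.inr h)) d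
    have e3 := congrFun (congrArg Prod.snd (hcol j hj)) (d + 1)
    have e4 := congrArg Prod.fst (hcol (j - 1) (by omega))
    have e5 := congrArg Prod.fst (hcol (j + 1) (by omega))
    simp only [col] at e3 e4 e5
    rw [e4, e5] at e1
    omega

end TwoPaths


/-! ### Independent blocks -/

section Blocks

variable {ι κ : Type*} [DecidableEq ι] {p : ℝ}

lemma Exs_blocks [DecidableEq κ] (I : Finset κ) (S : κ → Finset ι)
    (hd : ∀ i ∈ I, ∀ j ∈ I, i ≠ j → Disjoint (S i) (S j)) (g : κ → Finset ι → ℝ) :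
    Exs p (I.biUnion S) (fun A => ∏ i ∈ I, g i (A ∩ S i)) = ∏ i ∈ I, Exs p (S i) (g i) := by
  induction I using Finset.induction_on with
  | empty => simp [Exs_const]
  | insert a I ha ih =>
    have hdisj : Disjoint (S a) (I.biUnion S) := by
      rw [Finset.disjoint_biUnion_right]
      grind
    rw [Finset.prod_insert ha, ← ih fun i hi j hj => hd i (Finset.mem_insert_of_mem hi) j
      (Finset.mem_insert_of_mem hj), ← Exs_indep hdisj, Finset.biUnion_insert]
    refine Exs_congr fun A _ => ?_
    rw [Finset.prod_insert ha]
    congr 1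
    refine Finset.prod_congr rfl fun i hi => ?_
    rw [Finset.inter_assoc, Finset.inter_eq_right.2 (Finset.subset_biUnion_of_mem S hi)]

omit [DecidableEq ι] in
lemma Exs_card_eq (S : Finset ι) (t : ℕ) :
    Exs p S (fun A => ind (A.card = t)) = S.card.choose t * (p ^ t * (1 - p) ^ (S.card - t)) := by
  have h1 : ∀ A ∈ S.powerset, p ^ A.card * (1 - p) ^ (S.card - A.card) * ind (A.card = t)
      = if A.card = t then p ^ t * (1 - p) ^ (S.card - t) else 0 := by
    intro A _
    by_cases h : A.card = t
    · rw [ind_pos h, if_pos h, mul_one, h]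
    · rw [ind_neg h, if_neg h, mul_zero]
  unfold Exs
  rw [Finset.sum_congr rfl h1, ← Finset.sum_filter, Finset.sum_const, nsmul_eq_mul,
    ← Finset.powersetCard_eq_filter, Finset.card_powersetCard]

lemma two_pow_le_factorial_succ (t : ℕ) : 2 ^ t ≤ (t + 1).factorial := by
  induction t with
  | zero => simp
  | succ t ih =>
    rw [Nat.factorial_succ, pow_succ, mul_comm]
    exact Nat.mul_le_mul (by omega) ih

lemma Exs_card_eq_le (h0 : 0 ≤ p) (hp : p ≤ 1 / 2) {S : Finset ι} {N : ℕ} (hN : N ≤ S.card)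
    (hNp : N * p ≤ 1) (t : ℕ) :
    Exs p S (fun A => ind (A.card = t)) ≤ Real.exp (p - N * p) := by
  have hexact : ∀ t : ℕ, ((N.choose t : ℕ) : ℝ) * (p ^ t * (1 - p) ^ (N - t))
      ≤ Real.exp (p - N * p) := by
    intro t
    by_cases htN : t ≤ N
    · have h1 : ((N.choose t : ℕ) : ℝ) ≤ (N : ℝ) ^ t / t.factorial := Nat.choose_le_pow_div t N
      have h2 : (1 - p) ^ (N - t) ≤ Real.exp (-(p * (N - t : ℕ))) := by
        rw [← neg_mul, mul_comm, Real.exp_nat_mul]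
        exact pow_le_pow_left₀ (by linarith) (by linarith [Real.add_one_le_exp (-p)]) _
      have h3 : Real.exp (p * t) / t.factorial ≤ Real.exp p := by
        rw [div_le_iff₀ (by positivity)]
        cases t with
        | zero => simp [Real.one_le_exp_iff.2 h0]
        | succ t =>
          have h4 : Real.exp p ≤ 2 := by
            calc Real.exp p ≤ Real.exp (1 / 2) := Real.exp_le_exp.2 hp
              _ ≤ 2 := by
                have h5 : Real.exp (1 / 2) ^ 2 = Real.exp 1 := by
                  rw [← Real.exp_nat_mul]; norm_num
                have h6 := Real.exp_one_lt_d9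
                nlinarith [Real.exp_pos (1 / 2)]
          have h5 : Real.exp (p * (t + 1 : ℕ)) = Real.exp p * Real.exp p ^ t := by
            rw [← Real.exp_nat_mul, ← Real.exp_add]
            congr 1
            push_cast
            ring
          rw [h5]
          refine mul_le_mul_of_nonneg_left ?_ (Real.exp_pos p).le
          calc Real.exp p ^ t ≤ 2 ^ t := pow_le_pow_left₀ (Real.exp_pos p).le h4 _
            _ ≤ _ := by exact_mod_cast two_pow_le_factorial_succ t
      calc ((N.choose t : ℕ) : ℝ) * (p ^ t * (1 - p) ^ (N - t))
          ≤ ((N : ℝ) ^ t / t.factorial) * (p ^ t * Real.exp (-(p * (N - t : ℕ)))) := by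
            have : 0 ≤ (1 - p) ^ (N - t) := pow_nonneg (by linarith) _
            gcongr
        _ = (N * p) ^ t * Real.exp (-(N * p)) * (Real.exp (p * t) / t.factorial) := by
            rw [show -(p * ((N - t : ℕ) : ℝ)) = -(N * p) + p * t by
              rw [Nat.cast_sub htN]; ring, Real.exp_add, mul_pow]
            ring
        _ ≤ 1 * Real.exp (-(N * p)) * Real.exp p := by
            have h6 : ((N : ℝ) * p) ^ t ≤ 1 := pow_le_one₀ (by positivity) hNp
            have h7 : 0 ≤ Real.exp (p * t) / t.factorial := by positivity
            have h8 := Real.exp_pos (-(N * p))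
            gcongr
        _ = _ := by rw [one_mul, ← Real.exp_add]; congr 1; ring
    · rw [Nat.choose_eq_zero_of_lt (by omega)]
      simp [Real.exp_nonneg]
  obtain ⟨T, hTS, hT⟩ := Finset.exists_subset_card_eq hN
  have hd : Disjoint (S \ T) T := Finset.sdiff_disjoint
  rw [← Finset.sdiff_union_of_subset hTS, Exs_union hd]
  calc _ ≤ Exs p (S \ T) (fun _ => Real.exp (p - N * p)) := by
        refine Exs_mono h0 (by linarith) fun A hA => ?_
        have hAT : Disjoint A T := Finset.disjoint_of_subset_left hA hd
        by_cases ht : A.card ≤ t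
        · have : Exs p T (fun B => ind ((A ∪ B).card = t))
              = Exs p T (fun B => ind (B.card = t - A.card)) := by
            refine Exs_congr fun B hB => ind_congr ?_
            rw [Finset.card_union_of_disjoint (Finset.disjoint_of_subset_right hB hAT)]
            omega
          rw [this, Exs_card_eq, hT]
          exact hexact _
        · have : Exs p T (fun B => ind ((A ∪ B).card = t)) = Exs p T (fun _ => 0) := by
            refine Exs_congr fun B _ => ind_neg fun h => ?_
            have := Finset.card_le_card (Finset.subset_union_left (s₁ := A) (s₂ := B))
            omega
          rw [this, Exs_const]
          exact Real.exp_nonneg _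
    _ = _ := Exs_const _

end Blocks

open Classical in
/-- Prescribed edges inside `S` together with coincidences of outer profiles are unlikely. -/
lemma Pg_twin_le {n : ℕ} {p : ℝ} (h0 : 0 ≤ p) (hp : p ≤ 1 / 2) (S : Finset (Fin n))
    (Γ : Finset (Sym2 (Fin n))) (hΓ : ∀ e ∈ Γ, e ∈ edges n ∧ ∀ v ∈ e, v ∈ S)
    (D : Finset (Fin n)) (hDS : D ⊆ S) (π : Fin n → Fin n) (hπ : ∀ y ∈ D, π y ∈ S ∧ π y ∉ D)
    (D₁ : ℕ) (N₀ : ℕ → ℕ) (hN : ∀ d < D₁, N₀ d * p ≤ 1) :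
    Pg n p (fun G => (∀ e ∈ Γ, e ∈ G.edgeSet) ∧
      (∀ y ∈ D, ∀ d < D₁, chx G S y d = chx G S (π y) d) ∧
      ∀ d < D₁, N₀ d ≤ {z | z ∉ (S : Set (Fin n)) ∧ dgi G (S : Set (Fin n))ᶜ z = d}.ncard)
      ≤ p ^ Γ.card * Real.exp (∑ d ∈ Finset.range D₁, (p - N₀ d * p)) ^ D.card := by
  have h1 : p ≤ 1 := by linarith
  set star : Fin n → Finset (Sym2 (Fin n)) :=
    fun y => (Finset.univ \ S).image fun z => s(y, z) with hstar
  set E₁ := D.biUnion star with hE₁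
  have hmem : ∀ u v, s(u, v) ∈ E₁ ↔ (u ∈ D ∧ v ∉ S) ∨ (v ∈ D ∧ u ∉ S) := by grind
  have hE₁sub : E₁ ⊆ edges n := by
    intro e
    induction e using Sym2.ind with
    | _ u v =>
      rw [hmem, mk_mem_edges]
      grind
  set E₀ := edges n \ E₁ with hE₀
  have hdE : Disjoint E₀ E₁ := Finset.sdiff_disjoint
  have hEE : E₀ ∪ E₁ = edges n := Finset.sdiff_union_of_subset hE₁sub
  have hΓE : Γ ⊆ E₀ := by
    intro e he
    obtain ⟨h2, h3⟩ := hΓ e he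
    grind
  set stats : Finset (Sym2 (Fin n)) → Prop := fun A => ∀ d < D₁,
    N₀ d ≤ {z | z ∉ (S : Set (Fin n)) ∧ dgi (Gr A) (S : Set (Fin n))ᶜ z = d}.ncard with hstats
  set T : Finset (Sym2 (Fin n)) → Fin n × ℕ → Finset (Sym2 (Fin n)) := fun A i =>
    (Finset.univ.filter fun z => z ∉ S ∧ dgi (Gr A) (S : Set (Fin n))ᶜ z = i.2).image
      fun z => s(i.1, z) with hT
  set I := D ×ˢ Finset.range D₁ with hI
  -- inner expectation
  have inner : ∀ A, stats A → Exs p E₁ (fun B => ∏ i ∈ I,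
      ind ((B ∩ T A i).card = chx (Gr A) S (π i.1) i.2))
      ≤ Real.exp (∑ d ∈ Finset.range D₁, (p - N₀ d * p)) ^ D.card := by
    intro A hA
    have hTE : I.biUnion (T A) ⊆ E₁ := by grind
    rw [Exs_marginal hTE]
    · rw [Exs_blocks I (T A) ?_ (fun i B => ind (B.card = chx (Gr A) S (π i.1) i.2))]
      · calc _ ≤ ∏ i ∈ I, Real.exp (p - N₀ i.2 * p) := by
              refine Finset.prod_le_prod (fun i _ => Exs_nonneg h0 h1 fun _ _ => ind_nonneg _)
                fun i hi => ?_
              have hi2 : i.2 < D₁ := Finset.mem_range.1 (Finset.mem_product.1 hi).2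
              refine Exs_card_eq_le h0 hp ?_ (hN _ hi2) _
              rw [hT]
              dsimp only
              rw [Finset.card_image_of_injective _ fun a b hab => ?_]
              · have := hA i.2 hi2
                rw [Set.ncard_eq_toFinset_card'] at this
                simp_all
              · grind
          _ = _ := by
              rw [hI, Finset.prod_product, Real.exp_sum, ← Finset.prod_const]
      · rintro ⟨y, d⟩ hi ⟨y', d'⟩ hj hij
        rw [Finset.disjoint_left]
        grind
    · intro B _
      refine Finset.prod_congr rfl fun i hi => ?_
      rw [Finset.inter_assoc, Finset.inter_eq_right.2 (Finset.subset_biUnion_of_mem (T A) hi)]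
  unfold Pg Eg
  rw [← hEE, Exs_union hdE]
  calc _ ≤ Exs p E₀ (fun A => (if Γ ⊆ A then 1 else 0) *
        Real.exp (∑ d ∈ Finset.range D₁, (p - N₀ d * p)) ^ D.card) := by
        refine Exs_mono h0 h1 fun A hA => ?_
        have hAe : A ⊆ edges n := hA.trans Finset.sdiff_subset
        have hadj : ∀ B ⊆ E₁, ∀ u v, s(u, v) ∉ E₁ →
            ((Gr (A ∪ B)).Adj u v ↔ (Gr A).Adj u v) := by
          intro B hB u v huv
          rw [Gr_adj, Gr_adj, Finset.mem_union]
          grind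
        have hdgi : ∀ B ⊆ E₁, ∀ z, z ∉ S →
            dgi (Gr (A ∪ B)) (S : Set (Fin n))ᶜ z = dgi (Gr A) (S : Set (Fin n))ᶜ z := by
          intro B hB z hz
          unfold dgi
          grind
        have hst : ∀ B ⊆ E₁, (∀ d < D₁, N₀ d ≤ {z | z ∉ (S : Set (Fin n)) ∧
            dgi (Gr (A ∪ B)) (S : Set (Fin n))ᶜ z = d}.ncard) → stats A := by
          grind
        have hcx : ∀ B ⊆ E₁, ∀ y ∈ D, ∀ d,
            chx (Gr (A ∪ B)) S (π y) d = chx (Gr A) S (π y) d := by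
          intro B hB y hy d
          unfold chx
          grind
        have hcy : ∀ B ⊆ E₁, ∀ y ∈ D, ∀ d,
            chx (Gr (A ∪ B)) S y d = (B ∩ T A (y, d)).card := by
          intro B hB y hy d
          unfold chx
          rw [Set.ncard_eq_toFinset_card']
          refine Finset.card_bij (fun z _ => s(y, z)) ?_ ?_ ?_
          · intro z hz
            simp only [Set.mem_toFinset, Set.mem_ofPred_eq, Finset.mem_coe] at hz
            obtain ⟨ha, hzS, hzd⟩ := hz
            have h2 := (Gr_adj.1 ha).1
            grind
          · grind
          · intro e he
            obtain ⟨heB, heT⟩ := Finset.mem_inter.1 he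
            obtain ⟨z, hz, rfl⟩ := Finset.mem_image.1 heT
            simp only [Finset.mem_filter, Finset.mem_univ, true_and] at hz
            refine ⟨z, ?_, rfl⟩
            simp only [Set.mem_toFinset, Set.mem_ofPred_eq, Finset.mem_coe]
            refine ⟨Gr_adj.2 ⟨Finset.mem_union_right _ heB, ?_⟩, hz.1, ?_⟩
            all_goals grind
        have hexp : 0 ≤ Real.exp (∑ d ∈ Finset.range D₁, (p - N₀ d * p)) ^ D.card := by positivity
        by_cases hΓA : Γ ⊆ A
        · rw [if_pos hΓA, one_mul]
          by_cases hsA : stats A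
          · refine le_trans (Exs_mono h0 h1 fun B hB => ?_) (inner A hsA)
            refine ind_le_of (Finset.prod_nonneg fun i _ => ind_nonneg _) fun h => ?_
            refine (Finset.prod_eq_one fun i hi => ind_pos ?_).ge
            grind
          · refine le_trans (Exs_mono (g := fun _ => 0) h0 h1 fun B hB => ?_) ?_
            · exact (ind_neg fun h => hsA (hst B hB h.2.2)).le
            · rw [Exs_const]; exact hexp
        · rw [if_neg hΓA, zero_mul]
          refine le_trans (Exs_mono (g := fun _ => 0) h0 h1 fun B hB => ?_) (Exs_const _).le
          refine (ind_neg fun h => hΓA fun e he => ?_).le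
          have h2 := h.1 e he
          have h3 : e ∈ A ∪ B := by
            induction e using Sym2.ind with
            | _ u v => exact (Gr_adj.1 h2).1
          grind
    _ = _ := by rw [Exs_mul_const, Exs_superset_one hΓE]


/-! ### Twin paths -/

/-- A relation without isolated points has a matched set containing at least half the points. -/
lemma exists_half_dominated {V : Type} [DecidableEq V] (U : Finset V) (R : V → V → Prop)
    (hs : ∀ u v, R u v → R v u) (hU : ∀ u ∈ U, ∃ v ∈ U, R u v) (hirr : ∀ u ∈ U, ¬ R u u) :
    ∃ D ⊆ U, U.card ≤ 2 * D.card ∧ ∃ π : V → V, ∀ y ∈ D, π y ∈ U ∧ π y ∉ D ∧ R y (π y) := by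
  classical
  have hne : (U.powerset.filter fun I => ∀ u ∈ I, ∀ v ∈ I, ¬ R u v).Nonempty := ⟨∅, by simp⟩
  obtain ⟨I, hI, hmax⟩ := Finset.exists_max_image _ Finset.card hne
  simp only [Finset.mem_filter, Finset.mem_powerset] at hI hmax
  have hout : ∀ u ∈ U \ I, ∃ v, v ∈ U ∧ v ∉ U \ I ∧ R u v := by
    intro u hu
    obtain ⟨huU, huI⟩ := Finset.mem_sdiff.1 hu
    by_contra hcon
    push Not at hcon
    have hno : ∀ v ∈ I, ¬ R u v := fun v hv => hcon v (hI.1 hv) (by simp [hv])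
    have := hmax (insert u I) ⟨Finset.insert_subset huU hI.1, ?_⟩
    all_goals grind
  have hin : ∀ u ∈ I, ∃ v, v ∈ U ∧ v ∉ I ∧ R u v := by grind
  have hfin : ∀ D : Finset V, (∀ u ∈ D, ∃ v, v ∈ U ∧ v ∉ D ∧ R u v) →
      ∃ π : V → V, ∀ y ∈ D, π y ∈ U ∧ π y ∉ D ∧ R y (π y) := by
    intro D hD
    refine ⟨fun y => if h : y ∈ D then (hD y h).choose else y, fun y hy => ?_⟩
    simp only [hy, dif_pos]
    exact (hD y hy).choose_spec
  by_cases hc : U.card ≤ 2 * I.card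
  · exact ⟨I, hI.1, hc, hfin I hin⟩
  · refine ⟨U \ I, Finset.sdiff_subset, ?_, hfin _ hout⟩
    rw [Finset.card_sdiff_of_subset hI.1]
    omega

section Paths

variable {V : Type} [DecidableEq V] {x x' : ℕ → V} {w : ℕ}

/-- The edges of the path `x 0, …, x w`. -/
def pathE (x : ℕ → V) (w : ℕ) : Finset (Sym2 V) :=
  (Finset.range w).image fun i => s(x i, x (i + 1))

/-- The vertices of the path `x 0, …, x w`. -/
def pathV (x : ℕ → V) (w : ℕ) : Finset V := (Finset.range (w + 1)).image x

lemma mem_pathV {v : V} : v ∈ pathV x w ↔ PVert x w v := by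
  simp only [pathV, Finset.mem_image, Finset.mem_range, PVert]
  grind

lemma mem_pathE {u v : V} : s(u, v) ∈ pathE x w ↔ PEdge x w u v := by
  simp only [pathE, Finset.mem_image, Finset.mem_range, PEdge]
  grind

omit [DecidableEq V] in
lemma pathE_injOn (hx : Set.InjOn x (Set.Iic w)) :
    Set.InjOn (fun i => s(x i, x (i + 1))) (Finset.range w) := by
  intro i hi j hj hij
  have hi' : i < w := by simpa using hi
  have hj' : j < w := by simpa using hj
  rcases Sym2.eq_iff.1 hij with ⟨h, -⟩ | ⟨h, h'⟩
  · exact hx (Set.mem_Iic.2 (by omega)) (Set.mem_Iic.2 (by omega)) h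
  · have e1 := hx (Set.mem_Iic.2 (by omega)) (Set.mem_Iic.2 (by omega)) h
    have e2 := hx (Set.mem_Iic.2 (by omega)) (Set.mem_Iic.2 (by omega)) h'
    omega

lemma card_pathE (hx : Set.InjOn x (Set.Iic w)) : (pathE x w).card = w := by
  rw [pathE, Finset.card_image_of_injOn (pathE_injOn hx), Finset.card_range]

omit [DecidableEq V] in
lemma pathV_injOn (hx : Set.InjOn x (Set.Iic w)) : Set.InjOn x (Finset.range (w + 1)) :=
  hx.mono fun i hi => by simpa [Nat.lt_succ_iff] using hi

/-- Counting the values of an injection outside a set. -/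
lemma card_image_sdiff {ι : Type} {s : Finset ι} {f : ι → V} (hf : Set.InjOn f s) (T : Finset V) :
    (s.image f \ T).card = (s.filter fun i => f i ∉ T).card := by
  rw [← Finset.filter_notMem_eq_sdiff, Finset.filter_image,
    Finset.card_image_of_injOn (hf.mono fun i hi => (Finset.mem_filter.1 hi).1)]

lemma card_pathV (hx : Set.InjOn x (Set.Iic w)) : (pathV x w).card = w + 1 := by
  rw [pathV, Finset.card_image_of_injOn (pathV_injOn hx), Finset.card_range]

open Classical in
lemma prod_stepWt_eq (hx' : Set.InjOn x' (Set.Iic w)) (p b : ℝ) :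
    (∏ i ∈ Finset.range w, stepWt x w p b (x' i) (x' (i + 1))) * (if x' 0 ∈ pathV x w then 1 else b)
      = p ^ (pathE x' w \ pathE x w).card * b ^ (pathV x' w \ pathV x w).card := by
  simp only [stepWt]
  rw [Finset.prod_mul_distrib, mul_assoc]
  congr 1
  · rw [Finset.prod_ite, Finset.prod_const_one, one_mul, Finset.prod_const, pathE,
      card_image_sdiff (pathE_injOn hx')]
    simp only [mem_pathE]
  · simp only [mem_pathV]
    rw [← Finset.prod_range_succ' (fun i => if PVert x w (x' i) then (1 : ℝ) else b),
      Finset.prod_ite, Finset.prod_const_one, one_mul, Finset.prod_const, pathV,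
      card_image_sdiff (pathV_injOn hx')]
    simp only [mem_pathV]

end Paths

open Classical in
/-- The probability that two given paths are present and have matching profiles off `B`. -/
lemma Pg_twin_path_le {n : ℕ} {p b : ℝ} (h0 : 0 ≤ p) (hp : p ≤ 1 / 2) (hb0 : 0 < b) (hb1 : b ≤ 1)
    {D₁ : ℕ} {N₀ : ℕ → ℕ} (hN : ∀ d < D₁, N₀ d * p ≤ 1)
    (hθ : Real.exp (∑ d ∈ Finset.range D₁, (p - N₀ d * p)) ≤ b ^ 2) {w : ℕ} {x x' : ℕ → Fin n}
    (hx : Set.InjOn x (Set.Iic w)) (hx' : Set.InjOn x' (Set.Iic w))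
    (hne : ∀ j, 0 < j → j < w → x j ≠ x' j) (B : Finset ℕ) :
    Pg n p (fun G => IP G w x ∧ IP G w x' ∧
      (∀ j, 0 < j → j < w → j ∉ B → ∀ d < D₁,
        chx G (pathV x w ∪ pathV x' w : Finset (Fin n)) (x j) d
          = chx G (pathV x w ∪ pathV x' w : Finset (Fin n)) (x' j) d) ∧
      ∀ d < D₁, N₀ d ≤ {z | z ∉ ((pathV x w ∪ pathV x' w : Finset (Fin n)) : Set (Fin n)) ∧
        dgi G ((pathV x w ∪ pathV x' w : Finset (Fin n)) : Set (Fin n))ᶜ z = d}.ncard)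
      ≤ (1 / b) ^ (2 * B.card + 4) * (p ^ w * b ^ (w + 1) *
        ((∏ i ∈ Finset.range w, stepWt x w p b (x' i) (x' (i + 1))) *
          (if x' 0 ∈ pathV x w then 1 else b))) := by
  have h1 : p ≤ 1 := by linarith
  set S := pathV x w ∪ pathV x' w with hS
  set Γ := pathE x w ∪ pathE x' w with hΓ
  set J := (Finset.range (w + 1)).filter fun j => 0 < j ∧ j < w ∧ j ∉ B with hJ
  set U := J.image x ∪ J.image x' with hU
  have hUS : U ⊆ S := by
    intro v hv
    rcases Finset.mem_union.1 hv with hv | hv <;> obtain ⟨j, hj, rfl⟩ := Finset.mem_image.1 hv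
    · exact Finset.mem_union_left _ (Finset.mem_image_of_mem _ (Finset.mem_filter.1 hj).1)
    · exact Finset.mem_union_right _ (Finset.mem_image_of_mem _ (Finset.mem_filter.1 hj).1)
  have hSU : S.card ≤ U.card + (2 * B.card + 4) := by
    set K := B ∪ {0, w} with hK
    have hKc : K.card ≤ B.card + 2 :=
      (Finset.card_union_le _ _).trans (Nat.add_le_add_left Finset.card_le_two _)
    have hsub : S ⊆ U ∪ (K.image x ∪ K.image x') := by
      intro v hv
      have hjk : ∀ j ∈ Finset.range (w + 1), j ∈ J ∨ j ∈ K := by grind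
      rcases Finset.mem_union.1 hv with hv | hv <;> obtain ⟨j, hj, rfl⟩ := Finset.mem_image.1 hv <;>
        rcases hjk j hj with h | h
      all_goals grind
    have e1 := Finset.card_le_card hsub
    grind
  obtain ⟨D, hDU, hDc, π, hπ⟩ := exists_half_dominated U
    (fun u v => ∃ j ∈ J, (u = x j ∧ v = x' j) ∨ (u = x' j ∧ v = x j))
    (fun u v ⟨j, hj, h⟩ => ⟨j, hj, by tauto⟩)
    (by
      intro u hu
      rcases Finset.mem_union.1 hu with hv | hv <;> obtain ⟨j, hj, rfl⟩ := Finset.mem_image.1 hv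
      · grind
      · exact ⟨x j, Finset.mem_union_left _ (Finset.mem_image_of_mem _ hj), j, hj,
          Or.inr ⟨rfl, rfl⟩⟩)
    (by
      rintro u hu ⟨j, hj, h | h⟩
      · grind
      · exact hne j (Finset.mem_filter.1 hj).2.1 (Finset.mem_filter.1 hj).2.2.1
          (h.2.symm.trans h.1))
  have hΓS : ∀ e ∈ Γ, e ∈ edges n ∧ ∀ v ∈ e, v ∈ S := by
    have hg : ∀ y : ℕ → Fin n, Set.InjOn y (Set.Iic w) → pathV y w ⊆ S → ∀ e ∈ pathE y w,
        e ∈ edges n ∧ ∀ v ∈ e, v ∈ S := by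
      intro y hy hyS e he
      obtain ⟨i, hi, rfl⟩ := Finset.mem_image.1 he
      have hi' := Finset.mem_range.1 hi
      refine ⟨mk_mem_edges.2 fun h => ?_, fun v hv => hyS ?_⟩
      · have := hy (Set.mem_Iic.2 (by omega)) (Set.mem_Iic.2 (by omega)) h
        omega
      · rcases Sym2.mem_iff.1 hv with rfl | rfl
        · exact Finset.mem_image_of_mem _ (Finset.mem_range.2 (by omega))
        · exact Finset.mem_image_of_mem _ (Finset.mem_range.2 (by omega))
    grind
  have hmain := Pg_twin_le h0 hp S Γ hΓS D (hDU.trans hUS) π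
    (fun y hy => ⟨hUS (hπ y hy).1, (hπ y hy).2.1⟩) D₁ N₀ hN
  refine (Pg_mono h0 h1 ?_).trans (hmain.trans ?_)
  · rintro G ⟨hG, hG', hchi, hst⟩
    refine ⟨fun e he => ?_, fun y hy d hd => ?_, hst⟩
    · rcases Finset.mem_union.1 he with he | he <;> obtain ⟨i, hi, rfl⟩ := Finset.mem_image.1 he
      · exact hG.1 i (Finset.mem_range.1 hi)
      · exact hG'.1 i (Finset.mem_range.1 hi)
    · grind
  · rw [prod_stepWt_eq hx']
    have hΓc : Γ.card = w + (pathE x' w \ pathE x w).card := by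
      rw [hΓ, ← Finset.union_sdiff_self_eq_union, Finset.card_union_of_disjoint
        Finset.disjoint_sdiff, card_pathE hx]
    have hSc : S.card = w + 1 + (pathV x' w \ pathV x w).card := by
      rw [hS, ← Finset.union_sdiff_self_eq_union, Finset.card_union_of_disjoint
        Finset.disjoint_sdiff, card_pathV hx]
    have e1 : Real.exp (∑ d ∈ Finset.range D₁, (p - N₀ d * p)) ^ D.card ≤ b ^ U.card :=
      calc _ ≤ (b ^ 2) ^ D.card := pow_le_pow_left₀ (Real.exp_nonneg _) hθ _
        _ = b ^ (2 * D.card) := by rw [pow_mul]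
        _ ≤ _ := pow_le_pow_of_le_one hb0.le hb1 hDc
    have e2 : b ^ U.card ≤ (1 / b) ^ (2 * B.card + 4) * b ^ S.card := by
      rw [one_div, inv_pow, ← div_eq_inv_mul, le_div_iff₀ (by positivity), ← pow_add]
      exact pow_le_pow_of_le_one hb0.le hb1 hSU
    calc p ^ Γ.card * Real.exp (∑ d ∈ Finset.range D₁, (p - N₀ d * p)) ^ D.card
        ≤ p ^ Γ.card * ((1 / b) ^ (2 * B.card + 4) * b ^ S.card) :=
          mul_le_mul_of_nonneg_left (e1.trans e2) (by positivity)
      _ = _ := by rw [hΓc, hSc, pow_add, pow_add]; ring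


/-! ### Counting twin paths -/

lemma IP.congr {V : Type} {G : SimpleGraph V} {w : ℕ} {x y : ℕ → V} (h : IP G w x)
    (hxy : ∀ i ≤ w, x i = y i) : IP G w y := by
  refine ⟨fun i hi => ?_, fun i hi j hj hij => ?_⟩
  · rw [← hxy i hi.le, ← hxy (i + 1) hi]; exact h.1 i hi
  · rw [← hxy i hi, ← hxy j hj] at hij
    exact h.2 hi hj hij

/-- A small set of indices is covered by the values of some function. -/
lemma exists_cover_fun {e w : ℕ} (B : Finset ℕ) (hB : B ⊆ Finset.range (w + 1)) (hc : B.card ≤ e) :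
    ∃ f : Fin e → Fin (w + 2), ∀ j ∈ B, j ∈ Finset.univ.image fun i => (f i : ℕ) := by
  classical
  obtain ⟨φ⟩ : Nonempty (B ↪ Fin e) := Function.Embedding.nonempty_of_card_le (by simpa using hc)
  refine ⟨Function.extend φ (fun b => ⟨b, by have := Finset.mem_range.1 (hB b.2); omega⟩)
    fun _ => Fin.last _, fun j hj => Finset.mem_image.2 ⟨φ ⟨j, hj⟩, Finset.mem_univ _, ?_⟩⟩
  rw [φ.injective.extend_apply]

/-- The graph has few short cycles and its degree profile stays rich off small sets. -/
structure Nice {n : ℕ} (M E D₁ : ℕ) (N₀ : ℕ → ℕ) (G : SimpleGraph (Fin n)) : Prop where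
  excess : ∀ S, Cn G S → S.ncard ≤ M → ein G S ≤ S.ncard + E
  rich : ∀ S : Set (Fin n), S.ncard ≤ M → ∀ d < D₁, N₀ d ≤ {z | z ∉ S ∧ dgi G Sᶜ z = d}.ncard

/-- Numerical conditions for counting twin paths of length `w`. -/
structure TwinParams (n : ℕ) (p b : ℝ) (M E D₁ : ℕ) (N₀ : ℕ → ℕ) (w : ℕ) : Prop where
  h0 : 0 ≤ p
  hp : p ≤ 1 / 2
  hb0 : 0 < b
  hb1 : b ≤ 1
  hN : ∀ d < D₁, N₀ d * p ≤ 1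
  hθ : Real.exp (∑ d ∈ Finset.range D₁, (p - N₀ d * p)) ≤ b ^ 2
  hM : 2 * (w + 1) + (2 * E + 5) ≤ M
  hnb : n * (p * b) ≤ 1
  hε : 8 * p * (w + 1) ^ 3 ≤ 1

/-- The constant in the bound for the probability of twin paths of length `w`. -/
noncomputable def twinC (b : ℝ) (E w : ℕ) : ℝ :=
  (w + 2) ^ (16 * E + 34) * (1 / b) ^ (2 * (16 * E + 34) + 4)

section

variable {n : ℕ} {p b : ℝ} {M E D₁ : ℕ} {N₀ : ℕ → ℕ} {w : ℕ}

open Classical in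
/-- The weight of a second path `x'` twin to the path `x`. -/
noncomputable def twinWt (p b : ℝ) (w : ℕ) (x x' : ℕ → Fin n) : ℝ :=
  (∏ i ∈ Finset.range w, stepWt x w p b (x' i) (x' (i + 1))) * if x' 0 ∈ pathV x w then 1 else b

lemma twinWt_nonneg (h0 : 0 ≤ p) (hb0 : 0 ≤ b) (x x' : ℕ → Fin n) : 0 ≤ twinWt p b w x x' :=
  mul_nonneg (Finset.prod_nonneg fun _ _ => stepWt_nonneg h0 hb0 _ _) (by split <;> positivity)

open Classical in
lemma Pg_twin_le_weight (H : TwinParams n p b M E D₁ N₀ w) {x x' : ℕ → Fin n}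
    (hx : Set.InjOn x (Set.Iic w)) (hx' : Set.InjOn x' (Set.Iic w))
    (hne : ∀ j, 0 < j → j < w → x j ≠ x' j) :
    Pg n p (fun G => Nice M E D₁ N₀ G ∧ IP G w x ∧ IP G w x' ∧ ∀ i ≤ w, col G (x i) = col G (x' i))
      ≤ twinC b E w * (p * b) ^ w * twinWt p b w x x' := by
  obtain ⟨h0, hp, hb0, hb1, hN, hθ, hM, -, -⟩ := H
  have hW := twinWt_nonneg (w := w) h0 hb0.le x x'
  refine (Pg_exists_le h0 (by linarith) (Finset.univ : Finset (Fin (16 * E + 34) → Fin (w + 2)))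
    (fun f G => IP G w x ∧ IP G w x' ∧
      (∀ j, 0 < j → j < w → j ∉ Finset.univ.image (fun i => (f i : ℕ)) → ∀ d < D₁,
        chx G (pathV x w ∪ pathV x' w : Finset (Fin n)) (x j) d
          = chx G (pathV x w ∪ pathV x' w : Finset (Fin n)) (x' j) d) ∧
      ∀ d < D₁, N₀ d ≤ {z | z ∉ ((pathV x w ∪ pathV x' w : Finset (Fin n)) : Set (Fin n)) ∧
        dgi G ((pathV x w ∪ pathV x' w : Finset (Fin n)) : Set (Fin n))ᶜ z = d}.ncard)
    ?_).trans ?_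
  · rintro G ⟨hnice, hG, hG', hcol⟩
    have hS : ((pathV x w ∪ pathV x' w : Finset (Fin n)) : Set (Fin n))
        = x '' Set.Iic w ∪ x' '' Set.Iic w := by
      ext v
      simp only [Finset.coe_union, Set.mem_union, Finset.mem_coe, mem_pathV, Set.mem_image,
        Set.mem_Iic, PVert, eq_comm]
    obtain ⟨B, hB, hBc, hgood⟩ := exists_good_indices hnice.excess hG hG' hS hM hcol
    obtain ⟨f, hf⟩ := exists_cover_fun B hB hBc
    refine ⟨f, Finset.mem_univ _, hG, hG', fun j hj hjw hjf d _ =>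
      (hgood j hjw.le fun h => hjf (hf j h)).2.2 d, hnice.rich _ ?_⟩
    rw [Set.ncard_coe_finset]
    have := Finset.card_union_le (pathV x w) (pathV x' w)
    rw [card_pathV hx, card_pathV hx'] at this
    omega
  · refine (Finset.sum_le_sum fun f _ => (Pg_twin_path_le h0 hp hb0 hb1 hN hθ hx hx' hne _).trans
      (?_ : _ ≤ (1 / b) ^ (2 * (16 * E + 34) + 4) * (p ^ w * b ^ w * twinWt p b w x x'))).trans ?_
    · have h1 : (Finset.univ.image fun i => (f i : ℕ)).card ≤ 16 * E + 34 :=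
        Finset.card_image_le.trans (by simp)
      have h2 : b ^ (w + 1) ≤ b ^ w := pow_le_pow_of_le_one hb0.le hb1 (by omega)
      have h3 : 1 ≤ 1 / b := by rw [le_div_iff₀ hb0]; linarith
      change _ * (_ * twinWt p b w x x') ≤ _
      gcongr
    · rw [Finset.sum_const, nsmul_eq_mul, Finset.card_univ, Fintype.card_fun, Fintype.card_fin,
        Fintype.card_fin, twinC]
      push_cast
      exact le_of_eq (by ring)

open Classical in
lemma Pg_twin_sum_le (H : TwinParams n p b M E D₁ N₀ w) (Q : (ℕ → Fin n) → (ℕ → Fin n) → Prop)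
    (hQ : ∀ x y x' y', (∀ i ≤ w, x i = y i) → (∀ i ≤ w, x' i = y' i) → Q x x' → Q y y')
    (hQne : ∀ x x', Q x x' → ∀ j, 0 < j → j < w → x j ≠ x' j) {C : ℝ} (hC0 : 0 ≤ C)
    (hC : ∀ x, Set.InjOn x (Set.Iic w) →
      sumSeq w (fun x' => if Q x x' ∧ Set.InjOn x' (Set.Iic w) then twinWt p b w x x' else 0) ≤ C) :
    Pg n p (fun G => Nice M E D₁ N₀ G ∧ ∃ x x', Q x x' ∧ IP G w x ∧ IP G w x' ∧
        ∀ i ≤ w, col G (x i) = col G (x' i))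
      ≤ twinC b E w * (n * (n * (p * b)) ^ w * C) := by
  have h0 := H.h0
  have h1 : p ≤ 1 := by linarith [H.hp]
  have hb0 := H.hb0
  set T : (ℕ → Fin n) → (ℕ → Fin n) → SimpleGraph (Fin n) → Prop := fun x x' G =>
    Nice M E D₁ N₀ G ∧ Q x x' ∧ IP G w x ∧ IP G w x' ∧ ∀ i ≤ w, col G (x i) = col G (x' i) with hT
  have hTc : ∀ x y x' y' G, (∀ i ≤ w, x i = y i) → (∀ i ≤ w, x' i = y' i) → T x x' G →
      T y y' G := by
    rintro x y x' y' G h h' ⟨t1, t2, t3, t4, t5⟩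
    refine ⟨t1, hQ x y x' y' h h' t2, t3.congr h, t4.congr h', fun i hi => ?_⟩
    rw [← h i hi, ← h' i hi]; exact t5 i hi
  set K : ℝ := twinC b E w * (p * b) ^ w with hK
  have hK0 : 0 ≤ K := by rw [hK, twinC]; positivity
  have step : ∀ x x', Pg n p (T x x') ≤ K * if Q x x' ∧ Set.InjOn x' (Set.Iic w) then
      twinWt p b w x x' else 0 := by
    intro x x'
    have hW := twinWt_nonneg (w := w) h0 hb0.le x x'
    by_cases h : Set.InjOn x (Set.Iic w) ∧ Q x x' ∧ Set.InjOn x' (Set.Iic w)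
    · rw [if_pos h.2]
      exact (Pg_mono h0 h1 fun G t => ⟨t.1, t.2.2⟩).trans
        (Pg_twin_le_weight H h.1 h.2.2 (hQne x x' h.2.1))
    · refine (Pg_mono (Q := fun _ => False) h0 h1 ?_).trans ?_
      · rintro G ⟨-, t2, t3, t4, -⟩; exact h ⟨t3.2, t2, t4.2⟩
      · unfold Pg Eg; simp only [ind_neg not_false]; rw [Exs_const]
        split <;> positivity
  refine (Pg_exists_seq_le h0 h1 w (fun x G => ∃ x', T x x' G) ?_ ?_).trans ?_
  · rintro x y G hxy ⟨x', hx'⟩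
    exact ⟨x', hTc _ _ _ _ _ hxy (fun _ _ => rfl) hx'⟩
  · rintro G ⟨hn, x, x', h⟩
    exact ⟨x, x', hn, h⟩
  · refine (sumSeq_mono (F' := fun _ => K * C) fun x => ?_).trans (le_of_eq ?_)
    · by_cases hx : Set.InjOn x (Set.Iic w)
      · refine (Pg_exists_seq_le h0 h1 w (T x)
          (fun y y' G hy => hTc _ _ _ _ _ (fun _ _ => rfl) hy) (fun G h => h)).trans
          ((sumSeq_mono (step x)).trans ?_)
        rw [sumSeq_const_mul]
        exact mul_le_mul_of_nonneg_left (hC x hx) hK0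
      · refine (Pg_mono (Q := fun _ => False) h0 h1 ?_).trans ?_
        · rintro G ⟨x', t⟩; exact hx t.2.2.1.2
        · unfold Pg Eg; simp only [ind_neg not_false]; rw [Exs_const]
          positivity
    · rw [sumSeq_const, Fintype.card_fin, hK, mul_pow (n : ℝ), pow_succ]
      ring

open Classical in
lemma seqWt_one_eq {x x' : ℕ → Fin n} (hx' : Set.InjOn x' (Set.Iic w)) (u : Fin n)
    (hu : 0 < w → x' 1 ≠ u) (t : Fin n → ℝ) :
    seqWt (stepWt x w p b) t w u x'
      = (∏ i ∈ Finset.range w, stepWt x w p b (x' i) (x' (i + 1))) * t (x' w) :=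
  seqWt_eq w u x' hu fun i hi h => by
    have := hx' (Set.mem_Iic.2 hi) (Set.mem_Iic.2 (by omega)) h
    omega

lemma seqWt_nonneg {V : Type} [DecidableEq V] {s : V → V → ℝ} {t : V → ℝ}
    (hs : ∀ u v, 0 ≤ s u v) (ht : ∀ v, 0 ≤ t v) : ∀ r u (y : ℕ → V), 0 ≤ seqWt s t r u y
  | 0, _, _ => ht _
  | r + 1, _, _ => mul_nonneg (by split; exacts [hs _ _, le_rfl]) (seqWt_nonneg hs ht r _ _)

open Classical in
lemma sum_twin_le_EA (h0 : 0 ≤ p) (hb0 : 0 < b)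
    (hnb : n * (p * b) ≤ 1) (hε : 8 * p * (w + 1) ^ 3 ≤ 1) {x : ℕ → Fin n}
    (hx : Set.InjOn x (Set.Iic w)) :
    sumSeq w (fun x' => if Set.InjOn x' (Set.Iic w) then twinWt p b w x x' else 0)
      ≤ n * b * (1 + 8 * p * (w + 1) ^ 3) + 8 * (w + 1) ^ 2 := by
  have hbd := walkSum_bounds (V := Fin n) hx h0 hb0.le (by simpa using hnb) hε le_rfl
  have hA : ∀ v, sumFrom w v (fun x' => if Set.InjOn x' (Set.Iic w) then twinWt p b w x x' else 0)
      ≤ b * (1 + 8 * p * (w + 1) ^ 3) + if PVert x w v then 8 * (w + 1 : ℝ) else 0 := by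
    intro v
    refine (sumFrom_mono (F' := fun x' => (if PVert x w v then 1 else b) *
      seqWt (stepWt x w p b) 1 w v x') fun x' hv => ?_).trans ?_
    · by_cases hx' : Set.InjOn x' (Set.Iic w)
      · rw [if_pos hx', seqWt_one_eq hx', twinWt, hv]
        · simp only [mem_pathV, Pi.one_apply, mul_one]
          rw [mul_comm]
        · intro hw h
          rw [← hv] at h
          have := hx' (Set.mem_Iic.2 hw) (Set.mem_Iic.2 (Nat.zero_le _)) h
          omega
      · rw [if_neg hx']
        refine mul_nonneg (by split <;> positivity) ?_
        exact seqWt_nonneg (stepWt_nonneg h0 hb0.le) (fun _ => zero_le_one) _ _ _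
    · rw [sumFrom_const_mul, sumFrom_seqWt]
      by_cases hv : PVert x w v
      · rw [if_pos hv, if_pos hv, one_mul]
        have := hbd.2.1 v v hv
        have : 0 ≤ b * (1 + 8 * p * (w + 1 : ℝ) ^ 3) := by positivity
        linarith
      · rw [if_neg hv, if_neg hv, add_zero]
        have h1 := hbd.1 v v hv
        have h2 : 8 * p * (w + 1 : ℝ) ^ 2 * w ≤ 8 * p * (w + 1) ^ 3 := by
          have : 8 * p * (w + 1 : ℝ) ^ 3 = 8 * p * (w + 1) ^ 2 * w + 8 * p * (w + 1) ^ 2 := by ring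
          rw [this]
          have : 0 ≤ 8 * p * (w + 1 : ℝ) ^ 2 := by positivity
          linarith
        nlinarith
  refine (Finset.sum_le_sum fun v _ => hA v).trans ?_
  rw [Finset.sum_add_distrib, Finset.sum_const, ← Finset.sum_filter, Finset.sum_const,
    Finset.card_univ, Fintype.card_fin, nsmul_eq_mul, nsmul_eq_mul]
  have h3 : ((Finset.univ.filter (PVert x w)).card : ℝ) ≤ w + 1 := by
    exact_mod_cast card_PVert_le x w
  have h4 := mul_le_mul_of_nonneg_right h3 (show (0 : ℝ) ≤ 8 * (w + 1) by positivity)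
  nlinarith

open Classical in
lemma sum_twin_le_EB (h0 : 0 ≤ p) (hb0 : 0 < b) (hw : 0 < w)
    (hnb : n * (p * b) ≤ 1) (hε : 8 * p * (w + 1) ^ 3 ≤ 1) {x : ℕ → Fin n}
    (hx : Set.InjOn x (Set.Iic w)) :
    sumSeq w (fun x' => if (x 0 = x' 0 ∧ x w = x' w ∧ x 1 ≠ x' 1) ∧ Set.InjOn x' (Set.Iic w) then
        twinWt p b w x x' else 0)
      ≤ 8 * p * (w + 1) ^ 3 := by
  have hear := walkSum_ear (V := Fin n) hx h0 hb0.le (by simpa using hnb) hε hw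
  set t : Fin n → ℝ := fun z => if PVert x w z then 1 else 0 with ht
  have hA : ∀ v, sumFrom w v (fun x' =>
      if (x 0 = x' 0 ∧ x w = x' w ∧ x 1 ≠ x' 1) ∧ Set.InjOn x' (Set.Iic w) then
        twinWt p b w x x' else 0)
      ≤ if v = x 0 then walkSum (stepWt x w p b) t w (x 1) (x 0) else 0 := by
    intro v
    by_cases hv : v = x 0
    · subst hv
      rw [if_pos rfl, ← sumFrom_seqWt]
      refine sumFrom_mono fun x' hv' => ?_
      split
      · rename_i h
        rw [twinWt, seqWt_one_eq h.2 _ (fun _ => h.1.2.2.symm), ht, ← h.1.2.1, ← h.1.1]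
        have e1 : x 0 ∈ pathV x w := mem_pathV.2 ⟨0, Nat.zero_le _, rfl⟩
        have e2 : PVert x w (x w) := ⟨w, le_rfl, rfl⟩
        rw [if_pos e1]
        dsimp only
        rw [if_pos e2]
      · exact seqWt_nonneg (stepWt_nonneg h0 hb0.le)
          (fun z => by simp only [ht]; split <;> norm_num) _ _ _
    · rw [if_neg hv]
      refine (sumFrom_mono (F' := fun _ => 0) fun x' hv' => ?_).trans
        (by rw [sumFrom_const, mul_zero])
      rw [if_neg]
      rintro ⟨⟨h, -⟩, -⟩
      exact hv (by rw [← hv', h])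
  refine (Finset.sum_le_sum fun v _ => hA v).trans ?_
  rw [Finset.sum_ite_eq' Finset.univ (x 0)]
  simpa using hear

lemma Pg_noEA_le (H : TwinParams n p b M E D₁ N₀ w) :
    Pg n p (fun G => Nice M E D₁ N₀ G ∧ ¬ NoEA G w)
      ≤ twinC b E w * (n * (n * (p * b)) ^ w * (2 * n + 8 * (w + 1) ^ 2)) := by
  classical
  obtain ⟨Q, hQ⟩ : ∃ Q : (ℕ → Fin n) → (ℕ → Fin n) → Prop, ∀ x x', Q x x' ↔ ∀ i ≤ w, x i ≠ x' i :=
    ⟨_, fun _ _ => Iff.rfl⟩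
  have h0 := H.h0
  have hb0 := H.hb0
  refine (Pg_mono h0 (by linarith [H.hp]) ?_).trans
    (Pg_twin_sum_le H Q ?_ ?_ (by positivity) fun x hx => ?_)
  · rintro G ⟨hn, h⟩
    unfold NoEA at h
    push Not at h
    obtain ⟨x, x', h1, h2, h3, h4⟩ := h
    exact ⟨hn, x, x', (hQ _ _).2 h4, h1, h2, h3⟩
  · intro x y x' y' hx hx' h
    refine (hQ _ _).2 fun i hi => ?_
    rw [← hx i hi, ← hx' i hi]; exact (hQ _ _).1 h i hi
  · intro x x' h j _ hj; exact (hQ _ _).1 h j hj.le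
  · refine (sumSeq_mono fun x' => ?_).trans ((sum_twin_le_EA h0 hb0 H.hnb H.hε hx).trans ?_)
    · have := twinWt_nonneg (w := w) h0 hb0.le x x'
      by_cases h2 : Set.InjOn x' (Set.Iic w)
      · rw [if_pos h2]
        split <;> linarith
      · rw [if_neg h2, if_neg fun h => h2 h.2]
    · have h2 : (n : ℝ) * b * (1 + 8 * p * (w + 1) ^ 3) ≤ n * 1 * 2 := by
        gcongr
        · exact H.hb1
        · linarith [H.hε]
      linarith

lemma Pg_noEB_le (H : TwinParams n p b M E D₁ N₀ w) (hw : 2 ≤ w) :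
    Pg n p (fun G => Nice M E D₁ N₀ G ∧ ∃ x x', (x 0 = x' 0 ∧ x w = x' w ∧
        ∀ i, 0 < i → i < w → x i ≠ x' i) ∧ IP G w x ∧ IP G w x' ∧
        ∀ i ≤ w, col G (x i) = col G (x' i))
      ≤ twinC b E w * (n * (n * (p * b)) ^ w * (8 * p * (w + 1) ^ 3)) := by
  classical
  have h0 := H.h0
  have hb0 := H.hb0
  refine Pg_twin_sum_le H (fun x x' => x 0 = x' 0 ∧ x w = x' w ∧ ∀ i, 0 < i → i < w → x i ≠ x' i)
    ?_ (fun x x' h => h.2.2) (by positivity) fun x hx => ?_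
  · rintro x y x' y' hx hx' ⟨h1, h2, h3⟩
    refine ⟨?_, ?_, fun i hi hiw => ?_⟩
    · rw [← hx 0 (Nat.zero_le _), ← hx' 0 (Nat.zero_le _)]; exact h1
    · rw [← hx w le_rfl, ← hx' w le_rfl]; exact h2
    · rw [← hx i hiw.le, ← hx' i hiw.le]; exact h3 i hi hiw
  · refine (sumSeq_mono fun x' => ?_).trans (sum_twin_le_EB h0 hb0 (by omega) H.hnb H.hε hx)
    have := twinWt_nonneg (w := w) h0 hb0.le x x'
    split
    · rename_i h
      obtain ⟨⟨q1, q2, q3⟩, q4⟩ := h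
      exact le_of_eq (if_pos ⟨⟨q1, q2, q3 1 one_pos (by omega)⟩, q4⟩).symm
    · split <;> linarith

end


/-! ### Degree statistics -/

section

variable {n : ℕ} {p : ℝ}

/-- The potential edges at `x` other than the one towards `y`. -/
def starE (x y : Fin n) : Finset (Sym2 (Fin n)) :=
  (Finset.univ.filter fun z => z ≠ x ∧ z ≠ y).image fun z => s(x, z)

lemma card_starE {x y : Fin n} (h : x ≠ y) : (starE x y).card = n - 2 := by
  unfold starE
  rw [Finset.card_image_of_injOn]
  · have : (Finset.univ.filter fun z : Fin n => z ≠ x ∧ z ≠ y) = Finset.univ \ {x, y} := by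
      ext z; simp
    rw [this, Finset.card_sdiff_of_subset (Finset.subset_univ _), Finset.card_pair h,
      Finset.card_univ, Fintype.card_fin]
  · intro a _ b _ hab
    exact Sym2.congr_right.1 hab

lemma starE_subset {x y : Fin n} : starE x y ⊆ (edges n).erase s(x, y) := by
  intro e he
  obtain ⟨z, hz, rfl⟩ := Finset.mem_image.1 he
  obtain ⟨hzx, hzy⟩ := (Finset.mem_filter.1 hz).2
  refine Finset.mem_erase.2 ⟨?_, mk_mem_edges.2 hzx.symm⟩
  intro h
  simp only [Sym2.eq_iff] at h
  grind

lemma disjoint_starE {x y : Fin n} (h : x ≠ y) : Disjoint (starE x y) (starE y x) := by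
  rw [Finset.disjoint_left]
  intro e he he'
  obtain ⟨z, hz, rfl⟩ := Finset.mem_image.1 he
  obtain ⟨z', hz', h'⟩ := Finset.mem_image.1 he'
  simp_all

lemma dg_Gr_eq {x y : Fin n} {A : Finset (Sym2 (Fin n))} (hA : A ⊆ (edges n).erase s(x, y)) :
    dg (Gr A) x = (A ∩ starE x y).card := by
  classical
  have hE : A ⊆ edges n := hA.trans (Finset.erase_subset _ _)
  have hxy : s(x, y) ∉ A := fun h => Finset.notMem_erase _ _ (hA h)
  have : (A ∩ starE x y) = ((Finset.univ.filter fun z => (Gr A).Adj x z)).image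
      fun z => s(x, z) := by
    ext e
    simp only [Finset.mem_inter, starE, Finset.mem_image, Finset.mem_filter, Finset.mem_univ,
      true_and]
    constructor
    · rintro ⟨h1, z, -, rfl⟩
      exact ⟨z, (Gr_adj' hE).2 h1, rfl⟩
    · rintro ⟨z, hz, rfl⟩
      refine ⟨(Gr_adj' hE).1 hz, z, ⟨hz.ne', ?_⟩, rfl⟩
      rintro rfl
      exact hxy ((Gr_adj' hE).1 hz)
  rw [this, Finset.card_image_of_injOn, dg, Set.ncard_eq_toFinset_card']
  all_goals simp_all

/-- The probability that a binomial variable with `n - 2` trials equals `d`. -/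
noncomputable def binW (n : ℕ) (p : ℝ) (d : ℕ) : ℝ :=
  (n - 2).choose d * (p ^ d * (1 - p) ^ (n - 2 - d))

lemma Pg_dg_ge (h0 : 0 ≤ p) (h1 : p ≤ 1) {x y : Fin n} (h : x ≠ y) (d : ℕ) :
    (1 - p) * binW n p d ≤ Pg n p (fun G => dg G x = d) := by
  have he : s(x, y) ∈ edges n := mk_mem_edges.2 h
  unfold Pg Eg
  conv_rhs => rw [← Finset.insert_erase he]
  rw [Exs_insert (Finset.notMem_erase _ _)]
  have e1 : Exs p ((edges n).erase s(x, y)) (fun A => ind (dg (Gr A) x = d)) = binW n p d := by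
    rw [Exs_congr (g := fun A => ind ((A ∩ starE x y).card = d)) fun A hA => by rw [dg_Gr_eq hA],
      Exs_marginal (S := starE x y) starE_subset fun A _ => by rw [Finset.inter_assoc,
        Finset.inter_self],
      Exs_congr (g := fun A => ind (A.card = d)) fun A hA => by
        rw [Finset.inter_eq_left.2 hA],
      Exs_card_eq, card_starE h, binW]
  rw [e1]
  have : 0 ≤ Exs p ((edges n).erase s(x, y)) (fun A => ind (dg (Gr (insert s(x, y) A)) x = d)) :=
    Exs_nonneg h0 h1 fun _ _ => ind_nonneg _
  nlinarith

lemma Pg_dg_dg_le (h0 : 0 ≤ p) (h1 : p ≤ 1) {x y : Fin n} (h : x ≠ y) (d : ℕ) :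
    Pg n p (fun G => dg G x = d ∧ dg G y = d) ≤ p + binW n p d ^ 2 := by
  have he : s(x, y) ∈ edges n := mk_mem_edges.2 h
  have hst : starE x y ∪ starE y x ⊆ (edges n).erase s(x, y) :=
    Finset.union_subset starE_subset (by rw [Sym2.eq_swap]; exact starE_subset)
  have hb : ∀ x y : Fin n, x ≠ y →
      Exs p (starE x y) (fun A => ind (A.card = d)) = binW n p d := fun x y h => by
    rw [Exs_card_eq, card_starE h, binW]
  have e1 : Exs p ((edges n).erase s(x, y)) (fun A => ind (dg (Gr A) x = d ∧ dg (Gr A) y = d))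
      = binW n p d ^ 2 := by
    rw [Exs_congr (g := fun A => ind ((A ∩ starE x y).card = d) * ind ((A ∩ starE y x).card = d))
        fun A hA => by rw [ind_and, dg_Gr_eq hA, dg_Gr_eq (x := y) (y := x) (by
          rw [Sym2.eq_swap]; exact hA)],
      Exs_marginal hst fun A _ => by
        rw [Finset.inter_assoc, Finset.inter_assoc, Finset.inter_eq_right.2
          Finset.subset_union_left, Finset.inter_eq_right.2 Finset.subset_union_right],
      Exs_indep (disjoint_starE h) (fun A => ind (A.card = d)) (fun A => ind (A.card = d)),
      hb x y h, hb y x h.symm, sq]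
  unfold Pg Eg
  conv_lhs => rw [← Finset.insert_erase he]
  rw [Exs_insert (Finset.notMem_erase _ _), e1]
  have h2 : Exs p ((edges n).erase s(x, y)) (fun A => ind (dg (Gr (insert s(x, y) A)) x = d ∧
      dg (Gr (insert s(x, y) A)) y = d)) ≤ 1 := by
    refine (Exs_mono (g := fun _ => 1) h0 h1 fun _ _ => ind_le_one _).trans ?_
    rw [Exs_const]
  nlinarith [sq_nonneg (binW n p d)]

/-- Chebyshev's inequality for the number of vertices of a given degree. -/
lemma Pg_degree_count_le (h0 : 0 ≤ p) (h1 : p ≤ 1) (hn : 2 ≤ n) {ε : ℝ} (hε : 0 < ε) (d : ℕ) :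
    Pg n p (fun G => (({z | dg G z = d}.ncard : ℕ) : ℝ) < (binW n p d - ε) * n)
      ≤ (n + 3 * n ^ 2 * p) / (ε * n) ^ 2 := by
  classical
  have hq1 : binW n p d ≤ 1 := by
    have h := Exs_mono (S := Finset.range (n - 2)) (f := fun A => ind (A.card = d))
      (g := fun _ => 1) h0 h1 fun _ _ => ind_le_one _
    rwa [Exs_card_eq, Exs_const, Finset.card_range] at h
  set q := binW n p d with hq
  have hq0 : 0 ≤ q := by
    have := sub_nonneg.2 h1
    rw [hq, binW]; positivity
  have hcnt : ∀ G : SimpleGraph (Fin n), (({z | dg G z = d}.ncard : ℕ) : ℝ)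
      = ∑ z, ind (dg G z = d) := by
    intro G
    rw [Set.ncard_eq_toFinset_card', Set.toFinset_ofPred, Finset.card_filter]
    push_cast
    exact Finset.sum_congr rfl fun z _ => by unfold ind; congr
  have hn0 : (0 : ℝ) < n := by exact_mod_cast (by omega)
  have hsq : ∀ G : SimpleGraph (Fin n), ((∑ z, ind (dg G z = d)) - n * q) ^ 2
      = (∑ x, ∑ y, ind (dg G x = d ∧ dg G y = d)) - (2 * n * q) * ∑ x, ind (dg G x = d)
        + (n * q) ^ 2 := by
    intro G
    rw [sub_sq, sq (∑ z, ind (dg G z = d)), Finset.sum_mul_sum]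
    simp only [ind_and]
    ring
  have hE : Eg n p (fun G => ((∑ z, ind (dg G z = d)) - n * q) ^ 2) ≤ n + 3 * n ^ 2 * p := by
    have e1 : Eg n p (fun G => ((∑ z, ind (dg G z = d)) - n * q) ^ 2)
        = (∑ x, ∑ y, Pg n p (fun G => dg G x = d ∧ dg G y = d))
          - (2 * n * q) * (∑ x, Pg n p (fun G => dg G x = d)) + (n * q) ^ 2 := by
      unfold Pg Eg
      simp only [hsq]
      rw [Exs_add, Exs_sub, Exs_const_mul, Exs_const, Exs_sum, Exs_sum]
      simp only [Exs_sum]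
    rw [e1]
    have e2 : ∀ x : Fin n, ∑ y, Pg n p (fun G => dg G x = d ∧ dg G y = d)
        ≤ 1 + n * (p + q ^ 2) := by
      intro x
      have : ∀ y : Fin n, Pg n p (fun G => dg G x = d ∧ dg G y = d)
          ≤ (if x = y then 1 else 0) + (p + q ^ 2) := by
        intro y
        split
        · have := Pg_le_one (n := n) (P := fun G => dg G x = d ∧ dg G y = d) h0 h1
          nlinarith [sq_nonneg q]
        · rename_i h
          rw [zero_add]; exact Pg_dg_dg_le h0 h1 h d
      refine (Finset.sum_le_sum fun y _ => this y).trans ?_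
      rw [Finset.sum_add_distrib, Finset.sum_ite_eq, if_pos (Finset.mem_univ _), Finset.sum_const,
        Finset.card_univ, Fintype.card_fin, nsmul_eq_mul]
    have e3 : ∀ x : Fin n, (1 - p) * q ≤ Pg n p (fun G => dg G x = d) := by
      intro x
      have : Nontrivial (Fin n) := Fin.nontrivial_iff_two_le.2 hn
      obtain ⟨y, hy⟩ := exists_ne x
      exact Pg_dg_ge h0 h1 hy.symm d
    have s2 := Finset.sum_le_sum fun x (_ : x ∈ Finset.univ) => e2 x
    have s3 := Finset.sum_le_sum fun x (_ : x ∈ Finset.univ) => e3 x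
    rw [Finset.sum_const, Finset.card_univ, Fintype.card_fin, nsmul_eq_mul] at s2 s3
    have s4 := mul_le_mul_of_nonneg_left s3 (show 0 ≤ 2 * n * q by positivity)
    have s5 : q ^ 2 ≤ 1 := pow_le_one₀ hq0 hq1
    have s6 : (n : ℝ) ^ 2 * p * q ^ 2 ≤ n ^ 2 * p * 1 := by gcongr
    nlinarith
  have hpos : 0 < (ε * n) ^ 2 := by positivity
  refine (Pg_le_Eg (f := fun G => (1 / (ε * n) ^ 2) * ((∑ z, ind (dg G z = d)) - n * q) ^ 2)
    h0 h1 (fun G => by positivity) fun G hG => ?_).trans ?_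
  · rw [one_div_mul_eq_div, le_div_iff₀ hpos, one_mul]
    rw [hcnt] at hG
    have : ε * n ≤ n * q - ∑ z, ind (dg G z = d) := by linarith
    nlinarith [show 0 < ε * n by positivity]
  · unfold Eg at hE ⊢
    rw [Exs_const_mul, one_div_mul_eq_div]
    gcongr

end


/-! ### Poisson degree profile -/

/-- The Poisson probabilities. -/
noncomputable def pois (c : ℝ) (d : ℕ) : ℝ := Real.exp (-c) * c ^ d / d.factorial

lemma pois_pos {c : ℝ} (hc : 0 < c) (d : ℕ) : 0 < pois c d := by unfold pois; positivity

lemma pois_mul_sqrt_self_le {c : ℝ} (hc : 0 < c) {d : ℕ} (hd : 1 ≤ d) :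
    pois c d * Real.sqrt (2 * Real.pi * d) ≤ 1 := by
  have hd0 : (0 : ℝ) < d := by exact_mod_cast hd
  have h1 := Stirling.le_factorial_stirling d
  have h2 : Real.exp (-c) * c ^ d ≤ (d / Real.exp 1) ^ d := by
    have h3 : c / d ≤ Real.exp (c / d - 1) := by
      have := Real.add_one_le_exp (c / d - 1); linarith
    have h4 : (c / d) ^ d ≤ Real.exp (c - d) := by
      refine (pow_le_pow_left₀ (by positivity) h3 d).trans (le_of_eq ?_)
      rw [← Real.exp_nat_mul]; congr 1; field_simp
    rw [div_pow, div_le_iff₀ (by positivity)] at h4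
    rw [div_pow, ← Real.exp_nat_mul, mul_one, le_div_iff₀ (Real.exp_pos _)]
    calc Real.exp (-c) * c ^ d * Real.exp d ≤ Real.exp (-c) * (Real.exp (c - d) * d ^ d)
          * Real.exp d := by gcongr
      _ = (Real.exp (-c) * Real.exp (c - d) * Real.exp d) * d ^ d := by ring
      _ = d ^ d := by rw [← Real.exp_add, ← Real.exp_add]; ring_nf; simp
  have hf : (0 : ℝ) < d.factorial := by positivity
  rw [pois, div_mul_eq_mul_div, div_le_one hf]
  calc _ ≤ (d / Real.exp 1) ^ d * Real.sqrt (2 * Real.pi * d) := by gcongr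
    _ ≤ _ := by rw [mul_comm]; exact h1

lemma pois_mul_sqrt_le {c : ℝ} (hc : 1 ≤ c) (d : ℕ) : pois c d * Real.sqrt (Real.pi * c) ≤ 1 := by
  have hc0 : 0 < c := by linarith
  have key : ∀ d : ℕ, c / 2 ≤ d → pois c d * Real.sqrt (Real.pi * c) ≤ 1 := by
    intro d hd
    have hd1 : 1 ≤ d := by
      have : (0 : ℝ) < d := by linarith
      exact_mod_cast this
    refine le_trans ?_ (pois_mul_sqrt_self_le hc0 hd1)
    refine mul_le_mul_of_nonneg_left (Real.sqrt_le_sqrt ?_) (pois_pos hc0 d).le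
    nlinarith [Real.pi_pos]
  have hfl : c / 2 ≤ (⌊c⌋₊ : ℕ) := by
    have h1 := Nat.lt_floor_add_one c
    have h2 : (1 : ℝ) ≤ (⌊c⌋₊ : ℕ) := by exact_mod_cast Nat.le_floor (by simpa using hc)
    linarith
  by_cases hd : c / 2 ≤ d
  · exact key d hd
  · have hdf : d ≤ ⌊c⌋₊ := Nat.le_floor (by linarith)
    have hmono : ∀ m, d ≤ m → m ≤ ⌊c⌋₊ → pois c d ≤ pois c m := by
      intro m hm
      induction m, hm using Nat.le_induction with
      | base => exact fun _ => le_rfl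
      | succ m hm ih =>
        intro h
        refine (ih (by omega)).trans ?_
        have h1 : ((m + 1 : ℕ) : ℝ) ≤ c := (Nat.cast_le.2 h).trans (Nat.floor_le hc0.le)
        have h2 : pois c (m + 1) = pois c m * (c / (m + 1 : ℕ)) := by
          unfold pois
          rw [Nat.factorial_succ]
          push_cast
          field_simp
          ring
        rw [h2]
        refine le_mul_of_one_le_right (pois_pos hc0 m).le ?_
        rw [le_div_iff₀ (by positivity), one_mul]
        exact h1
    exact (mul_le_mul_of_nonneg_right (hmono _ hdf le_rfl) (Real.sqrt_nonneg _)).trans (key _ hfl)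

lemma tendsto_sum_pois (c : ℝ) :
    Tendsto (fun D => ∑ d ∈ Finset.range D, pois c d) atTop (nhds 1) := by
  have h := (NormedSpace.expSeries_div_hasSum_exp c).mul_left (Real.exp (-c))
  rw [← Real.exp_eq_exp_ℝ, ← Real.exp_add, neg_add_cancel, Real.exp_zero] at h
  refine (h.tendsto_sum_nat).congr fun D => Finset.sum_congr rfl fun d _ => ?_
  rw [pois, mul_div_assoc]

/-- The degree profile carries enough entropy to beat the branching. -/
lemma exists_profile {c : ℝ} (hc : 1 < c) : ∃ (b r : ℝ) (D₁ : ℕ), 0 < b ∧ b ≤ 1 ∧ c * b < 1 ∧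
    0 < r ∧ r < c ∧ (∀ d, r * pois c d ≤ 1) ∧
    Real.exp (-∑ d ∈ Finset.range D₁, r * pois c d) < b ^ 2 := by
  have hc0 : 0 < c := by linarith
  have hL : 0 < Real.log c := Real.log_pos hc
  have hs0 : 0 < Real.sqrt c := Real.sqrt_pos.2 hc0
  have hsq : Real.sqrt c ^ 2 = c := Real.sq_sqrt hc0.le
  have h1 : 2 * Real.log c < c := by
    have h := Real.add_one_le_exp (Real.log c - 1)
    rw [Real.exp_sub, Real.exp_log hc0] at h
    have he : 2 < Real.exp 1 := by have := Real.exp_one_gt_d9; linarith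
    have : c / Real.exp 1 < c / 2 := div_lt_div_of_pos_left hc0 (by norm_num) he
    linarith
  have h2 : 2 * Real.log c < Real.sqrt (Real.pi * c) := by
    have h := Real.add_one_le_exp (Real.log (Real.sqrt c) - 1)
    rw [Real.exp_sub, Real.exp_log hs0, Real.log_sqrt hc0.le] at h
    have he : (2.5 : ℝ) < Real.exp 1 := by have := Real.exp_one_gt_d9; linarith
    have h3 : Real.sqrt c / Real.exp 1 < Real.sqrt c / 2.5 :=
      div_lt_div_of_pos_left hs0 (by norm_num) he
    have h4 : 2 * Real.log c < 1.6 * Real.sqrt c := by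
      have : Real.sqrt c / 2.5 * 4 = 1.6 * Real.sqrt c := by ring
      linarith
    refine h4.trans_le (Real.le_sqrt_of_sq_le ?_)
    rw [mul_pow, hsq]
    have := Real.pi_gt_three
    nlinarith
  obtain ⟨r, hr1, hr2⟩ := exists_between (lt_min h1 h2)
  have hr0 : 0 < r := by linarith
  have hlim : Tendsto (fun D => ∑ d ∈ Finset.range D, r * pois c d) atTop (nhds (r * 1)) := by
    simp only [← Finset.mul_sum]
    exact (tendsto_sum_pois c).const_mul r
  rw [mul_one] at hlim
  obtain ⟨D₁, hD⟩ := (hlim.eventually (lt_mem_nhds hr1)).exists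
  obtain ⟨y, hy1, hy2⟩ := exists_between hD
  refine ⟨Real.exp (-y / 2), r, D₁, Real.exp_pos _, Real.exp_le_one_iff.2 (by linarith), ?_, hr0,
    hr2.trans_le (min_le_left _ _), fun d => ?_, ?_⟩
  · rw [← Real.exp_log hc0, ← Real.exp_add, Real.exp_lt_one_iff]
    linarith
  · refine le_trans ?_ (pois_mul_sqrt_le hc.le d)
    rw [mul_comm]
    exact mul_le_mul_of_nonneg_left (hr2.le.trans (min_le_right _ _)) (pois_pos hc0 d).le
  · rw [← Real.exp_nat_mul, Real.exp_lt_exp]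
    push_cast
    linarith

lemma tendsto_binW {c : ℝ} (d : ℕ) :
    Tendsto (fun n : ℕ => binW n (c / n) d) atTop (nhds (pois c d)) := by
  have h1 : Tendsto (fun n : ℕ => (n : ℝ) * (c / (n + 2 : ℕ))) atTop (nhds c) := by
    have h2 : Tendsto (fun n : ℕ => c - 2 * c / (n + 2 : ℕ)) atTop (nhds (c - 0)) :=
      tendsto_const_nhds.sub ((tendsto_const_div_nat (2 * c)).comp (tendsto_add_atTop_nat 2))
    rw [sub_zero] at h2
    refine h2.congr fun n => ?_
    push_cast
    field_simp
    ring
  have h2 := ProbabilityTheory.tendsto_choose_mul_pow_of_tendsto_mul_atTop d h1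
  rw [← tendsto_add_atTop_iff_nat 2]
  refine h2.congr fun n => ?_
  rw [binW, Nat.add_sub_cancel, mul_assoc]

lemma whp_degree_count {c : ℝ} (hc : 1 < c) {ρ : ℝ} (d : ℕ) (hρ : ρ < pois c d) :
    Whp c (fun n G => ρ * n ≤ ({z | dg G z = d}.ncard : ℕ)) := by
  have hc0 : 0 < c := by linarith
  obtain ⟨ε, hε, hε'⟩ : ∃ ε > 0, ρ + ε < pois c d := ⟨(pois c d - ρ) / 2, by linarith, by linarith⟩
  refine Whp.of_bound hc0 (tendsto_const_div_nat ((1 + 3 * c) / ε ^ 2)) ?_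
  filter_upwards [eventually_p hc0, eventually_ge_atTop 2,
    (tendsto_binW d).eventually (lt_mem_nhds hε')] with n hp hn hb
  have hn0 : (0 : ℝ) < n := by exact_mod_cast (by omega)
  refine (Pg_mono hp.1 hp.2 fun G hG => ?_).trans
    ((Pg_degree_count_le hp.1 hp.2 hn hε d).trans (le_of_eq ?_))
  · rw [not_le] at hG
    refine hG.trans_le ?_
    gcongr
    linarith
  · field_simp

lemma whp_forall_lt {c : ℝ} (hc : 0 < c) {P : ℕ → ∀ n : ℕ, SimpleGraph (Fin n) → Prop} (D : ℕ)
    (h : ∀ d, Whp c (P d)) : Whp c (fun n G => ∀ d < D, P d n G) := by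
  induction D with
  | zero =>
    exact (h 0).mono hc (Eventually.of_forall fun n G _ d hd => absurd hd (Nat.not_lt_zero d))
  | succ D ih =>
    refine (ih.and hc (h D)).mono hc (Eventually.of_forall fun n G hG d hd => ?_)
    rcases Nat.lt_succ_iff_lt_or_eq.1 hd with h' | rfl
    · exact hG.1 d h'
    · exact hG.2

lemma degree_count_off_le {V : Type} [Finite V] {G : SimpleGraph V} {l : ℕ} (hl : ∀ v, dg G v ≤ l)
    (S : Set V) (d : ℕ) :
    {z | dg G z = d}.ncard ≤ {z | z ∉ S ∧ dgi G Sᶜ z = d}.ncard + S.ncard * (l + 1) := by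
  classical
  have := Fintype.ofFinite V
  set N : Set V := ((S.toFinset.biUnion fun s => {w | G.Adj s w}.toFinset : Finset V) : Set V)
    with hN
  have hNc : N.ncard ≤ S.ncard * l := by
    rw [hN, Set.ncard_coe_finset, Set.ncard_eq_toFinset_card' S]
    refine Finset.card_biUnion_le_card_mul _ _ _ fun s _ => ?_
    rw [← Set.ncard_eq_toFinset_card']
    exact hl s
  have hsub : {z | dg G z = d} ⊆ {z | z ∉ S ∧ dgi G Sᶜ z = d} ∪ (S ∪ N) := by
    intro z hz
    by_cases h1 : z ∈ S ∪ N
    · exact Or.inr h1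
    · refine Or.inl ⟨fun h => h1 (Or.inl h), ?_⟩
      rw [Set.mem_ofPred_eq] at hz
      rw [← hz, dgi, dg]
      congr 1
      ext w
      simp only [Set.mem_ofPred_eq, Set.mem_compl_iff, and_iff_right_iff_imp]
      intro hzw hw
      refine h1 (Or.inr ?_)
      rw [hN, Finset.mem_coe, Finset.mem_biUnion]
      exact ⟨w, by simpa using hw, by simpa using hzw.symm⟩
  have h1 := Set.ncard_le_ncard hsub
  have h2 := Set.ncard_union_le {z | z ∉ S ∧ dgi G Sᶜ z = d} (S ∪ N)
  have h3 := Set.ncard_union_le S N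
  rw [mul_add, mul_one]
  omega

lemma whp_rich {c r : ℝ} (hc : 1 < c) (hr : r < c) (D₁ : ℕ) {M l : ℕ → ℕ}
    (hl : Whp c (fun n G => ∀ v, dg G v ≤ l n))
    (hM : ∀ δ > 0, ∀ᶠ n : ℕ in atTop, (M n : ℝ) * (l n + 1) ≤ δ * n) :
    Whp c (fun n G => ∀ S : Set (Fin n), S.ncard ≤ M n → ∀ d < D₁,
      ⌊r / c * pois c d * n⌋₊ ≤ {z | z ∉ S ∧ dgi G Sᶜ z = d}.ncard) := by
  have hc0 : 0 < c := by linarith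
  have h1 : Whp c (fun n G => ∀ d < D₁, ∀ S : Set (Fin n), S.ncard ≤ M n →
      ⌊r / c * pois c d * n⌋₊ ≤ {z | z ∉ S ∧ dgi G Sᶜ z = d}.ncard) := by
    refine whp_forall_lt hc0 D₁ fun d => ?_
    have hpd := pois_pos hc0 d
    have hlt : r / c * pois c d < pois c d := by
      have : r / c < 1 := (div_lt_one hc0).2 hr
      nlinarith
    obtain ⟨ρ, hρ1, hρ2⟩ := exists_between hlt
    refine ((whp_degree_count hc d hρ2).and hc0 hl).mono hc0 ?_
    filter_upwards [hM (ρ - r / c * pois c d) (by linarith)] with n hn G hG S hS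
    have h2 := degree_count_off_le hG.2 S d
    have h3 : S.ncard * (l n + 1) ≤ M n * (l n + 1) := Nat.mul_le_mul_right _ hS
    have h4 : (({z | dg G z = d}.ncard : ℕ) : ℝ)
        ≤ ({z | z ∉ S ∧ dgi G Sᶜ z = d}.ncard : ℕ) + M n * (l n + 1) := by
      exact_mod_cast h2.trans (by omega)
    have h5 : r / c * pois c d * n ≤ ({z | z ∉ S ∧ dgi G Sᶜ z = d}.ncard : ℕ) := by
      have := hG.1
      linarith
    exact Nat.floor_le_of_le h5
  exact h1.mono hc0 (Eventually.of_forall fun n G hG S hS d hd => hG d hd S hS)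


/-! ### Absence of long twin paths -/

lemma eventually_log_pow_le (C : ℝ) (j : ℕ) {δ : ℝ} (hδ : 0 < δ) :
    ∀ᶠ n : ℕ in atTop, C * Real.log n ^ j ≤ δ * n := by
  have h := (Real.isLittleO_pow_log_id_atTop (n := j)).bound
    (show (0 : ℝ) < δ / (|C| + 1) by positivity)
  filter_upwards [tendsto_natCast_atTop_atTop.eventually h, eventually_ge_atTop 1] with n hn h1
  have h2 : (0 : ℝ) ≤ Real.log n ^ j := pow_nonneg (Real.log_natCast_nonneg n) j
  rw [Real.norm_of_nonneg h2, id, Real.norm_of_nonneg (Nat.cast_nonneg n), div_mul_eq_mul_div,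
    le_div_iff₀ (by positivity)] at hn
  have h3 := le_abs_self C
  nlinarith

lemma eventually_le_log (C : ℝ) : ∀ᶠ n : ℕ in atTop, C ≤ Real.log n :=
  tendsto_log_nat.eventually_ge_atTop C

lemma whp_excess_log {c : ℝ} (hc : 1 < c) : ∃ e₁ : ℕ, ∀ u : ℕ → ℕ,
    (∀ᶠ n : ℕ in atTop, (u n : ℝ) ^ 4 * c ^ 2 ≤ n) → (∀ᶠ n : ℕ in atTop, u n ≤ n) →
    Whp c (fun n G => ∀ S, Cn G S → S.ncard ≤ u n →
      ein G S ≤ S.ncard + e₁ * (S.ncard / ⌈Real.log n⌉₊ + 1)) := by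
  have hc0 : 0 < c := by linarith
  refine ⟨2 * (⌈2 * (1 + Real.log c)⌉₊ + 3), fun u hu hu' => whp_excess hc le_rfl ?_ ?_ hu hu'⟩
  · filter_upwards [eventually_le_log 1, eventually_ge_atTop 1] with n hn hn1
    have hn0 : (0 : ℝ) < n := by exact_mod_cast hn1
    have h1 : (Real.exp 1 * c) = Real.exp (1 + Real.log c) := by
      rw [Real.exp_add, Real.exp_log hc0]
    have hL := Real.log_pos hc
    rw [h1, ← Real.exp_nat_mul, ← Real.rpow_natCast, Real.rpow_def_of_pos hn0, Real.exp_le_exp]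
    have h2 := Nat.ceil_lt_add_one (show 0 ≤ Real.log n by linarith)
    have h3 := Nat.le_ceil (2 * (1 + Real.log c))
    calc (⌈Real.log n⌉₊ : ℝ) * (1 + Real.log c) ≤ (2 * Real.log n) * (1 + Real.log c) := by
          gcongr; linarith
      _ = Real.log n * (2 * (1 + Real.log c)) := by ring
      _ ≤ _ := by gcongr
  · filter_upwards [eventually_le_log 1] with n hn
    exact Nat.ceil_pos.2 (by linarith)

lemma exists_nice {c : ℝ} (hc : 1 < c) : ∃ (b : ℝ) (D₁ : ℕ) (N₀ : ℕ → ℕ → ℕ), 0 < b ∧ b ≤ 1 ∧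
    c * b < 1 ∧ (∀ᶠ n : ℕ in atTop, ∀ d < D₁, N₀ n d * (c / n) ≤ 1) ∧
    (∀ᶠ n : ℕ in atTop,
      Real.exp (∑ d ∈ Finset.range D₁, (c / n - N₀ n d * (c / n))) ≤ b ^ 2) ∧
    ∀ K : ℝ, 0 < K → ∃ (E : ℕ) (M : ℕ → ℕ),
      (∀ᶠ n : ℕ in atTop, K * Real.log n + (2 * E + 7 : ℕ) ≤ M n) ∧
      Whp c (fun n G => Nice (M n) E D₁ (N₀ n) G) := by
  have hc0 : 0 < c := by linarith
  obtain ⟨b, r, D₁, hb0, hb1, hcb, hr0, hrc, hr1, hexp⟩ := exists_profile hc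
  refine ⟨b, D₁, fun n d => ⌊r / c * pois c d * n⌋₊, hb0, hb1, hcb, ?_, ?_, ?_⟩
  · filter_upwards [eventually_ge_atTop 1] with n hn d _
    have hn0 : (0 : ℝ) < n := by exact_mod_cast hn
    have hpos := pois_pos hc0 d
    calc (⌊r / c * pois c d * n⌋₊ : ℝ) * (c / n) ≤ (r / c * pois c d * n) * (c / n) := by
          gcongr; exact Nat.floor_le (by positivity)
      _ = r * pois c d := by field_simp
      _ ≤ 1 := hr1 d
  · have hlim : Tendsto (fun n : ℕ => Real.exp (2 * c * D₁ / n
        + -∑ d ∈ Finset.range D₁, r * pois c d)) atTop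
        (nhds (Real.exp (0 + -∑ d ∈ Finset.range D₁, r * pois c d))) :=
      (Real.continuous_exp.tendsto _).comp ((tendsto_const_div_nat _).add_const _)
    rw [zero_add] at hlim
    filter_upwards [hlim.eventually (gt_mem_nhds hexp), eventually_ge_atTop 1] with n hn hn1
    have hn0 : (0 : ℝ) < n := by exact_mod_cast hn1
    refine le_trans (Real.exp_le_exp.2 ?_) hn.le
    have h1 : ∀ d ∈ Finset.range D₁, c / n - (⌊r / c * pois c d * n⌋₊ : ℝ) * (c / n)
        ≤ 2 * c / n - r * pois c d := by
      intro d _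
      have h2 : r / c * pois c d * n - 1 ≤ (⌊r / c * pois c d * n⌋₊ : ℝ) :=
        (Nat.sub_one_lt_floor _).le
      have h3 : (r / c * pois c d * n - 1) * (c / n) = r * pois c d - c / n := by field_simp
      have h4 := mul_le_mul_of_nonneg_right h2 (show 0 ≤ c / n by positivity)
      have h5 : 2 * c / n = c / n + c / n := by ring
      linarith
    refine (Finset.sum_le_sum h1).trans (le_of_eq ?_)
    rw [Finset.sum_sub_distrib, Finset.sum_const, Finset.card_range, nsmul_eq_mul]
    ring
  · intro K hK
    obtain ⟨e₁, he₁⟩ := whp_excess_log hc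
    set M : ℕ → ℕ := fun n => ⌈(K + 1) * Real.log n⌉₊ with hM
    set E : ℕ := e₁ * (⌈K + 2⌉₊ + 1) with hE
    have hMle : ∀ᶠ n : ℕ in atTop, (M n : ℝ) ≤ (K + 2) * Real.log n := by
      filter_upwards [eventually_le_log 1] with n hn
      have := Nat.ceil_lt_add_one (show 0 ≤ (K + 1) * Real.log n by positivity)
      simp only [hM]
      linarith
    refine ⟨E, M, ?_, ?_⟩
    · filter_upwards [eventually_le_log ((2 * E + 7 : ℕ) : ℝ)] with n hn
      refine le_trans ?_ (Nat.le_ceil _)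
      linarith
    · have hl : ∀ᶠ n : ℕ in atTop, 4 * Real.log n
          ≤ ((⌈4 * Real.log n⌉₊ : ℕ) : ℝ) * Real.log (Real.log n) := by
        filter_upwards [tendsto_loglog_nat.eventually_ge_atTop 1] with n hn
        have h1 := Nat.le_ceil (4 * Real.log n)
        have h2 : (0 : ℝ) ≤ (⌈4 * Real.log n⌉₊ : ℕ) := Nat.cast_nonneg _
        nlinarith
      have hrich := whp_rich hc hrc D₁ (M := M) (whp_deg hc hl) (by
        intro δ hδ
        filter_upwards [hMle, eventually_log_pow_le (6 * (K + 2)) 2 hδ, eventually_le_log 1]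
          with n h1 h2 h3
        have h4 := Nat.ceil_lt_add_one (show 0 ≤ 4 * Real.log n by linarith)
        refine le_trans ?_ h2
        calc (M n : ℝ) * ((⌈4 * Real.log n⌉₊ : ℕ) + 1) ≤ ((K + 2) * Real.log n) *
              (6 * Real.log n) := by gcongr; linarith
          _ = _ := by ring)
      have hex := he₁ M (by
        filter_upwards [hMle, eventually_log_pow_le ((K + 2) ^ 4 * c ^ 2) 4 one_pos] with n h1 h2
        rw [one_mul] at h2
        refine le_trans ?_ h2
        calc (M n : ℝ) ^ 4 * c ^ 2 ≤ ((K + 2) * Real.log n) ^ 4 * c ^ 2 := by gcongr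
          _ = _ := by ring) (by
        filter_upwards [hMle, eventually_log_pow_le (K + 2) 1 one_pos] with n h1 h2
        rw [one_mul, pow_one] at h2
        exact_mod_cast h1.trans h2)
      refine (hrich.and hc0 hex).mono hc0 ?_
      filter_upwards [hMle, eventually_le_log 1] with n h1 h3 G hG
      refine ⟨fun S hS hSM => (hG.2 S hS hSM).trans ?_, hG.1⟩
      have h4 : S.ncard / ⌈Real.log n⌉₊ ≤ ⌈K + 2⌉₊ := by
        refine Nat.div_le_of_le_mul ?_
        have h5 : (M n : ℝ) ≤ (⌈Real.log n⌉₊ * ⌈K + 2⌉₊ : ℕ) := by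
          push_cast
          calc (M n : ℝ) ≤ Real.log n * (K + 2) := by linarith
            _ ≤ _ := by gcongr <;> exact Nat.le_ceil _
        exact hSM.trans (by exact_mod_cast h5)
      rw [hE]
      gcongr

lemma tendsto_tail_zero {F : ℕ → ℝ} (hF : Summable F) (h0 : ∀ i, 0 ≤ F i) {h k : ℕ → ℕ}
    (hh : Tendsto h atTop atTop) :
    Tendsto (fun n => ∑ w ∈ Finset.Ico (h n) (k n), F w) atTop (nhds 0) := by
  refine squeeze_zero (fun n => Finset.sum_nonneg fun i _ => h0 i) (fun n => ?_)
    ((tendsto_sum_nat_add F).comp hh)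
  rw [Finset.sum_Ico_eq_sum_range]
  have hs : Summable fun i => F (i + h n) := (summable_nat_add_iff (h n)).2 hF
  simp only [Function.comp, add_comm (h n)]
  exact hs.sum_le_tsum _ fun i _ => h0 _

lemma whp_no_twins {c : ℝ} (hc : 1 < c) : ∃ C > 0, ∀ (K : ℝ) (k h : ℕ → ℕ),
    (∀ᶠ n : ℕ in atTop, C * Real.log n ≤ k n) → (∀ᶠ n : ℕ in atTop, k n ≤ K * Real.log n) →
    Tendsto h atTop atTop →
    Whp c (fun n G => NoEA G (k n) ∧ NoEB G (h n) (2 * k n)) := by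
  have hc0 : 0 < c := by linarith
  obtain ⟨b, D₁, N₀, hb0, hb1, hcb, hN, hθ, hnice⟩ := exists_nice hc
  have hβ0 : 0 < c * b := by positivity
  have hlβ : Real.log (c * b) < 0 := Real.log_neg hβ0 hcb
  refine ⟨4 / -Real.log (c * b), by have := neg_pos.2 hlβ; positivity, fun K k h hk hK hh => ?_⟩
  have hK1 : ∀ᶠ n : ℕ in atTop, (k n : ℝ) ≤ (|K| + 1) * Real.log n := by
    filter_upwards [hK, eventually_le_log 0] with n h1 h2
    refine h1.trans ?_
    have := le_abs_self K
    gcongr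
    linarith
  obtain ⟨E, M, hM, hW⟩ := hnice (4 * (|K| + 1)) (by positivity)
  set a : ℕ := 16 * E + 34 with ha
  set Cb : ℝ := (1 / b) ^ (2 * a + 4) with hCb
  have hCb0 : 0 < Cb := by positivity
  have hH : ∀ᶠ n : ℕ in atTop, 1 ≤ n ∧ (n : ℝ) * (c / n * b) = c * b ∧ 0 ≤ c / n ∧ c / n ≤ 1 ∧
      ∀ w ≤ 2 * k n, TwinParams n (c / n) b (M n) E D₁ (N₀ n) w := by
    filter_upwards [hN, hθ, (tendsto_const_div_nat c).eventually (ge_mem_nhds one_half_pos), hK1, hM,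
      eventually_log_pow_le (8 * c * (2 * (|K| + 1) + 1) ^ 3) 3 one_pos, eventually_p hc0,
      eventually_ge_atTop 1, eventually_le_log 1] with n h1 h2 h3 h4 h5 h6 h7 h8 h9
    have hn0 : (0 : ℝ) < n := by exact_mod_cast h8
    have hpb : (n : ℝ) * (c / n * b) = c * b := by field_simp
    refine ⟨h8, hpb, h7.1, h7.2, fun w hw => ?_⟩
    have hwk : (w : ℝ) ≤ 2 * k n := by exact_mod_cast hw
    refine ⟨h7.1, h3, hb0, hb1, h1, h2, ?_, hpb.le.trans hcb.le, ?_⟩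
    · have : ((2 * (w + 1) + (2 * E + 5) : ℕ) : ℝ) ≤ M n := by
        refine le_trans ?_ h5
        push_cast
        linarith
      exact_mod_cast this
    · rw [mul_div_assoc', div_mul_eq_mul_div, div_le_one hn0]
      calc 8 * c * (w + 1 : ℝ) ^ 3 ≤ 8 * c * ((2 * (|K| + 1) + 1) * Real.log n) ^ 3 := by
            gcongr; linarith
        _ = 8 * c * (2 * (|K| + 1) + 1) ^ 3 * Real.log n ^ 3 := by ring
        _ ≤ n := by linarith
  have hA : Whp c (fun n G => Nice (M n) E D₁ (N₀ n) G → NoEA G (k n)) := by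
    refine Whp.of_bound hc0 (tendsto_const_div_nat 1) ?_
    filter_upwards [hH, hk, hK1, eventually_le_log 1,
      eventually_log_pow_le (Cb * (|K| + 3) ^ a * 10 * (|K| + 3) ^ 2) (a + 2) one_pos]
      with n ⟨h7, hpb, hp0, hp1, H⟩ h8 h9 h10 h11
    have hn0 : (0 : ℝ) < n := by exact_mod_cast h7
    have hn1 : (1 : ℝ) ≤ n := by exact_mod_cast h7
    refine (Pg_mono hp0 hp1 (fun G hG => Classical.not_imp.1 hG)).trans
      ((Pg_noEA_le (H (k n) (by omega))).trans ?_)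
    rw [hpb, twinC]
    have hβ : (c * b) ^ k n ≤ 1 / (n : ℝ) ^ 4 := by
      rw [← Real.exp_log hβ0, ← Real.exp_nat_mul, one_div, ← Real.exp_log (pow_pos hn0 4),
        ← Real.exp_neg, Real.exp_le_exp, Real.log_pow]
      have h12 := mul_le_mul_of_nonneg_right h8 (neg_pos.2 hlβ).le
      rw [div_mul_eq_mul_div, div_mul_cancel₀ _ (neg_pos.2 hlβ).ne'] at h12
      push_cast
      linarith
    have hw2 : (k n + 2 : ℝ) ≤ (|K| + 3) * Real.log n := by linarith
    have hw1 : (2 * n + 8 * (k n + 1 : ℝ) ^ 2) ≤ 10 * n * ((|K| + 3) * Real.log n) ^ 2 := by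
      have e1 : (k n + 1 : ℝ) ^ 2 ≤ ((|K| + 3) * Real.log n) ^ 2 := by gcongr; linarith
      have e2 : 1 ≤ ((|K| + 3) * Real.log n) ^ 2 := by
        refine one_le_pow₀ ?_
        have := abs_nonneg K
        nlinarith
      nlinarith [mul_le_mul_of_nonneg_left hn1 (show 0 ≤ ((|K| + 3) * Real.log n) ^ 2 by positivity)]
    calc ((k n + 2 : ℝ) ^ a * Cb) * (n * (c * b) ^ k n * (2 * n + 8 * (k n + 1 : ℝ) ^ 2))
        ≤ (((|K| + 3) * Real.log n) ^ a * Cb) * (n * (1 / (n : ℝ) ^ 4) *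
          (10 * n * ((|K| + 3) * Real.log n) ^ 2)) := by gcongr
      _ = (Cb * (|K| + 3) ^ a * 10 * (|K| + 3) ^ 2 * Real.log n ^ (a + 2)) / n ^ 2 := by
          rw [mul_pow, mul_pow, pow_add _ a 2]
          field_simp
      _ ≤ (1 * n) / n ^ 2 := by gcongr
      _ = 1 / n := by field_simp
  have hB : Whp c (fun n G => Nice (M n) E D₁ (N₀ n) G → NoEB G (h n) (2 * k n)) := by
    set F : ℕ → ℝ := fun w => ((w + 2 : ℝ) ^ a * Cb) * ((c * b) ^ w * (8 * c * (w + 1 : ℝ) ^ 3))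
      with hF
    have hF0 : ∀ w, 0 ≤ F w := fun w => by simp only [hF]; positivity
    have hFs : Summable F := by
      have h1 : Summable fun w : ℕ => ((w : ℝ) ^ (a + 3) * (c * b) ^ w : ℝ) :=
        summable_pow_mul_geometric_of_norm_lt_one _ (by rwa [Real.norm_of_nonneg hβ0.le])
      have h2 := ((summable_nat_add_iff 2).2 h1).mul_left (Cb * (8 * c) / (c * b) ^ 2)
      refine Summable.of_nonneg_of_le hF0 (fun w => ?_) h2
      simp only [hF]
      push_cast
      calc ((w + 2 : ℝ) ^ a * Cb) * ((c * b) ^ w * (8 * c * (w + 1 : ℝ) ^ 3))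
          ≤ ((w + 2 : ℝ) ^ a * Cb) * ((c * b) ^ w * (8 * c * (w + 2 : ℝ) ^ 3)) := by
            gcongr; norm_num
        _ = _ := by
          rw [pow_add _ a 3, pow_add _ w 2]
          field_simp
    refine Whp.of_bound hc0 (tendsto_tail_zero hFs hF0 hh (k := fun n => 2 * k n + 1)) ?_
    filter_upwards [hH, hh.eventually_ge_atTop 2] with n ⟨h7, hpb, hp0, hp1, H⟩ h8
    have hn0 : (0 : ℝ) < n := by exact_mod_cast h7
    refine (Pg_exists_le hp0 hp1 (Finset.Ico (h n) (2 * k n + 1)) (fun w G =>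
      Nice (M n) E D₁ (N₀ n) G ∧ ∃ x x', (x 0 = x' 0 ∧ x w = x' w ∧
        ∀ i, 0 < i → i < w → x i ≠ x' i) ∧ IP G w x ∧ IP G w x' ∧
        ∀ i ≤ w, col G (x i) = col G (x' i)) ?_).trans (Finset.sum_le_sum fun w hw => ?_)
    · intro G hG
      obtain ⟨hG1, hG2⟩ := Classical.not_imp.1 hG
      unfold NoEB at hG2
      push Not at hG2
      obtain ⟨w, hw1, hw2, x, x', e1, e2, e3, e4, e5, e6⟩ := hG2
      exact ⟨w, Finset.mem_Ico.2 ⟨hw1, by omega⟩, hG1, x, x', ⟨e4, e5, e6⟩, e1, e2, e3⟩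
    · obtain ⟨hw1, hw2⟩ := Finset.mem_Ico.1 hw
      refine (Pg_noEB_le (H w (by omega)) (by omega)).trans (le_of_eq ?_)
      rw [hpb, twinC, hF]
      field_simp
      rfl
  exact ((hW.and hc0 hA).and hc0 hB).mono hc0
    (Eventually.of_forall fun n G hG => ⟨hG.1.2 hG.1.1, hG.2 hG.1.1⟩)


/-! ### Long paths and the size of the largest component -/

lemma Exs_second_moment {ι : Type*} {p : ℝ} {S : Finset ι} (h0 : 0 ≤ p) (h1 : p ≤ 1)
    {f : Finset ι → ℝ} {P : Finset ι → Prop} {μ : ℝ} (hμ : 0 < μ) (hf : Exs p S f = μ)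
    (h : ∀ A ⊆ S, P A → f A = 0) :
    Exs p S (fun A => ind (P A)) ≤ Exs p S (fun A => f A * f A) / μ ^ 2 - 1 := by
  have h2 : Exs p S (fun A => ind (P A))
      ≤ Exs p S (fun A => (1 / μ ^ 2 * (f A * f A) - 2 / μ * f A) + 1) := by
    refine Exs_mono h0 h1 fun A hA => ?_
    have e : 1 / μ ^ 2 * (f A * f A) - 2 / μ * f A + 1 = (f A / μ - 1) ^ 2 := by
      field_simp
      ring
    rw [e]
    refine ind_le_of (sq_nonneg _) fun hP => ?_
    rw [h A hA hP]
    norm_num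
  refine h2.trans (le_of_eq ?_)
  rw [Exs_add, Exs_sub, Exs_const_mul, Exs_const_mul, Exs_const, hf]
  field_simp
  ring

/-- The sequence which continues a tuple by its last value. -/
def extend {V : Type} {r : ℕ} (f : Fin (r + 1) → V) : ℕ → V :=
  fun i => f ⟨min i r, by omega⟩

lemma extend_cons {V : Type} {r : ℕ} (v : V) (g : Fin (r + 1) → V) :
    extend (r := r + 1) (Fin.cons v g : Fin (r + 2) → V) = scons v (extend g) := by
  funext i
  cases i with
  | zero => rfl
  | succ i =>
    have : (⟨min (i + 1) (r + 1), by omega⟩ : Fin (r + 2))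
        = Fin.succ (⟨min i r, by omega⟩ : Fin (r + 1)) := by
      ext; simp
    simp only [extend, scons_succ, this, Fin.cons_succ]

lemma sumFrom_eq_sum {V : Type} [Fintype V] (r : ℕ) (v : V) (F : (ℕ → V) → ℝ) :
    sumFrom r v F = ∑ g : Fin r → V, F (extend (Fin.cons v g : Fin (r + 1) → V)) := by
  induction r generalizing v F with
  | zero =>
    simp only [sumFrom, Finset.univ_unique, Finset.sum_singleton]
    congr 1
    funext i
    simp [extend]
  | succ r ih =>
    simp only [sumFrom, ih]
    rw [← (Fin.consEquiv fun _ : Fin (r + 1) => V).sum_comp, Fintype.sum_prod_type]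
    refine Finset.sum_congr rfl fun z _ => Finset.sum_congr rfl fun g _ => ?_
    rw [extend_cons]
    rfl

lemma sumSeq_eq_sum {V : Type} [Fintype V] (r : ℕ) (F : (ℕ → V) → ℝ) :
    sumSeq r F = ∑ g : Fin (r + 1) → V, F (extend g) := by
  rw [← (Fin.consEquiv fun _ : Fin (r + 1) => V).sum_comp, Fintype.sum_prod_type]
  simp only [sumSeq, sumFrom_eq_sum]
  rfl

lemma extend_injOn {V : Type} {r : ℕ} {f : Fin (r + 1) → V} :
    Set.InjOn (extend f) (Set.Iic r) ↔ Function.Injective f := by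
  constructor
  · intro h i j hij
    have hi := i.2
    have hj := j.2
    have e : ∀ k : Fin (r + 1), extend f k = f k := fun k => by
      have hk := k.2
      simp only [extend, Nat.min_eq_left (show (k : ℕ) ≤ r by omega)]
    exact Fin.ext (h (Set.mem_Iic.2 (by omega)) (Set.mem_Iic.2 (by omega)) (by rw [e, e, hij]))
  · intro h i hi j hj hij
    have := congrArg Fin.val (h hij)
    simp only [Set.mem_Iic] at hi hj
    simp only at this
    omega

open Classical in
lemma Pg_no_path_le {n w : ℕ} {p b : ℝ} (h0 : 0 < p) (h1 : p ≤ 1) (hb0 : 0 < b) (hb1 : b ≤ 1)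
    (hnb : n * (p * b) ≤ 1) (hε : 8 * p * (w + 1) ^ 3 ≤ 1) (hw : w + 1 ≤ n) :
    Pg n p (fun G => ¬ ∃ x, IP G w x) ≤
      (n * b * (1 + 8 * p * (w + 1) ^ 3) + 8 * (w + 1) ^ 2) /
        ((n - w : ℝ) ^ (w + 1) * p ^ w * b ^ (w + 1)) - 1 := by
  set K : Finset (Fin (w + 1) → Fin n) := Finset.univ.filter Function.Injective with hK
  have hKc : ((n - w : ℝ)) ^ (w + 1) ≤ K.card := by
    have h2 : K.card = n.descFactorial (w + 1) := by
      rw [hK, ← Fintype.card_subtype,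
        Fintype.card_congr (Equiv.subtypeInjectiveEquivEmbedding (Fin (w + 1)) (Fin n)),
        Fintype.card_embedding_eq]
      simp
    have h3 := Nat.pow_sub_le_descFactorial n (w + 1)
    rw [← h2] at h3
    have h4 : ((n + 1 - (w + 1) : ℕ) : ℝ) = n - w := by
      rw [Nat.add_sub_add_right, Nat.cast_sub (by omega)]
    rw [← h4]
    exact_mod_cast h3
  have hnw : (0 : ℝ) < n - w := by
    have : (w + 1 : ℝ) ≤ n := by exact_mod_cast hw
    linarith
  have hK0 : (0 : ℝ) < K.card := lt_of_lt_of_le (by positivity) hKc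
  have hinj : ∀ k ∈ K, Set.InjOn (extend k) (Set.Iic w) := fun k hk =>
    extend_injOn.2 (Finset.mem_filter.1 hk).2
  have hsub : ∀ k ∈ K, pathE (extend k) w ⊆ edges n := by
    intro k hk e he
    obtain ⟨i, hi, rfl⟩ := Finset.mem_image.1 he
    rw [mk_mem_edges]
    intro h
    have hi' := Finset.mem_range.1 hi
    have := hinj k hk (Set.mem_Iic.2 hi'.le) (Set.mem_Iic.2 hi') h
    omega
  set f : Finset (Sym2 (Fin n)) → ℝ := fun A => ∑ k ∈ K, if pathE (extend k) w ⊆ A then 1 else 0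
    with hf
  have hμ : Exs p (edges n) f = K.card * p ^ w := by
    rw [hf, Exs_sum, Finset.sum_congr rfl fun k hk => (Exs_superset_one (hsub k hk)).trans
      (by rw [card_pathE (hinj k hk)]), Finset.sum_const, nsmul_eq_mul]
  set X : ℝ := n * b * (1 + 8 * p * (w + 1) ^ 3) + 8 * (w + 1) ^ 2 with hX
  have hXn : 0 ≤ X := by positivity
  have hin : ∀ k ∈ K, ∑ k' ∈ K, p ^ (pathE (extend k') w \ pathE (extend k) w).card
      ≤ X / b ^ (w + 1) := by
    intro k hk
    rw [le_div_iff₀ (by positivity), Finset.sum_mul]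
    refine le_trans ?_ (sum_twin_le_EA h0.le hb0 hnb hε (hinj k hk))
    rw [sumSeq_eq_sum, hK, Finset.sum_filter]
    refine Finset.sum_le_sum fun k' _ => ?_
    by_cases h : Function.Injective k'
    · rw [if_pos h, if_pos (extend_injOn.2 h), twinWt,
        prod_stepWt_eq (extend_injOn.2 h)]
      have h2 : (pathV (extend k') w \ pathV (extend k) w).card ≤ w + 1 :=
        (Finset.card_le_card Finset.sdiff_subset).trans (card_pathV (extend_injOn.2 h)).le
      exact mul_le_mul_of_nonneg_left (pow_le_pow_of_le_one hb0.le hb1 h2) (by positivity)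
    · rw [if_neg h, if_neg (fun h' => h (extend_injOn.1 h'))]
  have hsq : Exs p (edges n) (fun A => f A * f A) ≤ K.card * (p ^ w * (X / b ^ (w + 1))) := by
    have e : ∀ A, f A * f A = ∑ k ∈ K, ∑ k' ∈ K,
        if pathE (extend k) w ∪ pathE (extend k') w ⊆ A then 1 else 0 := by
      intro A
      rw [hf, Finset.sum_mul_sum]
      refine Finset.sum_congr rfl fun k _ => Finset.sum_congr rfl fun k' _ => ?_
      simp only [Finset.union_subset_iff, ite_and]
      split_ifs <;> simp
    rw [Exs_congr fun A _ => e A, Exs_sum]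
    refine (Finset.sum_le_card_nsmul _ _ _ fun k hk => ?_).trans_eq (nsmul_eq_mul _ _)
    rw [Exs_sum]
    refine le_trans (le_of_eq ?_) (mul_le_mul_of_nonneg_left (hin k hk) (by positivity))
    rw [Finset.mul_sum]
    refine Finset.sum_congr rfl fun k' hk' => ?_
    rw [Exs_superset_one (Finset.union_subset (hsub k hk) (hsub k' hk')),
      ← Finset.union_sdiff_self_eq_union, Finset.card_union_of_disjoint Finset.disjoint_sdiff,
      card_pathE (hinj k hk), pow_add]
  refine (Exs_second_moment h0.le h1 (f := f) (μ := K.card * p ^ w) (by positivity) hμ ?_).trans ?_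
  · intro A _ hA
    refine Finset.sum_eq_zero fun k hk => if_neg fun h => hA ⟨extend k, fun i hi => ?_, hinj k hk⟩
    have h2 : s(extend k i, extend k (i + 1)) ∈ pathE (extend k) w :=
      Finset.mem_image_of_mem _ (Finset.mem_range.2 hi)
    exact Gr_adj.2 ⟨h h2, mk_mem_edges.1 (hsub k hk h2)⟩
  · refine sub_le_sub_right ?_ _
    calc Exs p (edges n) (fun A => f A * f A) / (K.card * p ^ w) ^ 2
        ≤ K.card * (p ^ w * (X / b ^ (w + 1))) / (K.card * p ^ w) ^ 2 := by gcongr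
      _ = X / (K.card * p ^ w * b ^ (w + 1)) := by field_simp
      _ ≤ _ := by gcongr

lemma whp_path {c C : ℝ} (hc : 1 < c) {w : ℕ → ℕ} (hw : ∀ᶠ n : ℕ in atTop, w n ≤ C * Real.log n) :
    Whp c (fun n G => ∃ x, IP G (w n) x) := by
  have hc0 : 0 < c := by linarith
  have ht : Tendsto (fun n : ℕ => 64 * c * (|C| + 1) ^ 3 * (Real.log n ^ 3 / n)) atTop (nhds 0) := by
    have h := (Real.isLittleO_pow_log_id_atTop (n := 3)).tendsto_div_nhds_zero.comp
      tendsto_natCast_atTop_atTop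
    simpa using h.const_mul (64 * c * (|C| + 1) ^ 3)
  refine Whp.of_bound hc0 ht ?_
  filter_upwards [hw, eventually_le_log 1, eventually_ge_atTop 1, eventually_p hc0,
    eventually_log_pow_le (32 * c * (|C| + 1) ^ 3) 3 one_pos] with n h1 h2 h3 h4 h5
  have hn0 : (0 : ℝ) < n := by exact_mod_cast h3
  have hw1 : (w n + 1 : ℝ) ≤ (|C| + 1) * Real.log n := by
    have := mul_le_mul_of_nonneg_right (le_abs_self C) (show 0 ≤ Real.log n by linarith)
    linarith
  set y : ℝ := 16 * c * (w n + 1) ^ 3 / n with hy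
  have hw3 : (w n + 1 : ℝ) ^ 3 ≤ (|C| + 1) ^ 3 * Real.log n ^ 3 := by
    rw [← mul_pow]
    gcongr
  have hy2 : y ≤ 16 * c * (|C| + 1) ^ 3 * (Real.log n ^ 3 / n) := by
    rw [hy, mul_div_assoc', mul_assoc (16 * c)]
    gcongr
  have hy0 : 0 < y := by positivity
  have hy1 : y ≤ 1 / 2 := by
    refine hy2.trans ?_
    rw [mul_div_assoc', div_le_iff₀ hn0]
    linarith
  have hyn : y * n = 16 * c * (w n + 1) ^ 3 := by
    rw [hy]
    field_simp
  have hwpos : (1 : ℝ) ≤ w n + 1 := by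
    have : (0 : ℝ) ≤ w n := Nat.cast_nonneg _
    linarith
  have hpw : (w n + 1 : ℝ) ≤ (w n + 1 : ℝ) ^ 2 ∧ (w n + 1 : ℝ) ^ 2 ≤ (w n + 1 : ℝ) ^ 3 := by
    constructor <;> nlinarith [sq_nonneg (w n + 1 : ℝ)]
  have hwn : (w n + 1 : ℝ) ≤ n := by nlinarith
  have hcn : 8 * (c / n) * (w n + 1 : ℝ) ^ 3 = y / 2 := by
    rw [hy]
    ring
  refine (Pg_no_path_le (b := 1 / c) (by positivity) h4.2 (by positivity)
    (by rw [div_le_one hc0]; exact hc.le) (le_of_eq (by field_simp)) (by rw [hcn]; linarith)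
    (by exact_mod_cast hwn)).trans ?_
  rw [hcn]
  have hB : 1 - y ≤ ((n - w n : ℝ) / n) ^ (w n + 1) := by
    have h6 := one_add_mul_le_pow (a := -(w n / n : ℝ)) (by
      have : (w n : ℝ) / n ≤ 1 := by rw [div_le_one hn0]; linarith
      linarith) (w n + 1)
    have h7 : (1 + -(w n / n : ℝ)) = (n - w n : ℝ) / n := by field_simp; ring
    rw [h7] at h6
    refine le_trans ?_ h6
    have h8 : ((w n + 1 : ℕ) : ℝ) * (w n / n) ≤ y := by
      rw [hy, mul_div_assoc']
      refine div_le_div_of_nonneg_right ?_ hn0.le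
      push_cast
      nlinarith [mul_le_mul_of_nonneg_right hc.le (show 0 ≤ (w n + 1 : ℝ) ^ 3 by positivity)]
    linarith
  have hden : ((n - w n : ℝ)) ^ (w n + 1) * (c / n) ^ w n * (1 / c) ^ (w n + 1)
      = ((n - w n : ℝ) / n) ^ (w n + 1) * (n / c) := by
    rw [div_pow, div_pow, div_pow, one_pow, pow_succ (n : ℝ), pow_succ c]
    field_simp
  rw [hden]
  have h9 : n * (1 / c) * (1 + y / 2) + 8 * (w n + 1 : ℝ) ^ 2 ≤ (1 + y) * (n / c) := by
    have : 8 * (w n + 1 : ℝ) ^ 2 ≤ y / 2 * (n / c) := by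
      have : y / 2 * (n / c) = 8 * (w n + 1 : ℝ) ^ 3 := by
        rw [hy]
        field_simp
        ring
      rw [this]
      linarith
    calc _ ≤ n * (1 / c) * (1 + y / 2) + y / 2 * (n / c) := by linarith
      _ = _ := by ring
  calc _ ≤ (1 + y) * (n / c) / ((1 - y) * (n / c)) - 1 := by
        have : 0 < 1 - y := by linarith
        gcongr
    _ = (1 + y) / (1 - y) - 1 := by rw [mul_div_mul_right _ _ (by positivity)]
    _ ≤ 4 * y := by
        rw [sub_le_iff_le_add, div_le_iff₀ (by linarith)]
        nlinarith
    _ ≤ _ := by linarith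

lemma supp_eq_cc {V : Type} (G : SimpleGraph V) (x : V) :
    (G.connectedComponentMk x).supp = cc G x := by
  ext y
  rw [SimpleGraph.ConnectedComponent.mem_supp_iff, SimpleGraph.ConnectedComponent.eq]
  exact ⟨fun h => h.symm, fun h => h.symm⟩

lemma ebt_cc_compl {V : Type} [Finite V] (G : SimpleGraph V) (x : V) :
    ebt G (cc G x) (cc G x)ᶜ = 0 := by
  rw [ebt, Set.ncard_eq_zero (Set.toFinite _)]
  refine Set.eq_empty_of_forall_notMem fun r hr => hr.2.1 ?_
  exact SimpleGraph.Reachable.trans hr.1 hr.2.2.reachable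

/-- With high probability the graph expands and has a component of linear size. -/
lemma whp_giant {c : ℝ} (hc : 1 < c) : ∃ (ε : ℝ) (g : ℕ) (C : ℝ), 0 < ε ∧ 0 < C ∧
    Whp c (fun n G => (∀ S, Cn G S → C * Real.log n ≤ S.ncard → (S.ncard : ℝ) ≤ ε * n →
      S.ncard ≤ g * ebt G S Sᶜ) ∧ ∃ x, ε * n < (cc G x).ncard) := by
  have hc0 : 0 < c := by linarith
  obtain ⟨ε, g, C, hε, hC, hW⟩ := whp_expansion hc
  refine ⟨ε, g, C, hε, hC, (hW.and hc0 (whp_path hc (C := C + 1)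
    (w := fun n => ⌈C * Real.log n⌉₊) ?_)).mono hc0 (Eventually.of_forall ?_)⟩
  · filter_upwards [eventually_le_log 1] with n h1
    have := (Nat.ceil_lt_add_one (show 0 ≤ C * Real.log n by positivity)).le
    linarith
  · rintro n G ⟨h1, x, hx⟩
    refine ⟨h1, x 0, ?_⟩
    by_contra! h2
    have h3 : x '' Set.Iic ⌈C * Real.log n⌉₊ ⊆ cc G (x 0) :=
      (IP.cn hx.1).subset_cc ⟨0, Set.mem_Iic.2 (Nat.zero_le _), rfl⟩
    have h4 := Set.ncard_le_ncard h3 (Set.toFinite _)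
    rw [hx.ncard_image] at h4
    have h5 : C * Real.log n ≤ (cc G (x 0)).ncard := by
      refine (Nat.le_ceil _).trans ?_
      exact_mod_cast (Nat.le_succ _).trans h4
    have h6 := h1 _ (cn_cc G (x 0)) h5 h2
    rw [ebt_cc_compl] at h6
    omega


/-! ### Vertices with many pendant neighbours -/

section Pendant

variable {n : ℕ} {p : ℝ} {B : Finset (Fin n)}

/-- The pairs formed by `b` and a vertex outside of `B`. -/
def blk (B : Finset (Fin n)) (b : Fin n) : Finset (Sym2 (Fin n)) := Bᶜ.image fun a => s(a, b)

lemma mem_blk {b : Fin n} {e : Sym2 (Fin n)} : e ∈ blk B b ↔ ∃ a, a ∉ B ∧ s(a, b) = e := by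
  simp [blk]

lemma mk_inj_of_mem {a a' b b' : Fin n} (hb' : b' ∈ B) (ha : a ∉ B) (h : s(a, b) = s(a', b')) :
    a = a' ∧ b = b' := by
  rcases Sym2.eq_iff.1 h with h | ⟨rfl, -⟩
  · exact h
  · exact absurd hb' ha

lemma disjoint_blk {b b' : Fin n} (hb' : b' ∈ B) (h : b ≠ b') : Disjoint (blk B b) (blk B b') := by
  rw [Finset.disjoint_left]
  intro e he he'
  obtain ⟨a, ha, rfl⟩ := mem_blk.1 he
  obtain ⟨a', -, h2⟩ := mem_blk.1 he'
  exact h (mk_inj_of_mem hb' ha h2.symm).2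

lemma card_blk {b : Fin n} (hb : b ∈ B) : (blk B b).card = (Bᶜ).card :=
  Finset.card_image_of_injOn fun _ ha _ _ h =>
    (mk_inj_of_mem hb (Finset.mem_compl.1 (Finset.mem_coe.1 ha)) h).1

/-- Probability that a vertex of `B` is joined to a given vertex and no other one outside `B`. -/
noncomputable def pend (p : ℝ) (B : Finset (Fin n)) : ℝ := p * (1 - p) ^ ((Bᶜ).card - 1)

lemma Exs_eq_singleton {ι : Type*} [DecidableEq ι] {S : Finset ι} {e : ι} (he : e ∈ S) :
    Exs p S (fun I => ind (I = {e})) = p * (1 - p) ^ (S.card - 1) := by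
  rw [Exs, Finset.sum_eq_single {e}]
  · simp [ind_pos]
  · intro A _ hA
    rw [ind_neg hA, mul_zero]
  · intro h
    exact absurd (Finset.mem_powerset.2 (Finset.singleton_subset_iff.2 he)) h

/-- Indicator that every vertex of `L` has the neighbour prescribed by `u` as its only neighbour
outside of `B`. -/
noncomputable def pendInd (B : Finset (Fin n)) (u : Fin n → Fin n) (L : Finset (Fin n))
    (I : Finset (Sym2 (Fin n))) : ℝ := ∏ b ∈ L, ind (I ∩ blk B b = {s(u b, b)})

lemma Exs_pendInd {u : Fin n → Fin n} {L : Finset (Fin n)} (hL : L ⊆ B) (hu : ∀ b ∈ L, u b ∉ B) :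
    Exs p (B.biUnion (blk B)) (pendInd B u L) = pend p B ^ L.card := by
  have h := Exs_blocks (p := p) B (blk B) (fun i _ j hj hij => disjoint_blk hj hij)
    fun b X => if b ∈ L then ind (X = {s(u b, b)}) else 1
  simp only [Finset.prod_ite_mem, Finset.inter_eq_right.2 hL] at h
  refine Eq.trans h ?_
  have e2 : ∀ b ∈ B, Exs p (blk B b) (fun X => if b ∈ L then ind (X = {s(u b, b)}) else 1)
      = if b ∈ L then pend p B else 1 := by
    intro b hb
    split_ifs with h
    · rw [Exs_eq_singleton (mem_blk.2 ⟨u b, hu b h, rfl⟩), card_blk hb, pend]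
    · rw [Exs_const]
  rw [Finset.prod_congr rfl e2, Finset.prod_ite_mem, Finset.inter_eq_right.2 hL, Finset.prod_const]

lemma pendInd_nonneg (u : Fin n → Fin n) (L : Finset (Fin n)) (I : Finset (Sym2 (Fin n))) :
    0 ≤ pendInd B u L I := Finset.prod_nonneg fun _ _ => ind_nonneg _

lemma pend_nonneg (h0 : 0 ≤ p) (h1 : p ≤ 1) : 0 ≤ pend p B :=
  mul_nonneg h0 (pow_nonneg (by linarith) _)

lemma Exs_pendInd_mul (h0 : 0 ≤ p) (h1 : p ≤ 1) {v w : Fin n} {L L' : Finset (Fin n)} (hL : L ⊆ B)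
    (hL' : L' ⊆ B) (hv : v ∉ B) (hw : w ∉ B) :
    Exs p (B.biUnion (blk B)) (fun I => pendInd B (fun _ => v) L I * pendInd B (fun _ => w) L' I)
      ≤ pend p B ^ L.card * pend p B ^ L'.card +
        if v = w then pend p B ^ L.card * ∏ b ∈ L', (if b ∈ L then 1 else pend p B) else 0 := by
  have hρ := pend_nonneg (B := B) h0 h1
  split_ifs with h
  · subst h
    have h2 : ∏ b ∈ L', (if b ∈ L then 1 else pend p B) = pend p B ^ (L' \ L).card := by
      rw [Finset.prod_ite, Finset.prod_const_one, one_mul, Finset.prod_const]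
      congr 2
      ext b
      simp
    rw [h2, ← pow_add _ L.card (L' \ L).card, ← Finset.card_union_of_disjoint Finset.disjoint_sdiff,
      ← Exs_pendInd (u := fun _ => v) (Finset.union_subset hL (Finset.sdiff_subset.trans hL'))
        fun _ _ => hv]
    refine le_add_of_nonneg_of_le (by positivity) (Exs_mono h0 h1 fun I _ => ?_)
    rw [pendInd, pendInd, pendInd, Finset.prod_union Finset.disjoint_sdiff]
    refine mul_le_mul_of_nonneg_left ?_ (pendInd_nonneg _ L I)
    rw [← Finset.prod_inter_mul_prod_sdiff L' L]
    exact mul_le_of_le_one_left (pendInd_nonneg _ _ I)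
      (Finset.prod_le_one (fun _ _ => ind_nonneg _) fun _ _ => ind_le_one _)
  · rw [add_zero]
    by_cases hd : Disjoint L L'
    · rw [← pow_add, ← Finset.card_union_of_disjoint hd, ← Exs_pendInd (u := fun b =>
        if b ∈ L then v else w) (Finset.union_subset hL hL') (fun b _ => by split_ifs <;> assumption)]
      refine Exs_mono h0 h1 fun I _ => le_of_eq ?_
      rw [pendInd, pendInd, pendInd, Finset.prod_union hd]
      congr 1
      · exact Finset.prod_congr rfl fun b hb => by simp only [if_pos hb]
      · exact Finset.prod_congr rfl fun b hb => by
          simp only [if_neg (Finset.disjoint_right.1 hd hb)]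
    · obtain ⟨b, hb, hb'⟩ := Finset.not_disjoint_iff.1 hd
      have hz : ∀ I, pendInd B (fun _ => v) L I * pendInd B (fun _ => w) L' I = 0 := by
        intro I
        by_cases hI : I ∩ blk B b = {s(v, b)}
        · refine mul_eq_zero_of_right _ (Finset.prod_eq_zero hb' (ind_neg fun hI' => ?_))
          exact h (mk_inj_of_mem (hL hb) hv (Finset.singleton_injective (hI.symm.trans hI'))).1
        · exact mul_eq_zero_of_left (Finset.prod_eq_zero hb (ind_neg hI)) _
      simp only [hz, Exs_const]
      positivity

/-- Some vertex of `U` has `k` pendant neighbours in `B'`, up to a small probability. -/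
lemma Exs_no_pendant_le (h0 : 0 < p) (h1 : p < 1) {U B' : Finset (Fin n)} (hU : Disjoint U B)
    (hU0 : U.Nonempty) (hB' : B' ⊆ B) {k : ℕ} (hk : k ≤ B'.card) :
    Exs p (B.biUnion (blk B)) (fun I => ind (∀ v ∈ U, ∀ L ⊆ B', L.card = k →
        ¬ ∀ b ∈ L, I ∩ blk B b = {s(v, b)}))
      ≤ 2 ^ k * (1 + pend p B) ^ B'.card / (U.card * (B'.card.choose k * pend p B ^ k)) := by
  set ρ := pend p B with hρ
  have hρ0 : 0 < ρ := mul_pos h0 (pow_pos (by linarith) _)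
  set K := U ×ˢ Finset.powersetCard k B' with hK
  have hKm : ∀ x ∈ K, x.1 ∉ B ∧ x.2 ⊆ B ∧ x.2.card = k ∧ x.1 ∈ U ∧ x.2 ⊆ B' := by
    intro x hx
    obtain ⟨h2, h3⟩ := Finset.mem_product.1 hx
    obtain ⟨h4, h5⟩ := Finset.mem_powersetCard.1 h3
    exact ⟨Finset.disjoint_left.1 hU h2, h4.trans hB', h5, h2, h4⟩
  have hch : 0 < B'.card.choose k := Nat.choose_pos hk
  have hKc : (K.card : ℝ) = U.card * B'.card.choose k := by
    rw [hK, Finset.card_product, Finset.card_powersetCard]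
    push_cast
    rfl
  have hU1 : (0 : ℝ) < U.card := by exact_mod_cast hU0.card_pos
  have hK0 : (0 : ℝ) < K.card := by rw [hKc]; positivity
  set f : Finset (Sym2 (Fin n)) → ℝ := fun I => ∑ x ∈ K, pendInd B (fun _ => x.1) x.2 I with hf
  have hμ : Exs p (B.biUnion (blk B)) f = K.card * ρ ^ k := by
    rw [hf, Exs_sum, Finset.sum_congr rfl fun x hx => (Exs_pendInd (hKm x hx).2.1 fun _ _ =>
      (hKm x hx).1).trans (by rw [(hKm x hx).2.2.1]), Finset.sum_const, nsmul_eq_mul]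
  set X := 2 ^ k * (1 + ρ) ^ B'.card with hX
  have hw : ∀ x ∈ K, ∑ y ∈ K, (if x.1 = y.1 then
      ρ ^ k * ∏ b ∈ y.2, (if b ∈ x.2 then 1 else ρ) else 0) ≤ ρ ^ k * X := by
    intro x hx
    obtain ⟨-, -, hx3, hx4, hx5⟩ := hKm x hx
    rw [hK, Finset.sum_product, Finset.sum_eq_single x.1]
    · simp only [if_true, ← Finset.mul_sum]
      refine mul_le_mul_of_nonneg_left ?_ (by positivity)
      calc ∑ L ∈ Finset.powersetCard k B', ∏ b ∈ L, (if b ∈ x.2 then 1 else ρ)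
          ≤ ∑ L ∈ B'.powerset, ∏ b ∈ L, (if b ∈ x.2 then 1 else ρ) := by
            refine Finset.sum_le_sum_of_subset_of_nonneg (fun L hL => Finset.mem_powerset.2
              (Finset.mem_powersetCard.1 hL).1) fun L _ _ => Finset.prod_nonneg fun b _ => ?_
            split_ifs <;> positivity
        _ = ∏ b ∈ B', (1 + if b ∈ x.2 then 1 else ρ) := (Finset.prod_one_add _).symm
        _ ≤ ∏ b ∈ B', ((if b ∈ x.2 then 2 else 1) * (1 + ρ)) := by
            refine Finset.prod_le_prod (fun b _ => ?_) fun b _ => ?_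
            · split_ifs <;> positivity
            · split_ifs <;> linarith
        _ = X := by
            rw [Finset.prod_mul_distrib, Finset.prod_const, Finset.prod_ite_mem,
              Finset.inter_eq_right.2 hx5, Finset.prod_const, hx3]
    · intro v _ hv
      exact Finset.sum_eq_zero fun L _ => if_neg hv.symm
    · intro h
      exact absurd hx4 h
  have hsq : Exs p (B.biUnion (blk B)) (fun I => f I * f I)
      ≤ (K.card * ρ ^ k) ^ 2 + K.card * (ρ ^ k * X) := by
    have e : ∀ I, f I * f I = ∑ x ∈ K, ∑ y ∈ K,
        pendInd B (fun _ => x.1) x.2 I * pendInd B (fun _ => y.1) y.2 I := fun I => by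
      rw [hf, Finset.sum_mul_sum]
    rw [Exs_congr fun I _ => e I, Exs_sum]
    have hx : ∀ x ∈ K, Exs p (B.biUnion (blk B)) (fun I => ∑ y ∈ K,
        pendInd B (fun _ => x.1) x.2 I * pendInd B (fun _ => y.1) y.2 I)
        ≤ K.card * (ρ ^ k * ρ ^ k) + ρ ^ k * X := by
      intro x hx
      rw [Exs_sum, ← nsmul_eq_mul, ← Finset.sum_const]
      refine le_trans ?_ (add_le_add_right (hw x hx) _)
      rw [← Finset.sum_add_distrib]
      refine Finset.sum_le_sum fun y hy => ?_
      have := Exs_pendInd_mul h0.le h1.le (hKm x hx).2.1 (hKm y hy).2.1 (hKm x hx).1 (hKm y hy).1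
      rwa [(hKm x hx).2.2.1, (hKm y hy).2.2.1] at this
    refine (Finset.sum_le_card_nsmul _ _ _ hx).trans (le_of_eq ?_)
    rw [nsmul_eq_mul]
    ring
  refine (Exs_second_moment h0.le h1.le (f := f) (μ := K.card * ρ ^ k) (by positivity) hμ ?_).trans ?_
  · intro I _ hI
    refine Finset.sum_eq_zero fun x hx => ?_
    obtain ⟨-, -, h3, h4, h5⟩ := hKm x hx
    have := hI x.1 h4 x.2 h5 h3
    push Not at this
    obtain ⟨b, hb, h6⟩ := this
    exact Finset.prod_eq_zero hb (ind_neg h6)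
  · rw [← mul_assoc (U.card : ℝ), ← hKc, sub_le_iff_le_add, div_le_iff₀ (by positivity)]
    refine hsq.trans (le_of_eq ?_)
    field_simp
    ring

end Pendant


/-! ### Components after the deletion of a small cut -/

open Classical in
/-- In an expanding graph, a large component keeps a large part outside of a small set. -/
lemma exists_large_part {V : Type} [Fintype V] {G G₁ : SimpleGraph V} {B : Finset V} (hG₁ : G₁ ≤ G)
    (h1 : ∀ u v, u ∉ B → v ∉ B → G.Adj u v → G₁.Adj u v)
    (h2 : ∀ u v, G₁.Adj u v → u ∉ B → v ∉ B) {R T : ℝ} {l : ℕ} (hR : 0 ≤ R)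
    (hdeg : ∀ v, dg G v ≤ l)
    (hexp : ∀ S, Cn G S → (S.ncard : ℝ) ≤ T → 0 < ebt G S Sᶜ → (S.ncard : ℝ) ≤ R * ebt G S Sᶜ)
    (hB : B.card * (R * l + 1) ≤ T) {x : V} (hx : T < (cc G x).ncard) :
    ∃ v ∈ cc G x, v ∉ B ∧ T < (cc G₁ v).ncard ∧ ∀ z ∈ cc G₁ v, z ∈ cc G x ∧ z ∉ B := by
  have hav : ∀ v ∉ B, ∀ z ∈ cc G₁ v, z ∉ B := by
    intro v hv z hz hzB
    obtain ⟨a, -, b, -, h3, h4, h5⟩ := (cn_cc G₁ v).2 {z | z ∉ B} ⟨v, mem_cc_self _ _, hv⟩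
      ⟨z, hz, fun h => h hzB⟩
    exact h4 (h2 a b h5 h3)
  have hsub : ∀ v ∈ cc G x, cc G₁ v ⊆ cc G x := fun v hv z hz =>
    SimpleGraph.Reachable.trans hv (SimpleGraph.Reachable.mono hG₁ hz)
  by_contra! h
  have hsm : ∀ v ∈ cc G x, v ∉ B → ((cc G₁ v).ncard : ℝ) ≤ T := by
    intro v hv hvB
    by_contra! h3
    obtain ⟨z, hz, h4⟩ := h v hv hvB h3
    exact hav v hvB z hz (h4 (hsub v hv hz))
  set P : Finset (V × V) := Finset.univ.filter fun r => r.1 ∉ B ∧ r.2 ∈ B ∧ G.Adj r.1 r.2 with hP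
  set W : Finset V := Finset.univ.filter fun v => v ∈ cc G x ∧ v ∉ B with hW
  have hPc : P.card ≤ l * B.card := by
    refine (Finset.card_le_mul_card_image (f := Prod.snd) P l fun b _ => ?_).trans
      (Nat.mul_le_mul_left _ (Finset.card_le_card fun b hb => ?_))
    · refine le_trans ?_ (hdeg b)
      rw [← Set.ncard_coe_finset]
      refine Set.ncard_le_ncard_of_injOn Prod.fst ?_ ?_ (Set.toFinite _)
      · intro r hr
        simp only [hP, Finset.coe_filter, Finset.mem_filter, Finset.mem_univ, true_and,
          Set.mem_ofPred_eq] at hr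
        obtain ⟨⟨-, -, h3⟩, rfl⟩ := hr
        exact h3.symm
      · intro r hr r' hr' hrr
        simp only [Finset.coe_filter, Set.mem_ofPred_eq] at hr hr'
        exact Prod.ext hrr (hr.2.trans hr'.2.symm)
    · obtain ⟨r, hr, rfl⟩ := Finset.mem_image.1 hb
      exact (Finset.mem_filter.1 hr).2.2.1
  have hpos : ∀ v, (0 : ℝ) < (cc G₁ v).ncard := fun v => by
    exact_mod_cast (Set.ncard_pos (Set.toFinite _)).2 ⟨v, mem_cc_self _ _⟩
  have h3 : ∀ v ∈ W, (1 : ℝ) ≤ R * ∑ r ∈ P, if r.1 ∈ cc G₁ v then 1 / ((cc G₁ v).ncard : ℝ) else 0 := by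
    intro v hv
    obtain ⟨hv1, hv2⟩ := (Finset.mem_filter.1 hv).2
    have hS := hsm v hv1 hv2
    have h4 : ebt G (cc G₁ v) (cc G₁ v)ᶜ ≤ (P.filter fun r => r.1 ∈ cc G₁ v).card := by
      rw [ebt, ← Set.ncard_coe_finset]
      refine Set.ncard_le_ncard (fun r hr => ?_) (Set.toFinite _)
      obtain ⟨e1, e2, e3⟩ := hr
      have e4 := hav v hv2 _ e1
      simp only [hP, Finset.coe_filter, Finset.mem_filter, Finset.mem_univ, true_and,
        Set.mem_ofPred_eq]
      refine ⟨⟨e4, by_contra fun e5 => e2 ?_, e3⟩, e1⟩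
      exact SimpleGraph.Reachable.trans e1 (h1 _ _ e4 e5 e3).reachable
    have h5 : 0 < ebt G (cc G₁ v) (cc G₁ v)ᶜ := by
      by_contra! h6
      have h7 : cc G v ⊆ cc G₁ v := by
        intro z hz
        by_contra hz'
        obtain ⟨a, -, b, -, e1, e2, e3⟩ := (cn_cc G v).2 (cc G₁ v)
          ⟨v, mem_cc_self _ _, mem_cc_self _ _⟩ ⟨z, hz, hz'⟩
        rw [Nat.le_zero, ebt, Set.ncard_eq_zero (Set.toFinite _)] at h6
        exact (Set.eq_empty_iff_forall_notMem.1 h6 (a, b)) ⟨e1, e2, e3⟩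
      have h8 := Set.ncard_le_ncard h7 (Set.toFinite _)
      rw [cc_eq_of_mem hv1] at h8
      have : ((cc G x).ncard : ℝ) ≤ (cc G₁ v).ncard := by exact_mod_cast h8
      linarith
    have h6 := hexp _ ((cn_cc G₁ v).mono fun _ _ _ _ h => hG₁ h) hS h5
    rw [← Finset.sum_filter, Finset.sum_const, nsmul_eq_mul, mul_one_div, mul_div_assoc',
      le_div_iff₀ (hpos v), one_mul]
    refine h6.trans (mul_le_mul_of_nonneg_left ?_ hR)
    exact_mod_cast h4
  have h4 : (W.card : ℝ) ≤ R * (l * B.card) := by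
    have h5 := Finset.sum_le_sum h3
    rw [Finset.sum_const, nsmul_eq_mul, mul_one, ← Finset.mul_sum, Finset.sum_comm] at h5
    refine h5.trans (mul_le_mul_of_nonneg_left ?_ hR)
    refine (Finset.sum_le_card_nsmul P _ 1 fun r _ => ?_).trans ?_
    · rw [← Finset.sum_filter]
      have h6 : ∀ v ∈ W.filter (fun v => r.1 ∈ cc G₁ v),
          1 / ((cc G₁ v).ncard : ℝ) = 1 / ((cc G₁ r.1).ncard : ℝ) := fun v hv => by
        rw [cc_eq_of_mem (Finset.mem_filter.1 hv).2]
      rw [Finset.sum_congr rfl h6, Finset.sum_const, nsmul_eq_mul, mul_one_div,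
        div_le_one (hpos _)]
      norm_cast
      rw [← Set.ncard_coe_finset]
      refine Set.ncard_le_ncard (fun v hv => ?_) (Set.toFinite _)
      exact SimpleGraph.Reachable.symm (Finset.mem_filter.1 (Finset.mem_coe.1 hv)).2
    · rw [nsmul_eq_mul, mul_one]
      exact_mod_cast hPc
  have h5 : (cc G x).ncard ≤ W.card + B.card := by
    rw [← Set.ncard_coe_finset, ← Set.ncard_coe_finset]
    refine (Set.ncard_le_ncard (fun z hz => ?_) (Set.toFinite _)).trans (Set.ncard_union_le _ _)
    by_cases hzB : z ∈ B
    · exact Or.inr hzB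
    · exact Or.inl (by simp [hW, hz, hzB])
  have h6 : ((cc G x).ncard : ℝ) ≤ W.card + B.card := by exact_mod_cast h5
  nlinarith

open Classical in
/-- The vertices of `B` without neighbours in `B`. -/
noncomputable def isol {n : ℕ} (G : SimpleGraph (Fin n)) (B : Finset (Fin n)) : Finset (Fin n) :=
  B.filter fun b => ∀ d ∈ B, ¬ G.Adj b d

/-- Every component with more than `T` vertices has a vertex with `k` pendant neighbours. -/
def Pendants {V : Type} (G : SimpleGraph V) (T : ℝ) (k : ℕ) : Prop :=
  ∀ x, T < (cc G x).ncard → ∃ v ∈ cc G x, ∃ L : Finset V, L.card = k ∧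
    ∀ b ∈ L, ∀ y, G.Adj b y ↔ y = v

open Classical in
lemma Pg_isol_le {n s : ℕ} {p : ℝ} (h0 : 0 ≤ p) (h1 : p ≤ 1) {B : Finset (Fin n)}
    (hs : 2 * s ≤ B.card) : Pg n p (fun G => ¬ s ≤ (isol G B).card) ≤ 2 * B.card * p := by
  rcases B.eq_empty_or_nonempty with rfl | hB
  · have : s = 0 := by simpa using hs
    subst this
    refine le_of_eq_of_le ?_ (show (0 : ℝ) ≤ _ by simp)
    simp [Pg, Eg, ind, Exs]
  have hB0 : (0 : ℝ) < B.card := by exact_mod_cast hB.card_pos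
  refine (Pg_le_Eg h0 h1 (f := fun G => ∑ b ∈ B, ∑ b' ∈ B, 2 / B.card * ind (G.Adj b b'))
    (fun G => Finset.sum_nonneg fun _ _ => Finset.sum_nonneg fun _ _ =>
      mul_nonneg (by positivity) (ind_nonneg _)) fun G hG => ?_).trans ?_
  · simp only [← Finset.mul_sum]
    have h2 : ((B.filter fun b => ¬ ∀ b' ∈ B, ¬ G.Adj b b').card : ℝ)
        ≤ ∑ b ∈ B, ∑ b' ∈ B, ind (G.Adj b b') := by
      rw [Finset.card_filter]
      push_cast
      refine Finset.sum_le_sum fun b _ => ?_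
      split_ifs with h
      · exact Finset.sum_nonneg fun _ _ => ind_nonneg _
      · push Not at h
        obtain ⟨b', hb', h3⟩ := h
        rw [← ind_pos h3]
        exact Finset.single_le_sum (f := fun b' => ind (G.Adj b b')) (fun _ _ => ind_nonneg _) hb'
    have h3 := Finset.card_filter_add_card_filter_not (s := B) fun b => ∀ b' ∈ B, ¬ G.Adj b b'
    have h4 : B.card ≤ 2 * (B.filter fun b => ¬ ∀ b' ∈ B, ¬ G.Adj b b').card := by
      unfold isol at hG
      omega
    have h5 : (B.card : ℝ) ≤ 2 * (B.filter fun b => ¬ ∀ b' ∈ B, ¬ G.Adj b b').card := by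
      exact_mod_cast h4
    rw [div_mul_eq_mul_div, le_div_iff₀ hB0]
    linarith
  · have h2 : ∀ b b', Exs p (edges n) (fun A => 2 / B.card * ind ((Gr A).Adj b b'))
        ≤ 2 / B.card * p := by
      intro b b'
      rw [Exs_const_mul]
      refine mul_le_mul_of_nonneg_left ?_ (by positivity)
      by_cases h : b = b'
      · subst h
        simp [ind, Exs_const, h0]
      · refine le_of_le_of_eq (Exs_mono h0 h1 (g := fun A => if {s(b, b')} ⊆ A then 1 else 0)
          fun A _ => ind_le_of (by split_ifs <;> norm_num) fun h3 => ?_)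
          ((Exs_superset_one (Finset.singleton_subset_iff.2 (mk_mem_edges.2 h))).trans (by simp))
        rw [if_pos (Finset.singleton_subset_iff.2 (Gr_adj.1 h3).1)]
    rw [Eg, Exs_sum]
    simp only [Exs_sum]
    refine (Finset.sum_le_sum fun b _ => Finset.sum_le_sum fun b' _ => h2 b b').trans (le_of_eq ?_)
    simp only [Finset.sum_const, nsmul_eq_mul]
    field_simp


open Classical in
/-- In an expanding random graph, large components have vertices with many pendant neighbours. -/
lemma Pg_pendant_le {n k l s : ℕ} {p R T : ℝ} (h0 : 0 < p) (h1 : p < 1) {B : Finset (Fin n)}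
    (hT : 0 < T) (hR : 0 ≤ R) (hk : k ≤ s) (hB : B.card * (R * l + 1) ≤ T) :
    Pg n p (fun G => ¬ ((∀ v, dg G v ≤ l) → (∀ S, Cn G S → (S.ncard : ℝ) ≤ T →
        0 < ebt G S Sᶜ → (S.ncard : ℝ) ≤ R * ebt G S Sᶜ) → s ≤ (isol G B).card → Pendants G T k))
      ≤ n / T * (2 ^ k * (1 + pend p B) ^ s / (T * (s.choose k * pend p B ^ k))) := by
  set E₂ := B.biUnion (blk B) with hE₂
  have hmem : ∀ {e}, e ∈ E₂ ↔ ∃ b ∈ B, ∃ a, a ∉ B ∧ s(a, b) = e := by simp [hE₂, mem_blk]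
  have hsub : E₂ ⊆ edges n := fun e he => by
    obtain ⟨b, hb, a, ha, rfl⟩ := hmem.1 he
    exact mk_mem_edges.2 fun h => ha (h ▸ hb)
  set X := 2 ^ k * (1 + pend p B) ^ s / (T * (s.choose k * pend p B ^ k)) with hX
  have hρ : 0 < pend p B := mul_pos h0 (pow_pos (by linarith) _)
  have hch : (0 : ℝ) < s.choose k := by exact_mod_cast Nat.choose_pos hk
  rw [Pg, Eg, ← Finset.sdiff_union_of_subset hsub, Exs_union Finset.sdiff_disjoint]
  refine (Exs_mono h0.le h1.le (g := fun _ => n / T * X) fun O hO => ?_).trans_eq (Exs_const _)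
  have hOE : ∀ e ∈ O, e ∉ E₂ := fun e he => (Finset.mem_sdiff.1 (hO he)).2
  by_cases hiso : s ≤ (isol (Gr O) B).card
  swap
  · refine (Exs_mono h0.le h1.le (g := fun _ => 0) fun I _ => (ind_neg fun h => ?_).le).trans
      (by rw [Exs_const]; positivity)
    push Not at h
    refine hiso (h.2.2.1.trans (Finset.card_le_card fun b hb => ?_))
    obtain ⟨h3, h4⟩ := Finset.mem_filter.1 hb
    exact Finset.mem_filter.2 ⟨h3, fun b' hb' h5 =>
      h4 b' hb' (Gr_mono Finset.subset_union_left h5)⟩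
  obtain ⟨B', hB', hB's⟩ := Finset.exists_subset_card_eq hiso
  set U : Fin n → Finset (Fin n) := fun v => (cc (Gr O) v).toFinset with hU
  set V : Finset (Fin n) := Finset.univ.filter fun v =>
    T < (cc (Gr O) v).ncard ∧ ∀ z ∈ cc (Gr O) v, z ∉ B with hV
  set bad : Fin n → Finset (Sym2 (Fin n)) → Prop := fun v I => ∀ w ∈ U v, ∀ L ⊆ B', L.card = k →
    ¬ ∀ b ∈ L, I ∩ blk B b = {s(w, b)} with hbad
  have hbd : ∀ v ∈ V, Exs p E₂ (fun I => 1 / T * ind (bad v I)) ≤ 1 / T * X := by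
    intro v hv
    obtain ⟨-, h2, h3⟩ := Finset.mem_filter.1 hv
    have hc : ((U v).card : ℝ) = (cc (Gr O) v).ncard := by rw [Set.ncard_eq_toFinset_card']
    rw [Exs_const_mul]
    refine mul_le_mul_of_nonneg_left ((Exs_no_pendant_le h0 h1 (U := U v) (B' := B')
      (Finset.disjoint_left.2 fun z hz => h3 z (Set.mem_toFinset.1 hz))
      ⟨v, Set.mem_toFinset.2 (mem_cc_self _ _)⟩ (hB'.trans (Finset.filter_subset _ _))
      (hB's ▸ hk)).trans ?_) (by positivity)
    rw [hB's, hX, hc]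
    gcongr
  refine (Exs_mono h0.le h1.le (g := fun I => ∑ v ∈ V, 1 / T * ind (bad v I)) fun I hI =>
    ind_le_of (Finset.sum_nonneg fun _ _ => mul_nonneg (by positivity) (ind_nonneg _))
      fun h => ?_).trans ?_
  · push Not at h
    obtain ⟨hdeg, hexp, -, hP⟩ := h
    unfold Pendants at hP
    push Not at hP
    obtain ⟨x, hx, hP⟩ := hP
    have hI' : ∀ {u v}, s(u, v) ∈ I → u ∉ B → v ∈ B := fun {u v} h hu => by
      obtain ⟨b, hb, a, ha, h3⟩ := hmem.1 (hI h)
      rcases Sym2.eq_iff.1 h3 with ⟨-, rfl⟩ | ⟨-, rfl⟩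
      · exact hb
      · exact absurd hb hu
    obtain ⟨v, -, -, hvT, hv⟩ := exists_large_part (G := Gr (O ∪ I)) (G₁ := Gr O) (B := B)
      (Gr_mono Finset.subset_union_left)
      (fun u v hu hv h => Gr_adj.2 ⟨((Finset.mem_union.1 (Gr_adj.1 h).1).resolve_right
        fun h3 => hv (hI' h3 hu)), h.ne⟩)
      (fun u v h hu hv => hOE _ (Gr_adj.1 h).1 (hmem.2 ⟨v, hv, u, hu, rfl⟩)) hR hdeg hexp hB hx
    have hz : ∀ z ∈ U v, z ∈ V ∧ bad z I := by
      intro z hz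
      have hcz := cc_eq_of_mem (Set.mem_toFinset.1 hz)
      refine ⟨Finset.mem_filter.2 ⟨Finset.mem_univ _, ?_⟩, fun w hw L hL hLk hall => ?_⟩
      · rw [hcz]
        exact ⟨hvT, fun z hz => (hv z hz).2⟩
      · simp only [hU, hcz, Set.mem_toFinset] at hw
        obtain ⟨hw1, hw2⟩ := hv w hw
        obtain ⟨b, hb, y, hy⟩ := hP w hw1 L hLk
        obtain ⟨hbB, hbi⟩ := Finset.mem_filter.1 (hB' (hL hb))
        have hwb : s(w, b) ∈ I ∩ blk B b := by simp [hall b hb]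
        have hIb := (Finset.mem_inter.1 hwb).1
        have key : (Gr (O ∪ I)).Adj b y ↔ y = w := by
          constructor
          · intro h
            rw [Gr_adj, Sym2.eq_swap, Finset.mem_union] at h
            by_cases hyB : y ∈ B
            · rcases h with ⟨h | h, h3⟩
              · exact absurd (Gr_adj.2 ⟨Sym2.eq_swap ▸ h, h3⟩) (hbi y hyB)
              · obtain ⟨b', hb', a, ha, h4⟩ := hmem.1 (hI h)
                rcases Sym2.eq_iff.1 h4 with ⟨rfl, -⟩ | ⟨rfl, -⟩ <;> contradiction
            · have h4 := Finset.mem_inter.2 ⟨h.1.resolve_left fun h4 =>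
                hOE _ h4 (hmem.2 ⟨b, hbB, y, hyB, rfl⟩), mem_blk.2 ⟨y, hyB, rfl⟩⟩
              rw [hall b hb, Finset.mem_singleton] at h4
              exact (mk_inj_of_mem hbB hyB h4).1
          · rintro rfl
            exact Gr_adj.2 ⟨Finset.mem_union_right _ (Sym2.eq_swap ▸ hIb), fun h => hw2 (h ▸ hbB)⟩
        tauto
    refine le_trans ?_ (Finset.sum_le_sum_of_subset_of_nonneg (fun z h => (hz z h).1)
      fun _ _ _ => mul_nonneg (by positivity) (ind_nonneg _))
    rw [Finset.sum_congr rfl fun z h => by rw [ind_pos (hz z h).2], Finset.sum_const, nsmul_eq_mul,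
      mul_one, mul_one_div, one_le_div hT, ← Set.ncard_eq_toFinset_card']
    exact hvT.le
  · rw [Exs_sum]
    refine (Finset.sum_le_card_nsmul _ _ _ hbd).trans ?_
    rw [nsmul_eq_mul, ← mul_assoc, mul_one_div]
    have : V.card ≤ n := (Finset.card_le_univ V).trans (by simp)
    gcongr


open Classical in
lemma whp_pendant {c : ℝ} (hc : 1 < c) {ε C : ℝ} {g : ℕ} (hε : 0 < ε) (hC : 0 < C)
    (hexp : Whp c (fun n G => ∀ S, Cn G S → C * Real.log n ≤ S.ncard → (S.ncard : ℝ) ≤ ε * n →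
      S.ncard ≤ g * ebt G S Sᶜ)) :
    Whp c (fun n G => Pendants G (ε * n) ⌊Real.log n / (12 * Real.log (Real.log n))⌋₊) := by
  have hc0 : 0 < c := by linarith
  set k : ℕ → ℕ := fun n => ⌊Real.log n / (12 * Real.log (Real.log n))⌋₊
  set m : ℕ → ℕ := fun n => ⌊n / Real.log n ^ 4⌋₊
  set l : ℕ → ℕ := fun n => ⌈4 * Real.log n⌉₊
  set R : ℕ → ℝ := fun n => C * Real.log n + g
  have hm : ∀ n : ℕ, (m n : ℝ) ≤ n / Real.log n ^ 4 := fun n => Nat.floor_le (by positivity)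
  have hmn : ∀ᶠ n : ℕ in atTop, m n ≤ n := by
    filter_upwards [eventually_le_log 1] with n h1
    exact_mod_cast (hm n).trans (div_le_self (by positivity) (one_le_pow₀ h1))
  have hB : ∀ n, ∃ B : Finset (Fin n), m n ≤ n → B.card = m n := fun n => by
    by_cases h : m n ≤ n
    · obtain ⟨B, -, hB⟩ := Finset.exists_subset_card_eq (s := (Finset.univ : Finset (Fin n)))
        (by simpa using h)
      exact ⟨B, fun _ => hB⟩
    · exact ⟨∅, fun h' => absurd h' h⟩
  choose B hB using hB
  have w1 : Whp c (fun n G => m n / 2 ≤ (isol G (B n)).card) := by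
    refine Whp.of_bound hc0 (tendsto_log_nat.const_div_atTop (2 * c)) ?_
    filter_upwards [eventually_p hc0, hmn, eventually_le_log 1, eventually_ge_atTop 1]
      with n hp h2 h1 hn
    refine (Pg_isol_le hp.1 hp.2 (by rw [hB n h2]; omega)).trans ?_
    rw [hB n h2]
    have hn' : (0 : ℝ) < n := by exact_mod_cast hn
    calc 2 * (m n : ℝ) * (c / n) ≤ 2 * (n / Real.log n ^ 4) * (c / n) := by
          have := hm n
          gcongr
      _ = 2 * c / Real.log n ^ 4 := by field_simp
      _ ≤ 2 * c / Real.log n := by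
          gcongr
          exact le_self_pow₀ h1 (by norm_num)
  have w2 : Whp c (fun n G => (∀ v, dg G v ≤ l n) → (∀ S, Cn G S → (S.ncard : ℝ) ≤ ε * n →
      0 < ebt G S Sᶜ → (S.ncard : ℝ) ≤ R n * ebt G S Sᶜ) → m n / 2 ≤ (isol G (B n)).card →
      Pendants G (ε * n) (k n)) := by
    set δ := c * (Real.exp (-c) / 2) with hδ
    have hδ0 : 0 < δ := by positivity
    have ht : Tendsto (fun n : ℕ => Real.exp c / ε ^ 2 * Real.exp (-(Real.log n / 2))) atTop
        (nhds 0) := by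
      simpa using (Real.tendsto_exp_neg_atTop_nhds_zero.comp
        (tendsto_log_nat.atTop_div_const two_pos)).const_mul (Real.exp c / ε ^ 2)
    refine Whp.of_bound hc0 ht ?_
    filter_upwards [hmn, eventually_le_log 1, eventually_log_pow_le 4 5 one_pos,
      eventually_le_log (8 / δ), eventually_le_log ((5 * (C + g) + 1) / ε), eventually_gt_atTop ⌈c⌉₊,
      tendsto_loglog_nat.eventually_ge_atTop 1, (Real.tendsto_one_add_div_pow_exp (-c)).eventually
        (lt_mem_nhds (half_lt_self (Real.exp_pos (-c))))] with n hmn h1 h2 h3 h4 h5 h6 h7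
    have hcn : c < n := Nat.lt_of_ceil_lt h5
    have hn : (0 : ℝ) < n := by linarith
    have hp1 : c / n < 1 := (div_lt_one hn).2 hcn
    have hp0 : 0 < c / n := by positivity
    rw [div_le_iff₀ hδ0] at h3
    rw [div_le_iff₀ hε] at h4
    rw [one_mul] at h2
    set lam := Real.log n with hlam
    set ρ := pend (c / n) (B n) with hρ
    have hρ1 : δ / n ≤ ρ := by
      rw [hδ, mul_div_right_comm, hρ, pend]
      refine mul_le_mul_of_nonneg_left (h7.le.trans ?_) hp0.le
      rw [neg_div, ← sub_eq_add_neg]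
      refine pow_le_pow_of_le_one (by linarith) (by linarith) ?_
      have := Finset.card_le_univ (B n)ᶜ
      rw [Fintype.card_fin] at this
      omega
    have hρ2 : ρ ≤ c / n := mul_le_of_le_one_right hp0.le (pow_le_one₀ (by linarith) (by linarith))
    have hρ0 : 0 < ρ := lt_of_lt_of_le (by positivity) hρ1
    have hkL : (k n : ℝ) * (12 * Real.log lam) ≤ lam := by
      rw [← le_div_iff₀ (by positivity)]
      exact Nat.floor_le (by positivity)
    have hkl : (k n : ℝ) ≤ lam := by
      have : (0 : ℝ) ≤ k n := by positivity
      nlinarith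
    have hM : 4 * lam ≤ n / lam ^ 4 := by
      rw [le_div_iff₀ (by positivity)]
      linarith
    have hs : n / lam ^ 4 / 2 - 1 ≤ ((m n / 2 : ℕ) : ℝ) := by
      have e1 : n / lam ^ 4 < m n + 1 := Nat.lt_floor_add_one _
      have e2 : (m n : ℝ) ≤ 2 * ((m n / 2 : ℕ) : ℝ) + 1 := by exact_mod_cast (by omega)
      linarith
    have hks : k n ≤ m n / 2 := by
      have : (k n : ℝ) ≤ ((m n / 2 : ℕ) : ℝ) := by linarith
      exact_mod_cast this
    have hch : (2 : ℝ) ^ k n ≤ (lam ^ 6) ^ k n * ((m n / 2).choose (k n) * ρ ^ k n) := by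
      have hD : 2 * (k n : ℝ) ≤ lam ^ 6 * ρ * ((m n / 2 + 1 - k n : ℕ) : ℝ) := by
        rw [Nat.cast_sub (by omega)]
        push_cast
        calc 2 * (k n : ℝ) ≤ lam ^ 6 * (δ / n) * (n / lam ^ 4 / 4) := by
              have : lam ^ 6 * (δ / n) * (n / lam ^ 4 / 4) = lam * (lam * δ) / 4 := by field_simp
              rw [this]
              nlinarith
          _ ≤ _ := by
              gcongr
              linarith
      have e1 : (((m n / 2 + 1 - k n : ℕ) : ℝ)) ^ k n ≤ (m n / 2).choose (k n) * (k n : ℝ) ^ k n := by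
        have := Nat.pow_sub_le_descFactorial (m n / 2) (k n)
        rw [Nat.descFactorial_eq_factorial_mul_choose, mul_comm] at this
        exact_mod_cast this.trans (Nat.mul_le_mul_left _ (Nat.factorial_le_pow _))
      have e2 : (0 : ℝ) < (k n : ℝ) ^ k n := by exact_mod_cast Nat.pow_self_pos
      refine le_of_mul_le_mul_right ?_ e2
      rw [← mul_pow]
      refine (pow_le_pow_left₀ (by positivity) hD _).trans ?_
      rw [mul_pow, mul_pow]
      calc _ ≤ (lam ^ 6) ^ k n * ρ ^ k n * ((m n / 2).choose (k n) * (k n : ℝ) ^ k n) := by gcongr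
        _ = _ := by ring
    have hX : (lam ^ 6) ^ k n ≤ Real.exp (lam / 2) := by
      rw [← pow_mul, ← Real.exp_log (show 0 < lam by linarith), ← Real.exp_nat_mul,
        Real.exp_log (show 0 < lam by linarith)]
      refine Real.exp_le_exp.2 ?_
      push_cast
      linarith
    have hY : (1 + ρ) ^ (m n / 2) ≤ Real.exp c := by
      calc (1 + ρ) ^ (m n / 2) ≤ Real.exp ρ ^ n := by
            refine (pow_le_pow_left₀ (by positivity) (by linarith [Real.add_one_le_exp ρ]) _).trans
              (pow_le_pow_right₀ (Real.one_le_exp hρ0.le) (by omega))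
        _ ≤ Real.exp c := by
            rw [← Real.exp_nat_mul, Real.exp_le_exp]
            exact (mul_le_mul_of_nonneg_left hρ2 hn.le).trans_eq (by field_simp)
    refine (Pg_pendant_le hp0 hp1 (by positivity) (by positivity) hks ?_).trans ?_
    · rw [hB n hmn]
      have e1 : (l n : ℝ) ≤ 5 * lam := by
        have := Nat.ceil_lt_add_one (show 0 ≤ 4 * lam by positivity)
        linarith
      calc (m n : ℝ) * (R n * l n + 1) ≤ n / lam ^ 4 * ((C * lam + g * lam) * (5 * lam) + lam ^ 2) := by
            have := hm n
            have : R n ≤ C * lam + g * lam :=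
              add_le_add_right (le_mul_of_one_le_right (by positivity) h1) _
            have : 1 ≤ lam ^ 2 := one_le_pow₀ h1
            gcongr
        _ = n / lam ^ 2 * (5 * (C + g) + 1) := by field_simp
        _ ≤ n / lam ^ 2 * (lam ^ 2 * ε) := by
            gcongr
            nlinarith
        _ = ε * n := by field_simp
    · have hpos : (0 : ℝ) < (m n / 2).choose (k n) := by exact_mod_cast Nat.choose_pos hks
      calc _ ≤ n / (ε * n) * ((lam ^ 6) ^ k n * ((m n / 2).choose (k n) * ρ ^ k n) * Real.exp c /
            (ε * n * ((m n / 2).choose (k n) * ρ ^ k n))) := by gcongr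
        _ = Real.exp c / ε ^ 2 * ((lam ^ 6) ^ k n / n) := by field_simp
        _ ≤ Real.exp c / ε ^ 2 * (Real.exp (lam / 2) / n) := by gcongr
        _ = _ := by
            rw [show (n : ℝ) = Real.exp lam from (Real.exp_log hn).symm, ← Real.exp_sub]
            congr 2
            ring
  have w3 : Whp c (fun n G => ∀ v, dg G v ≤ l n) := whp_deg hc (by
    filter_upwards [eventually_le_log 1, tendsto_loglog_nat.eventually_ge_atTop 1] with n h1 h6
    have : 4 * Real.log n ≤ l n := Nat.le_ceil _
    nlinarith)
  refine ((w1.and hc0 w2).and hc0 (w3.and hc0 hexp)).mono hc0 ?_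
  filter_upwards [eventually_le_log 1] with n h1
  rintro G ⟨⟨h2, h3⟩, h4, h5⟩
  refine h3 h4 (fun S hS hSn h0 => ?_) h2
  have h0' : (1 : ℝ) ≤ ebt G S Sᶜ := by exact_mod_cast h0
  have hg : (0 : ℝ) ≤ g * ebt G S Sᶜ := by positivity
  have hl : 0 ≤ C * Real.log n := by positivity
  rw [add_mul]
  rcases le_total (C * Real.log n) S.ncard with h | h
  · have : (S.ncard : ℝ) ≤ g * ebt G S Sᶜ := by exact_mod_cast h5 S hS h hSn
    nlinarith
  · nlinarith


lemma natLog_two_le {k : ℕ} (hk : k ≠ 0) : Nat.log 2 k * (1 / 2) ≤ Real.log k := by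
  have h := Real.log_le_log (by positivity)
    (show ((2 : ℝ) ^ Nat.log 2 k) ≤ k by exact_mod_cast Nat.pow_log_le_self 2 hk)
  rw [Real.log_pow] at h
  have := Real.log_two_gt_d9
  nlinarith [(Nat.cast_nonneg (Nat.log 2 k) : (0 : ℝ) ≤ _)]

lemma log_le_natLog_two {k : ℕ} (hk : 2 ≤ k) : Real.log k ≤ 2 * Nat.log 2 k := by
  have h := Real.log_le_log (by positivity)
    (show (k : ℝ) ≤ 2 ^ (Nat.log 2 k + 1) by exact_mod_cast (Nat.lt_pow_succ_log_self one_lt_two k).le)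
  rw [Real.log_pow] at h
  have h1 := Real.log_two_lt_d9
  have h2 : (1 : ℝ) ≤ Nat.log 2 k := by exact_mod_cast Nat.log_pos one_lt_two hk
  push_cast at h
  nlinarith

lemma eventually_log_pow_four_le : ∀ᶠ y : ℝ in atTop, Real.log y ^ 4 ≤ y := by
  filter_upwards [Real.isLittleO_pow_log_id_atTop (n := 4) |>.bound one_pos,
    eventually_ge_atTop 0] with y h hy
  rw [id, one_mul, Real.norm_of_nonneg hy] at h
  exact (Real.le_norm_self _).trans h

/-- Admissible parameters of the identification argument, as functions of `y = log n`. -/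
lemma exists_sizes {C₀ Ck : ℝ} (h0 : 1 ≤ C₀) (hk : 1 ≤ Ck) (g e₁ : ℕ) :
    ∃ b : ℝ, ∀ᶠ y : ℝ in atTop, ∃ α q₁ : ℕ, 3 ≤ α ∧
      (∀ k, 2 ≤ k → k ≤ ⌈4 * (y / Real.log y)⌉₊ → k + 2 ≤ α * Nat.log 2 k) ∧
      Sizes ⌈4 * (y / Real.log y)⌉₊ g e₁ ⌈y⌉₊ ⌈C₀ * y⌉₊ ⌈y ^ 4⌉₊ ⌈Real.log y⌉₊ ⌈Ck * (y / Real.log y)⌉₊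
        q₁ ∧
      totalCost α ⌈4 * (y / Real.log y)⌉₊ e₁ ⌈y⌉₊ ⌈Real.log y⌉₊ ⌈Ck * (y / Real.log y)⌉₊ q₁
        ≤ b * (y / Real.log y) := by
  set C₇ : ℝ := C₀ + 160 * g + 1 with hC₇
  have hC₇1 : C₀ + 1 ≤ C₇ := by linarith [(Nat.cast_nonneg g : (0 : ℝ) ≤ _)]
  set Q : ℝ := 24 * Ck + 2 * C₇ + 8 * Ck + 4 with hQ
  refine ⟨1700 + 4 * (e₁ * Q) + 4 * Ck, ?_⟩
  filter_upwards [eventually_ge_atTop (Q + 34 * (C₇ * C₀)), eventually_ge_atTop (4 * (g * e₁ : ℝ)),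
    eventually_ge_atTop (4 * (g * (2 + e₁ * Q)) + 1), Real.tendsto_log_atTop.eventually_ge_atTop 1,
    eventually_log_pow_four_le] with y y1 y2 y3 hL1 hL4
  have hCC : C₇ ≤ C₇ * C₀ := le_mul_of_one_le_right (by linarith) h0
  have hQ0 : 0 ≤ Q := by linarith
  have hy4 : 1 ≤ y := by linarith
  have hy0 : 0 < y := by linarith
  have hyC : y ≤ C₀ * y := le_mul_of_one_le_left hy0.le h0
  have hyk : y ≤ Ck * y := le_mul_of_one_le_left hy0.le hk
  have hy7 : C₀ * y + y ≤ C₇ * y := by linarith [mul_le_mul_of_nonneg_right hC₇1 hy0.le]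
  set L := Real.log y with hL
  have hL0 : 0 < L := by linarith
  set x := y / L with hx
  have hxL : x * L = y := div_mul_cancel₀ _ hL0.ne'
  have hL2 : L ≤ L ^ 2 := le_self_pow₀ hL1 two_ne_zero
  have hL3 : L ^ 2 ≤ L ^ 3 := pow_le_pow_right₀ hL1 (by norm_num)
  have hLx : L ^ 3 ≤ x := by
    rw [hx, le_div_iff₀ hL0]
    linarith
  have hx1 : 1 ≤ x := by linarith
  have hxy : x ≤ y := div_le_self hy0.le hL1
  have hxk : x ≤ Ck * x := le_mul_of_one_le_left (by linarith) hk
  have hxL1 : 1 ≤ x / L := by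
    rw [le_div_iff₀ hL0]
    linarith
  have c2 : ∀ {z : ℝ}, 1 ≤ z → (⌈z⌉₊ : ℝ) ≤ 2 * z := fun {z} hz => by
    linarith [Nat.ceil_lt_add_one (show 0 ≤ z by linarith)]
  set l := ⌈4 * x⌉₊
  set m := ⌈y⌉₊
  set s₀ := ⌈C₀ * y⌉₊
  set s₂ := ⌈y ^ 4⌉₊
  set h := ⌈L⌉₊
  set N := ⌈Ck * x⌉₊
  set q₁ := ⌈C₇ * y⌉₊
  set α := ⌈100 * (x / L)⌉₊
  have bl : (l : ℝ) ≤ 8 * x := (c2 (by linarith)).trans_eq (by ring)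
  have bs₀ : (s₀ : ℝ) ≤ 2 * (C₀ * y) := c2 (by linarith)
  have bh : (h : ℝ) ≤ 2 * L := c2 hL1
  have bN : (N : ℝ) ≤ 2 * (Ck * x) := c2 (by linarith)
  have bq : (q₁ : ℝ) ≤ 2 * (C₇ * y) := c2 (by linarith)
  have bα : (α : ℝ) ≤ 200 * (x / L) := (c2 (by linarith)).trans_eq (by ring)
  have lα : 100 * (x / L) ≤ α := Nat.le_ceil _
  have ls₂ : y ^ 4 ≤ s₂ := Nat.le_ceil _
  have hdiv : ∀ (a : ℕ) {z : ℝ}, 0 ≤ z → a ≤ z * y → ((a / m : ℕ) : ℝ) ≤ z := fun a z h0 hz =>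
    Nat.cast_div_le.trans (div_le_of_le_mul₀ (by positivity) h0
      (hz.trans (mul_le_mul_of_nonneg_left (Nat.le_ceil _) h0)))
  have bNh : (N : ℝ) * h ≤ 4 * (Ck * y) := by
    calc (N : ℝ) * h ≤ 2 * (Ck * x) * (2 * L) := by gcongr
      _ = _ := by rw [← hxL]; ring
  have bfan : 2 * (N : ℝ) * (2 * h + 2) ≤ 24 * (Ck * y) := by
    calc 2 * (N : ℝ) * (2 * h + 2) ≤ 2 * (2 * (Ck * x)) * (2 * (2 * L) + 2 * L) := by
          gcongr
          linarith
      _ = _ := by rw [← hxL]; ring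
  have hQy : Q * y = 24 * (Ck * y) + 2 * (C₇ * y) + 8 * (Ck * y) + 4 * y := by rw [hQ]; ring
  have hy3 : (Q + 34 * (C₇ * C₀)) * y ^ 3 ≤ y ^ 4 := by
    rw [pow_succ' y 3]
    exact mul_le_mul_of_nonneg_right y1 (by positivity)
  have hQs : Q * y ≤ s₂ := by
    have e1 := mul_le_mul_of_nonneg_left (le_self_pow₀ hy4 three_ne_zero) hQ0
    have e2 : 0 ≤ C₇ * C₀ * y ^ 3 := mul_nonneg (by linarith) (by positivity)
    linarith
  have half : ∀ b : ℝ, y ≤ b → g * (2 + e₁ * (b / y + (Q - 1) + 1)) < b / 2 := fun b hb => by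
    have e1 : g * e₁ * (b / y) ≤ y / 4 * (b / y) := by
      have : 0 ≤ b / y := div_nonneg (by linarith) hy0.le
      gcongr
      linarith
    have e2 : y / 4 * (b / y) = b / 4 := by field_simp
    linarith
  have hlog : ∀ M : ℕ, M ≠ 0 → M ≤ Q * y → (α : ℝ) * Nat.log 2 M ≤ 800 * x := fun M hM0 hM => by
    have e1 : Real.log M ≤ 2 * L := by
      rw [hL, ← Nat.cast_two, ← Real.log_pow]
      refine Real.log_le_log (by positivity) (hM.trans ?_)
      rw [sq]
      exact mul_le_mul_of_nonneg_right (by linarith) hy0.le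
    have e2 := natLog_two_le hM0
    calc (α : ℝ) * Nat.log 2 M ≤ 200 * (x / L) * (4 * L) := by
          gcongr
          linarith
      _ = 800 * x := by field_simp; norm_num
  have hN : 0 < N := Nat.ceil_pos.2 (by linarith)
  have hq : 0 < q₁ := Nat.ceil_pos.2 (by linarith)
  refine ⟨α, q₁, ?_, ?_, ⟨hN, hq, ?_, ?_, ?_, ?_, ?_, ?_⟩, ?_⟩
  · have : (3 : ℝ) ≤ α := by linarith
    exact_mod_cast this
  · intro k hk2 hkl
    have e1 : (1 : ℝ) ≤ Nat.log 2 k := by exact_mod_cast Nat.log_pos one_lt_two hk2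
    have e2 : (2 : ℝ) ≤ k := by exact_mod_cast hk2
    have e3 : (k : ℝ) ≤ l := by exact_mod_cast hkl
    suffices 2 * (k : ℝ) ≤ α * Nat.log 2 k by
      have : ((k + 2 : ℕ) : ℝ) ≤ ((α * Nat.log 2 k : ℕ) : ℝ) := by
        push_cast
        linarith
      exact_mod_cast this
    rcases le_total (k : ℝ) (x / L) with hkx | hkx
    · linarith [le_mul_of_one_le_right (Nat.cast_nonneg α) e1]
    · have e4 : L / 2 ≤ Real.log k := by
        refine le_trans ?_ (Real.log_le_log (by positivity) hkx)
        have e5 := Real.log_le_log (by positivity) hL4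
        rw [Real.log_pow] at e5
        rw [hx, Real.log_div (by positivity) hL0.ne', Real.log_div hy0.ne' hL0.ne', ← hL]
        push_cast at e5
        linarith
      have e5 : L / 4 ≤ Nat.log 2 k := by linarith [log_le_natLog_two hk2]
      calc 2 * (k : ℝ) ≤ 100 * (x / L) * (L / 4) := by
            have : 100 * (x / L) * (L / 4) = 25 * x := by field_simp; norm_num
            linarith
        _ ≤ _ := by gcongr
  · have : (2 : ℝ) * N * (2 * h + 2) ≤ 2 * s₂ := by linarith
    exact_mod_cast this
  · intro b hb _
    have e1 : y ≤ b := by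
      have : C₀ * y ≤ b := (Nat.le_ceil _).trans (Nat.cast_le.2 hb)
      linarith
    have e2 := hdiv (b + (q₁ + 2 * (N * h) + 2)) (z := b / y + (Q - 1))
      (add_nonneg (by positivity) (by linarith)) (by
      push_cast
      rw [add_mul, div_mul_cancel₀ _ hy0.ne']
      linarith)
    have : ((g * (2 + e₁ * ((b + (q₁ + 2 * (N * h) + 2)) / m + 1)) : ℕ) : ℝ) < b := by
      refine lt_of_le_of_lt ?_ ((half b e1).trans (half_lt_self (by linarith)))
      push_cast at e2 ⊢
      gcongr
    exact_mod_cast this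
  · intro b hb _
    have e1 : C₇ * y ≤ b := (Nat.le_ceil _).trans (Nat.cast_le.2 hb)
    have e2 := hdiv (b + (N * h + 1)) (z := b / y + (Q - 1)) (add_nonneg (by positivity) (by linarith)) (by
      push_cast
      rw [add_mul, div_mul_cancel₀ _ hy0.ne']
      linarith)
    have e3 : (l : ℝ) * (2 * h + 1) ≤ 40 * y := by
      calc (l : ℝ) * (2 * h + 1) ≤ 8 * x * (2 * (2 * L) + L) := by gcongr
        _ = _ := by rw [← hxL]; ring
    have e4 : C₇ * y = C₀ * y + 160 * (g * y) + y := by rw [hC₇]; ring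
    have e5 : (g : ℝ) * (l * (2 * h + 1)) ≤ g * (40 * y) := by gcongr
    have e6 : (0 : ℝ) ≤ g * y := by positivity
    have : ((g * (2 + e₁ * ((b + (N * h + 1)) / m + 1) + l * (2 * h + 1)) : ℕ) : ℝ) < b := by
      refine lt_of_le_of_lt ?_ (show _ < (b : ℝ) by linarith [half b (by linarith)] :
        (g : ℝ) * (2 + e₁ * (b / y + (Q - 1) + 1)) + g * (l * (2 * h + 1)) < b)
      push_cast at e2 ⊢
      rw [← mul_add]
      gcongr
    exact_mod_cast this
  · have : (q₁ : ℝ) + 2 * (N * h) + 2 ≤ s₂ := by linarith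
    exact_mod_cast this
  · exact Nat.ceil_mono (by linarith)
  · have : (q₁ : ℝ) + q₁ * (l * s₀) ≤ s₂ := by
      calc (q₁ : ℝ) + q₁ * (l * s₀) ≤ 2 * (C₇ * y) + 2 * (C₇ * y) * (8 * y * (2 * (C₀ * y))) := by
            gcongr
            linarith
        _ = 2 * (C₇ * y) + 32 * (C₇ * C₀) * y ^ 3 := by ring
        _ ≤ 2 * (C₇ * C₀ * y ^ 3) + 32 * (C₇ * C₀) * y ^ 3 := by
            gcongr
            exact le_self_pow₀ hy4 three_ne_zero
        _ ≤ s₂ := by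
            have : 0 ≤ Q * y ^ 3 := by positivity
            linarith
    exact_mod_cast this
  · have e1 := hlog (2 * N * (2 * h + 2)) (by positivity) (by push_cast; linarith)
    have e2 := hlog q₁ hq.ne' (by linarith)
    have e3 := hdiv (2 * N * (2 * h + 2)) (z := Q - 1) (by linarith) (by push_cast; linarith)
    have e4 := hdiv q₁ (z := Q - 1) (by linarith) (by linarith)
    have e5 : ∀ {z : ℝ}, z ≤ Q - 1 → e₁ * (z + 1) ≤ e₁ * Q := fun {z} hz => by
      gcongr
      linarith
    have e6 : e₁ * Q ≤ e₁ * Q * x := le_mul_of_one_le_right (by positivity) hx1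
    have e7 := e5 e3
    have e8 := e5 e4
    unfold totalCost idCost fcost
    push_cast at e1 e2 e7 e8 ⊢
    linarith

lemma Pendants.le_D {n k : ℕ} {G : SimpleGraph (Fin n)} {T : ℝ} (h : Pendants G T k)
    (K : G.ConnectedComponent) (hT : T < K.supp.ncard) (hex : ∃ φ, Defines (G.induce K.supp) φ) :
    k ≤ D (G.induce K.supp) := by
  classical
  induction K using SimpleGraph.ConnectedComponent.ind with | _ x
  obtain ⟨v, hv, L, rfl, hL⟩ := h x (by rwa [← supp_eq_cc])
  rw [← supp_eq_cc] at hv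
  refine le_D_of_leaves _ (v := ⟨v, hv⟩) (L := L.subtype (· ∈ (G.connectedComponentMk x).supp)) ?_
    (fun b hb y => ?_) hex
  · rw [Finset.card_subtype, Finset.filter_true_of_mem fun b hb => ?_]
    exact (SimpleGraph.ConnectedComponent.mem_supp_congr_adj _ ((hL b hb v).2 rfl)).2 hv
  · rw [SimpleGraph.induce_adj, hL _ (Finset.mem_subtype.1 hb), Subtype.ext_iff]

end GC

theorem statement2 (c : ℝ) (hc : 1 < c)
    (giant : ∀ n : ℕ, SimpleGraph (Fin n) → Set (Fin n)) (hgiant : IsGiantRule giant) :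
    ∃ a b : ℝ, 0 < a ∧ a ≤ b ∧
      Tendsto (fun n : ℕ => gnpProb n (c / n)
          {G | a * (Real.log n / Real.log (Real.log n)) ≤ (D (G.induce (giant n G)) : ℝ) ∧
            (D (G.induce (giant n G)) : ℝ) ≤ b * (Real.log n / Real.log (Real.log n))})
        atTop (nhds 1) := by
  have hc0 : 0 < c := by linarith
  obtain ⟨ε, g, C, hε, hC, hG⟩ := GC.whp_giant hc
  obtain ⟨Ck, hCk, hT⟩ := GC.whp_no_twins hc
  obtain ⟨e₁, hE⟩ := GC.whp_excess_log hc
  obtain ⟨b, hb⟩ := GC.exists_sizes (C₀ := C + 1) (Ck := Ck + 1) (by linarith) (by linarith) g e₁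
  set lam : ℕ → ℝ := fun n => Real.log n with hlam
  set s₂ : ℕ → ℕ := fun n => ⌈lam n ^ 4⌉₊
  set h : ℕ → ℕ := fun n => ⌈Real.log (lam n)⌉₊
  set N : ℕ → ℕ := fun n => ⌈(Ck + 1) * (lam n / Real.log (lam n))⌉₊
  have hbig : ∀ K : ℝ, ∀ᶠ n : ℕ in atTop, K ≤ lam n ∧ K ≤ Real.log (lam n) ∧ 1 ≤ Real.log (lam n) ∧
      Real.log (lam n) ^ 4 ≤ lam n := fun K => (GC.eventually_le_log K).and
    ((GC.tendsto_loglog_nat.eventually_ge_atTop K).and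
      ((GC.tendsto_loglog_nat.eventually_ge_atTop 1).and
        (GC.tendsto_log_nat.eventually GC.eventually_log_pow_four_le)))
  have hceil : ∀ {z : ℝ}, 1 ≤ z → (⌈z⌉₊ : ℝ) ≤ 2 * z := fun {z} hz => by
    linarith [Nat.ceil_lt_add_one (show 0 ≤ z by linarith)]
  have hs₂ : ∀ {δ : ℝ}, 0 < δ → ∀ᶠ n : ℕ in atTop, (s₂ n : ℝ) ≤ δ * n := fun {δ} hδ => by
    filter_upwards [hbig 1, GC.eventually_log_pow_le 2 4 hδ] with n hn h2
    exact (hceil (one_le_pow₀ hn.1)).trans h2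
  have hh : ∀ᶠ n : ℕ in atTop, (h n : ℝ) ≤ 2 * Real.log (lam n) := by
    filter_upwards [hbig 1] with n hn
    exact hceil hn.2.1
  have hx1 : ∀ {n}, 1 ≤ Real.log (lam n) ∧ Real.log (lam n) ^ 4 ≤ lam n →
      Real.log (lam n) ≤ lam n / Real.log (lam n) := fun {n} hn => by
    rw [le_div_iff₀ (by linarith), ← sq]
    exact (pow_le_pow_right₀ hn.1 (by norm_num)).trans hn.2
  have w1 := GC.whp_deg hc (l := fun n => ⌈4 * (lam n / Real.log (lam n))⌉₊) (by
    filter_upwards [hbig 1] with n hn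
    rw [← div_le_iff₀ (by linarith), ← mul_div_assoc']
    exact Nat.le_ceil _)
  have w2 := GC.whp_unicyclic hc (u := fun n => 6 * h n + 6) (by
    filter_upwards [hbig (4 * (18 * (1 + Real.log c))), hh] with n hn h2
    have h3 := mul_le_mul_of_nonneg_right hn.2.1 (show 0 ≤ Real.log (lam n) by linarith)
    have h4 := hx1 hn.2.2
    rw [le_div_iff₀ (by linarith)] at h4
    push_cast
    have : (6 * (h n : ℝ) + 6) * (1 + Real.log c) ≤ 18 * Real.log (lam n) * (1 + Real.log c) := by
      have := Real.log_pos hc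
      gcongr
      linarith
    linarith) (by
    filter_upwards [hbig 18, hh, GC.eventually_log_pow_le 1 10 one_pos] with n hn h2 h3
    have h4 := hx1 hn.2.2
    rw [le_div_iff₀ (by linarith)] at h4
    have h5 := mul_le_mul_of_nonneg_right hn.2.1 (show 0 ≤ Real.log (lam n) by linarith)
    have h6 : 6 * (h n : ℝ) + 6 ≤ lam n := by linarith
    rw [one_mul, one_mul] at h3
    exact_mod_cast (pow_le_pow_left₀ (by positivity) h6 10).trans h3)
  have w3 := hE (fun n => 2 * s₂ n) (by
    filter_upwards [hbig 1, GC.eventually_log_pow_le (256 * c ^ 2) 16 one_pos] with n hn h2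
    have h3 : (s₂ n : ℝ) ≤ 2 * lam n ^ 4 := hceil (one_le_pow₀ hn.1)
    push_cast
    calc (2 * (s₂ n : ℝ)) ^ 4 * c ^ 2 ≤ (2 * (2 * lam n ^ 4)) ^ 4 * c ^ 2 := by gcongr
      _ = 256 * c ^ 2 * lam n ^ 16 := by ring
      _ ≤ n := by rwa [one_mul] at h2) (by
    filter_upwards [hs₂ (δ := 1 / 2) (by norm_num)] with n hn
    have : (2 : ℝ) * s₂ n ≤ n := by linarith
    exact_mod_cast this)
  have w4 := hT (4 * (Ck + 1)) (fun n => N n * h n) h (by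
    filter_upwards [hbig 1] with n hn
    have h3 : (Ck + 1) * (lam n / Real.log (lam n)) * Real.log (lam n) ≤ N n * h n :=
      mul_le_mul (Nat.le_ceil _) (Nat.le_ceil _) (by linarith) (Nat.cast_nonneg _)
    rw [mul_assoc, div_mul_cancel₀ _ (by linarith)] at h3
    push_cast
    linarith) (by
    filter_upwards [hbig 1, hh] with n hn h2
    have h3 := hx1 hn.2.2
    have h4 : (N n : ℝ) ≤ 2 * ((Ck + 1) * (lam n / Real.log (lam n))) :=
      hceil (one_le_mul_of_one_le_of_one_le (by linarith) (by linarith))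
    have h5 := mul_le_mul h4 h2 (Nat.cast_nonneg _)
      (mul_nonneg two_pos.le (mul_nonneg (by linarith) (by linarith)))
    have h6 : 2 * ((Ck + 1) * (lam n / Real.log (lam n))) * (2 * Real.log (lam n))
        = 4 * (Ck + 1) * lam n := by
      have h0 : Real.log (lam n) ≠ 0 := (zero_lt_one.trans_le hn.2.2.1).ne'
      field_simp
      ring
    push_cast
    linarith) (tendsto_nat_ceil_atTop.comp GC.tendsto_loglog_nat)
  have w5 := GC.whp_pendant hc hε hC (hG.mono hc0 (Eventually.of_forall fun n G h => h.1))
  refine ⟨1 / 24, max b 1, by norm_num, le_max_of_le_right (by norm_num), ?_⟩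
  simp only [GC.gnpProb_eq]
  refine GC.Whp.tendsto_one ((((w1.and hc0 w2).and hc0 (w3.and hc0 w4)).and hc0
    (w5.and hc0 hG)).mono hc0 ?_)
  filter_upwards [GC.tendsto_log_nat.eventually hb, hbig 24, hs₂ hε, eventually_gt_atTop 0]
    with n hn hn24 hsn hn0
  obtain ⟨α, q₁, hα, hl, hS, hcost⟩ := hn
  rintro G ⟨⟨⟨g1, g2⟩, g3, g4, g5⟩, g6, g7, x, hx⟩
  obtain ⟨K, hK, hmax⟩ := hgiant n hn0 G
  have hKn : ε * n < K.supp.ncard := by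
    refine hx.trans_le (Nat.cast_le.2 ?_)
    rw [← GC.supp_eq_cc]
    exact hmax _
  have hqs : q₁ ≤ s₂ n := by
    have : q₁ + 2 * (N n * h n) + 2 ≤ s₂ n := hS.arms
    omega
  have good : GC.Good G _ g e₁ ⌈lam n⌉₊ ⌈(C + 1) * lam n⌉₊ (s₂ n) (h n) (N n * h n) :=
    ⟨g1, fun S h1 h2 h3 => g7 S h1 ((Nat.le_ceil _).trans (Nat.cast_le.2 h2) |>.trans' (by
      gcongr
      linarith)) ((Nat.cast_le.2 h3).trans hsn), g3, g2, g4, g5⟩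
  obtain ⟨hex, hD⟩ := good.D_induce_le hS hα hl K (by
    exact_mod_cast ((Nat.cast_le.2 hqs).trans hsn).trans hKn.le)
  have hlow := g6.le_D K hKn hex
  rw [hK]
  refine ⟨le_trans ?_ (Nat.cast_le.2 hlow), ?_⟩
  · have e1 := hx1 hn24.2.2
    have e2 := Nat.lt_floor_add_one (lam n / (12 * Real.log (lam n)))
    have e3 : lam n / (12 * Real.log (lam n)) = 1 / 12 * (lam n / Real.log (lam n)) := by
      field_simp
    linarith
  · refine ((Nat.cast_le.2 hD).trans hcost).trans ?_
    gcongr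
    · linarith [hx1 hn24.2.2]
    · exact le_max_left _ _
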